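/- Let ω ∈ ℝ^r satisfy the Diophantine condition with constants C₀ > 0 and τ₀ ≥ r−1, and let f : ℝ^r × ℝ^s → ℝ be real analytic and 2π-periodic in each of its d = r+s variables. Let β₀ ∈ ℝ^s be such that ∇f₀(β₀) = 0 and assume that the Hessian matrix ∂²f₀(β₀) has s pairwise distinct, strictly positive eigenvalues. Then there exist ε̄ > 0, a measurable set ℰ ⊆ (0, ε̄) with Leb(ℰ ∩ (0, ε))/ε → 1 as ε → 0⁺, and Lipschitz functions A : [0, ε̄] × ℝ^r → ℝ^r and B : [0, ε̄] × ℝ^r → ℝ^s, 2π-periodic in each component of the second argument and vanishing identically at ε = 0, such that for every ε ∈ ℰ the functions a = A(ε, ·) and b = B(ε, ·) are real analytic and, for every ψ ∈ ℝ^r, the curves α(t) = ψ + ωt + a(ψ + ωt) and β(t) = β₀ + b(ψ + ωt) satisfy α̈(t) = −ε ∇_α f(α(t), β(t)) and β̈(t) = −ε ∇_β f(α(t), β(t)) for all t ∈ ℝ. -/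

import Mathlib

open MeasureTheory Real Filter

namespace KAM

open scoped ContDiff

set_option linter.unusedSectionVars false

variable {ι : Type*} [Fintype ι]

/-- The pairing `ν · ψ` of an integer vector with a real vector. -/
noncomputable def dotZ (ν : ι → ℤ) (ψ : ι → ℝ) : ℝ := ∑ k, (ν k : ℝ) * ψ k

/-- The `ℓ¹`-norm of an integer vector. -/
noncomputable def l1 (ν : ι → ℤ) : ℝ := ∑ k, |(ν k : ℝ)|

/-- The character `ψ ↦ exp (i ν · ψ)`. -/
noncomputable def chr (ν : ι → ℤ) (ψ : ι → ℝ) : ℂ := Complex.exp ((dotZ ν ψ : ℝ) * Complex.I)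

lemma l1_nonneg (ν : ι → ℤ) : 0 ≤ l1 ν := Finset.sum_nonneg fun _ _ => abs_nonneg _

lemma l1_add_le (ν μ : ι → ℤ) : l1 (ν + μ) ≤ l1 ν + l1 μ := by
  unfold l1
  rw [← Finset.sum_add_distrib]
  gcongr with k
  simpa using abs_add_le (ν k : ℝ) (μ k)

@[simp] lemma l1_neg (ν : ι → ℤ) : l1 (-ν) = l1 ν := by simp [l1]

@[simp] lemma l1_zero : l1 (0 : ι → ℤ) = 0 := by simp [l1]

lemma abs_le_l1 (ν : ι → ℤ) (k : ι) : |(ν k : ℝ)| ≤ l1 ν :=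
  Finset.single_le_sum (f := fun k => |(ν k : ℝ)|) (fun _ _ => abs_nonneg _) (Finset.mem_univ k)

lemma one_le_l1 {ν : ι → ℤ} (h : ν ≠ 0) : 1 ≤ l1 ν := by
  obtain ⟨k, hk⟩ := Function.ne_iff.mp h
  refine le_trans ?_ (abs_le_l1 ν k)
  exact_mod_cast Int.one_le_abs hk

lemma dotZ_add_left (ν μ : ι → ℤ) (ψ : ι → ℝ) : dotZ (ν + μ) ψ = dotZ ν ψ + dotZ μ ψ := by
  simp [dotZ, add_mul, Finset.sum_add_distrib]

lemma dotZ_add_right (ν : ι → ℤ) (ψ φ : ι → ℝ) : dotZ ν (ψ + φ) = dotZ ν ψ + dotZ ν φ := by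
  simp [dotZ, mul_add, Finset.sum_add_distrib]

lemma dotZ_smul_right (ν : ι → ℤ) (t : ℝ) (ψ : ι → ℝ) : dotZ ν (t • ψ) = t * dotZ ν ψ := by
  simp only [dotZ, Pi.smul_apply, smul_eq_mul, Finset.mul_sum]
  exact Finset.sum_congr rfl fun _ _ => by ring

@[simp] lemma dotZ_neg_left (ν : ι → ℤ) (ψ : ι → ℝ) : dotZ (-ν) ψ = - dotZ ν ψ := by
  simp [dotZ]

@[simp] lemma dotZ_zero_left (ψ : ι → ℝ) : dotZ 0 ψ = 0 := by simp [dotZ]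

@[simp] lemma dotZ_single [DecidableEq ι] (ν : ι → ℤ) (k : ι) (t : ℝ) :
    dotZ ν (Pi.single k t) = ν k * t := by
  simp [dotZ, Pi.single_apply]

lemma abs_dotZ_le (ν : ι → ℤ) (ψ : ι → ℝ) : |dotZ ν ψ| ≤ l1 ν * ‖ψ‖ := by
  unfold dotZ l1
  rw [Finset.sum_mul]
  refine (Finset.abs_sum_le_sum_abs _ _).trans ?_
  gcongr with k
  rw [abs_mul]
  gcongr
  exact norm_le_pi_norm ψ k

lemma chr_add_left (ν μ : ι → ℤ) (ψ : ι → ℝ) : chr (ν + μ) ψ = chr ν ψ * chr μ ψ := by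
  simp [chr, dotZ_add_left, add_mul, Complex.exp_add]

lemma chr_add_right (ν : ι → ℤ) (ψ φ : ι → ℝ) : chr ν (ψ + φ) = chr ν ψ * chr ν φ := by
  simp [chr, dotZ_add_right, add_mul, Complex.exp_add]

@[simp] lemma chr_zero_left (ψ : ι → ℝ) : chr 0 ψ = 1 := by simp [chr]

@[simp] lemma norm_chr (ν : ι → ℤ) (ψ : ι → ℝ) : ‖chr ν ψ‖ = 1 := by
  simp [chr, Complex.norm_exp_ofReal_mul_I]

lemma chr_neg_left (ν : ι → ℤ) (ψ : ι → ℝ) : chr (-ν) ψ = (starRingEnd ℂ) (chr ν ψ) := by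
  simp [chr, ← Complex.exp_conj]

lemma chr_period [DecidableEq ι] (ν : ι → ℤ) (ψ : ι → ℝ) (k : ι) :
    chr ν (ψ + Pi.single k (2 * π)) = chr ν ψ := by
  rw [chr_add_right]
  have : chr ν (Pi.single k (2 * π)) = 1 := by
    rw [chr, dotZ_single]
    rw [Complex.exp_eq_one_iff]
    exact ⟨ν k, by push_cast; ring⟩
  rw [this, mul_one]

/-- The linear form `ψ ↦ i ν · ψ`. -/
noncomputable def dotL (ν : ι → ℤ) : (ι → ℝ) →L[ℝ] ℂ :=
  LinearMap.toContinuousLinearMap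
    { toFun := fun ψ => (dotZ ν ψ : ℂ) * Complex.I
      map_add' := fun ψ φ => by rw [dotZ_add_right]; push_cast; ring
      map_smul' := fun t ψ => by rw [dotZ_smul_right]; simp; ring }

@[simp] lemma dotL_apply (ν : ι → ℤ) (ψ : ι → ℝ) : dotL ν ψ = (dotZ ν ψ : ℂ) * Complex.I := rfl

lemma norm_dotL_le (ν : ι → ℤ) : ‖dotL ν‖ ≤ l1 ν := by
  refine ContinuousLinearMap.opNorm_le_bound _ (l1_nonneg ν) fun ψ => ?_
  simpa using abs_dotZ_le ν ψ

lemma chr_eq_exp (ν : ι → ℤ) : chr ν = fun ψ => Complex.exp (dotL ν ψ) := rfl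

lemma contDiff_chr (ν : ι → ℤ) {n : WithTop ℕ∞} : ContDiff ℝ n (chr ν) := by
  rw [chr_eq_exp]
  exact (Complex.contDiff_exp (𝕜 := ℝ)).comp (dotL ν).contDiff

lemma continuous_chr (ν : ι → ℤ) : Continuous (chr ν) := (contDiff_chr ν (n := 0)).continuous

lemma hasFDerivAt_chr (ν : ι → ℤ) (ψ : ι → ℝ) :
    HasFDerivAt (chr ν) (chr ν ψ • dotL ν) ψ := by
  have h := (dotL ν).hasFDerivAt (x := ψ)
  simpa [chr_eq_exp] using h.cexp

/-! ### Orthogonality of characters and uniqueness of Fourier coefficients -/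

/-- The fundamental cube `[0, 2π]^ι`. -/
def cube (ι : Type*) : Set (ι → ℝ) := Set.univ.pi fun _ => Set.Icc (0 : ℝ) (2 * π)

lemma isCompact_cube {ι : Type*} : IsCompact (cube ι) := isCompact_univ_pi fun _ => isCompact_Icc

lemma volume_cube : (volume (cube ι)).toReal = (2 * π) ^ Fintype.card ι := by
  rw [cube, volume_pi, Measure.pi_pi]
  simp [Real.pi_pos.le]

lemma integral_exp_circle (n : ℤ) (hn : n ≠ 0) :
    ∫ t in Set.Icc (0 : ℝ) (2 * π), Complex.exp (((n : ℝ) * t : ℝ) * Complex.I) = 0 := by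
  rw [integral_Icc_eq_integral_Ioc, ← intervalIntegral.integral_of_le (by positivity)]
  have hc : ((n : ℂ) * Complex.I) ≠ 0 := by simp [hn]
  have := integral_exp_mul_complex (a := 0) (b := 2 * π) hc
  have h2 : ∀ t : ℝ, Complex.exp (((n : ℝ) * t : ℝ) * Complex.I)
      = Complex.exp ((n : ℂ) * Complex.I * t) := fun t => by
    congr 1; push_cast; ring
  simp_rw [h2]
  have h3 : Complex.exp ((n : ℂ) * Complex.I * ((2 * π : ℝ) : ℂ)) = 1 := by
    rw [Complex.exp_eq_one_iff]; exact ⟨n, by push_cast; ring⟩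
  rw [this, h3]
  simp

lemma integral_chr (ν : ι → ℤ) (hν : ν ≠ 0) : ∫ ψ in cube ι, chr ν ψ = 0 := by
  have h1 : ∀ ψ, chr ν ψ = ∏ k, Complex.exp (((ν k : ℝ) * ψ k : ℝ) * Complex.I) := by
    intro ψ
    rw [← Complex.exp_sum, chr, dotZ]
    push_cast
    rw [Finset.sum_mul]
  simp_rw [h1]
  rw [cube, volume_pi, Measure.restrict_pi_pi]
  rw [integral_fintype_prod_eq_prod
    (f := fun k (t : ℝ) => Complex.exp (((ν k : ℝ) * t : ℝ) * Complex.I))]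
  obtain ⟨k, hk⟩ := Function.ne_iff.mp hν
  exact Finset.prod_eq_zero (Finset.mem_univ k) (integral_exp_circle _ hk)

/-- Fourier coefficients of a function of `ψ`. -/
noncomputable def coef (F : (ι → ℝ) → ℂ) (ν : ι → ℤ) : ℂ :=
  (((2 * π) ^ Fintype.card ι : ℝ) : ℂ)⁻¹ * ∫ ψ in cube ι, F ψ * chr (-ν) ψ

instance : IsFiniteMeasure (volume.restrict (cube ι)) :=
  ⟨by rw [Measure.restrict_apply_univ]; exact isCompact_cube.measure_lt_top⟩

lemma coef_eq_of_hasSum {F : (ι → ℝ) → ℂ} {c : (ι → ℤ) → ℂ} (hc : Summable fun ν => ‖c ν‖)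
    (h : ∀ ψ, HasSum (fun ν => c ν * chr ν ψ) (F ψ)) (ν : ι → ℤ) : coef F ν = c ν := by
  classical
  have h1 : ∀ ψ, F ψ * chr (-ν) ψ = ∑' μ, c μ * chr (μ - ν) ψ := fun ψ => by
    rw [← (h ψ).tsum_eq, ← tsum_mul_right]
    refine tsum_congr fun μ => ?_
    rw [sub_eq_add_neg, chr_add_left, mul_assoc]
  have h2 : ∀ μ, ∫ ψ in cube ι, c μ * chr (μ - ν) ψ
      = if μ = ν then c ν * ((2 * π) ^ Fintype.card ι : ℝ) else 0 := by
    intro μ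
    rw [integral_const_mul]
    split_ifs with hμ
    · subst hμ
      have hv := volume_cube (ι := ι)
      simp only [sub_self, chr_zero_left, integral_const, MeasurableSet.univ,
        measureReal_restrict_apply, Set.univ_inter, Complex.real_smul, mul_one]
      rw [measureReal_def, hv]
    · rw [integral_chr _ (sub_ne_zero.mpr hμ), mul_zero]
  have h3 := hasSum_integral_of_summable_integral_norm (μ := volume.restrict (cube ι))
    (F := fun μ ψ => c μ * chr (μ - ν) ψ)
    (fun μ => (continuous_const.mul (continuous_chr _)).continuousOn.integrableOn_compact
      isCompact_cube) (by
      simp only [norm_mul, norm_chr, mul_one, integral_const]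
      exact hc.mul_left _)
  rw [coef]
  simp_rw [h1]
  rw [← h3.tsum_eq]
  simp_rw [h2]
  rw [tsum_ite_eq]
  have : (((2 * π) ^ Fintype.card ι : ℝ) : ℂ) ≠ 0 := by
    exact_mod_cast (by positivity : ((2 * π) ^ Fintype.card ι : ℝ) ≠ 0)
  field_simp

/-! ### Analyticity of Fourier series with exponentially decaying coefficients -/

lemma pow_le_factorial_mul_exp {x δ : ℝ} (hx : 0 ≤ x) (hδ : 0 < δ) (n : ℕ) :
    x ^ n ≤ n.factorial * δ⁻¹ ^ n * Real.exp (δ * x) := by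
  have h := Real.pow_div_factorial_le_exp (δ * x) (by positivity) n
  rw [div_le_iff₀ (by positivity), mul_pow] at h
  rw [inv_pow]
  calc x ^ n = (δ ^ n)⁻¹ * (δ ^ n * x ^ n) := by field_simp
    _ ≤ (δ ^ n)⁻¹ * (Real.exp (δ * x) * n.factorial) := by gcongr
    _ = _ := by ring

lemma summable_of_exp {c : (ι → ℤ) → ℂ} {σ : ℝ} (hσ : 0 ≤ σ)
    (hc : Summable fun ν => Real.exp (σ * l1 ν) * ‖c ν‖) : Summable fun ν => ‖c ν‖ := by
  refine Summable.of_nonneg_of_le (fun _ => norm_nonneg _) (fun ν => ?_) hc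
  exact le_mul_of_one_le_left (norm_nonneg _)
    (Real.one_le_exp (mul_nonneg hσ (l1_nonneg _)))

lemma norm_expSeries_comp_dotL_le (ν : ι → ℤ) (n : ℕ) :
    ‖(NormedSpace.expSeries ℝ ℂ n).compContinuousLinearMap (fun _ => dotL ν)‖
      ≤ l1 ν ^ n / n.factorial := by
  refine (ContinuousMultilinearMap.norm_compContinuousLinearMap_le _ _).trans ?_
  rw [Finset.prod_const, Finset.card_univ, Fintype.card_fin]
  have h1 : ‖NormedSpace.expSeries ℝ ℂ n‖ ≤ 1 / n.factorial := by
    rw [NormedSpace.expSeries]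
    rw [norm_smul, ContinuousMultilinearMap.norm_mkPiAlgebraFin, mul_one]
    simp
  calc _ ≤ (1 / n.factorial) * l1 ν ^ n := by
        gcongr
        exact norm_dotL_le ν
    _ = _ := by ring

lemma summable_prod_pow_div_factorial {c : (ι → ℤ) → ℂ} {σ : ℝ} (hσ : 0 < σ)
    (hc : Summable fun ν => Real.exp (σ * l1 ν) * ‖c ν‖) :
    Summable fun x : (ι → ℤ) × ℕ => ‖c x.1‖ * ((σ * l1 x.1) ^ x.2 / x.2.factorial) := by
  rw [summable_prod_of_nonneg]
  · constructor
    · intro ν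
      have h : Summable fun n : ℕ => ‖c ν‖ * ((σ * l1 ν) ^ n / n.factorial) :=
        (Real.summable_pow_div_factorial (σ * l1 ν)).mul_left _
      exact h
    · refine hc.congr fun ν => ?_
      dsimp only
      rw [tsum_mul_left, mul_comm, Real.exp_eq_exp_ℝ, NormedSpace.exp_eq_tsum_div]
  · intro x
    have := mul_nonneg hσ.le (l1_nonneg x.1)
    exact mul_nonneg (norm_nonneg _) (div_nonneg (pow_nonneg this _) (Nat.cast_nonneg _))

lemma analyticOnNhd_fourier {c : (ι → ℤ) → ℂ} {σ : ℝ} (hσ : 0 < σ)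
    (hc : Summable fun ν => Real.exp (σ * l1 ν) * ‖c ν‖) :
    AnalyticOnNhd ℝ (fun ψ => ∑' ν, c ν * chr ν ψ) Set.univ := by
  intro ψ₀ _
  set q : (ι → ℤ) → FormalMultilinearSeries ℝ (ι → ℝ) ℂ := fun ν n =>
    (c ν * chr ν ψ₀) •
      (NormedSpace.expSeries ℝ ℂ n).compContinuousLinearMap (fun _ => dotL ν) with hq
  have hqn : ∀ ν n, ‖q ν n‖ ≤ ‖c ν‖ * (l1 ν ^ n / n.factorial) := by
    intro ν n
    simp only [hq]
    rw [norm_smul, norm_mul, norm_chr, mul_one]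
    exact mul_le_mul_of_nonneg_left (norm_expSeries_comp_dotL_le ν n) (norm_nonneg _)
  have hqe : ∀ ν n, ‖q ν n‖ * σ ^ n ≤ Real.exp (σ * l1 ν) * ‖c ν‖ := by
    intro ν n
    have h := Real.pow_div_factorial_le_exp (σ * l1 ν) (mul_nonneg hσ.le (l1_nonneg ν)) n
    calc _ ≤ (‖c ν‖ * (l1 ν ^ n / n.factorial)) * σ ^ n := by gcongr; exact hqn ν n
      _ = (σ * l1 ν) ^ n / n.factorial * ‖c ν‖ := by rw [mul_pow]; ring
      _ ≤ _ := by gcongr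
  have hqs' : ∀ n, Summable fun ν => ‖q ν n‖ * σ ^ n := fun n =>
    Summable.of_nonneg_of_le (fun _ => by positivity) (fun ν => hqe ν n) hc
  have hqs : ∀ n, Summable fun ν => ‖q ν n‖ := fun n =>
    (summable_mul_right_iff (pow_ne_zero n hσ.ne')).mp (hqs' n)
  let p : FormalMultilinearSeries ℝ (ι → ℝ) ℂ := fun n => ∑' ν, q ν n
  refine ⟨p, ENNReal.ofReal σ, ?_, by simpa using hσ, ?_⟩
  · rw [ENNReal.ofReal]
    refine FormalMultilinearSeries.le_radius_of_bound _
      (∑' ν, Real.exp (σ * l1 ν) * ‖c ν‖) fun n => ?_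
    rw [Real.coe_toNNReal _ hσ.le]
    calc ‖p n‖ * σ ^ n ≤ (∑' ν, ‖q ν n‖) * σ ^ n := by
          gcongr; exact norm_tsum_le_tsum_norm (hqs n)
      _ = ∑' ν, ‖q ν n‖ * σ ^ n := by rw [tsum_mul_right]
      _ ≤ _ := (hqs' n).tsum_le_tsum (fun ν => hqe ν n) hc
  · intro y hy
    have hy' : ‖y‖ < σ := by
      simpa [Metric.mem_eball, edist_dist, ENNReal.ofReal_lt_ofReal_iff hσ] using hy
    have hpt : ∀ n, p n (fun _ => y) = ∑' ν, c ν * chr ν ψ₀ * (dotL ν y ^ n / n.factorial) := by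
      intro n
      have := (ContinuousMultilinearMap.apply ℝ (fun _ : Fin n => (ι → ℝ)) ℂ (fun _ => y)).map_tsum
        (hqs n).of_norm
      rw [ContinuousMultilinearMap.apply_apply] at this
      rw [show p n (fun _ => y) = _ from this]
      refine tsum_congr fun ν => ?_
      rw [ContinuousMultilinearMap.apply_apply]
      simp only [hq, _root_.smul_apply,
        ContinuousMultilinearMap.compContinuousLinearMap_apply, smul_eq_mul]
      rw [NormedSpace.expSeries_apply_eq_div]
    simp_rw [hpt]
    have hsum2 := summable_prod_pow_div_factorial hσ hc
    have hs : Summable fun x : (ι → ℤ) × ℕ =>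
        c x.1 * chr x.1 ψ₀ * (dotL x.1 y ^ x.2 / x.2.factorial) := by
      refine Summable.of_norm_bounded hsum2 fun x => ?_
      rw [norm_mul, norm_mul, norm_chr, mul_one, norm_div, norm_pow]
      have h5 : ‖dotL x.1 y‖ ≤ σ * l1 x.1 := by
        rw [mul_comm]
        exact ((dotL x.1).le_of_opNorm_le (norm_dotL_le _) y).trans
          (mul_le_mul_of_nonneg_left hy'.le (l1_nonneg _))
      rw [Complex.norm_natCast]
      gcongr
    have h6 := hs.prod_symm.hasSum.prod_fiberwise (fun n => (hs.prod_symm.prod_factor n).hasSum)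
    have h8 : ∑' x : ℕ × (ι → ℤ), c x.swap.1 * chr x.swap.1 ψ₀ *
        (dotL x.swap.1 y ^ x.swap.2 / (x.swap.2.factorial : ℂ))
        = ∑' ν, c ν * chr ν (ψ₀ + y) := by
      refine ((Equiv.prodComm ℕ (ι → ℤ)).tsum_eq (fun x : (ι → ℤ) × ℕ =>
        c x.1 * chr x.1 ψ₀ * (dotL x.1 y ^ x.2 / (x.2.factorial : ℂ)))).trans ?_
      rw [hs.tsum_prod]
      refine tsum_congr fun ν => ?_
      dsimp only
      rw [tsum_mul_left, chr_add_right, ← mul_assoc, show chr ν y = Complex.exp (dotL ν y) from rfl,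
        Complex.exp_eq_exp_ℂ, NormedSpace.exp_eq_tsum_div (𝔸 := ℂ)]
    rw [h8] at h6
    exact h6

variable {ι : Type*} [Fintype ι]

/-- The algebra of smooth complex functions on `ℝ^ι`. -/
def Sm (ι : Type*) [Fintype ι] : Subalgebra ℂ ((ι → ℝ) → ℂ) where
  carrier := {F | ContDiff ℝ ∞ F}
  mul_mem' {a b} (ha : ContDiff ℝ ∞ a) (hb : ContDiff ℝ ∞ b) := ContDiff.mul ha hb
  add_mem' {a b} (ha : ContDiff ℝ ∞ a) (hb : ContDiff ℝ ∞ b) := ContDiff.add ha hb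
  algebraMap_mem' a := show ContDiff ℝ ∞ fun _ => a from contDiff_const

lemma Sm.contDiff (F : Sm ι) : ContDiff ℝ ∞ F.1 := F.2

lemma Sm.differentiable (F : Sm ι) : Differentiable ℝ F.1 :=
  (Sm.contDiff F).differentiable (by simp)

@[ext] lemma Sm.ext {F G : Sm ι} (h : ∀ ψ, F.1 ψ = G.1 ψ) : F = G := Subtype.ext (funext h)

@[simp] lemma Sm.add_val (F G : Sm ι) (ψ : ι → ℝ) : (F + G).1 ψ = F.1 ψ + G.1 ψ := rfl
@[simp] lemma Sm.sub_val (F G : Sm ι) (ψ : ι → ℝ) : (F - G).1 ψ = F.1 ψ - G.1 ψ := rfl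
@[simp] lemma Sm.neg_val (F : Sm ι) (ψ : ι → ℝ) : (-F).1 ψ = -F.1 ψ := rfl
@[simp] lemma Sm.mul_val (F G : Sm ι) (ψ : ι → ℝ) : (F * G).1 ψ = F.1 ψ * G.1 ψ := rfl
@[simp] lemma Sm.smul_val (a : ℂ) (F : Sm ι) (ψ : ι → ℝ) : (a • F).1 ψ = a * F.1 ψ := rfl
@[simp] lemma Sm.zero_val (ψ : ι → ℝ) : (0 : Sm ι).1 ψ = 0 := rfl
@[simp] lemma Sm.one_val (ψ : ι → ℝ) : (1 : Sm ι).1 ψ = 1 := rfl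
@[simp] lemma Sm.algebraMap_val (a : ℂ) (ψ : ι → ℝ) : (algebraMap ℂ (Sm ι) a).1 ψ = a := rfl
@[simp] lemma Sm.pow_val (F : Sm ι) (n : ℕ) (ψ : ι → ℝ) : (F ^ n).1 ψ = F.1 ψ ^ n := rfl
@[simp] lemma Sm.sum_val {κ : Type*} (s : Finset κ) (F : κ → Sm ι) (ψ : ι → ℝ) :
    (∑ i ∈ s, F i).1 ψ = ∑ i ∈ s, (F i).1 ψ := by
  rw [AddSubmonoidClass.coe_finsetSum, Finset.sum_apply]

/-- Directional derivative of smooth functions. -/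
noncomputable def dd (v : ι → ℝ) : Derivation ℂ (Sm ι) (Sm ι) :=
  Derivation.mk'
    { toFun := fun F => ⟨fun ψ => fderiv ℝ F.1 ψ v,
        (((Sm.contDiff F).fderiv_right (m := ∞) (by simp)).clm_apply contDiff_const)⟩
      map_add' := fun F G => Sm.ext fun ψ => by
        change fderiv ℝ (F.1 + G.1) ψ v = fderiv ℝ F.1 ψ v + fderiv ℝ G.1 ψ v
        rw [fderiv_add (Sm.differentiable F ψ) (Sm.differentiable G ψ)]; rfl
      map_smul' := fun a F => Sm.ext fun ψ => by
        change fderiv ℝ (a • F.1) ψ v = a * fderiv ℝ F.1 ψ v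
        rw [fderiv_const_smul (Sm.differentiable F ψ)]; rfl }
    (fun F G => Sm.ext fun ψ => by
      change fderiv ℝ (F.1 * G.1) ψ v = F.1 ψ * fderiv ℝ G.1 ψ v + G.1 ψ * fderiv ℝ F.1 ψ v
      rw [fderiv_mul (Sm.differentiable F ψ) (Sm.differentiable G ψ)]
      simp)

lemma dd_val (v : ι → ℝ) (F : Sm ι) (ψ : ι → ℝ) : (dd v F).1 ψ = fderiv ℝ F.1 ψ v := rfl

lemma dd_comm (v v' : ι → ℝ) (F : Sm ι) : dd v (dd v' F) = dd v' (dd v F) := by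
  ext ψ
  simp only [dd_val]
  have h2 : ContDiff ℝ 2 F.1 := (Sm.contDiff F).of_le (WithTop.coe_le_coe.mpr le_top)
  have hd : DifferentiableAt ℝ (fderiv ℝ F.1) ψ :=
    ((h2.fderiv_right (m := 1) (by norm_num)).differentiable (by norm_num)) ψ
  have key : ∀ a b : ι → ℝ, fderiv ℝ (dd a F).1 ψ b = fderiv ℝ (fderiv ℝ F.1) ψ b a := by
    intro a b
    change fderiv ℝ (fun ψ => fderiv ℝ F.1 ψ a) ψ b = _
    rw [fderiv_clm_apply hd (by fun_prop)]
    simp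
  rw [key, key]
  have hs : IsSymmSndFDerivAt ℝ F.1 ψ := h2.contDiffAt.isSymmSndFDerivAt (by simp)
  exact hs v v'

lemma hasSum_fderiv_fourier {F : (ι → ℝ) → ℂ} {c : (ι → ℤ) → ℂ} {σ : ℝ} (hσ : 0 < σ)
    (hc : Summable fun ν => Real.exp (σ * l1 ν) * ‖c ν‖)
    (h : ∀ ψ, HasSum (fun ν => c ν * chr ν ψ) (F ψ)) (ψ v : ι → ℝ) :
    HasSum (fun ν => (c ν * (dotZ ν v * Complex.I)) * chr ν ψ) (fderiv ℝ F ψ v) := by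
  have hF : F = fun ψ => ∑' ν, c ν * chr ν ψ := funext fun ψ => (h ψ).tsum_eq.symm
  have hu : Summable fun ν => ‖c ν‖ * l1 ν := by
    refine Summable.of_nonneg_of_le (fun ν => mul_nonneg (norm_nonneg _) (l1_nonneg _))
      (fun ν => ?_) (hc.mul_left σ⁻¹)
    have := pow_le_factorial_mul_exp (l1_nonneg ν) hσ 1
    simp only [pow_one, Nat.factorial_one, Nat.cast_one, one_mul] at this
    calc ‖c ν‖ * l1 ν ≤ ‖c ν‖ * (σ⁻¹ * Real.exp (σ * l1 ν)) := by gcongr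
      _ = _ := by ring
  have hfd : ∀ (ν : ι → ℤ) (x : ι → ℝ),
      HasFDerivAt (fun ψ => c ν * chr ν ψ) (c ν • (chr ν x • dotL ν)) x :=
    fun ν x => (hasFDerivAt_chr ν x).const_mul (c ν)
  have hb : ∀ (ν : ι → ℤ) (x : ι → ℝ), ‖c ν • (chr ν x • dotL ν)‖ ≤ ‖c ν‖ * l1 ν := fun ν x => by
    rw [norm_smul, norm_smul, norm_chr, one_mul]
    gcongr
    exact norm_dotL_le ν
  have hd := hasFDerivAt_tsum hu hfd hb (h 0).summable ψ
  rw [hF, hd.fderiv]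
  have hs : Summable fun ν => c ν • (chr ν ψ • dotL ν) :=
    Summable.of_norm_bounded hu fun ν => hb ν ψ
  have := (ContinuousLinearMap.apply ℝ ℂ v).hasSum hs.hasSum
  convert! this using 1
  funext ν
  simp
  ring

lemma smooth_fourier {c : (ι → ℤ) → ℂ} {σ : ℝ} (hσ : 0 < σ)
    (hc : Summable fun ν => Real.exp (σ * l1 ν) * ‖c ν‖) :
    ContDiff ℝ ∞ (fun ψ => ∑' ν, c ν * chr ν ψ) :=
  (contDiff_omega_iff_analyticOnNhd.mpr (analyticOnNhd_fourier hσ hc)).of_le le_top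

section families

variable {X : Type*}

/-- The derivation `F ↦ κ x • ∂_v (F x)` on families of smooth functions. -/
noncomputable def RD (κ : X → ℂ) (v : ι → ℝ) : Derivation ℂ (X → Sm ι) (X → Sm ι) :=
  Derivation.mk'
    { toFun := fun F x => κ x • dd v (F x)
      map_add' := fun F G => funext fun x => by simp
      map_smul' := fun a F => funext fun x => by simp [smul_comm a] }
    (fun F G => funext fun x => by simp)

@[simp] lemma RD_apply (κ : X → ℂ) (v : ι → ℝ) (F : X → Sm ι) (x : X) :
    RD κ v F x = κ x • dd v (F x) := rfl

lemma RD_comm (κ κ' : X → ℂ) (v v' : ι → ℝ) (F : X → Sm ι) :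
    RD κ v (RD κ' v' F) = RD κ' v' (RD κ v F) := by
  funext x
  simp [dd_comm v v', smul_comm (κ x)]

/-- Constants (in `ψ`) depending on the parameter. -/
def cst (a : X → ℂ) : X → Sm ι := fun x => algebraMap ℂ (Sm ι) (a x)

@[simp] lemma RD_cst (κ : X → ℂ) (v : ι → ℝ) (a : X → ℂ) : RD κ v (cst a : X → Sm ι) = 0 := by
  funext x; simp [cst]

/-- Nonnegativity of the distance function on the parameter space. -/
class PosRho (ρ : X → X → ℝ) : Prop where
  nonneg : ∀ x y, 0 ≤ ρ x y

/-- Nonnegativity of a weight on the parameter space. -/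
class PosWt (w : X → ℝ) : Prop where
  nonneg : ∀ x, 0 ≤ w x

instance : PosWt (1 : X → ℝ) := ⟨fun _ => zero_le_one⟩

/-- `a` is bounded by `A w / 2` and has Lipschitz constant `A w / 2` with respect to `ρ`. -/
def LipB (ρ : X → X → ℝ) (w : X → ℝ) (a : X → ℂ) (A : ℝ) : Prop :=
  (∀ x, 2 * ‖a x‖ ≤ A * w x) ∧ ∀ x y, 2 * ‖a x - a y‖ ≤ A * max (w x) (w y) * ρ x y

/-- `F` is the sum of the Fourier series with coefficients `c`, which are majorized by `m`,
and `m` is summable with weight `exp (σ |ν|)`. -/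
structure Maj (ρ : X → X → ℝ) (w : X → ℝ) (σ : ℝ) (F : X → Sm ι) (c : (ι → ℤ) → X → ℂ)
    (m : (ι → ℤ) → ℝ) : Prop where
  nonneg : ∀ ν, 0 ≤ m ν
  lip : ∀ ν, LipB ρ w (c ν) (m ν)
  rep : ∀ x ψ, HasSum (fun ν => c ν x * chr ν ψ) ((F x).1 ψ)
  summable : Summable fun ν => Real.exp (σ * l1 ν) * m ν

/-- The weighted Wiener norm of the family `F` is at most `C`. -/
def Bd (ρ : X → X → ℝ) (w : X → ℝ) (σ : ℝ) (F : X → Sm ι) (C : ℝ) : Prop :=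
  ∃ c m, Maj ρ w σ F c m ∧ ∑' ν, Real.exp (σ * l1 ν) * m ν ≤ C

variable {ρ : X → X → ℝ} {w : X → ℝ} {σ : ℝ} {F G : X → Sm ι} {C C' : ℝ}

lemma LipB.add {a b : X → ℂ} {A B : ℝ} (ha : LipB ρ w a A) (hb : LipB ρ w b B) :
    LipB ρ w (a + b) (A + B) := by
  constructor
  · intro x
    have := norm_add_le (a x) (b x)
    have h1 := ha.1 x
    have h2 := hb.1 x
    simp only [Pi.add_apply]
    linarith
  · intro x y
    have h1 := ha.2 x y
    have h2 := hb.2 x y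
    have := norm_add_le (a x - a y) (b x - b y)
    have h3 : (a + b) x - (a + b) y = (a x - a y) + (b x - b y) := by simp; ring
    rw [h3]
    linarith

lemma LipB.neg {a : X → ℂ} {A : ℝ} (ha : LipB ρ w a A) : LipB ρ w (-a) A := by
  refine ⟨fun x => by simpa using ha.1 x, fun x y => ?_⟩
  have : (-a) x - (-a) y = -(a x - a y) := by simp; ring
  rw [this, norm_neg]; exact ha.2 x y

lemma LipB.mul [PosRho ρ] [PosWt w] {a b : X → ℂ} {A B : ℝ} (hA : 0 ≤ A) (hB : 0 ≤ B)
    (ha : LipB ρ w a A) (hb : LipB ρ 1 b B) : LipB ρ w (a * b) (A * B) := by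
  have hw := PosWt.nonneg (w := w)
  have hρ := PosRho.nonneg (ρ := ρ)
  constructor
  · intro x
    have h1 := ha.1 x
    have h2 := hb.1 x
    simp only [Pi.one_apply, mul_one] at h2
    have h3 : ‖a x‖ ≤ A * w x / 2 := by linarith
    have h4 : ‖b x‖ ≤ B / 2 := by linarith
    have h5 := mul_le_mul h3 h4 (norm_nonneg _) (by have := hw x; positivity)
    have h6 : 0 ≤ A * w x * B := by have := hw x; positivity
    simp only [Pi.mul_apply, norm_mul]
    nlinarith
  · intro x y
    have h1 := ha.1 x
    have h2 := hb.1 y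
    have h3 := ha.2 x y
    have h4 := hb.2 x y
    simp only [Pi.one_apply, mul_one, max_self] at h2 h4
    have h5 : (a * b) x - (a * b) y = a x * (b x - b y) + (a x - a y) * b y := by simp; ring
    have hm : w x ≤ max (w x) (w y) := le_max_left _ _
    have hm0 : 0 ≤ max (w x) (w y) := (hw x).trans hm
    have hr := hρ x y
    have h6 : ‖a x‖ ≤ A * max (w x) (w y) / 2 := by
      have : A * w x ≤ A * max (w x) (w y) := by gcongr
      linarith
    have h7 := mul_le_mul h6 (show ‖b x - b y‖ ≤ B * ρ x y / 2 by linarith) (norm_nonneg _)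
      (by positivity)
    have h8 := mul_le_mul (show ‖a x - a y‖ ≤ A * max (w x) (w y) * ρ x y / 2 by linarith)
      (show ‖b y‖ ≤ B / 2 by linarith) (norm_nonneg _) (by positivity)
    have h9 := norm_add_le (a x * (b x - b y)) ((a x - a y) * b y)
    rw [norm_mul, norm_mul] at h9
    rw [h5]
    calc 2 * ‖a x * (b x - b y) + (a x - a y) * b y‖
        ≤ 2 * (A * max (w x) (w y) / 2 * (B * ρ x y / 2)
          + A * max (w x) (w y) * ρ x y / 2 * (B / 2)) := by linarith
      _ = _ := by ring

lemma LipB.mono [PosRho ρ] [PosWt w] {a : X → ℂ} {A A' : ℝ}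
    (ha : LipB ρ w a A) (h : A ≤ A') : LipB ρ w a A' := by
  have hw := PosWt.nonneg (w := w)
  have hρ := PosRho.nonneg (ρ := ρ)
  refine ⟨fun x => (ha.1 x).trans (mul_le_mul_of_nonneg_right h (hw x)), fun x y => ?_⟩
  refine (ha.2 x y).trans ?_
  have : 0 ≤ max (w x) (w y) := (hw x).trans (le_max_left _ _)
  have := hρ x y
  gcongr

lemma LipB.weight [PosRho ρ] {w' : X → ℝ} {a : X → ℂ} {A : ℝ} (hA : 0 ≤ A)
    (hww : ∀ x, w x ≤ w' x) (ha : LipB ρ w a A) : LipB ρ w' a A := by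
  have hρ := PosRho.nonneg (ρ := ρ)
  refine ⟨fun x => (ha.1 x).trans (mul_le_mul_of_nonneg_left (hww x) hA), fun x y => ?_⟩
  refine (ha.2 x y).trans ?_
  have := hρ x y
  gcongr
  · exact hww x
  · exact hww y

lemma LipB.tsum {κ : Type*} {a : κ → X → ℂ} {A : κ → ℝ} (ha : ∀ k, LipB ρ w (a k) (A k))
    (hA : Summable A) :
    LipB ρ w (fun x => ∑' k, a k x) (∑' k, A k) ∧ ∀ x, Summable fun k => ‖a k x‖ := by
  have hs : ∀ x, Summable fun k => ‖a k x‖ := fun x => by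
    refine Summable.of_nonneg_of_le (fun _ => norm_nonneg _) (fun k => ?_)
      (hA.mul_right (w x / 2))
    have := (ha k).1 x
    linarith
  refine ⟨⟨fun x => ?_, fun x y => ?_⟩, hs⟩
  · calc 2 * ‖∑' k, a k x‖ ≤ 2 * ∑' k, ‖a k x‖ := by
          gcongr; exact norm_tsum_le_tsum_norm (hs x)
      _ = ∑' k, 2 * ‖a k x‖ := by rw [tsum_mul_left]
      _ ≤ ∑' k, A k * w x :=
          ((hs x).mul_left 2).tsum_le_tsum (fun k => (ha k).1 x) (hA.mul_right _)
      _ = _ := by rw [tsum_mul_right]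
  · rw [← (hs x).of_norm.tsum_sub (hs y).of_norm]
    have hs2 : Summable fun k => ‖a k x - a k y‖ :=
      Summable.of_nonneg_of_le (fun _ => norm_nonneg _) (fun k => norm_sub_le _ _)
        ((hs x).add (hs y))
    calc 2 * ‖∑' k, (a k x - a k y)‖ ≤ 2 * ∑' k, ‖a k x - a k y‖ := by
          gcongr; exact norm_tsum_le_tsum_norm hs2
      _ = ∑' k, 2 * ‖a k x - a k y‖ := by rw [tsum_mul_left]
      _ ≤ ∑' k, A k * (max (w x) (w y) * ρ x y) := (hs2.mul_left 2).tsum_le_tsum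
          (fun k => by rw [← mul_assoc]; exact (ha k).2 x y) (hA.mul_right _)
      _ = _ := by rw [tsum_mul_right, mul_assoc]

lemma Maj.summable_norm {c : (ι → ℤ) → X → ℂ} {m : (ι → ℤ) → ℝ} (h : Maj ρ w σ F c m) (x : X) :
    Summable fun ν => Real.exp (σ * l1 ν) * ‖c ν x‖ := by
  refine Summable.of_nonneg_of_le (fun _ => by positivity) (fun ν => ?_)
    (h.summable.mul_right (w x / 2))
  have := (h.lip ν).1 x
  have he := Real.exp_pos (σ * l1 ν)
  nlinarith

lemma Maj.coef {c : (ι → ℤ) → X → ℂ} {m : (ι → ℤ) → ℝ} (hσ : 0 ≤ σ) (h : Maj ρ w σ F c m)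
    (x : X) (ν : ι → ℤ) : coef (F x).1 ν = c ν x :=
  coef_eq_of_hasSum (summable_of_exp hσ (h.summable_norm x)) (h.rep x) ν

/-- Existence of a family with prescribed, majorized coefficients. -/
lemma exists_maj {c : (ι → ℤ) → X → ℂ} {m : (ι → ℤ) → ℝ} (hσ : 0 < σ) (hm : ∀ ν, 0 ≤ m ν)
    (hc : ∀ ν, LipB ρ w (c ν) (m ν)) (hs : Summable fun ν => Real.exp (σ * l1 ν) * m ν) :
    ∃ F : X → Sm ι, Maj ρ w σ F c m := by
  have h1 : ∀ x, Summable fun ν => Real.exp (σ * l1 ν) * ‖c ν x‖ := fun x => by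
    refine Summable.of_nonneg_of_le (fun _ => by positivity) (fun ν => ?_)
      (hs.mul_right (w x / 2))
    have := (hc ν).1 x
    have he := Real.exp_pos (σ * l1 ν)
    nlinarith
  refine ⟨fun x => ⟨fun ψ => ∑' ν, c ν x * chr ν ψ, smooth_fourier hσ (h1 x)⟩, hm, hc, ?_, hs⟩
  intro x ψ
  refine Summable.hasSum (Summable.of_norm ?_)
  simpa using summable_of_exp hσ.le (h1 x)

end families

section families

variable {ι : Type*} [Fintype ι] {X : Type*}
variable {ρ : X → X → ℝ} {w : X → ℝ} {σ : ℝ} {F G : X → Sm ι} {C C' : ℝ}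

lemma Bd.nonneg (h : Bd ρ w σ F C) : 0 ≤ C := by
  obtain ⟨c, m, hm, hC⟩ := h
  exact (tsum_nonneg fun ν => mul_nonneg (Real.exp_pos _).le (hm.nonneg ν)).trans hC

lemma Bd.mono (h : Bd ρ w σ F C) (hC : C ≤ C') : Bd ρ w σ F C' := by
  obtain ⟨c, m, hm, h⟩ := h
  exact ⟨c, m, hm, h.trans hC⟩

lemma Maj.anti {c : (ι → ℤ) → X → ℂ} {m : (ι → ℤ) → ℝ} {σ' : ℝ} (h : Maj ρ w σ F c m)
    (hσ : σ' ≤ σ) : Maj ρ w σ' F c m :=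
  ⟨h.nonneg, h.lip, h.rep, Summable.of_nonneg_of_le
    (fun ν => mul_nonneg (Real.exp_pos _).le (h.nonneg ν)) (fun ν => by
      have := l1_nonneg ν
      have := h.nonneg ν
      gcongr) h.summable⟩

lemma Bd.anti {σ' : ℝ} (h : Bd ρ w σ F C) (hσ : σ' ≤ σ) : Bd ρ w σ' F C := by
  obtain ⟨c, m, hm, h⟩ := h
  refine ⟨c, m, hm.anti hσ, le_trans ?_ h⟩
  refine (hm.anti hσ).summable.tsum_le_tsum (fun ν => ?_) hm.summable
  have := l1_nonneg ν
  have := hm.nonneg ν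
  gcongr

lemma Bd.weight [PosRho ρ] {w' : X → ℝ} (hww : ∀ x, w x ≤ w' x) (h : Bd ρ w σ F C) :
    Bd ρ w' σ F C := by
  obtain ⟨c, m, hm, h⟩ := h
  exact ⟨c, m, ⟨hm.nonneg, fun ν => (hm.lip ν).weight (hm.nonneg ν) hww, hm.rep, hm.summable⟩, h⟩

lemma Bd.comap {Y : Type*} (g : Y → X) (h : Bd ρ w σ F C) :
    Bd (fun a b => ρ (g a) (g b)) (w ∘ g) σ (F ∘ g) C := by
  obtain ⟨c, m, hm, h⟩ := h
  exact ⟨fun ν => c ν ∘ g, m, ⟨hm.nonneg, fun ν => ⟨fun x => (hm.lip ν).1 (g x),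
    fun x y => (hm.lip ν).2 (g x) (g y)⟩, fun x ψ => hm.rep (g x) ψ, hm.summable⟩, h⟩

lemma Bd.add (hF : Bd ρ w σ F C) (hG : Bd ρ w σ G C') : Bd ρ w σ (F + G) (C + C') := by
  obtain ⟨c, m, hm, h⟩ := hF
  obtain ⟨c', m', hm', h'⟩ := hG
  have e : (fun ν => Real.exp (σ * l1 ν) * (m + m') ν)
      = fun ν => Real.exp (σ * l1 ν) * m ν + Real.exp (σ * l1 ν) * m' ν := by
    funext ν; simp [mul_add]
  refine ⟨c + c', m + m', ⟨fun ν => add_nonneg (hm.nonneg ν) (hm'.nonneg ν),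
    fun ν => (hm.lip ν).add (hm'.lip ν), fun x ψ => ?_, ?_⟩, ?_⟩
  · simpa [add_mul] using (hm.rep x ψ).add (hm'.rep x ψ)
  · rw [e]; exact hm.summable.add hm'.summable
  · rw [e, hm.summable.tsum_add hm'.summable]
    exact add_le_add h h'

lemma Bd.neg (hF : Bd ρ w σ F C) : Bd ρ w σ (-F) C := by
  obtain ⟨c, m, hm, h⟩ := hF
  refine ⟨-c, m, ⟨hm.nonneg, fun ν => (hm.lip ν).neg, fun x ψ => ?_, hm.summable⟩, h⟩
  simpa using (hm.rep x ψ).neg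

lemma Bd.sub (hF : Bd ρ w σ F C) (hG : Bd ρ w σ G C') : Bd ρ w σ (F - G) (C + C') := by
  rw [sub_eq_add_neg]; exact hF.add hG.neg

/-- A single Fourier mode. -/
lemma Bd.mode [PosRho ρ] {a : X → ℂ} {A : ℝ} (hA : 0 ≤ A) (ha : LipB ρ w a A) (ν : ι → ℤ)
    (hF : ∀ x ψ, (F x).1 ψ = a x * chr ν ψ) : Bd ρ w σ F (Real.exp (σ * l1 ν) * A) := by
  classical
  refine ⟨fun μ => if μ = ν then a else 0, fun μ => if μ = ν then A else 0,
    ⟨fun μ => ?_, fun μ => ?_, fun x ψ => ?_, ?_⟩, ?_⟩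
  · split_ifs <;> simp [hA]
  · split_ifs
    · exact ha
    · exact ⟨fun x => by simp, fun x y => by simp⟩
  · rw [hF]
    convert hasSum_ite_eq ν (a x * chr ν ψ) using 1
    funext μ
    split_ifs with h
    · rw [h]
    · simp
  · exact summable_of_ne_finset_zero (s := {ν}) fun μ hμ => by
      simp at hμ; simp [hμ]
  · rw [tsum_eq_single ν (fun μ hμ => by simp [hμ])]
    simp

lemma Bd.cst [PosRho ρ] {a : X → ℂ} {A : ℝ} (hA : 0 ≤ A) (ha : LipB ρ w a A) :
    Bd ρ w σ (cst a : X → Sm ι) A := by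
  simpa using Bd.mode (σ := σ) (F := (KAM.cst a : X → Sm ι)) hA ha 0 (fun x ψ => by simp [KAM.cst])

lemma LipB.const [PosRho ρ] (z : ℂ) : LipB ρ 1 (fun _ => z) (2 * ‖z‖) :=
  ⟨fun x => by simp, fun x y => by
    have := PosRho.nonneg (ρ := ρ) x y
    simp
    positivity⟩

lemma Bd.const [PosRho ρ] (z : ℂ) : Bd ρ 1 σ (fun _ => algebraMap ℂ (Sm ι) z) (2 * ‖z‖) :=
  Bd.cst (by positivity) (LipB.const z)

lemma Bd.one [PosRho ρ] : Bd ρ 1 σ (1 : X → Sm ι) 2 := by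
  have := Bd.const (ρ := ρ) (σ := σ) (ι := ι) (1 : ℂ)
  rw [norm_one, mul_one] at this
  exact (show (1 : X → Sm ι) = fun _ => algebraMap ℂ (Sm ι) 1 by funext x; simp) ▸ this

lemma LipB.zero [PosRho ρ] [PosWt w] : LipB ρ w 0 0 := ⟨fun x => by simp, fun x y => by simp⟩

lemma Bd.zero [PosRho ρ] [PosWt w] : Bd ρ w σ (0 : X → Sm ι) 0 := by
  have := Bd.cst (σ := σ) (ι := ι) le_rfl (LipB.zero (ρ := ρ) (w := w))
  convert this using 1
  funext x; simp [KAM.cst]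

lemma Bd.sum [PosRho ρ] [PosWt w] {κ : Type*} (s : Finset κ) {F : κ → X → Sm ι} {C : κ → ℝ}
    (h : ∀ k ∈ s, Bd ρ w σ (F k) (C k)) : Bd ρ w σ (∑ k ∈ s, F k) (∑ k ∈ s, C k) := by
  classical
  induction s using Finset.induction_on with
  | empty => simpa using Bd.zero
  | insert a s ha ih =>
    rw [Finset.sum_insert ha, Finset.sum_insert ha]
    exact (h a (by simp)).add (ih fun k hk => h k (by simp [hk]))

/-- The reindexing `(ν, μ) ↦ (μ, ν - μ)`. -/
def convEquiv (ι : Type*) : (ι → ℤ) × (ι → ℤ) ≃ (ι → ℤ) × (ι → ℤ) where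
  toFun x := (x.2, x.1 - x.2)
  invFun y := (y.1 + y.2, y.1)
  left_inv x := by simp
  right_inv y := by simp

lemma hasSum_of_eq {κ : Type*} {f g : κ → ℂ} {a : ℂ} (hf : HasSum f a) (h : ∀ k, g k = f k) :
    HasSum g a := by
  rwa [show g = f from funext h]

lemma hasSum_mul_complex {κ : Type*} {f g : κ → ℂ} {a b : ℂ} (hf : HasSum f a) (hg : HasSum g b)
    (h1 : Summable fun k => ‖f k‖) (h2 : Summable fun k => ‖g k‖) :
    HasSum (fun z : κ × κ => f z.1 * g z.2) (a * b) :=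
  hf.mul hg (summable_mul_of_summable_norm h1 h2)

lemma Bd.mul [PosRho ρ] [PosWt w] (hσ : 0 ≤ σ) (hF : Bd ρ w σ F C) (hG : Bd ρ 1 σ G C') :
    Bd ρ w σ (F * G) (C * C') := by
  have hC := hF.nonneg
  obtain ⟨c, m, hm, h⟩ := hF
  obtain ⟨c', m', hm', h'⟩ := hG
  have hsm : Summable fun x : (ι → ℤ) × (ι → ℤ) =>
      (Real.exp (σ * l1 x.1) * m x.1) * (Real.exp (σ * l1 x.2) * m' x.2) :=
    hm.summable.mul_of_nonneg hm'.summable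
      (fun ν => mul_nonneg (Real.exp_pos _).le (hm.nonneg ν))
      (fun ν => mul_nonneg (Real.exp_pos _).le (hm'.nonneg ν))
  have hsm2 := (convEquiv ι).summable_iff.mpr hsm
  have hle : ∀ x : (ι → ℤ) × (ι → ℤ), Real.exp (σ * l1 x.1) * (m x.2 * m' (x.1 - x.2))
      ≤ (Real.exp (σ * l1 x.2) * m x.2) * (Real.exp (σ * l1 (x.1 - x.2)) * m' (x.1 - x.2)) := by
    intro x
    have h1 : l1 x.1 ≤ l1 x.2 + l1 (x.1 - x.2) := by
      have := l1_add_le x.2 (x.1 - x.2)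
      simpa using this
    have h2 : Real.exp (σ * l1 x.1) ≤ Real.exp (σ * l1 x.2) * Real.exp (σ * l1 (x.1 - x.2)) := by
      rw [← Real.exp_add, ← mul_add]
      gcongr
    calc _ ≤ (Real.exp (σ * l1 x.2) * Real.exp (σ * l1 (x.1 - x.2))) *
          (m x.2 * m' (x.1 - x.2)) :=
          mul_le_mul_of_nonneg_right h2 (mul_nonneg (hm.nonneg _) (hm'.nonneg _))
      _ = _ := by ring
  have hsm3 : Summable fun x : (ι → ℤ) × (ι → ℤ) =>
      Real.exp (σ * l1 x.1) * (m x.2 * m' (x.1 - x.2)) :=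
    Summable.of_nonneg_of_le (fun x => mul_nonneg (Real.exp_pos _).le
      (mul_nonneg (hm.nonneg _) (hm'.nonneg _))) hle hsm2
  have hfib : ∀ ν : ι → ℤ, Summable fun μ : ι → ℤ => m μ * m' (ν - μ) := fun ν =>
    (summable_mul_left_iff (Real.exp_pos (σ * l1 ν)).ne').mp (hsm3.prod_factor ν)
  have hpair : ∀ ν μ : ι → ℤ, LipB ρ w (c μ * c' (ν - μ)) (m μ * m' (ν - μ)) := fun ν μ =>
    (hm.lip μ).mul (hm.nonneg _) (hm'.nonneg _) (hm'.lip _)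
  have hcs : ∀ ν, _ := fun ν => LipB.tsum (hpair ν) (hfib ν)
  refine ⟨fun ν x => ∑' μ, c μ x * c' (ν - μ) x, fun ν => ∑' μ, m μ * m' (ν - μ),
    ⟨fun ν => tsum_nonneg fun μ => mul_nonneg (hm.nonneg _) (hm'.nonneg _),
      fun ν => (hcs ν).1, fun x ψ => ?_, ?_⟩, ?_⟩
  · have h1 : Summable fun ν => ‖c ν x * chr ν ψ‖ := by
      simpa using summable_of_exp hσ (hm.summable_norm x)
    have h2 : Summable fun ν => ‖c' ν x * chr ν ψ‖ := by
      simpa using summable_of_exp hσ (hm'.summable_norm x)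
    have h3 := hasSum_mul_complex (hm.rep x ψ) (hm'.rep x ψ) h1 h2
    have h4 := (convEquiv ι).hasSum_iff.mpr h3
    refine HasSum.prod_fiberwise h4 fun ν => ?_
    have h5 := ((hcs ν).2 x).of_norm.hasSum.mul_right (chr ν ψ)
    simp only [Pi.mul_apply] at h5
    refine hasSum_of_eq h5 fun μ => ?_
    simp only [convEquiv, Equiv.coe_fn_mk, Function.comp_apply]
    rw [show chr ν ψ = chr μ ψ * chr (ν - μ) ψ by rw [← chr_add_left]; congr 1; simp]
    ring
  · refine hsm3.prod.congr fun ν => ?_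
    dsimp only
    rw [tsum_mul_left]
  · have h6 := hsm3.tsum_prod
    simp only [tsum_mul_left] at h6
    rw [← h6]
    calc _ ≤ ∑' x : (ι → ℤ) × (ι → ℤ), _ := hsm3.tsum_le_tsum hle hsm2
      _ = ∑' x : (ι → ℤ) × (ι → ℤ),
          (Real.exp (σ * l1 x.1) * m x.1) * (Real.exp (σ * l1 x.2) * m' x.2) :=
          (convEquiv ι).tsum_eq (fun x : (ι → ℤ) × (ι → ℤ) =>
          (Real.exp (σ * l1 x.1) * m x.1) * (Real.exp (σ * l1 x.2) * m' x.2))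
      _ = (∑' ν, Real.exp (σ * l1 ν) * m ν) * ∑' ν, Real.exp (σ * l1 ν) * m' ν :=
          (hm.summable.tsum_mul_tsum hm'.summable hsm).symm
      _ ≤ C * C' := mul_le_mul h h'
          (tsum_nonneg fun ν => mul_nonneg (Real.exp_pos _).le (hm'.nonneg ν)) hC

lemma Bd.mul' [PosRho ρ] [PosWt w] (hσ : 0 ≤ σ) (hF : Bd ρ 1 σ F C) (hG : Bd ρ w σ G C') :
    Bd ρ w σ (F * G) (C * C') := by
  rw [mul_comm F, mul_comm C]; exact hG.mul hσ hF

/-- Countable sums. -/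
lemma Bd.tsum {κ : Type*} (hσ : 0 < σ) {F : κ → X → Sm ι} {C : κ → ℝ}
    (h : ∀ k, Bd ρ w σ (F k) (C k)) (hC : Summable C) :
    ∃ S : X → Sm ι, Bd ρ w σ S (∑' k, C k) ∧ ∀ x ψ, HasSum (fun k => (F k x).1 ψ) ((S x).1 ψ) := by
  choose c m hm hle using h
  have hnn : ∀ k ν, 0 ≤ Real.exp (σ * l1 ν) * m k ν := fun k ν =>
    mul_nonneg (Real.exp_pos _).le ((hm k).nonneg ν)
  have hs2 : Summable fun x : κ × (ι → ℤ) => Real.exp (σ * l1 x.2) * m x.1 x.2 := by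
    rw [summable_prod_of_nonneg (fun x => hnn _ _)]
    exact ⟨fun k => (hm k).summable, Summable.of_nonneg_of_le
      (fun k => tsum_nonneg fun ν => hnn k ν) hle hC⟩
  have hs3 : Summable fun x : (ι → ℤ) × κ => Real.exp (σ * l1 x.1) * m x.2 x.1 := hs2.prod_symm
  have hs4 : ∀ ν, Summable fun k => m k ν := fun ν =>
    (summable_mul_left_iff (Real.exp_pos (σ * l1 ν)).ne').mp (hs3.prod_factor ν)
  have hl : ∀ ν, _ := fun ν => LipB.tsum (fun k => (hm k).lip ν) (hs4 ν)
  have hs5 : Summable fun ν => Real.exp (σ * l1 ν) * ∑' k, m k ν := by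
    refine hs3.prod.congr fun ν => ?_
    dsimp only
    rw [tsum_mul_left]
  obtain ⟨S, hS⟩ := exists_maj (m := fun ν => ∑' k, m k ν) hσ
    (fun ν => tsum_nonneg fun k => (hm k).nonneg ν) (fun ν => (hl ν).1) hs5
  refine ⟨S, ⟨_, _, hS, ?_⟩, fun x ψ => ?_⟩
  · have h6 := hs3.tsum_prod
    simp only [tsum_mul_left] at h6
    rw [← h6, ← (Equiv.prodComm κ (ι → ℤ)).tsum_eq]
    refine (hs2.tsum_prod.trans_le ?_)
    exact hs2.prod.tsum_le_tsum hle hC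
  · have h7 : Summable fun z : κ × (ι → ℤ) => c z.1 z.2 x * chr z.2 ψ := by
      refine Summable.of_norm_bounded (hs2.mul_right (w x / 2)) fun z => ?_
      rw [norm_mul, norm_chr, mul_one]
      have h8 := ((hm z.1).lip z.2).1 x
      have h9 : 1 ≤ Real.exp (σ * l1 z.2) := Real.one_le_exp (mul_nonneg hσ.le (l1_nonneg _))
      have h10 : 0 ≤ m z.1 z.2 * w x / 2 := by
        have := norm_nonneg (c z.1 z.2 x); linarith
      calc ‖c z.1 z.2 x‖ ≤ m z.1 z.2 * w x / 2 := by linarith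
        _ ≤ Real.exp (σ * l1 z.2) * (m z.1 z.2 * w x / 2) := le_mul_of_one_le_left h10 h9
        _ = _ := by ring
    have h8 : HasSum (fun k => (F k x).1 ψ) (∑' z : κ × (ι → ℤ), c z.1 z.2 x * chr z.2 ψ) :=
      h7.hasSum.prod_fiberwise fun k => (hm k).rep x ψ
    convert h8 using 1
    have h9 := h7.prod_symm.hasSum
    have h10 := h9.prod_fiberwise (g := fun ν => (∑' k, c k ν x) * chr ν ψ) fun ν =>
      (((hl ν).2 x).of_norm.hasSum.mul_right (chr ν ψ))
    rw [(hS.rep x ψ).unique h10]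
    exact (Equiv.prodComm (ι → ℤ) κ).tsum_eq (fun z : κ × (ι → ℤ) => c z.1 z.2 x * chr z.2 ψ)

lemma Bd.congr (h : Bd ρ w σ F C) (hFG : ∀ x ψ, (G x).1 ψ = (F x).1 ψ) : Bd ρ w σ G C := by
  rw [show G = F from funext fun x => Sm.ext (hFG x)]; exact h

/-- Countable sums, with the sum given. -/
lemma Bd.of_hasSum {κ : Type*} (hσ : 0 < σ) {F : κ → X → Sm ι} {C : κ → ℝ}
    (h : ∀ k, Bd ρ w σ (F k) (C k)) (hC : Summable C)
    (hG : ∀ x ψ, HasSum (fun k => (F k x).1 ψ) ((G x).1 ψ)) : Bd ρ w σ G (∑' k, C k) := by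
  obtain ⟨S, hS, hs⟩ := Bd.tsum hσ h hC
  exact hS.congr fun x ψ => (hG x ψ).unique (hs x ψ)

lemma Bd.norm_le (hσ : 0 ≤ σ) (h : Bd ρ w σ F C) (x : X) (ψ : ι → ℝ) (hw : 0 ≤ w x) :
    2 * ‖(F x).1 ψ‖ ≤ C * w x := by
  obtain ⟨c, m, hm, h⟩ := h
  have h0 : Summable m := Summable.of_nonneg_of_le hm.nonneg (fun ν =>
    le_mul_of_one_le_left (hm.nonneg ν) (Real.one_le_exp (mul_nonneg hσ (l1_nonneg _)))) hm.summable
  have h1 : Summable fun ν => ‖c ν x * chr ν ψ‖ := by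
    simpa using summable_of_exp hσ (hm.summable_norm x)
  rw [← (hm.rep x ψ).tsum_eq]
  calc 2 * ‖∑' ν, c ν x * chr ν ψ‖ ≤ 2 * ∑' ν, ‖c ν x * chr ν ψ‖ := by
        gcongr; exact norm_tsum_le_tsum_norm h1
    _ = ∑' ν, 2 * ‖c ν x * chr ν ψ‖ := by rw [tsum_mul_left]
    _ ≤ ∑' ν, (Real.exp (σ * l1 ν) * m ν) * w x := by
        refine (h1.mul_left 2).tsum_le_tsum (fun ν => ?_) (hm.summable.mul_right _)
        rw [norm_mul, norm_chr, mul_one]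
        refine ((hm.lip ν).1 x).trans ?_
        gcongr
        exact le_mul_of_one_le_left (hm.nonneg ν)
          (Real.one_le_exp (mul_nonneg hσ (l1_nonneg _)))
    _ = (∑' ν, Real.exp (σ * l1 ν) * m ν) * w x := by rw [tsum_mul_right]
    _ ≤ C * w x := by gcongr

lemma Bd.lip_le [PosRho ρ] [PosWt w] (hσ : 0 ≤ σ) (h : Bd ρ w σ F C) (x y : X) (ψ : ι → ℝ) :
    2 * ‖(F x).1 ψ - (F y).1 ψ‖ ≤ C * max (w x) (w y) * ρ x y := by
  obtain ⟨c, m, hm, h⟩ := h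
  have hr := PosRho.nonneg (ρ := ρ) x y
  have hmw : 0 ≤ max (w x) (w y) := (PosWt.nonneg x).trans (le_max_left _ _)
  have h1 : ∀ x, Summable fun ν => ‖c ν x‖ := fun x => summable_of_exp hσ (hm.summable_norm x)
  have h2 : Summable fun ν => ‖(c ν x - c ν y) * chr ν ψ‖ := by
    simp only [norm_mul, norm_chr, mul_one]
    exact Summable.of_nonneg_of_le (fun _ => norm_nonneg _) (fun ν => norm_sub_le _ _)
      ((h1 x).add (h1 y))
  have h3 : HasSum (fun ν => (c ν x - c ν y) * chr ν ψ) ((F x).1 ψ - (F y).1 ψ) := by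
    simpa [sub_mul] using (hm.rep x ψ).sub (hm.rep y ψ)
  rw [← h3.tsum_eq]
  calc 2 * ‖∑' ν, (c ν x - c ν y) * chr ν ψ‖ ≤ 2 * ∑' ν, ‖(c ν x - c ν y) * chr ν ψ‖ := by
        gcongr; exact norm_tsum_le_tsum_norm h2
    _ = ∑' ν, 2 * ‖(c ν x - c ν y) * chr ν ψ‖ := by rw [tsum_mul_left]
    _ ≤ ∑' ν, (Real.exp (σ * l1 ν) * m ν) * (max (w x) (w y) * ρ x y) := by
        refine (h2.mul_left 2).tsum_le_tsum (fun ν => ?_) (hm.summable.mul_right _)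
        rw [norm_mul, norm_chr, mul_one]
        refine ((hm.lip ν).2 x y).trans ?_
        rw [mul_assoc]
        gcongr
        exact le_mul_of_one_le_left (hm.nonneg ν)
          (Real.one_le_exp (mul_nonneg hσ (l1_nonneg _)))
    _ = (∑' ν, Real.exp (σ * l1 ν) * m ν) * (max (w x) (w y) * ρ x y) := by rw [tsum_mul_right]
    _ ≤ C * (max (w x) (w y) * ρ x y) := by gcongr
    _ = _ := by ring

/-! ### Fourier multipliers -/

lemma Maj.multiplier [PosRho ρ] [PosWt w] {c : (ι → ℤ) → X → ℂ} {m : (ι → ℤ) → ℝ}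
    {a : (ι → ℤ) → X → ℂ} {L δ : ℝ} (hL : 0 ≤ L)
    (ha : ∀ ν, LipB ρ 1 (a ν) (L * Real.exp (δ * l1 ν))) (hF : Maj ρ w σ F c m) :
    (∀ ν, LipB ρ w (c ν * a ν) (m ν * (L * Real.exp (δ * l1 ν)))) ∧
    (Summable fun ν => Real.exp ((σ - δ) * l1 ν) * (m ν * (L * Real.exp (δ * l1 ν)))) ∧
    ∑' ν, Real.exp ((σ - δ) * l1 ν) * (m ν * (L * Real.exp (δ * l1 ν)))
      = L * ∑' ν, Real.exp (σ * l1 ν) * m ν := by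
  have e : ∀ ν : ι → ℤ, Real.exp ((σ - δ) * l1 ν) * (m ν * (L * Real.exp (δ * l1 ν)))
      = L * (Real.exp (σ * l1 ν) * m ν) := fun ν => by
    rw [sub_mul, Real.exp_sub]
    field_simp
  simp_rw [e]
  exact ⟨fun ν => (hF.lip ν).mul (hF.nonneg ν) (by positivity) (ha ν), hF.summable.mul_left L,
    tsum_mul_left⟩

lemma Bd.multiplier [PosRho ρ] [PosWt w] {a : (ι → ℤ) → X → ℂ} {L δ : ℝ} (hL : 0 ≤ L)
    (hσ : 0 ≤ σ) (hσδ : 0 < σ - δ)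
    (ha : ∀ ν, LipB ρ 1 (a ν) (L * Real.exp (δ * l1 ν))) (hF : Bd ρ w σ F C) :
    ∃ S : X → Sm ι, Bd ρ w (σ - δ) S (L * C) ∧ ∀ x,
      (Summable fun ν => Real.exp ((σ - δ) * l1 ν) * ‖coef (F x).1 ν * a ν x‖) ∧
      ∀ ψ, HasSum (fun ν => (coef (F x).1 ν * a ν x) * chr ν ψ) ((S x).1 ψ) := by
  obtain ⟨c, m, hm, h⟩ := hF
  obtain ⟨h1, h2, h3⟩ := hm.multiplier hL ha
  obtain ⟨S, hS⟩ := exists_maj hσδ (fun ν => mul_nonneg (hm.nonneg ν) (by positivity)) h1 h2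
  refine ⟨S, ⟨_, _, hS, ?_⟩, fun x => ⟨?_, fun ψ => ?_⟩⟩
  · rw [h3]; gcongr
  · simp_rw [hm.coef hσ x]
    exact hS.summable_norm x
  · simp_rw [hm.coef hσ x]
    exact hS.rep x ψ

/-- The basic a priori estimate: if the coefficients of `G` are those of `F` times `a`. -/
lemma Bd.of_coef [PosRho ρ] [PosWt w] {a : (ι → ℤ) → X → ℂ} {L δ σ' : ℝ} (hL : 0 ≤ L)
    (hσ : 0 ≤ σ) (hσδ : 0 < σ - δ) (hσ' : 0 ≤ σ')
    (ha : ∀ ν, LipB ρ 1 (a ν) (L * Real.exp (δ * l1 ν))) (hF : Bd ρ w σ F C)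
    {w' : X → ℝ} (hG : Bd ρ w' σ' G C')
    (hc : ∀ x ν, coef (G x).1 ν = coef (F x).1 ν * a ν x) : Bd ρ w (σ - δ) G (L * C) := by
  obtain ⟨S, hS, h⟩ := hF.multiplier hL hσ hσδ ha
  obtain ⟨c, m, hm, -⟩ := hG
  refine hS.congr fun x ψ => ?_
  have h1 := hm.rep x ψ
  simp_rw [← hm.coef hσ' x, hc x] at h1
  exact h1.unique ((h x).2 ψ)

lemma Bd.coef_RD (hσ : 0 < σ) (hF : Bd ρ w σ F C) (κ : X → ℂ) (v : ι → ℝ) (x : X) (ν : ι → ℤ) :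
    coef (RD κ v F x).1 ν = coef (F x).1 ν * (κ x * (dotZ ν v * Complex.I)) := by
  obtain ⟨c, m, hm, -⟩ := hF
  rw [hm.coef hσ.le x]
  have hs := hm.summable_norm x
  have hu : Summable fun ν => ‖c ν x‖ * l1 ν := by
    refine Summable.of_nonneg_of_le (fun ν => mul_nonneg (norm_nonneg _) (l1_nonneg _))
      (fun ν => ?_) (hs.mul_left σ⁻¹)
    have := pow_le_factorial_mul_exp (l1_nonneg ν) hσ 1
    simp only [pow_one, Nat.factorial_one, Nat.cast_one, one_mul] at this
    calc ‖c ν x‖ * l1 ν ≤ ‖c ν x‖ * (σ⁻¹ * Real.exp (σ * l1 ν)) := by gcongr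
      _ = _ := by ring
  refine coef_eq_of_hasSum (c := fun ν => c ν x * (κ x * (dotZ ν v * Complex.I))) ?_
    (fun ψ => ?_) ν
  · refine Summable.of_nonneg_of_le (fun _ => norm_nonneg _) (fun ν => ?_)
      (hu.mul_left (‖κ x‖ * ‖v‖))
    simp only [norm_mul, Complex.norm_real, Complex.norm_I, mul_one, Real.norm_eq_abs]
    have := abs_dotZ_le ν v
    calc ‖c ν x‖ * (‖κ x‖ * |dotZ ν v|) ≤ ‖c ν x‖ * (‖κ x‖ * (l1 ν * ‖v‖)) := by gcongr
      _ = _ := by ring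
  · have h := (hasSum_fderiv_fourier hσ hs (hm.rep x) ψ v).mul_left (κ x)
    simp only [RD_apply, Sm.smul_val, dd_val]
    refine hasSum_of_eq h fun μ => ?_
    ring

end families

section families

variable {ι : Type*} [Fintype ι] {X : Type*}
variable {ρ : X → X → ℝ} {w : X → ℝ} {σ : ℝ} {F G : X → Sm ι} {C C' : ℝ}

lemma Bd.smul [PosRho ρ] [PosWt w] (hσ : 0 ≤ σ) (z : ℂ) (hF : Bd ρ w σ F C) :
    Bd ρ w σ (z • F) (2 * ‖z‖ * C) :=
  ((Bd.const z).mul' hσ hF).congr fun x ψ => by simp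

lemma Bd.pd [PosRho ρ] [PosWt w] {δ : ℝ} (hδ : 0 < δ) (hσδ : 0 < σ - δ)
    (hF : Bd ρ w σ F C) {v : ι → ℝ} (hv : ‖v‖ ≤ 1) :
    Bd ρ w (σ - δ) (RD 1 v F) (2 * δ⁻¹ * C) := by
  have hσ : 0 < σ := by linarith
  have ha : ∀ ν : ι → ℤ, LipB ρ 1 (fun _ : X => (dotZ ν v : ℂ) * Complex.I)
      (2 * δ⁻¹ * Real.exp (δ * l1 ν)) := fun ν => by
    refine (LipB.const _).mono ?_
    have := pow_le_factorial_mul_exp (l1_nonneg ν) hδ 1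
    simp only [pow_one, Nat.factorial_one, Nat.cast_one, one_mul] at this
    have h2 := abs_dotZ_le ν v
    have h3 : l1 ν * ‖v‖ ≤ l1 ν := mul_le_of_le_one_right (l1_nonneg ν) hv
    simp only [norm_mul, Complex.norm_real, Complex.norm_I, mul_one, Real.norm_eq_abs]
    linarith
  obtain ⟨S, hS, h⟩ := hF.multiplier (by positivity) hσ.le hσδ ha
  obtain ⟨c, m, hm, -⟩ := hF
  refine hS.congr fun x ψ => ?_
  have h1 := hasSum_fderiv_fourier hσ (hm.summable_norm x) (hm.rep x) ψ v
  have h2 := (h x).2 ψ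
  simp_rw [hm.coef hσ.le x] at h2
  simp only [RD_apply, Pi.one_apply, one_smul, dd_val]
  exact h1.unique h2

/-- Complex conjugation of smooth functions. -/
noncomputable def cj (F : Sm ι) : Sm ι :=
  ⟨fun ψ => (starRingEnd ℂ) (F.1 ψ), Complex.conjCLE.contDiff.comp (Sm.contDiff F)⟩

/-- The real part of a smooth function. -/
noncomputable def reS (F : Sm ι) : Sm ι :=
  ⟨fun ψ => ((F.1 ψ).re : ℂ),
    Complex.ofRealCLM.contDiff.comp (Complex.reCLM.contDiff.comp (Sm.contDiff F))⟩

@[simp] lemma reS_val (F : Sm ι) (ψ : ι → ℝ) : (reS F).1 ψ = ((F.1 ψ).re : ℂ) := rfl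

lemma Bd.cj (hF : Bd ρ w σ F C) : Bd ρ w σ (fun x => cj (F x)) C := by
  obtain ⟨c, m, hm, h⟩ := hF
  refine ⟨fun ν x => (starRingEnd ℂ) (c (-ν) x), fun ν => m (-ν),
    ⟨fun ν => hm.nonneg _, fun ν => ⟨fun x => ?_, fun x y => ?_⟩, fun x ψ => ?_, ?_⟩, ?_⟩
  · simpa using (hm.lip (-ν)).1 x
  · rw [← map_sub, RCLike.norm_conj]; exact (hm.lip (-ν)).2 x y
  · have h1 := (Complex.hasSum_conj' (f := fun ν => c ν x * chr ν ψ)).mpr (hm.rep x ψ)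
    have h2 := (Equiv.neg (ι → ℤ)).hasSum_iff.mpr h1
    refine hasSum_of_eq h2 fun ν => ?_
    simp [chr_neg_left]
  · have := (Equiv.neg (ι → ℤ)).summable_iff.mpr hm.summable
    simpa [Function.comp_def] using this
  · have := (Equiv.neg (ι → ℤ)).tsum_eq (fun ν => Real.exp (σ * l1 ν) * m ν)
    simp only [Equiv.neg_apply, l1_neg] at this
    rwa [this]

lemma Bd.re [PosRho ρ] [PosWt w] (hσ : 0 ≤ σ) (hF : Bd ρ w σ F C) :
    Bd ρ w σ (fun x => reS (F x)) (2 * C) := by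
  have h := ((hF.add hF.cj).smul hσ (1 / 2))
  refine (h.mono (le_of_eq ?_)).congr fun x ψ => ?_
  · norm_num; ring
  · simp only [reS_val, Pi.smul_apply, Pi.add_apply, Sm.smul_val, Sm.add_val, KAM.cj]
    rw [Complex.re_eq_add_conj]; ring

/-- The mean value over the torus. -/
noncomputable def mean (F : X → Sm ι) : X → ℂ := fun x => coef (F x).1 0

lemma Bd.lipB_mean [PosRho ρ] [PosWt w] (hσ : 0 ≤ σ) (hF : Bd ρ w σ F C) :
    LipB ρ w (mean F) C := by
  obtain ⟨c, m, hm, h⟩ := hF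
  have h1 : mean F = c 0 := funext fun x => hm.coef hσ x 0
  rw [h1]
  refine (hm.lip 0).mono (le_trans ?_ h)
  have := hm.summable.le_tsum (i := 0) fun ν _ => mul_nonneg (Real.exp_pos _).le (hm.nonneg ν)
  simpa using this

lemma Bd.mean [PosRho ρ] [PosWt w] {σ' : ℝ} (hσ : 0 ≤ σ) (hF : Bd ρ w σ F C) :
    Bd ρ w σ' (KAM.cst (KAM.mean F) : X → Sm ι) C :=
  Bd.cst hF.nonneg (hF.lipB_mean hσ)

lemma Bd.coef_add (hσ : 0 ≤ σ) {w' : X → ℝ} (hF : Bd ρ w σ F C) (hG : Bd ρ w' σ G C') (x : X)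
    (ν : ι → ℤ) : coef ((F + G) x).1 ν = coef (F x).1 ν + coef (G x).1 ν := by
  obtain ⟨c, m, hm, -⟩ := hF
  obtain ⟨c', m', hm', -⟩ := hG
  rw [hm.coef hσ, hm'.coef hσ]
  refine coef_eq_of_hasSum (c := fun ν => c ν x + c' ν x) ?_ (fun ψ => ?_) ν
  · exact Summable.of_nonneg_of_le (fun _ => norm_nonneg _) (fun ν => norm_add_le _ _)
      ((summable_of_exp hσ (hm.summable_norm x)).add (summable_of_exp hσ (hm'.summable_norm x)))
  · exact hasSum_of_eq ((hm.rep x ψ).add (hm'.rep x ψ)) fun ν => by ring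

lemma Bd.coef_smul (hσ : 0 ≤ σ) (hF : Bd ρ w σ F C) (x : X) (a : ℂ) (ν : ι → ℤ) :
    coef (a • F x).1 ν = a * coef (F x).1 ν := by
  obtain ⟨c, m, hm, -⟩ := hF
  rw [hm.coef hσ]
  refine coef_eq_of_hasSum (c := fun ν => a * c ν x) ?_ (fun ψ => ?_) ν
  · simpa using (summable_of_exp hσ (hm.summable_norm x)).mul_left ‖a‖
  · exact hasSum_of_eq ((hm.rep x ψ).mul_left a) fun ν => by ring

lemma coef_neg (F : (ι → ℝ) → ℂ) (ν : ι → ℤ) : coef (-F) ν = -coef F ν := by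
  simp [coef, integral_neg]

lemma coef_const (a : ℂ) (ν : ι → ℤ) : coef (fun _ : ι → ℝ => a) ν = if ν = 0 then a else 0 := by
  classical
  refine coef_eq_of_hasSum (c := fun ν => if ν = 0 then a else 0) ?_ (fun ψ => ?_) ν
  · exact summable_of_ne_finset_zero (s := {0}) fun μ hμ => by simp at hμ; simp [hμ]
  · refine hasSum_of_eq (hasSum_ite_eq 0 a) fun μ => ?_
    split_ifs with h <;> simp [h]

lemma mean_cst (a : X → ℂ) : mean (cst a : X → Sm ι) = a := by
  funext x
  exact (coef_const (ι := ι) (a x) 0).trans (by simp)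

/-! ### Powers and exponentials -/

lemma Bd.pow_succ [PosRho ρ] [PosWt w] {Cw : ℝ} (hσ : 0 ≤ σ) (hw : Bd ρ w σ F Cw)
    (hF : Bd ρ 1 σ F C) (n : ℕ) : Bd ρ w σ (F ^ (n + 1)) (Cw * C ^ n) := by
  induction n with
  | zero => simpa using hw
  | succ n ih =>
    rw [_root_.pow_succ, _root_.pow_succ C, ← mul_assoc]
    exact ih.mul hσ hF

/-- The exponential of a smooth function. -/
noncomputable def expS (F : Sm ι) : Sm ι :=
  ⟨fun ψ => Complex.exp (F.1 ψ), Complex.contDiff_exp.comp (Sm.contDiff F)⟩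

@[simp] lemma expS_val (F : Sm ι) (ψ : ι → ℝ) : (expS F).1 ψ = Complex.exp (F.1 ψ) := rfl

lemma hasSum_cexp (z : ℂ) : HasSum (fun n : ℕ => z ^ n / n.factorial) (Complex.exp z) := by
  rw [Complex.exp_eq_exp_ℂ]
  exact NormedSpace.expSeries_div_hasSum_exp z

lemma hasSum_rexp (z : ℝ) : HasSum (fun n : ℕ => z ^ n / n.factorial) (Real.exp z) := by
  rw [Real.exp_eq_exp_ℝ]
  exact NormedSpace.expSeries_div_hasSum_exp z

lemma Bd.exp_tail [PosRho ρ] [PosWt w] {Cw : ℝ} (hσ : 0 < σ) (hw : Bd ρ w σ F Cw)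
    (hF : Bd ρ 1 σ F C) (j : ℕ)
    (hG : ∀ x ψ, HasSum (fun k : ℕ => ((F x).1 ψ) ^ (k + j + 1) / (k + j + 1).factorial)
      ((G x).1 ψ)) :
    Bd ρ w σ G (2 * Cw * C ^ j * Real.exp C) := by
  have hC := hF.nonneg
  have hCw := hw.nonneg
  have h1 : ∀ k : ℕ, Bd ρ w σ (((1 / (k + j + 1).factorial : ℝ) : ℂ) • F ^ (k + j + 1))
      (2 * Cw * C ^ j * (C ^ k / k.factorial)) := fun k => by
    refine ((hw.pow_succ hσ.le hF (k + j)).smul hσ.le _).mono ?_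
    rw [Complex.norm_real, Real.norm_of_nonneg (by positivity)]
    have hk : (k.factorial : ℝ) ≤ (k + j + 1).factorial := by
      exact_mod_cast Nat.factorial_le (by omega)
    have hk0 : (0 : ℝ) < k.factorial := by positivity
    have : (1 / (k + j + 1).factorial : ℝ) ≤ 1 / k.factorial := one_div_le_one_div_of_le hk0 hk
    calc 2 * (1 / ((k + j + 1).factorial : ℝ)) * (Cw * C ^ (k + j))
        ≤ 2 * (1 / k.factorial) * (Cw * C ^ (k + j)) := by gcongr
      _ = _ := by rw [pow_add]; ring
  have hs : HasSum (fun k : ℕ => 2 * Cw * C ^ j * (C ^ k / k.factorial))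
      (2 * Cw * C ^ j * Real.exp C) := (hasSum_rexp C).mul_left _
  rw [← hs.tsum_eq]
  refine Bd.of_hasSum hσ h1 hs.summable fun x ψ => ?_
  refine hasSum_of_eq (hG x ψ) fun k => ?_
  simp [div_eq_inv_mul]

lemma Bd.exp_sub_one [PosRho ρ] [PosWt w] {Cw : ℝ} (hσ : 0 < σ) (hw : Bd ρ w σ F Cw)
    (hF : Bd ρ 1 σ F C) :
    Bd ρ w σ ((fun x => expS (F x)) - 1) (2 * Cw * Real.exp C) := by
  have h := Bd.exp_tail (G := (fun x => expS (F x)) - 1) hσ hw hF 0 fun x ψ => by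
    have := (hasSum_nat_add_iff' 1).mpr (hasSum_cexp ((F x).1 ψ))
    simpa using this
  simpa using h

lemma Bd.exp_sub_one_sub [PosRho ρ] [PosWt w] {Cw : ℝ} (hσ : 0 < σ) (hw : Bd ρ w σ F Cw)
    (hF : Bd ρ 1 σ F C) :
    Bd ρ w σ ((fun x => expS (F x)) - 1 - F) (2 * Cw * C * Real.exp C) := by
  have h := Bd.exp_tail (G := (fun x => expS (F x)) - 1 - F) hσ hw hF 1 fun x ψ => by
    have := (hasSum_nat_add_iff' 2).mpr (hasSum_cexp ((F x).1 ψ))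
    simpa [Finset.sum_range_succ, sub_sub] using this
  simpa using h

lemma Bd.exp [PosRho ρ] (hσ : 0 < σ) (hF : Bd ρ 1 σ F C) :
    Bd ρ 1 σ (fun x => expS (F x)) (2 * Real.exp (2 * C)) := by
  have h := (Bd.exp_sub_one hσ hF hF).add Bd.one
  refine (h.mono ?_).congr fun x ψ => by simp
  have hC := hF.nonneg
  have h1 := Real.add_one_le_exp C
  have h2 : Real.exp (2 * C) = Real.exp C * Real.exp C := by rw [← Real.exp_add]; ring_nf
  rw [h2]
  nlinarith [Real.exp_pos C]

end families

/-! ### Matrices -/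

section matrices

variable {ι : Type*} [Fintype ι] {X : Type*}
variable {ρ : X → X → ℝ} {w : X → ℝ} {σ : ℝ} {C C' : ℝ}
variable {m n p : Type*} [Fintype m] [Fintype n] [Fintype p]

/-- The sum of the norms of the entries of `M` is at most `C`. -/
def MBd (ρ : X → X → ℝ) (w : X → ℝ) (σ : ℝ) (M : Matrix m n (X → Sm ι)) (C : ℝ) : Prop :=
  ∃ b : m → n → ℝ, (∀ i j, Bd ρ w σ (M i j) (b i j)) ∧ ∑ i, ∑ j, b i j ≤ C

variable {M N : Matrix m n (X → Sm ι)}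

lemma MBd.nonneg (h : MBd ρ w σ M C) : 0 ≤ C := by
  obtain ⟨b, hb, h⟩ := h
  exact (Finset.sum_nonneg fun i _ => Finset.sum_nonneg fun j _ => (hb i j).nonneg).trans h

lemma MBd.mono (h : MBd ρ w σ M C) (hC : C ≤ C') : MBd ρ w σ M C' := by
  obtain ⟨b, hb, h⟩ := h
  exact ⟨b, hb, h.trans hC⟩

lemma MBd.anti {σ' : ℝ} (h : MBd ρ w σ M C) (hσ : σ' ≤ σ) : MBd ρ w σ' M C := by
  obtain ⟨b, hb, h⟩ := h
  exact ⟨b, fun i j => (hb i j).anti hσ, h⟩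

lemma MBd.weight [PosRho ρ] {w' : X → ℝ} (hww : ∀ x, w x ≤ w' x) (h : MBd ρ w σ M C) :
    MBd ρ w' σ M C := by
  obtain ⟨b, hb, h⟩ := h
  exact ⟨b, fun i j => (hb i j).weight hww, h⟩

lemma MBd.comap {Y : Type*} (g : Y → X) (h : MBd ρ w σ M C) :
    MBd (fun a b => ρ (g a) (g b)) (w ∘ g) σ (M.map (· ∘ g)) C := by
  obtain ⟨b, hb, h⟩ := h
  exact ⟨b, fun i j => (hb i j).comap g, h⟩

lemma MBd.add (hM : MBd ρ w σ M C) (hN : MBd ρ w σ N C') : MBd ρ w σ (M + N) (C + C') := by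
  obtain ⟨b, hb, h⟩ := hM
  obtain ⟨b', hb', h'⟩ := hN
  refine ⟨fun i j => b i j + b' i j, fun i j => (hb i j).add (hb' i j), ?_⟩
  simp only [Finset.sum_add_distrib]
  exact add_le_add h h'

lemma MBd.neg (hM : MBd ρ w σ M C) : MBd ρ w σ (-M) C := by
  obtain ⟨b, hb, h⟩ := hM
  exact ⟨b, fun i j => (hb i j).neg, h⟩

lemma MBd.sub (hM : MBd ρ w σ M C) (hN : MBd ρ w σ N C') : MBd ρ w σ (M - N) (C + C') := by
  rw [sub_eq_add_neg]; exact hM.add hN.neg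

lemma MBd.entry (hM : MBd ρ w σ M C) (i : m) (j : n) : Bd ρ w σ (M i j) C := by
  obtain ⟨b, hb, h⟩ := hM
  refine (hb i j).mono (le_trans ?_ h)
  calc b i j ≤ ∑ j, b i j :=
        Finset.single_le_sum (f := fun j => b i j) (fun j _ => (hb i j).nonneg) (Finset.mem_univ j)
    _ ≤ _ := Finset.single_le_sum (f := fun i => ∑ j, b i j)
        (fun i _ => Finset.sum_nonneg fun j _ => (hb i j).nonneg) (Finset.mem_univ i)

lemma MBd.of_entries (h : ∀ i j, Bd ρ w σ (M i j) C) :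
    MBd ρ w σ M (Fintype.card m * Fintype.card n * C) :=
  ⟨fun _ _ => C, h, by simp [mul_assoc]⟩

lemma MBd.transpose (hM : MBd ρ w σ M C) : MBd ρ w σ M.transpose C := by
  obtain ⟨b, hb, h⟩ := hM
  refine ⟨fun j i => b i j, fun j i => hb i j, ?_⟩
  rwa [Finset.sum_comm]

lemma MBd.mul [PosRho ρ] [PosWt w] {M : Matrix m n (X → Sm ι)} {N : Matrix n p (X → Sm ι)}
    (hσ : 0 ≤ σ) (hM : MBd ρ w σ M C) (hN : MBd ρ 1 σ N C') : MBd ρ w σ (M * N) (C * C') := by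
  have hC := hM.nonneg
  have hC' := hN.nonneg
  obtain ⟨b, hb, h⟩ := hM
  obtain ⟨b', hb', h'⟩ := hN
  refine ⟨fun i k => ∑ j, b i j * b' j k, fun i k => ?_, ?_⟩
  · rw [Matrix.mul_apply]
    exact Bd.sum _ fun j _ => (hb i j).mul hσ (hb' j k)
  · calc ∑ i, ∑ k, ∑ j, b i j * b' j k = ∑ i, ∑ j, b i j * ∑ k, b' j k := by
          refine Finset.sum_congr rfl fun i _ => ?_
          rw [Finset.sum_comm]
          simp_rw [Finset.mul_sum]
      _ ≤ ∑ i, ∑ j, b i j * C' := by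
          gcongr with i _ j _
          · exact (hb i j).nonneg
          · exact (Finset.single_le_sum (f := fun j => ∑ k, b' j k)
              (fun j _ => Finset.sum_nonneg fun k _ => (hb' j k).nonneg) (Finset.mem_univ j)).trans h'
      _ = (∑ i, ∑ j, b i j) * C' := by simp_rw [Finset.sum_mul]
      _ ≤ C * C' := by gcongr

lemma MBd.mul' [PosRho ρ] [PosWt w] {M : Matrix m n (X → Sm ι)} {N : Matrix n p (X → Sm ι)}
    (hσ : 0 ≤ σ) (hM : MBd ρ 1 σ M C) (hN : MBd ρ w σ N C') : MBd ρ w σ (M * N) (C * C') := by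
  have h := (hN.transpose.mul hσ hM.transpose).transpose
  rwa [← Matrix.transpose_mul, Matrix.transpose_transpose, mul_comm] at h

lemma MBd.one [PosRho ρ] [DecidableEq m] :
    MBd ρ 1 σ (1 : Matrix m m (X → Sm ι)) (2 * Fintype.card m) := by
  refine ⟨fun i j => if i = j then 2 else 0, fun i j => ?_, by simp [mul_comm]⟩
  by_cases h : i = j
  · subst h; simpa using Bd.one
  · simpa [h] using Bd.zero

lemma MBd.pow_succ [PosRho ρ] [DecidableEq m] {M : Matrix m m (X → Sm ι)}
    (hσ : 0 ≤ σ) (hM : MBd ρ 1 σ M C) (k : ℕ) : MBd ρ 1 σ (M ^ (k + 1)) (C ^ (k + 1)) := by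
  induction k with
  | zero => simpa using hM
  | succ k ih => rw [_root_.pow_succ, _root_.pow_succ C]; exact ih.mul hσ hM

/-- Neumann series. -/
lemma MBd.exists_inv [PosRho ρ] [DecidableEq m] {M : Matrix m m (X → Sm ι)} {q : ℝ}
    (hσ : 0 < σ) (hM : MBd ρ 1 σ M q) (hq : q ≤ 1 / 2) :
    ∃ N : Matrix m m (X → Sm ι), (1 + M) * (1 + N) = 1 ∧
      MBd ρ 1 σ N (Fintype.card m * Fintype.card m * (2 * q)) := by
  have hq0 := hM.nonneg
  have hk : ∀ (k : ℕ) i j, Bd ρ 1 σ (((-M) ^ (k + 1)) i j) (q ^ (k + 1)) := fun k i j =>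
    (hM.neg.pow_succ hσ.le k).entry i j
  have hgeo : HasSum (fun k : ℕ => q ^ (k + 1)) (q * (1 - q)⁻¹) := by
    simpa [_root_.pow_succ'] using
      (hasSum_geometric_of_lt_one hq0 (lt_of_le_of_lt hq (by norm_num))).mul_left q
  have hle : q * (1 - q)⁻¹ ≤ 2 * q := by
    have : (1 - q)⁻¹ ≤ 2 := by
      rw [inv_le_comm₀ (by linarith) (by norm_num)]; linarith
    nlinarith
  choose N hN hs using fun i j => Bd.tsum (F := fun k => ((-M) ^ (k + 1)) i j) hσ
    (fun k => hk k i j) hgeo.summable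
  refine ⟨Matrix.of N, ?_, MBd.of_entries fun i j => (hN i j).mono (by rw [hgeo.tsum_eq]; exact hle)⟩
  have key : Matrix.of N + M + M * Matrix.of N = 0 := by
    ext i j x ψ
    have h1 := hs i j x ψ
    have h2 : HasSum (fun k : ℕ => (((-M) ^ (k + 2)) i j x).1 ψ)
        (-∑ l, (M i l x).1 ψ * (N l j x).1 ψ) := by
      have h3 : HasSum (fun k : ℕ => ∑ l, (M i l x).1 ψ * (((-M) ^ (k + 1)) l j x).1 ψ)
          (∑ l, (M i l x).1 ψ * (N l j x).1 ψ) :=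
        hasSum_sum fun l _ => (hs l j x ψ).mul_left _
      refine hasSum_of_eq h3.neg fun k => ?_
      rw [show (-M) ^ (k + 2) = (-M) * (-M) ^ (k + 1) from _root_.pow_succ' _ _, Matrix.mul_apply]
      simp [Finset.sum_apply]
    have h4 := (hasSum_nat_add_iff' 1).mpr h1
    have h5 := h4.unique h2
    simp only [Finset.range_one, Finset.sum_singleton, zero_add, pow_one, Matrix.neg_apply,
      Pi.neg_apply, Sm.neg_val, sub_neg_eq_add] at h5
    simp only [Matrix.add_apply, Matrix.of_apply, Matrix.mul_apply, Pi.add_apply, Sm.add_val,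
      Finset.sum_apply, Pi.mul_apply, Sm.sum_val, Sm.mul_val, Matrix.zero_apply, Pi.zero_apply,
      Sm.zero_val]
    rw [h5]; ring
  calc (1 + M) * (1 + Matrix.of N) = 1 + (Matrix.of N + M + M * Matrix.of N) := by noncomm_ring
    _ = 1 := by rw [key, add_zero]

end matrices

section algebra

variable {𝕜 R : Type*} [CommRing 𝕜] [CommRing R] [Algebra 𝕜 R] (D : Derivation 𝕜 R R)
variable {m n p : Type*} [Fintype n]

lemma map_add_derivation (M N : Matrix m n R) : (M + N).map D = M.map D + N.map D := by
  ext; simp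

lemma map_neg_derivation (M : Matrix m n R) : (-M).map D = -M.map D := by
  ext; simp

lemma map_mul_derivation (M : Matrix m n R) (N : Matrix n p R) :
    (M * N).map D = M.map D * N + M * N.map D := by
  ext i j
  simp only [Matrix.map_apply, Matrix.mul_apply, Matrix.add_apply, map_sum, Derivation.leibniz,
    smul_eq_mul, ← Finset.sum_add_distrib]
  exact Finset.sum_congr rfl fun k _ => by ring

lemma map_transpose_derivation (M : Matrix m n R) :
    M.transpose.map D = (M.map D).transpose := rfl

lemma map_one_derivation [DecidableEq m] : (1 : Matrix m m R).map D = 0 := by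
  ext i j
  by_cases h : i = j
  · subst h; simp
  · simp [h]

variable {N a b c : Type*} [Fintype N] [DecidableEq N] [Fintype a] [DecidableEq a] [Fintype b]
  [Fintype c]

open Matrix in
/-- The approximate solution of the linearized equation in an adapted moving frame. -/
theorem linear_identity (J Om : Matrix N N R) (hOm : Om.map D = 0) (hJ : Jᵀ * Om + Om * J = 0)
    (T1 T2 : Matrix N a R) (Y : Matrix N b R) (Q1 Q2 : Matrix a N R) (Q3 : Matrix b N R)
    (hQ : T1 * Q1 + T2 * Q2 + Y * Q3 = 1)
    (F1 : Matrix N a R) (hT1 : T1.map D = J * T1 + F1)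
    (X2 : Matrix N a R) (hT2 : T2.map D = J * T2 + X2)
    (Lam : Matrix b b R) (e : Matrix N b R) (hY : Y.map D = J * Y - Y * Lam + e)
    (U : Matrix a a R) (hU : U * (T1ᵀ * Om * T2) = 1) (hU' : (T1ᵀ * Om * T2) * U = 1)
    (Rm : Matrix N c R) (Lam' : Matrix c c R) (y : Matrix a c R)
    (hy : y.map D + y * Lam' = T1ᵀ * Om * Rm)
    (w1 : Matrix a c R) (hw1 : w1.map D + w1 * Lam' = Q1 * Rm - Q1 * X2 * (U * y))
    (w3 Del : Matrix b c R)
    (hw3 : w3.map D - Lam * w3 + w3 * Lam' = Q3 * Rm - Q3 * X2 * (U * y) - Del) :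
    (T1 * w1 + T2 * (U * y) + Y * w3).map D - J * (T1 * w1 + T2 * (U * y) + Y * w3)
      + (T1 * w1 + T2 * (U * y) + Y * w3) * Lam'
    = Rm - Y * Del + F1 * w1 + e * w3
      + T2 * (U * ((T1ᵀ * Om * T1) * (Q1 * Rm) + (T1ᵀ * Om * Y) * (Q3 * Rm)
        - (F1ᵀ * Om * T2 + (T1ᵀ * Om * T1) * (Q1 * X2) + (T1ᵀ * Om * Y) * (Q3 * X2)) * (U * y))) := by
  have hX2 : X2 = T1 * (Q1 * X2) + T2 * (Q2 * X2) + Y * (Q3 * X2) := by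
    simp only [← Matrix.mul_assoc, ← Matrix.add_mul, hQ, Matrix.one_mul]
  have hRm : Rm = T1 * (Q1 * Rm) + T2 * (Q2 * Rm) + Y * (Q3 * Rm) := by
    simp only [← Matrix.mul_assoc, ← Matrix.add_mul, hQ, Matrix.one_mul]
  set θ := Q1 * X2
  set τ := Q2 * X2
  set ξ := Q3 * X2
  set h1 := Q1 * Rm
  set h2 := Q2 * Rm
  set h3 := Q3 * Rm
  set w2 := U * y with hw2
  set B := T1ᵀ * Om * T2 with hB
  have hBw2 : B * w2 = y := by rw [hw2, ← Matrix.mul_assoc, hU', Matrix.one_mul]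
  clear_value w2 B θ τ ξ h1 h2 h3
  have hJt : Jᵀ * Om = -(Om * J) := eq_neg_of_add_eq_zero_left hJ
  have hDB : B.map D = F1ᵀ * Om * T2 + T1ᵀ * Om * X2 := by
    rw [hB, map_mul_derivation, map_mul_derivation, map_transpose_derivation, hOm, hT1, hT2,
      Matrix.transpose_add, Matrix.transpose_mul]
    simp only [Matrix.add_mul, Matrix.mul_add, Matrix.mul_zero, add_zero]
    rw [Matrix.mul_assoc T1ᵀ Jᵀ Om, hJt]
    simp only [Matrix.mul_neg, Matrix.neg_mul, Matrix.mul_assoc]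
    abel
  have hBτ : B * τ = B.map D - (F1ᵀ * Om * T2 + (T1ᵀ * Om * T1) * θ + (T1ᵀ * Om * Y) * ξ) := by
    have h4 : T1ᵀ * Om * X2 = (T1ᵀ * Om * T1) * θ + B * τ + (T1ᵀ * Om * Y) * ξ := by
      conv_lhs => rw [hX2]
      simp only [Matrix.mul_add, Matrix.mul_assoc, hB]
    rw [hDB, h4]
    abel
  have hBh : T1ᵀ * Om * Rm = (T1ᵀ * Om * T1) * h1 + B * h2 + (T1ᵀ * Om * Y) * h3 := by
    conv_lhs => rw [hRm]
    simp only [Matrix.mul_add, Matrix.mul_assoc, hB]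
  have hr2 : w2.map D + τ * w2 + w2 * Lam' - h2
      = U * ((T1ᵀ * Om * T1) * h1 + (T1ᵀ * Om * Y) * h3
        - (F1ᵀ * Om * T2 + (T1ᵀ * Om * T1) * θ + (T1ᵀ * Om * Y) * ξ) * w2) := by
    have h5 : B * (w2.map D + τ * w2 + w2 * Lam' - h2) = (T1ᵀ * Om * T1) * h1
        + (T1ᵀ * Om * Y) * h3
        - (F1ᵀ * Om * T2 + (T1ᵀ * Om * T1) * θ + (T1ᵀ * Om * Y) * ξ) * w2 := by
      have h6 : B.map D * w2 + B * w2.map D = y.map D := by rw [← map_mul_derivation, hBw2]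
      have h7 : y.map D = (T1ᵀ * Om * T1) * h1 + B * h2 + (T1ᵀ * Om * Y) * h3 - y * Lam' := by
        rw [← hBh, ← hy]; abel
      have h8 : B * (τ * w2) = B.map D * w2
          - (F1ᵀ * Om * T2 + (T1ᵀ * Om * T1) * θ + (T1ᵀ * Om * Y) * ξ) * w2 := by
        rw [← Matrix.mul_assoc, hBτ, Matrix.sub_mul]
      have h9 : B * (w2 * Lam') = y * Lam' := by rw [← Matrix.mul_assoc, hBw2]
      rw [Matrix.mul_sub, Matrix.mul_add, Matrix.mul_add, h8, h9]
      calc _ = (B.map D * w2 + B * w2.map D) + y * Lam' - B * h2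
          - (F1ᵀ * Om * T2 + (T1ᵀ * Om * T1) * θ + (T1ᵀ * Om * Y) * ξ) * w2 := by abel
        _ = _ := by rw [h6, h7]; abel
    rw [← h5, ← Matrix.mul_assoc, hU, Matrix.one_mul]
  rw [← hr2]
  have hD1 : w1.map D = h1 - θ * w2 - w1 * Lam' := by rw [← hw1]; abel
  have hD3 : w3.map D = h3 - ξ * w2 - Del + Lam * w3 - w3 * Lam' := by rw [← hw3]; abel
  rw [map_add_derivation, map_add_derivation, map_mul_derivation, map_mul_derivation,
    map_mul_derivation, hT1, hT2, hY, hD1, hD3]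
  have e1 : X2 * w2 = T1 * (θ * w2) + T2 * (τ * w2) + Y * (ξ * w2) := by
    conv_lhs => rw [hX2]
    simp only [Matrix.add_mul, Matrix.mul_assoc]
  have e2 : Rm = T1 * h1 + T2 * h2 + Y * h3 := hRm
  simp only [Matrix.add_mul, Matrix.sub_mul, Matrix.mul_add, Matrix.mul_sub, Matrix.mul_assoc] at *
  rw [e1]
  conv_rhs => rw [e2]
  abel

end algebra

/-! ### The homological equation -/

section solver

variable {ι : Type*} [Fintype ι] {X : Type*}
variable {ρ : X → X → ℝ} {w : X → ℝ} {σ : ℝ} {F G : X → Sm ι} {C C' : ℝ}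

/-- `a ν` is the inverse of the divisor `κ i (ν · v) + μ`, except possibly at `ν = 0`. -/
structure IsDiv (ρ : X → X → ℝ) (κ : X → ℂ) (v : ι → ℝ) (μ : X → ℂ) (L δ : ℝ)
    (a : (ι → ℤ) → X → ℂ) : Prop where
  lip : ∀ ν, LipB ρ 1 (a ν) (L * Real.exp (δ * l1 ν))
  inv : ∀ ν x, ν ≠ 0 → (κ x * (dotZ ν v * Complex.I) + μ x) * a ν x = 1

lemma exists_solution [PosRho ρ] [PosWt w] {κ : X → ℂ} {v : ι → ℝ} {μ : X → ℂ} {L δ : ℝ}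
    {a : (ι → ℤ) → X → ℂ} (hL : 0 ≤ L) (hσ : 0 ≤ σ) (hσδ : 0 < σ - δ)
    (ha : IsDiv ρ κ v μ L δ a) (hF : Bd ρ w σ F C)
    (h0 : ∀ x, coef (F x).1 0 = 0 ∨ μ x * a 0 x = 1) :
    ∃ y : X → Sm ι, RD κ v y + cst μ * y = F ∧ Bd ρ w (σ - δ) y (L * C) := by
  obtain ⟨S, hS, h⟩ := hF.multiplier hL hσ hσδ ha.lip
  refine ⟨S, ?_, hS⟩
  obtain ⟨c, m, hm, -⟩ := hF
  funext x
  ext ψ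
  have h1 := hasSum_fderiv_fourier hσδ (h x).1 (h x).2 ψ v
  have h2 := (h1.mul_left (κ x)).add (((h x).2 ψ).mul_left (μ x))
  have h3 := hm.rep x ψ
  simp_rw [hm.coef hσ x] at h2 h0
  simp only [Pi.add_apply, RD_apply, Pi.mul_apply, KAM.cst, Sm.add_val, Sm.smul_val, dd_val, Sm.mul_val,
    Sm.algebraMap_val]
  refine h2.unique (hasSum_of_eq h3 fun ν => ?_)
  by_cases hν : ν = 0
  · subst hν
    rcases h0 x with h4 | h4
    · rw [hm.coef hσ x] at h4
      simp [h4]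
    · simp only [dotZ_zero_left, Complex.ofReal_zero, zero_mul, mul_zero, chr_zero_left, mul_one,
        zero_add]
      linear_combination (c 0 x) * h4
  · linear_combination (c ν x * chr ν ψ) * ha.inv ν x hν

lemma Bd.of_solution [PosRho ρ] [PosWt w] {κ : X → ℂ} {v : ι → ℝ} {μ : X → ℂ} {L δ σ' : ℝ}
    {a : (ι → ℤ) → X → ℂ} {w' : X → ℝ} (hL : 0 ≤ L) (hσ : 0 ≤ σ) (hσδ : 0 < σ - δ) (hσ' : 0 < σ')
    (ha : IsDiv ρ κ v μ L δ a) (hF : Bd ρ w σ F C) (hG : Bd ρ w' σ' G C')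
    (h : RD κ v G + KAM.cst μ * G = F)
    (h0 : ∀ x, coef (G x).1 0 = 0 ∨ μ x * a 0 x = 1) : Bd ρ w (σ - δ) G (L * C) := by
  refine Bd.of_coef (F := F) (a := a) (σ' := σ') hL hσ hσδ hσ'.le ha.lip hF hG ?_
  have hG2 := hG
  obtain ⟨c, m, hm, -⟩ := hG2
  have hcF : ∀ x ν, coef (F x).1 ν
      = coef (G x).1 ν * (κ x * (dotZ ν v * Complex.I) + μ x) := by
    intro x ν
    rw [hm.coef hσ'.le x]
    have hs := hm.summable_norm x
    refine coef_eq_of_hasSum (c := fun ν => c ν x * (κ x * (dotZ ν v * Complex.I) + μ x)) ?_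
      (fun ψ => ?_) ν
    · have hu : Summable fun ν => σ'⁻¹ * (Real.exp (σ' * l1 ν) * ‖c ν x‖) * (‖κ x‖ * ‖v‖)
          + ‖c ν x‖ * ‖μ x‖ :=
        ((hs.mul_left _).mul_right _).add ((summable_of_exp hσ'.le hs).mul_right _)
      refine Summable.of_nonneg_of_le (fun _ => norm_nonneg _) (fun ν => ?_) hu
      rw [mul_add]
      refine (norm_add_le _ _).trans ?_
      rw [norm_mul (c ν x) (μ x)]
      refine add_le_add ?_ le_rfl
      have h1 := pow_le_factorial_mul_exp (l1_nonneg ν) hσ' 1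
      simp only [pow_one, Nat.factorial_one, Nat.cast_one, one_mul] at h1
      simp only [norm_mul, Complex.norm_real, Complex.norm_I, mul_one, Real.norm_eq_abs]
      have h2 := abs_dotZ_le ν v
      calc ‖c ν x‖ * (‖κ x‖ * |dotZ ν v|) ≤ ‖c ν x‖ * (‖κ x‖ * (l1 ν * ‖v‖)) := by gcongr
        _ ≤ ‖c ν x‖ * (‖κ x‖ * ((σ'⁻¹ * Real.exp (σ' * l1 ν)) * ‖v‖)) := by gcongr
        _ = _ := by ring
    · have h1 := hasSum_fderiv_fourier hσ' hs (hm.rep x) ψ v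
      have h2 := (h1.mul_left (κ x)).add ((hm.rep x ψ).mul_left (μ x))
      rw [← h]
      simp only [Pi.add_apply, RD_apply, Pi.mul_apply, KAM.cst, Sm.add_val, Sm.smul_val, dd_val,
        Sm.mul_val, Sm.algebraMap_val]
      exact hasSum_of_eq h2 fun ν => by ring
  intro x ν
  rw [hcF]
  by_cases hν : ν = 0
  · subst hν
    rcases h0 x with h4 | h4
    · simp [h4]
    · simp only [dotZ_zero_left, Complex.ofReal_zero, zero_mul, mul_zero, zero_add, mul_assoc]
      rw [h4, mul_one]
  · rw [mul_assoc, ha.inv ν x hν, mul_one]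

lemma Bd.mean_RD (hσ : 0 < σ) (hF : Bd ρ w σ F C) (κ : X → ℂ) (v : ι → ℝ) :
    KAM.mean (RD κ v F) = 0 := by
  funext x
  rw [KAM.mean, hF.coef_RD hσ κ v x 0]
  simp

end solver

section composition

variable {ι κ : Type*} [Fintype ι] [Fintype κ] {X : Type*}

/-- `φ` has the absolutely convergent Fourier expansion with coefficients `φh`. -/
structure FS {d : Type*} [Fintype d] (r M : ℝ) (φ : Sm d) (φh : (d → ℤ) → ℂ) : Prop where
  rep : ∀ x, HasSum (fun k => φh k * chr k x) (φ.1 x)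
  summable : Summable fun k => Real.exp (r * l1 k) * ‖φh k‖
  le : ∑' k, Real.exp (r * l1 k) * ‖φh k‖ ≤ M

/-- A real-valued family. -/
def IsReal (F : X → Sm ι) : Prop := ∀ x ψ, ((F x).1 ψ).im = 0

lemma IsReal.ofReal_re {F : X → Sm ι} (h : IsReal F) (x : X) (ψ : ι → ℝ) :
    ((((F x).1 ψ).re : ℝ) : ℂ) = (F x).1 ψ := by
  apply Complex.ext <;> simp [h x ψ]

lemma IsReal.add {F G : X → Sm ι} (hF : IsReal F) (hG : IsReal G) : IsReal (F + G) :=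
  fun x ψ => by simp [hF x ψ, hG x ψ]

/-- The point `(ψ, β₀) + Re u (ψ)`. -/
def qpt (β₀ : κ → ℝ) (u : ι ⊕ κ → X → Sm ι) (x : X) (ψ : ι → ℝ) : ι ⊕ κ → ℝ :=
  fun i => Sum.elim ψ β₀ i + ((u i x).1 ψ).re

lemma contDiff_qpt (β₀ : κ → ℝ) (u : ι ⊕ κ → X → Sm ι) (x : X) :
    ContDiff ℝ ∞ (qpt β₀ u x) := by
  rw [contDiff_pi]
  intro i
  refine ContDiff.add ?_ (Complex.reCLM.contDiff.comp (Sm.contDiff (u i x)))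
  cases i with
  | inl k => exact contDiff_apply ℝ ℝ k
  | inr j => exact contDiff_const

/-- The composition `ψ ↦ φ ((ψ, β₀) + Re u (ψ))`. -/
def comp (β₀ : κ → ℝ) (φ : Sm (ι ⊕ κ)) (u : ι ⊕ κ → X → Sm ι) : X → Sm ι :=
  fun x => ⟨fun ψ => φ.1 (qpt β₀ u x ψ), (Sm.contDiff φ).comp (contDiff_qpt β₀ u x)⟩

lemma comp_val (β₀ : κ → ℝ) (φ : Sm (ι ⊕ κ)) (u : ι ⊕ κ → X → Sm ι) (x : X) (ψ : ι → ℝ) :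
    (comp β₀ φ u x).1 ψ = φ.1 (qpt β₀ u x ψ) := rfl

variable {ρ : X → X → ℝ} {w : X → ℝ} {σ : ℝ}

/-- The function `i k · u`. -/
noncomputable def ku (k : ι ⊕ κ → ℤ) (u : ι ⊕ κ → X → Sm ι) : X → Sm ι :=
  ∑ i, ((k i : ℂ) * Complex.I) • u i

lemma ku_val (k : ι ⊕ κ → ℤ) (u : ι ⊕ κ → X → Sm ι) (x : X) (ψ : ι → ℝ) :
    (ku k u x).1 ψ = ∑ i, ((k i : ℂ) * Complex.I) * (u i x).1 ψ := by
  simp [ku, Finset.sum_apply]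

lemma Bd.ku [PosRho ρ] [PosWt w] {C : ℝ} (hσ : 0 ≤ σ) {u : ι ⊕ κ → X → Sm ι}
    (hu : ∀ i, Bd ρ w σ (u i) C) (k : ι ⊕ κ → ℤ) : Bd ρ w σ (ku k u) (2 * l1 k * C) := by
  refine (Bd.sum _ fun i _ => (hu i).smul hσ ((k i : ℂ) * Complex.I)).mono (le_of_eq ?_)
  simp only [norm_mul, Complex.norm_I, mul_one, l1, Finset.mul_sum, Finset.sum_mul]
  refine Finset.sum_congr rfl fun i _ => ?_
  rw [Complex.norm_intCast]

/-- The `k`-th term of the expansion of a composition. -/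
noncomputable def term (β₀ : κ → ℝ) (φh : (ι ⊕ κ → ℤ) → ℂ) (u : ι ⊕ κ → X → Sm ι)
    (k : ι ⊕ κ → ℤ) : X → Sm ι := fun x =>
  ⟨fun ψ => φh k * chr k (Sum.elim ψ β₀), by
    have h : ContDiff ℝ ∞ (fun ψ : ι → ℝ => (Sum.elim ψ β₀ : ι ⊕ κ → ℝ)) := by
      rw [contDiff_pi]
      intro i
      cases i with
      | inl k => exact contDiff_apply ℝ ℝ k
      | inr j => exact contDiff_const
    exact contDiff_const.mul ((contDiff_chr k).comp h)⟩ * expS (ku k u x)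

lemma chr_elim (k : ι ⊕ κ → ℤ) (ψ : ι → ℝ) (β₀ : κ → ℝ) :
    chr k (Sum.elim ψ β₀) = chr (k ∘ Sum.inr) β₀ * chr (k ∘ Sum.inl) ψ := by
  simp only [chr, ← Complex.exp_add, dotZ, Fintype.sum_sum_type, Sum.elim_inl, Sum.elim_inr,
    Function.comp_apply]
  congr 1
  push_cast
  ring

lemma l1_inl_le (k : ι ⊕ κ → ℤ) : l1 (k ∘ Sum.inl) ≤ l1 k := by
  simp only [l1, Fintype.sum_sum_type, Function.comp_apply]
  have : 0 ≤ ∑ x : κ, |(k (Sum.inr x) : ℝ)| := Finset.sum_nonneg fun _ _ => abs_nonneg _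
  linarith

lemma Bd.term [PosRho ρ] {C : ℝ} (hσ : 0 < σ) {u : ι ⊕ κ → X → Sm ι}
    (hu : ∀ i, Bd ρ 1 σ (u i) C) (β₀ : κ → ℝ) (φh : (ι ⊕ κ → ℤ) → ℂ) (k : ι ⊕ κ → ℤ) :
    Bd ρ 1 σ (KAM.term β₀ φh u k) (4 * ‖φh k‖ * Real.exp ((σ + 4 * C) * l1 k)) := by
  have h1 := Bd.exp hσ (Bd.ku hσ.le hu k)
  have h2 : ∀ G : X → Sm ι, (∀ x ψ, (G x).1 ψ = φh k * chr k (Sum.elim ψ β₀)) →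
      Bd ρ 1 σ G (Real.exp (σ * l1 (k ∘ Sum.inl)) * (2 * ‖φh k * chr (k ∘ Sum.inr) β₀‖)) :=
    fun G hG => Bd.mode (by positivity) (LipB.const (φh k * chr (k ∘ Sum.inr) β₀)) _
      fun x ψ => by rw [hG, chr_elim, mul_assoc]
  refine ((h2 _ fun x ψ => rfl).mul hσ.le h1).mono ?_
  rw [norm_mul, norm_chr, mul_one]
  have h3 : Real.exp (σ * l1 (k ∘ Sum.inl)) ≤ Real.exp (σ * l1 k) := by
    have := l1_inl_le k
    gcongr
  have h4 : Real.exp ((σ + 4 * C) * l1 k)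
      = Real.exp (σ * l1 k) * Real.exp (2 * (2 * l1 k * C)) := by
    rw [← Real.exp_add]; ring_nf
  rw [h4]
  calc _ ≤ Real.exp (σ * l1 k) * (2 * ‖φh k‖) * (2 * Real.exp (2 * (2 * l1 k * C))) := by gcongr
    _ = _ := by ring

lemma chr_qpt {u : ι ⊕ κ → X → Sm ι} (hu : ∀ i, IsReal (u i)) (β₀ : κ → ℝ) (k : ι ⊕ κ → ℤ) (x : X)
    (ψ : ι → ℝ) : chr k (qpt β₀ u x ψ) = chr k (Sum.elim ψ β₀) * Complex.exp ((ku k u x).1 ψ) := by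
  rw [show qpt β₀ u x ψ = Sum.elim ψ β₀ + fun i => ((u i x).1 ψ).re from rfl, chr_add_right]
  congr 1
  rw [chr, dotZ, ku_val]
  congr 1
  push_cast
  rw [Finset.sum_mul]
  refine Finset.sum_congr rfl fun i _ => ?_
  rw [(hu i).ofReal_re]; ring

lemma term_val {u : ι ⊕ κ → X → Sm ι} (hu : ∀ i, IsReal (u i)) (β₀ : κ → ℝ)
    (φh : (ι ⊕ κ → ℤ) → ℂ) (k : ι ⊕ κ → ℤ) (x : X) (ψ : ι → ℝ) :
    (term β₀ φh u k x).1 ψ = φh k * chr k (qpt β₀ u x ψ) := by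
  rw [chr_qpt hu, ← mul_assoc]; rfl

lemma ku_add (k : ι ⊕ κ → ℤ) (u v : ι ⊕ κ → X → Sm ι) : ku k (u + v) = ku k u + ku k v := by
  simp [ku, Finset.sum_add_distrib]

lemma term_add_val {u v : ι ⊕ κ → X → Sm ι} (β₀ : κ → ℝ)
    (φh : (ι ⊕ κ → ℤ) → ℂ) (k : ι ⊕ κ → ℤ) (x : X) (ψ : ι → ℝ) :
    (term β₀ φh (u + v) k x).1 ψ = (term β₀ φh u k x).1 ψ * Complex.exp ((ku k v x).1 ψ) := by
  simp only [term, Sm.mul_val, expS_val, ku_add, Pi.add_apply, Sm.add_val, Complex.exp_add]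
  ring

variable {r M : ℝ} {φ : Sm (ι ⊕ κ)} {φh : (ι ⊕ κ → ℤ) → ℂ}

lemma FS.nonneg {d : Type*} [Fintype d] {φ : Sm d} {φh : (d → ℤ) → ℂ} (h : FS r M φ φh) : 0 ≤ M :=
  (tsum_nonneg fun k => by positivity).trans h.le

/-- Comparison of a series with the series of Fourier coefficients. -/
lemma FS.summable_le {d : Type*} [Fintype d] {φ : Sm d} {φh : (d → ℤ) → ℂ} (h : FS r M φ φh)
    {b : (d → ℤ) → ℝ} {A : ℝ} (hb0 : ∀ k, 0 ≤ b k) (hA : 0 ≤ A)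
    (hb : ∀ k, b k ≤ A * (Real.exp (r * l1 k) * ‖φh k‖)) : Summable b ∧ ∑' k, b k ≤ A * M := by
  have h1 := h.summable.mul_left A
  have h2 := Summable.of_nonneg_of_le hb0 hb h1
  refine ⟨h2, (h2.tsum_le_tsum hb h1).trans ?_⟩
  rw [tsum_mul_left]
  gcongr
  exact h.le

lemma Bd.comp [PosRho ρ] {C : ℝ} (hσ : 0 < σ) (hφ : FS r M φ φh) {u : ι ⊕ κ → X → Sm ι}
    (hur : ∀ i, IsReal (u i)) (hu : ∀ i, Bd ρ 1 σ (u i) C) (hC : σ + 4 * C ≤ r) (β₀ : κ → ℝ) :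
    Bd ρ 1 σ (KAM.comp β₀ φ u) (4 * M) := by
  obtain ⟨h1, h2⟩ := hφ.summable_le (b := fun k => 4 * ‖φh k‖ * Real.exp ((σ + 4 * C) * l1 k))
    (A := 4) (fun k => by positivity) (by norm_num) fun k => by
      have := l1_nonneg k
      calc 4 * ‖φh k‖ * Real.exp ((σ + 4 * C) * l1 k)
          ≤ 4 * ‖φh k‖ * Real.exp (r * l1 k) := by gcongr
        _ = _ := by ring
  refine (Bd.of_hasSum hσ (fun k => Bd.term hσ hu β₀ φh k) h1 fun x ψ => ?_).mono h2
  exact hasSum_of_eq (hφ.rep _) fun k => term_val hur β₀ φh k x ψ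

lemma l1_le_exp (hr : 0 < r) {d : Type*} [Fintype d] (k : d → ℤ) :
    l1 k ≤ 4 / r * Real.exp (r / 4 * l1 k) := by
  have := pow_le_factorial_mul_exp (l1_nonneg k) (by positivity : 0 < r / 4) 1
  simpa using this

lemma l1_sq_le_exp (hr : 0 < r) {d : Type*} [Fintype d] (k : d → ℤ) :
    l1 k ^ 2 ≤ 2 * (4 / r) ^ 2 * Real.exp (r / 4 * l1 k) := by
  have := pow_le_factorial_mul_exp (l1_nonneg k) (by positivity : 0 < r / 4) 2
  simpa using this

lemma Bd.comp_sub [PosRho ρ] [PosWt w] {C C' Cw : ℝ} (hσ : 0 < σ) (hr : 0 < r)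
    (hφ : FS r M φ φh)
    {u v : ι ⊕ κ → X → Sm ι} (hur : ∀ i, IsReal (u i)) (hvr : ∀ i, IsReal (v i))
    (hu : ∀ i, Bd ρ 1 σ (u i) C) (hv : ∀ i, Bd ρ 1 σ (v i) C') (hvw : ∀ i, Bd ρ w σ (v i) Cw)
    (hCw : 0 ≤ Cw) (hC : σ + 4 * C + 2 * C' ≤ r / 2) (β₀ : κ → ℝ) :
    Bd ρ w σ (KAM.comp β₀ φ (u + v) - KAM.comp β₀ φ u) (16 * (4 / r) * Cw * M) := by
  have h0 := hφ.nonneg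
  have hb : ∀ k, Bd ρ w σ (KAM.term β₀ φh u k * ((fun x => expS (KAM.ku k v x)) - 1))
      (4 * ‖φh k‖ * Real.exp ((σ + 4 * C) * l1 k)
        * (2 * (2 * l1 k * Cw) * Real.exp (2 * l1 k * C'))) := fun k =>
    (Bd.term hσ hu β₀ φh k).mul' hσ.le
      (Bd.exp_sub_one hσ (Bd.ku hσ.le hvw k) (Bd.ku hσ.le hv k))
  obtain ⟨h1, h2⟩ := hφ.summable_le (A := 16 * (4 / r) * Cw)
    (b := fun k => 4 * ‖φh k‖ * Real.exp ((σ + 4 * C) * l1 k)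
        * (2 * (2 * l1 k * Cw) * Real.exp (2 * l1 k * C'))) (fun k => by
          have := l1_nonneg k
          positivity) (by positivity) fun k => by
      have hl := l1_nonneg k
      have hle := l1_le_exp hr k
      have e1 : Real.exp ((σ + 4 * C) * l1 k) * Real.exp (2 * l1 k * C')
          ≤ Real.exp (r / 2 * l1 k) := by
        rw [← Real.exp_add]
        gcongr
        nlinarith
      calc _ = 16 * ‖φh k‖ * Cw * l1 k *
            (Real.exp ((σ + 4 * C) * l1 k) * Real.exp (2 * l1 k * C')) := by ring
        _ ≤ 16 * ‖φh k‖ * Cw * (4 / r * Real.exp (r / 4 * l1 k)) * Real.exp (r / 2 * l1 k) := by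
            gcongr
        _ = 16 * (4 / r) * Cw * (Real.exp (r / 4 * l1 k + r / 2 * l1 k) * ‖φh k‖) := by
            rw [Real.exp_add]; ring
        _ ≤ _ := by
            gcongr
            nlinarith
  refine (Bd.of_hasSum hσ hb h1 fun x ψ => ?_).mono h2
  have h3 := (hφ.rep (qpt β₀ (u + v) x ψ)).sub (hφ.rep (qpt β₀ u x ψ))
  refine hasSum_of_eq h3 fun k => ?_
  rw [← term_val hur, ← term_val (u := u + v) (fun i => (hur i).add (hvr i)), term_add_val]
  simp
  ring

lemma Bd.comp_taylor [PosRho ρ] [PosWt w] [DecidableEq ι] [DecidableEq κ] {C C' Cw : ℝ}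
    (hσ : 0 < σ) (hr : 0 < r) (hφ : FS r M φ φh)
    {u v : ι ⊕ κ → X → Sm ι} (hur : ∀ i, IsReal (u i)) (hvr : ∀ i, IsReal (v i))
    (hu : ∀ i, Bd ρ 1 σ (u i) C) (hv : ∀ i, Bd ρ 1 σ (v i) C') (hvw : ∀ i, Bd ρ w σ (v i) Cw)
    (hCw : 0 ≤ Cw) (hC' : 0 ≤ C') (hC : σ + 4 * C + 2 * C' ≤ r / 2) (β₀ : κ → ℝ) :
    Bd ρ w σ (KAM.comp β₀ φ (u + v) - KAM.comp β₀ φ u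
      - ∑ i, KAM.comp β₀ (dd (Pi.single i 1) φ) u * v i) (64 * (4 / r) ^ 2 * Cw * C' * M) := by
  have h0 := hφ.nonneg
  have hb : ∀ k, Bd ρ w σ
      (KAM.term β₀ φh u k * ((fun x => expS (KAM.ku k v x)) - 1 - KAM.ku k v))
      (4 * ‖φh k‖ * Real.exp ((σ + 4 * C) * l1 k)
        * (2 * (2 * l1 k * Cw) * (2 * l1 k * C') * Real.exp (2 * l1 k * C'))) := fun k =>
    (Bd.term hσ hu β₀ φh k).mul' hσ.le
      (Bd.exp_sub_one_sub hσ (Bd.ku hσ.le hvw k) (Bd.ku hσ.le hv k))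
  obtain ⟨h1, h2⟩ := hφ.summable_le (A := 64 * (4 / r) ^ 2 * Cw * C')
    (b := fun k => 4 * ‖φh k‖ * Real.exp ((σ + 4 * C) * l1 k)
        * (2 * (2 * l1 k * Cw) * (2 * l1 k * C') * Real.exp (2 * l1 k * C'))) (fun k => by
          have := l1_nonneg k
          positivity) (by positivity) fun k => by
      have hl := l1_nonneg k
      have hle := l1_sq_le_exp hr k
      have e1 : Real.exp ((σ + 4 * C) * l1 k) * Real.exp (2 * l1 k * C')
          ≤ Real.exp (r / 2 * l1 k) := by
        rw [← Real.exp_add]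
        gcongr
        nlinarith
      calc _ = 32 * ‖φh k‖ * Cw * C' * l1 k ^ 2 *
            (Real.exp ((σ + 4 * C) * l1 k) * Real.exp (2 * l1 k * C')) := by ring
        _ ≤ 32 * ‖φh k‖ * Cw * C' * (2 * (4 / r) ^ 2 * Real.exp (r / 4 * l1 k))
            * Real.exp (r / 2 * l1 k) := by
            gcongr
        _ = 64 * (4 / r) ^ 2 * Cw * C' * (Real.exp (r / 4 * l1 k + r / 2 * l1 k) * ‖φh k‖) := by
            rw [Real.exp_add]; ring
        _ ≤ _ := by
            gcongr
            nlinarith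
  refine (Bd.of_hasSum hσ hb h1 fun x ψ => ?_).mono h2
  have h3 := (hφ.rep (qpt β₀ (u + v) x ψ)).sub (hφ.rep (qpt β₀ u x ψ))
  have h4 : HasSum (fun k => ∑ i, (φh k * (dotZ k (Pi.single i 1) * Complex.I)
      * chr k (qpt β₀ u x ψ)) * (v i x).1 ψ)
      (∑ i, fderiv ℝ φ.1 (qpt β₀ u x ψ) (Pi.single i 1) * (v i x).1 ψ) :=
    hasSum_sum fun i _ =>
      (hasSum_fderiv_fourier hr hφ.summable hφ.rep (qpt β₀ u x ψ) (Pi.single i 1)).mul_right _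
  have h5 := h3.sub h4
  simp only [Pi.sub_apply, Sm.sub_val, Finset.sum_apply, Sm.sum_val, Pi.mul_apply, Sm.mul_val,
    comp_val, dd_val]
  refine hasSum_of_eq h5 fun k => ?_
  rw [← term_val hur, ← term_val (u := u + v) (fun i => (hur i).add (hvr i)), term_add_val]
  have h6 : ∑ i, (φh k * (dotZ k (Pi.single i 1) * Complex.I) * chr k (qpt β₀ u x ψ)) * (v i x).1 ψ
      = (KAM.term β₀ φh u k x).1 ψ * (KAM.ku k v x).1 ψ := by
    rw [ku_val, Finset.mul_sum, term_val hur]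
    refine Finset.sum_congr rfl fun i _ => ?_
    rw [dotZ_single]
    push_cast
    ring
  rw [h6]
  simp
  ring

/-- The Fourier coefficients of a derivative. -/
lemma FS.dd {d : Type*} [Fintype d] {φ : Sm d} {φh : (d → ℤ) → ℂ} (h : FS r M φ φh) {r' : ℝ}
    (hr' : 0 < r') (hrr : r' < r) {v : d → ℝ} (hv : ‖v‖ ≤ 1) :
    FS r' ((r - r')⁻¹ * M) (dd v φ) (fun k => φh k * (dotZ k v * Complex.I)) := by
  have hb : ∀ k, Real.exp (r' * l1 k) * ‖φh k * (dotZ k v * Complex.I)‖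
      ≤ (r - r')⁻¹ * (Real.exp (r * l1 k) * ‖φh k‖) := fun k => by
    have h1 := pow_le_factorial_mul_exp (l1_nonneg k) (by linarith : 0 < r - r') 1
    simp only [pow_one, Nat.factorial_one, Nat.cast_one, one_mul] at h1
    have h2 := abs_dotZ_le k v
    have h3 : l1 k * ‖v‖ ≤ l1 k := mul_le_of_le_one_right (l1_nonneg k) hv
    simp only [norm_mul, Complex.norm_real, Complex.norm_I, mul_one, Real.norm_eq_abs]
    calc Real.exp (r' * l1 k) * (‖φh k‖ * |dotZ k v|)
        ≤ Real.exp (r' * l1 k) * (‖φh k‖ * ((r - r')⁻¹ * Real.exp ((r - r') * l1 k))) := by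
          gcongr; linarith
      _ = (r - r')⁻¹ * (Real.exp (r' * l1 k + (r - r') * l1 k) * ‖φh k‖) := by
          rw [Real.exp_add]; ring
      _ = _ := by ring_nf
  obtain ⟨h1, h2⟩ := h.summable_le (fun k => by positivity)
    (by rw [inv_nonneg]; linarith) hb
  exact ⟨fun x => hasSum_fderiv_fourier (by linarith) h.summable h.rep x v, h1, h2⟩

/-- Chain rule. -/
lemma RD_comp [DecidableEq ι] [DecidableEq κ] (β₀ : κ → ℝ) (φ : Sm (ι ⊕ κ))
    {u : ι ⊕ κ → X → Sm ι} (hur : ∀ i, IsReal (u i)) (c : X → ℂ) (v : ι → ℝ) :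
    RD c v (comp β₀ φ u) = ∑ i, comp β₀ (dd (Pi.single i 1) φ) u *
      (cst (fun x => c x * (Sum.elim v 0 i : ℝ)) + RD c v (u i)) := by
  funext x
  ext ψ
  have hq : HasFDerivAt (qpt β₀ u x) (ContinuousLinearMap.pi fun i =>
      (Sum.elim (fun k => (ContinuousLinearMap.proj k : (ι → ℝ) →L[ℝ] ℝ)) (fun _ => 0) i)
        + Complex.reCLM.comp (fderiv ℝ (u i x).1 ψ)) ψ := by
    rw [hasFDerivAt_pi]
    intro i
    refine HasFDerivAt.add ?_ (Complex.reCLM.hasFDerivAt.comp ψ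
      (Sm.differentiable (u i x) ψ).hasFDerivAt)
    cases i with
    | inl k => exact hasFDerivAt_apply k ψ
    | inr j => exact hasFDerivAt_const _ _
  have hc := ((Sm.differentiable φ (qpt β₀ u x ψ)).hasFDerivAt.comp ψ hq).fderiv
  simp only [RD_apply, Sm.smul_val, dd_val, Finset.sum_apply, Sm.sum_val, Pi.mul_apply, Sm.mul_val,
    Pi.add_apply, Sm.add_val, cst, Sm.algebraMap_val, comp_val]
  change c x * fderiv ℝ (φ.1 ∘ qpt β₀ u x) ψ v = _
  rw [hc]
  have hre : ∀ i, ((((fderiv ℝ (u i x).1 ψ v).re : ℝ)) : ℂ) = fderiv ℝ (u i x).1 ψ v := by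
    intro i
    apply Complex.ext
    · simp
    · have h1 : HasFDerivAt (fun ψ => ((u i x).1 ψ).im)
          (Complex.imCLM.comp (fderiv ℝ (u i x).1 ψ)) ψ :=
        Complex.imCLM.hasFDerivAt.comp ψ (Sm.differentiable (u i x) ψ).hasFDerivAt
      have h2 : (fun ψ => ((u i x).1 ψ).im) = fun _ => 0 := funext fun ψ => hur i x ψ
      rw [h2] at h1
      have h3 := h1.unique (hasFDerivAt_const (0 : ℝ) ψ)
      have h4 := congrArg (fun L : (ι → ℝ) →L[ℝ] ℝ => L v) h3
      simpa using h4.symm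
  have hlin : ∀ z : ι ⊕ κ → ℝ, fderiv ℝ φ.1 (qpt β₀ u x ψ) z
      = ∑ i, fderiv ℝ φ.1 (qpt β₀ u x ψ) (Pi.single i 1) * (z i : ℂ) := by
    intro z
    conv_lhs => rw [pi_eq_sum_univ' z]
    rw [map_sum]
    refine Finset.sum_congr rfl fun i _ => ?_
    rw [map_smul, Complex.real_smul, mul_comm]
  rw [ContinuousLinearMap.comp_apply, hlin, Finset.mul_sum]
  refine Finset.sum_congr rfl fun i _ => ?_
  rw [← hre i]
  have : ((ContinuousLinearMap.pi fun i =>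
      (Sum.elim (fun k => (ContinuousLinearMap.proj k : (ι → ℝ) →L[ℝ] ℝ)) (fun _ => 0) i)
        + Complex.reCLM.comp (fderiv ℝ (u i x).1 ψ)) v) i
      = (Sum.elim v 0 i : ℝ) + (fderiv ℝ (u i x).1 ψ v).re := by
    cases i <;> simp
  rw [this]
  push_cast
  ring

end composition

section torus

variable {ι κ X : Type*} [Fintype ι]

lemma derivation_ite (D : Derivation ℂ (X → Sm ι) (X → Sm ι)) (P : Prop) [Decidable P] :
    D (if P then 1 else 0) = 0 := by split_ifs <;> simp

variable [Fintype κ] [DecidableEq ι] [DecidableEq κ]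

/-- The rescaled derivative `η⁻¹ om · ∂`. -/
noncomputable def Dη (η : X → ℝ) (om : ι → ℝ) : Derivation ℂ (X → Sm ι) (X → Sm ι) :=
  RD (fun x => (((η x)⁻¹ : ℝ) : ℂ)) om

/-- The partial derivative `∂_k`. -/
noncomputable def pd (k : ι) : Derivation ℂ (X → Sm ι) (X → Sm ι) := RD 1 (Pi.single k 1)

lemma pd_Dη (η : X → ℝ) (om : ι → ℝ) (k : ι) (F : X → Sm ι) :
    pd k (Dη η om F) = Dη η om (pd k F) := RD_comm _ _ _ _ _

lemma pd_pd (k l : ι) (F : X → Sm ι) : pd k (pd l F) = pd l (pd k F) := RD_comm _ _ _ _ _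

variable (β₀ : κ → ℝ) (f : Sm (ι ⊕ κ)) (η : X → ℝ) (om : ι → ℝ)

/-- The gradient of `f` along the torus. -/
noncomputable def grad (u : ι ⊕ κ → X → Sm ι) (i : ι ⊕ κ) : X → Sm ι :=
  comp β₀ (dd (Pi.single i 1) f) u

/-- The Hessian of `f` along the torus. -/
noncomputable def hess (u : ι ⊕ κ → X → Sm ι) : Matrix (ι ⊕ κ) (ι ⊕ κ) (X → Sm ι) :=
  Matrix.of fun i j => comp β₀ (dd (Pi.single j 1) (dd (Pi.single i 1) f)) u

lemma hess_transpose (u : ι ⊕ κ → X → Sm ι) : (hess β₀ f u).transpose = hess β₀ f u := by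
  ext1 i j
  simp only [hess, Matrix.transpose_apply, Matrix.of_apply]
  rw [dd_comm]

/-- The matrix of the linearized equations of motion. -/
noncomputable def Jm (u : ι ⊕ κ → X → Sm ι) :
    Matrix ((ι ⊕ κ) ⊕ (ι ⊕ κ)) ((ι ⊕ κ) ⊕ (ι ⊕ κ)) (X → Sm ι) :=
  Matrix.fromBlocks 0 1 (-hess β₀ f u) 0

variable (ι κ X) in
/-- The standard symplectic matrix. -/
def Om : Matrix ((ι ⊕ κ) ⊕ (ι ⊕ κ)) ((ι ⊕ κ) ⊕ (ι ⊕ κ)) (X → Sm ι) :=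
  Matrix.fromBlocks 0 1 (-1) 0

/-- The matrix with columns `∂_k (q, p)`, without the constant part. -/
noncomputable def dK (K : (ι ⊕ κ) ⊕ (ι ⊕ κ) → X → Sm ι) :
    Matrix ((ι ⊕ κ) ⊕ (ι ⊕ κ)) ι (X → Sm ι) := Matrix.of fun i k => pd k (K i)

variable (ι κ X) in
/-- The constant tangent vectors. -/
def T10 : Matrix ((ι ⊕ κ) ⊕ (ι ⊕ κ)) ι (X → Sm ι) :=
  Matrix.of fun i k => if i = Sum.inl (Sum.inl k) then 1 else 0

variable (ι κ X) in
/-- The constant vectors conjugate to the tangent ones. -/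
def T2 : Matrix ((ι ⊕ κ) ⊕ (ι ⊕ κ)) ι (X → Sm ι) :=
  Matrix.of fun i k => if i = Sum.inr (Sum.inl k) then 1 else 0

/-- The tangent vectors `∂_k (q, p)`. -/
noncomputable def T1 (K : (ι ⊕ κ) ⊕ (ι ⊕ κ) → X → Sm ι) :
    Matrix ((ι ⊕ κ) ⊕ (ι ⊕ κ)) ι (X → Sm ι) := T10 ι κ X + dK K

/-- The error in the equations of motion. -/
noncomputable def Err (K : (ι ⊕ κ) ⊕ (ι ⊕ κ) → X → Sm ι) :
    Matrix ((ι ⊕ κ) ⊕ (ι ⊕ κ)) Unit (X → Sm ι) := Matrix.of fun i _ =>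
  Sum.elim (fun i => Dη η om (K (Sum.inl i)) - K (Sum.inr i))
    (fun i => Dη η om (K (Sum.inr i)) + grad β₀ f (K ∘ Sum.inl) i) i

/-- The derivative of the error. -/
noncomputable def dErr (K : (ι ⊕ κ) ⊕ (ι ⊕ κ) → X → Sm ι) :
    Matrix ((ι ⊕ κ) ⊕ (ι ⊕ κ)) ι (X → Sm ι) := Matrix.of fun i k => pd k (Err β₀ f η om K i ())

lemma Om_map (D : Derivation ℂ (X → Sm ι) (X → Sm ι)) : (Om ι κ X).map D = 0 := by
  rw [Om, Matrix.fromBlocks_map, map_neg_derivation, map_one_derivation]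
  ext1 i j
  rcases i with i | i <;> rcases j with j | j <;> simp

open Matrix in
lemma Jm_Om (u : ι ⊕ κ → X → Sm ι) : (Jm β₀ f u)ᵀ * Om ι κ X + Om ι κ X * Jm β₀ f u = 0 := by
  rw [Jm, Om, fromBlocks_transpose, fromBlocks_multiply, fromBlocks_multiply, fromBlocks_add,
    transpose_neg, hess_transpose]
  simp

lemma Jm_T2 (u : ι ⊕ κ → X → Sm ι) : Jm β₀ f u * T2 ι κ X = T10 ι κ X := by
  ext1 i k
  rcases i with i | i <;>
  simp [Jm, T2, T10, Matrix.mul_apply, Matrix.one_apply]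

lemma T2_map (u : ι ⊕ κ → X → Sm ι) :
    (T2 ι κ X).map (Dη η om) = Jm β₀ f u * T2 ι κ X + -T10 ι κ X := by
  rw [Jm_T2, add_neg_cancel]
  ext1 i k
  simp only [T2, Matrix.map_apply, Matrix.of_apply, Matrix.zero_apply]
  exact derivation_ite _ _

/-- The derivative of a composition in terms of the tangent vectors. -/
lemma pd_comp (φ : Sm (ι ⊕ κ)) {K : (ι ⊕ κ) ⊕ (ι ⊕ κ) → X → Sm ι}
    (hK : ∀ i, IsReal (K i)) (k : ι) :
    pd k (comp β₀ φ (K ∘ Sum.inl)) = ∑ i, comp β₀ (dd (Pi.single i 1) φ) (K ∘ Sum.inl)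
      * T1 K (Sum.inl i) k := by
  rw [pd, RD_comp β₀ φ (u := K ∘ Sum.inl) (fun i => hK (Sum.inl i))]
  refine Finset.sum_congr rfl fun i _ => ?_
  congr 1
  simp only [T1, T10, dK, Matrix.add_apply, Matrix.of_apply, pd, Function.comp_apply]
  congr 1
  funext x
  rcases i with i | i
  · by_cases h : i = k
    · subst h; simp [cst]
    · simp [cst, h]
  · simp [cst]

lemma T1_map {K : (ι ⊕ κ) ⊕ (ι ⊕ κ) → X → Sm ι} (hK : ∀ i, IsReal (K i)) :
    (T1 K).map (Dη η om) = Jm β₀ f (K ∘ Sum.inl) * T1 K + dErr β₀ f η om K := by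
  ext1 i k
  have h0 : (T1 K).map (Dη η om) i k = Dη η om (pd k (K i)) := by
    simp only [T1, T10, dK, Matrix.map_apply, Matrix.add_apply, Matrix.of_apply, map_add,
      derivation_ite, zero_add]
  rw [h0, ← pd_Dη]
  rcases i with i | i
  · have h1 : (Jm β₀ f (K ∘ Sum.inl) * T1 K) (Sum.inl i) k = T1 K (Sum.inr i) k := by
      simp [Jm, Matrix.mul_apply, Fintype.sum_sum_type, Matrix.one_apply]
    rw [Matrix.add_apply, h1]
    simp [T1, T10, dK, dErr, Err]
  · have h1 : (Jm β₀ f (K ∘ Sum.inl) * T1 K) (Sum.inr i) k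
        = -pd k (grad β₀ f (K ∘ Sum.inl) i) := by
      rw [grad, pd_comp β₀ _ hK, Matrix.mul_apply, Fintype.sum_sum_type]
      simp only [Jm, hess, Matrix.fromBlocks_apply₂₁, Matrix.fromBlocks_apply₂₂, Matrix.zero_apply,
        Matrix.neg_apply, Matrix.of_apply, zero_mul, Finset.sum_const_zero, add_zero]
      rw [← Finset.sum_neg_distrib]
      exact Finset.sum_congr rfl fun i _ => by ring
    rw [Matrix.add_apply, h1]
    simp [dErr, Err]

open Matrix in
lemma T1_Om_apply {c : Type*} (M : Matrix ((ι ⊕ κ) ⊕ (ι ⊕ κ)) ι (X → Sm ι))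
    (N : Matrix ((ι ⊕ κ) ⊕ (ι ⊕ κ)) c (X → Sm ι)) (k : ι) (l : c) :
    (Mᵀ * Om ι κ X * N) k l
      = ∑ i, (M (Sum.inl i) k * N (Sum.inr i) l - M (Sum.inr i) k * N (Sum.inl i) l) := by
  have h1 : ∀ i, (Om ι κ X * N) (Sum.inl i) l = N (Sum.inr i) l := fun i => by
    simp only [Om, Matrix.mul_apply, Fintype.sum_sum_type (α₁ := ι ⊕ κ) (α₂ := ι ⊕ κ),
      Matrix.fromBlocks_apply₁₁, Matrix.fromBlocks_apply₁₂, Matrix.zero_apply, Matrix.one_apply,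
      zero_mul, Finset.sum_const_zero, zero_add, ite_mul, one_mul, Finset.sum_ite_eq,
      Finset.mem_univ, if_true]
  have h2 : ∀ i, (Om ι κ X * N) (Sum.inr i) l = -N (Sum.inl i) l := fun i => by
    simp only [Om, Matrix.mul_apply, Fintype.sum_sum_type (α₁ := ι ⊕ κ) (α₂ := ι ⊕ κ),
      Matrix.fromBlocks_apply₂₁, Matrix.fromBlocks_apply₂₂, Matrix.zero_apply, Matrix.one_apply,
      Matrix.neg_apply, zero_mul, Finset.sum_const_zero, add_zero]
    rw [Finset.sum_eq_single i]
    · rw [if_pos rfl]; ring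
    · intro j _ hj
      rw [if_neg (Ne.symm hj)]; ring
    · simp
  rw [Matrix.mul_assoc, Matrix.mul_apply, Fintype.sum_sum_type, ← Finset.sum_add_distrib]
  refine Finset.sum_congr rfl fun i _ => ?_
  rw [h1, h2, Matrix.transpose_apply, Matrix.transpose_apply]
  ring

open Matrix in
lemma T1_Om_T1 (K : (ι ⊕ κ) ⊕ (ι ⊕ κ) → X → Sm ι) (k l : ι) :
    ((T1 K)ᵀ * Om ι κ X * T1 K) k l
      = pd l (∑ i, T1 K (Sum.inl i) k * K (Sum.inr i))
        - pd k (∑ i, T1 K (Sum.inl i) l * K (Sum.inr i)) := by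
  rw [T1_Om_apply, map_sum, map_sum, ← Finset.sum_sub_distrib]
  refine Finset.sum_congr rfl fun i _ => ?_
  have h : ∀ k l, pd l (T1 K (Sum.inl i) k) = pd l (pd k (K (Sum.inl i))) := fun k l => by
    simp only [T1, T10, dK, Matrix.add_apply, Matrix.of_apply, map_add, derivation_ite, zero_add]
  have h' : ∀ k, T1 K (Sum.inr i) k = pd k (K (Sum.inr i)) := fun k => by
    simp [T1, T10, dK]
  simp only [Derivation.leibniz, h, h', smul_eq_mul]
  rw [pd_pd k l]
  ring

open Matrix in
lemma T1_Om_Err {K : (ι ⊕ κ) ⊕ (ι ⊕ κ) → X → Sm ι} (hK : ∀ i, IsReal (K i)) (k : ι) :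
    ((T1 K)ᵀ * Om ι κ X * Err β₀ f η om K) k ()
      = pd k (comp β₀ f (K ∘ Sum.inl) + ∑ i, ((1 / 2 : ℂ) • (K (Sum.inr i) * K (Sum.inr i))
          - Dη η om (K (Sum.inl i)) * K (Sum.inr i)))
        + Dη η om (∑ i, T1 K (Sum.inl i) k * K (Sum.inr i)) := by
  rw [T1_Om_apply, map_add, pd_comp β₀ f hK, map_sum, map_sum, ← Finset.sum_add_distrib,
    ← Finset.sum_add_distrib]
  refine Finset.sum_congr rfl fun i _ => ?_
  have h : Dη η om (T1 K (Sum.inl i) k) = pd k (Dη η om (K (Sum.inl i))) := by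
    rw [pd_Dη]
    simp only [T1, T10, dK, Matrix.add_apply, Matrix.of_apply, map_add, derivation_ite, zero_add]
  have h' : T1 K (Sum.inr i) k = pd k (K (Sum.inr i)) := by
    simp [T1, T10, dK]
  simp only [Derivation.leibniz, h, h', smul_eq_mul, map_sub, Derivation.map_smul, Err,
    Matrix.of_apply, Sum.elim_inl, Sum.elim_inr, grad]
  have h2 : (1 / 2 : ℂ) • (K (Sum.inr i) * pd k (K (Sum.inr i))
      + K (Sum.inr i) * pd k (K (Sum.inr i))) = K (Sum.inr i) * pd k (K (Sum.inr i)) := by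
    rw [← two_smul ℂ, smul_smul]; norm_num
  rw [h2]
  ring

end torus

/-! ### Bounds by powers of a large number -/

section powers

variable {ι : Type*} [Fintype ι] {X : Type*}
variable {ρ : X → X → ℝ} {w : X → ℝ} {σ σ' Z ε ε' : ℝ} {a b : ℕ}
variable {m n p : Type*} [Fintype m] [Fintype n] [Fintype p]

/-- The sum of the norms of the entries of `M` is at most `Z ^ a * ε`. -/
def ZB (ρ : X → X → ℝ) (w : X → ℝ) (σ Z : ℝ) (a : ℕ) (ε : ℝ) (M : Matrix m n (X → Sm ι)) : Prop :=
  0 < σ ∧ 2 ≤ Z ∧ 0 ≤ ε ∧ MBd ρ w σ M (Z ^ a * ε)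

variable {M N : Matrix m n (X → Sm ι)}

lemma ZB.bd (h : ZB ρ w σ Z a ε M) : MBd ρ w σ M (Z ^ a * ε) := h.2.2.2

lemma ZB.up (h : ZB ρ w σ Z a ε M) (hab : a ≤ b) : ZB ρ w σ Z b ε M := by
  obtain ⟨h1, h2, h3, h4⟩ := h
  refine ⟨h1, h2, h3, h4.mono ?_⟩
  have : 1 ≤ Z := by linarith
  gcongr

lemma ZB.anti (h : ZB ρ w σ Z a ε M) (h0 : 0 < σ') (hσ : σ' ≤ σ) : ZB ρ w σ' Z a ε M :=
  ⟨h0, h.2.1, h.2.2.1, h.bd.anti hσ⟩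

lemma ZB.weight [PosRho ρ] (hw : ∀ x, w x ≤ 1) (h : ZB ρ w σ Z a ε M) : ZB ρ 1 σ Z a ε M :=
  ⟨h.1, h.2.1, h.2.2.1, h.bd.weight hw⟩

lemma ZB.transpose (h : ZB ρ w σ Z a ε M) : ZB ρ w σ Z a ε M.transpose :=
  ⟨h.1, h.2.1, h.2.2.1, h.bd.transpose⟩

lemma ZB.neg (h : ZB ρ w σ Z a ε M) : ZB ρ w σ Z a ε (-M) := ⟨h.1, h.2.1, h.2.2.1, h.bd.neg⟩

lemma ZB.add (h : ZB ρ w σ Z a ε M) (h' : ZB ρ w σ Z b ε N) :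
    ZB ρ w σ Z (max a b + 1) ε (M + N) := by
  have h1 := (h.up (le_max_left a b)).bd.add (h'.up (le_max_right a b)).bd
  refine ⟨h.1, h.2.1, h.2.2.1, h1.mono ?_⟩
  have h2 := h.2.1
  have h3 := h.2.2.1
  rw [pow_succ]
  have : 0 ≤ Z ^ max a b * ε := by positivity
  nlinarith

lemma ZB.sub (h : ZB ρ w σ Z a ε M) (h' : ZB ρ w σ Z b ε N) :
    ZB ρ w σ Z (max a b + 1) ε (M - N) := by
  rw [sub_eq_add_neg]; exact h.add h'.neg

lemma ZB.mulE [PosRho ρ] [PosWt w] {M : Matrix m n (X → Sm ι)} {N : Matrix n p (X → Sm ι)}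
    (h : ZB ρ 1 σ Z a ε M) (h' : ZB ρ w σ Z b ε' N) : ZB ρ w σ Z (a + b) (ε * ε') (M * N) := by
  refine ⟨h.1, h.2.1, mul_nonneg h.2.2.1 h'.2.2.1, (h.bd.mul' h.1.le h'.bd).mono (le_of_eq ?_)⟩
  rw [pow_add]; ring

lemma ZB.mul' [PosRho ρ] [PosWt w] {M : Matrix m n (X → Sm ι)} {N : Matrix n p (X → Sm ι)}
    (h : ZB ρ 1 σ Z a 1 M) (h' : ZB ρ w σ Z b ε N) : ZB ρ w σ Z (a + b) ε (M * N) := by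
  simpa using h.mulE h'

lemma ZB.mul [PosRho ρ] [PosWt w] {M : Matrix m n (X → Sm ι)} {N : Matrix n p (X → Sm ι)}
    (h : ZB ρ w σ Z a ε M) (h' : ZB ρ 1 σ Z b 1 N) : ZB ρ w σ Z (a + b) ε (M * N) := by
  refine ⟨h.1, h.2.1, h.2.2.1, (h.bd.mul h.1.le h'.bd).mono (le_of_eq ?_)⟩
  rw [pow_add]; ring

/-- Entrywise bounds. -/
lemma ZB.of_entries {c : ℝ} (hσ : 0 < σ) (hZ : 2 ≤ Z) (hε : 0 ≤ ε)
    (hc : (Fintype.card m : ℝ) * Fintype.card n * c ≤ Z ^ a) (h : ∀ i j, Bd ρ w σ (M i j) (c * ε)) :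
    ZB ρ w σ Z a ε M :=
  ⟨hσ, hZ, hε, (MBd.of_entries h).mono (by
    calc (Fintype.card m : ℝ) * Fintype.card n * (c * ε)
        = (Fintype.card m : ℝ) * Fintype.card n * c * ε := by ring
      _ ≤ _ := by gcongr)⟩

end powers

section solver

variable {ι : Type*} [Fintype ι] {X : Type*}
variable {ρ : X → X → ℝ} {w : X → ℝ} {σ Z ε : ℝ} {a : ℕ}
variable {m n : Type*} [Fintype m] [Fintype n]

lemma ZB.exists_solution [PosRho ρ] [PosWt w] {κ : X → ℂ} {v : ι → ℝ} {μ : m → n → X → ℂ} {L δ : ℝ}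
    {M : Matrix m n (X → Sm ι)}
    (hL : 0 ≤ L) (hLZ : L ≤ Z) (hσδ : 0 < σ - δ) (hM : ZB ρ w σ Z a ε M)
    (hd : ∀ i j, ∃ c, IsDiv ρ κ v (μ i j) L δ c ∧
      ∀ x, coef (M i j x).1 0 = 0 ∨ μ i j x * c 0 x = 1) :
    ∃ y : Matrix m n (X → Sm ι), (∀ i j, RD κ v (y i j) + cst (μ i j) * y i j = M i j) ∧
      ZB ρ w (σ - δ) Z (a + 1) ε y := by
  obtain ⟨h1, h2, h3, b, hb, hC⟩ := hM
  choose c hc h0 using hd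
  choose y hy hyb using fun i j => KAM.exists_solution hL h1.le hσδ (hc i j) (hb i j) (h0 i j)
  refine ⟨Matrix.of y, hy, hσδ, h2, h3, fun i j => L * b i j, hyb, ?_⟩
  simp_rw [← Finset.mul_sum]
  calc _ ≤ L * (Z ^ a * ε) := by gcongr
    _ ≤ Z * (Z ^ a * ε) := by gcongr
    _ = _ := by rw [pow_succ]; ring

lemma ZB.of_solution [PosRho ρ] [PosWt w] {κ : X → ℂ} {v : ι → ℝ} {μ : m → n → X → ℂ}
    {L δ σ' C : ℝ} {w' : X → ℝ} {M G : Matrix m n (X → Sm ι)}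
    (hL : 0 ≤ L) (hLZ : L ≤ Z) (hσδ : 0 < σ - δ) (hM : ZB ρ w σ Z a ε M) (hσ' : 0 < σ')
    (hG : MBd ρ w' σ' G C) (h : ∀ i j, RD κ v (G i j) + cst (μ i j) * G i j = M i j)
    (hd : ∀ i j, ∃ c, IsDiv ρ κ v (μ i j) L δ c ∧
      ∀ x, coef (G i j x).1 0 = 0 ∨ μ i j x * c 0 x = 1) :
    ZB ρ w (σ - δ) Z (a + 1) ε G := by
  obtain ⟨h1, h2, h3, b, hb, hC⟩ := hM
  choose c hc h0 using hd
  refine ⟨hσδ, h2, h3, fun i j => L * b i j, fun i j =>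
    Bd.of_solution hL h1.le hσδ hσ' (hc i j) (hb i j) (hG.entry i j) (h i j) (h0 i j), ?_⟩
  simp_rw [← Finset.mul_sum]
  calc _ ≤ L * (Z ^ a * ε) := by gcongr
    _ ≤ Z * (Z ^ a * ε) := by gcongr
    _ = _ := by rw [pow_succ]; ring

end solver

/-! ### Means of matrices -/

section means

variable {ι : Type*} [Fintype ι] {X : Type*}
variable {ρ : X → X → ℝ} {w : X → ℝ} {σ Z ε : ℝ} {a : ℕ}
variable {m n : Type*} [Fintype m] [Fintype n]

/-- The mean of a matrix, as a matrix of constant functions. -/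
noncomputable def meanM (M : Matrix m n (X → Sm ι)) : Matrix m n (X → Sm ι) :=
  M.map fun F => cst (mean F)

lemma MBd.meanM [PosRho ρ] [PosWt w] {C σ' : ℝ} {M : Matrix m n (X → Sm ι)} (hσ : 0 ≤ σ)
    (h : MBd ρ w σ M C) : MBd ρ w σ' (meanM M) C := by
  obtain ⟨b, hb, h⟩ := h
  exact ⟨b, fun i j => (hb i j).mean hσ, h⟩

lemma Bd.mean_add {w' : X → ℝ} {F G : X → Sm ι} {C C' : ℝ} (hσ : 0 ≤ σ) (hF : Bd ρ w σ F C)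
    (hG : Bd ρ w' σ G C') : KAM.mean (F + G) = KAM.mean F + KAM.mean G :=
  funext fun x => hF.coef_add hσ hG x 0

lemma mean_neg (F : X → Sm ι) : mean (-F) = -mean F :=
  funext fun x => coef_neg (F x).1 0

lemma Bd.mean_sub {w' : X → ℝ} {F G : X → Sm ι} {C C' : ℝ} (hσ : 0 ≤ σ) (hF : Bd ρ w σ F C)
    (hG : Bd ρ w' σ G C') : KAM.mean (F - G) = KAM.mean F - KAM.mean G := by
  rw [sub_eq_add_neg, hF.mean_add hσ hG.neg, mean_neg, sub_eq_add_neg]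

lemma Bd.mean_cst_mul {F : X → Sm ι} {C : ℝ} (hσ : 0 ≤ σ) (hF : Bd ρ w σ F C)
    (z : X → ℂ) : KAM.mean (KAM.cst z * F) = z * KAM.mean F := by
  funext x
  have := hF.coef_smul hσ x (z x) 0
  simp only [KAM.mean, Pi.mul_apply, KAM.cst]
  rw [← this]
  congr 2

lemma mean_zero : mean (0 : X → Sm ι) = 0 := by
  have := mean_cst (ι := ι) (0 : X → ℂ)
  rwa [show (cst 0 : X → Sm ι) = 0 from funext fun x => by simp [cst]] at this

lemma Bd.mean_sum [PosRho ρ] [PosWt w] {κ : Type*} (s : Finset κ) {F : κ → X → Sm ι} {C : κ → ℝ}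
    (hσ : 0 ≤ σ) (h : ∀ k ∈ s, Bd ρ w σ (F k) (C k)) :
    KAM.mean (∑ k ∈ s, F k) = ∑ k ∈ s, KAM.mean (F k) := by
  classical
  induction s using Finset.induction_on with
  | empty => simpa using KAM.mean_zero
  | insert a s ha ih =>
    rw [Finset.sum_insert ha, Finset.sum_insert ha, Bd.mean_add hσ (h a (by simp))
      (Bd.sum s fun k hk => h k (by simp [hk])), ih fun k hk => h k (by simp [hk])]

lemma cst_add (a b : X → ℂ) : (cst (a + b) : X → Sm ι) = cst a + cst b := by
  funext x; simp [cst]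

lemma cst_neg (a : X → ℂ) : (cst (-a) : X → Sm ι) = -cst a := by
  funext x; simp [cst]

lemma cst_sub (a b : X → ℂ) : (cst (a - b) : X → Sm ι) = cst a - cst b := by
  funext x; simp [cst]

lemma cst_mul (a b : X → ℂ) : (cst (a * b) : X → Sm ι) = cst a * cst b := by
  funext x; simp [cst]

lemma cst_sum {κ : Type*} (s : Finset κ) (a : κ → X → ℂ) :
    (cst (∑ k ∈ s, a k) : X → Sm ι) = ∑ k ∈ s, cst (a k) := by
  funext x; simp [cst, Finset.sum_apply]

lemma cst_zero : (cst 0 : X → Sm ι) = 0 := by funext x; simp [cst]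

lemma meanM_add {w' : X → ℝ} {M N : Matrix m n (X → Sm ι)} {C C' : ℝ} (hσ : 0 ≤ σ)
    (hM : MBd ρ w σ M C) (hN : MBd ρ w' σ N C') : meanM (M + N) = meanM M + meanM N := by
  ext1 i j
  simp only [meanM, Matrix.map_apply, Matrix.add_apply]
  rw [(hM.entry i j).mean_add hσ (hN.entry i j), cst_add]

lemma meanM_neg (M : Matrix m n (X → Sm ι)) : meanM (-M) = -meanM M := by
  ext1 i j
  simp only [meanM, Matrix.map_apply, Matrix.neg_apply]
  rw [mean_neg, cst_neg]

lemma meanM_meanM (M : Matrix m n (X → Sm ι)) : meanM (meanM M) = meanM M := by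
  ext1 i j
  simp only [meanM, Matrix.map_apply]
  rw [mean_cst]

/-- Constant matrices can be taken out of the mean. -/
lemma meanM_mul_meanM [PosRho ρ] [PosWt w] {p : Type*} [Fintype p] {M : Matrix m n (X → Sm ι)}
    {N : Matrix n p (X → Sm ι)} {C : ℝ} (hσ : 0 ≤ σ) (hM : MBd ρ 1 σ M C) {C' : ℝ}
    (hN : MBd ρ w σ N C') : meanM (M * meanM N) = meanM M * meanM N := by
  ext1 i j
  have h1 : ∀ k, Bd ρ w σ (M i k * meanM N k j) (C * C') := fun k =>
    (hM.entry i k).mul' hσ ((hN.meanM hσ).entry k j)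
  have h2 : ∀ k, mean (M i k * meanM N k j) = mean (M i k) * mean (N k j) := fun k => by
    rw [mul_comm, mul_comm (mean _)]
    exact (hM.entry i k).mean_cst_mul hσ _
  simp only [meanM, Matrix.map_apply, Matrix.mul_apply] at h1 h2 ⊢
  rw [Bd.mean_sum _ hσ fun k _ => h1 k, cst_sum]
  refine Finset.sum_congr rfl fun k _ => ?_
  rw [h2, cst_mul]

lemma meanM_meanM_mul [PosRho ρ] [PosWt w] {p : Type*} [Fintype p] {M : Matrix m n (X → Sm ι)}
    {N : Matrix n p (X → Sm ι)} {C : ℝ} (hσ : 0 ≤ σ) (hM : MBd ρ 1 σ M C) {C' : ℝ}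
    (hN : MBd ρ w σ N C') : meanM (meanM M * N) = meanM M * meanM N := by
  ext1 i j
  have h1 : ∀ k, Bd ρ w σ (meanM M i k * N k j) (C * C') := fun k =>
    ((hM.meanM hσ).entry i k).mul' hσ (hN.entry k j)
  have h2 : ∀ k, mean (meanM M i k * N k j) = mean (M i k) * mean (N k j) := fun k =>
    (hN.entry k j).mean_cst_mul hσ _
  simp only [meanM, Matrix.map_apply, Matrix.mul_apply] at h1 h2 ⊢
  rw [Bd.mean_sum _ hσ fun k _ => h1 k, cst_sum]
  refine Finset.sum_congr rfl fun k _ => ?_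
  rw [h2, cst_mul]

lemma meanM_one [DecidableEq m] : meanM (1 : Matrix m m (X → Sm ι)) = 1 := by
  ext1 i j
  simp only [meanM, Matrix.map_apply, Matrix.one_apply]
  split_ifs
  · rw [show (1 : X → Sm ι) = cst 1 from funext fun x => by simp [cst], mean_cst]
  · rw [mean_zero, cst_zero]

/-- A constant matrix close to the identity has a constant inverse. -/
lemma exists_inv_meanM [PosRho ρ] [DecidableEq m] {S : Matrix m m (X → Sm ι)} {q : ℝ}
    (hσ : 0 < σ) (hS : MBd ρ 1 σ S q) (hq : q ≤ 1 / 2) :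
    ∃ N : Matrix m m (X → Sm ι), (1 + meanM S) * (1 + meanM N) = 1 ∧
      MBd ρ 1 σ (meanM N) (Fintype.card m * Fintype.card m * (2 * q)) := by
  obtain ⟨N, h1, h2⟩ := MBd.exists_inv hσ (hS.meanM (σ' := σ) hσ.le) hq
  refine ⟨N, ?_, h2.meanM hσ.le⟩
  have h3 : MBd ρ 1 σ (1 + S) _ := MBd.one.add hS
  have h4 : MBd ρ 1 σ (1 + N) _ := MBd.one.add h2
  have e1 : 1 + meanM S = meanM (1 + S) := by
    rw [meanM_add hσ.le (MBd.one (ρ := ρ) (σ := σ)) hS, meanM_one]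
  have e2 : 1 + meanM N = meanM (1 + N) := by
    rw [meanM_add hσ.le (MBd.one (ρ := ρ) (σ := σ)) h2, meanM_one]
  rw [e2, e1, ← meanM_meanM_mul hσ.le h3 h4, ← e1, h1, meanM_one]

end means

section frame

variable {ι κ X : Type*} [Fintype ι] [Fintype κ] [DecidableEq ι] [DecidableEq κ]

/-- The index set of the coordinates of phase space. -/
abbrev Ph (ι κ : Type*) := (ι ⊕ κ) ⊕ (ι ⊕ κ)

/-- Bounds on the Fourier coefficients of the potential and its derivatives. -/
structure Pot (f : Sm (ι ⊕ κ)) (r M : ℝ) : Prop where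
  real : ∀ x, (f.1 x).im = 0
  pos : 0 < r
  fs : ∃ h, FS r M f h
  fs1 : ∀ i, ∃ h, FS r M (dd (Pi.single i 1) f) h
  fs2 : ∀ i j, ∃ h, FS r M (dd (Pi.single j 1) (dd (Pi.single i 1) f)) h

/-- The reference normal frame and its dual. -/
structure Ref (ρ : X → X → ℝ) (Y0 : Matrix (Ph ι κ) (κ ⊕ κ) (X → Sm ι))
    (Q1 Q2 : Matrix ι (Ph ι κ) (X → Sm ι)) (Q3 : Matrix (κ ⊕ κ) (Ph ι κ) (X → Sm ι)) (c : ℝ) :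
    Prop where
  inv : T10 ι κ X * Q1 + T2 ι κ X * Q2 + Y0 * Q3 = 1
  inv1 : Q1 * T10 ι κ X = 1
  one_le : 1 ≤ c
  card : 2 * (Fintype.card (Ph ι κ) : ℝ) ^ 2 ≤ c
  Y0_le : ∀ σ, MBd ρ 1 σ Y0 c
  Q1_le : ∀ σ, MBd ρ 1 σ Q1 c
  Q2_le : ∀ σ, MBd ρ 1 σ Q2 c
  Q3_le : ∀ σ, MBd ρ 1 σ Q3 c

variable (ι) in
/-- The diagonal matrix of the normal frequencies. -/
noncomputable def LamM (lam : κ ⊕ κ → X → ℂ) : Matrix (κ ⊕ κ) (κ ⊕ κ) (X → Sm ι) :=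
  Matrix.diagonal fun j => cst (lam j)

/-- The error in the equation for the normal frame. -/
noncomputable def nErr (β₀ : κ → ℝ) (f : Sm (ι ⊕ κ)) (η : X → ℝ) (om : ι → ℝ) (K : Ph ι κ → X → Sm ι)
    (Y : Matrix (Ph ι κ) (κ ⊕ κ) (X → Sm ι)) (lam : κ ⊕ κ → X → ℂ) :
    Matrix (Ph ι κ) (κ ⊕ κ) (X → Sm ι) :=
  Y.map (Dη η om) - Jm β₀ f (K ∘ Sum.inl) * Y + Y * LamM ι lam

/-- `K` is an approximately invariant torus and `Y` an approximate normal frame. -/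
structure Approx (ρ : X → X → ℝ) (w : X → ℝ) (β₀ : κ → ℝ) (f : Sm (ι ⊕ κ)) (η : X → ℝ) (om : ι → ℝ)
    (Y0 : Matrix (Ph ι κ) (κ ⊕ κ) (X → Sm ι)) (σ k ε εn : ℝ) (K : Ph ι κ → X → Sm ι)
    (Y : Matrix (Ph ι κ) (κ ⊕ κ) (X → Sm ι)) (lam : κ ⊕ κ → X → ℂ) : Prop where
  real : ∀ i, IsReal (K i)
  K_le : ∀ i, Bd ρ 1 σ (K i) k
  dK_le : MBd ρ 1 σ (dK K) k
  Y_le : MBd ρ 1 σ (Y - Y0) k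
  err : MBd ρ w σ (Err β₀ f η om K) ε
  nrm : MBd ρ 1 σ (nErr β₀ f η om K Y lam) εn

/-- The inverses of the divisors are under control. -/
structure NonRes (ρ : X → X → ℝ) (η : X → ℝ) (om : ι → ℝ) (lam : κ ⊕ κ → X → ℂ) (L δ : ℝ) :
    Prop where
  zero : ∃ a, IsDiv ρ (fun x => (((η x)⁻¹ : ℝ) : ℂ)) om 0 L δ a
  pos : ∀ j, ∃ a, IsDiv ρ (fun x => (((η x)⁻¹ : ℝ) : ℂ)) om (lam j) L δ a ∧
    ∀ x, lam j x * a 0 x = 1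
  neg : ∀ j, ∃ a, IsDiv ρ (fun x => (((η x)⁻¹ : ℝ) : ℂ)) om (-lam j) L δ a ∧
    ∀ x, -lam j x * a 0 x = 1
  diff : ∀ i j, i ≠ j → ∃ a, IsDiv ρ (fun x => (((η x)⁻¹ : ℝ) : ℂ)) om (lam j - lam i) L δ a ∧
    ∀ x, (lam j x - lam i x) * a 0 x = 1

variable {ρ : X → X → ℝ} {w : X → ℝ} {σ Z c k : ℝ}
variable {Y0 : Matrix (Ph ι κ) (κ ⊕ κ) (X → Sm ι)} {Q1 Q2 : Matrix ι (Ph ι κ) (X → Sm ι)}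
  {Q3 : Matrix (κ ⊕ κ) (Ph ι κ) (X → Sm ι)}

lemma Bd.ite [PosRho ρ] (P : Prop) [Decidable P] :
    Bd ρ 1 σ (if P then 1 else 0 : X → Sm ι) 2 := by
  split_ifs
  · exact Bd.one
  · exact Bd.zero.mono zero_le_two

lemma card_le_card_Ph : (Fintype.card ι : ℝ) ≤ Fintype.card (Ph ι κ) := by
  have : Fintype.card ι ≤ Fintype.card (Ph ι κ) := by
    simp only [Fintype.card_sum]; omega
  exact_mod_cast this

lemma card_normal_le : (Fintype.card (κ ⊕ κ) : ℝ) ≤ Fintype.card (Ph ι κ) := by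
  have : Fintype.card (κ ⊕ κ) ≤ Fintype.card (Ph ι κ) := by
    simp only [Fintype.card_sum]; omega
  exact_mod_cast this

lemma MBd.of_card {m n : Type*} [Fintype m] [Fintype n] {M : Matrix m n (X → Sm ι)}
    (hc : 2 * (Fintype.card (Ph ι κ) : ℝ) ^ 2 ≤ c)
    (hm : (Fintype.card m : ℝ) ≤ Fintype.card (Ph ι κ))
    (hn : (Fintype.card n : ℝ) ≤ Fintype.card (Ph ι κ))
    (h : ∀ i j, Bd ρ w σ (M i j) 2) : MBd ρ w σ M c := by
  refine (MBd.of_entries h).mono (le_trans ?_ hc)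
  calc (Fintype.card m : ℝ) * Fintype.card n * 2
      ≤ Fintype.card (Ph ι κ) * Fintype.card (Ph ι κ) * 2 := by gcongr
    _ = _ := by ring

lemma Ref.T10_le [PosRho ρ] (hR : Ref ρ Y0 Q1 Q2 Q3 c) : MBd ρ 1 σ (T10 ι κ X) c :=
  MBd.of_card hR.card le_rfl card_le_card_Ph fun _ _ => Bd.ite _

lemma Ref.T2_le [PosRho ρ] (hR : Ref ρ Y0 Q1 Q2 Q3 c) : MBd ρ 1 σ (T2 ι κ X) c :=
  MBd.of_card hR.card le_rfl card_le_card_Ph fun _ _ => Bd.ite _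

lemma Ref.Om_le [PosRho ρ] (hR : Ref ρ Y0 Q1 Q2 Q3 c) : MBd ρ 1 σ (Om ι κ X) c := by
  refine MBd.of_card hR.card le_rfl le_rfl fun i j => ?_
  have h0 : Bd ρ 1 σ (0 : X → Sm ι) 2 := Bd.zero.mono zero_le_two
  rcases i with i | i <;> rcases j with j | j
  · exact h0
  · exact Bd.ite (i = j)
  · exact (Bd.ite (i = j)).neg
  · exact h0

open Matrix in
lemma T10_Om_T2 : (T10 ι κ X)ᵀ * Om ι κ X * T2 ι κ X = 1 := by
  ext1 k l
  rw [T1_Om_apply, Finset.sum_eq_single (Sum.inl k)]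
  · simp [T10, T2, Matrix.one_apply]
  · intro i _ hi
    simp [T10, hi]
  · simp

lemma one_add_le_pow {c Z : ℝ} (hZ : 2 ≤ Z) (hcZ : c ≤ Z) : c + 1 ≤ Z ^ 2 := by nlinarith

open Matrix in
/-- The moving frame close to the reference frame, and its dual. -/
lemma Ref.exists_frame [PosRho ρ] (hR : Ref ρ Y0 Q1 Q2 Q3 c) (hσ : 0 < σ) (hZ : 2 ≤ Z)
    (hcZ : c ≤ Z) (hk : 16 * c ^ 8 * k ≤ 1) {K : Ph ι κ → X → Sm ι}
    {Y : Matrix (Ph ι κ) (κ ⊕ κ) (X → Sm ι)} (hK : MBd ρ 1 σ (dK K) k)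
    (hY : MBd ρ 1 σ (Y - Y0) k) :
    ∃ (P1 P2 : Matrix ι (Ph ι κ) (X → Sm ι)) (P3 : Matrix (κ ⊕ κ) (Ph ι κ) (X → Sm ι))
      (U S : Matrix ι ι (X → Sm ι)),
      T1 K * P1 + T2 ι κ X * P2 + Y * P3 = 1 ∧
      U * ((T1 K)ᵀ * Om ι κ X * T2 ι κ X) = 1 ∧ ((T1 K)ᵀ * Om ι κ X * T2 ι κ X) * U = 1 ∧
      ZB ρ 1 σ Z 3 1 P1 ∧ ZB ρ 1 σ Z 3 1 P3 ∧ ZB ρ 1 σ Z 2 1 U ∧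
      P1 * (-T10 ι κ X) * U = -(1 + S) ∧ MBd ρ 1 σ S (1 / 2) := by
  have hk0 := hK.nonneg
  have hc1 := hR.one_le
  have hcard : (Fintype.card (Ph ι κ) : ℝ) * Fintype.card (Ph ι κ) ≤ c / 2 := by
    have := hR.card; nlinarith
  have hcard2 : 2 * (Fintype.card (Ph ι κ) : ℝ) ≤ c := by
    refine le_trans ?_ hR.card
    have h0 : (Fintype.card (Ph ι κ)) ≤ (Fintype.card (Ph ι κ)) ^ 2 := Nat.le_self_pow two_ne_zero _
    have : (Fintype.card (Ph ι κ) : ℝ) ≤ (Fintype.card (Ph ι κ) : ℝ) ^ 2 := by exact_mod_cast h0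
    linarith
  have hcι : (Fintype.card ι : ℝ) ≤ Fintype.card (Ph ι κ) := card_le_card_Ph
  have hpow : ∀ j : ℕ, j ≤ 8 → 16 * c ^ j * k ≤ 1 := fun j hj => by
    refine le_trans ?_ hk
    gcongr
  -- the dual frame
  have hD : MBd ρ 1 σ (dK K * Q1 + (Y - Y0) * Q3) (k * c + k * c) :=
    (hK.mul hσ.le (hR.Q1_le σ)).add (hY.mul hσ.le (hR.Q3_le σ))
  obtain ⟨N, hN1, hN2⟩ := MBd.exists_inv hσ hD (by have := hpow 1 (by norm_num); nlinarith)
  have hNk : MBd ρ 1 σ N (2 * k * c ^ 2) := hN2.mono (by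
    calc _ ≤ c / 2 * (2 * (k * c + k * c)) := by gcongr
      _ = _ := by ring)
  have hN1' : MBd ρ 1 σ (1 + N) (c + 1) := ((MBd.one).add hNk).mono (by
    have := hpow 2 (by norm_num); nlinarith)
  have hQN : c * (c + 1) ≤ Z ^ 3 * 1 := by
    have := one_add_le_pow hZ hcZ
    calc c * (c + 1) ≤ Z * Z ^ 2 := by gcongr
      _ = _ := by ring
  -- the inverse of `B`
  have hB0 : MBd ρ 1 σ ((dK K)ᵀ * Om ι κ X * T2 ι κ X) (k * c * c) :=
    (hK.transpose.mul hσ.le hR.Om_le).mul hσ.le hR.T2_le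
  obtain ⟨N', hN'1, hN'2⟩ := MBd.exists_inv hσ hB0
    (by have := hpow 2 (by norm_num); nlinarith)
  have hN'k : MBd ρ 1 σ N' (k * c ^ 3) := hN'2.mono (by
    calc _ ≤ (Fintype.card (Ph ι κ) : ℝ) * Fintype.card (Ph ι κ) * (2 * (k * c * c)) := by gcongr
      _ ≤ c / 2 * (2 * (k * c * c)) := by gcongr
      _ = _ := by ring)
  have hBeq : (T1 K)ᵀ * Om ι κ X * T2 ι κ X = 1 + (dK K)ᵀ * Om ι κ X * T2 ι κ X := by
    rw [T1, transpose_add, Matrix.add_mul, Matrix.add_mul, T10_Om_T2]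
  have hBU : ((T1 K)ᵀ * Om ι κ X * T2 ι κ X) * (1 + N') = 1 := by rw [hBeq, hN'1]
  have hP : MBd ρ 1 σ (Q1 * N * T10 ι κ X) (c * (2 * k * c ^ 2) * c) :=
    ((hR.Q1_le σ).mul hσ.le hNk).mul hσ.le hR.T10_le
  refine ⟨Q1 * (1 + N), Q2 * (1 + N), Q3 * (1 + N), 1 + N',
    Q1 * N * T10 ι κ X + N' + Q1 * N * T10 ι κ X * N', ?_,
    mul_eq_one_comm.mp hBU, hBU, ⟨hσ, hZ, zero_le_one, ((hR.Q1_le σ).mul hσ.le hN1').mono hQN⟩,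
    ⟨hσ, hZ, zero_le_one, ((hR.Q3_le σ).mul hσ.le hN1').mono hQN⟩,
    ⟨hσ, hZ, zero_le_one, ?_⟩, ?_, ?_⟩
  · have h1 : T1 K * Q1 + T2 ι κ X * Q2 + Y * Q3 = 1 + (dK K * Q1 + (Y - Y0) * Q3) := by
      rw [← hR.inv, T1, Matrix.add_mul, Matrix.sub_mul]
      abel
    rw [← Matrix.mul_assoc, ← Matrix.mul_assoc, ← Matrix.mul_assoc, ← Matrix.add_mul,
      ← Matrix.add_mul, h1, hN1]
  · refine ((MBd.one).add hN'k).mono ?_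
    have := hpow 3 (by norm_num)
    have := one_add_le_pow hZ hcZ
    nlinarith
  · have h1 : Q1 * (1 + N) * (-T10 ι κ X) = -(1 + Q1 * N * T10 ι κ X) := by
      rw [Matrix.mul_add, Matrix.mul_one, Matrix.mul_neg, Matrix.add_mul, hR.inv1]
    rw [h1, Matrix.neg_mul, Matrix.add_mul, Matrix.one_mul, Matrix.mul_add, Matrix.mul_one]
    abel
  · refine ((hP.add hN'k).add (hP.mul hσ.le hN'k)).mono ?_
    have h4 := hpow 4 (by norm_num)
    have h3 := hpow 3 (by norm_num)
    have h7 : c * (2 * k * c ^ 2) * c * (k * c ^ 3) = 2 * (c ^ 4 * k) * (c ^ 3 * k) := by ring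
    have h8 : c * (2 * k * c ^ 2) * c = 2 * (c ^ 4 * k) := by ring
    have e4 : 0 ≤ c ^ 4 * k := by positivity
    have e3 : 0 ≤ c ^ 3 * k := by positivity
    rw [h7, h8]
    nlinarith

end frame

section smallness

variable {ι κ X : Type*} [Fintype ι] [Fintype κ] [DecidableEq ι] [DecidableEq κ]

/-- The large number `Z` dominates all constants. -/
structure Num (r M c Z L δ : ℝ) : Prop where
  two_le : 2 ≤ Z
  c_le : c ≤ Z
  L_nonneg : 0 ≤ L
  L_le : L ≤ Z
  δ_pos : 0 < δ
  δ_le : 2 * δ⁻¹ ≤ Z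
  M1 : 16 * (4 / r) * M ≤ Z
  M2 : 64 * (4 / r) ^ 2 * M ≤ Z

variable {ρ : X → X → ℝ} {w : X → ℝ} {β₀ : κ → ℝ} {f : Sm (ι ⊕ κ)} {η : X → ℝ} {om : ι → ℝ}
variable {σ Z c k r M L δ ε ε' : ℝ}
variable {Y0 : Matrix (Ph ι κ) (κ ⊕ κ) (X → Sm ι)} {Q1 Q2 : Matrix ι (Ph ι κ) (X → Sm ι)}
  {Q3 : Matrix (κ ⊕ κ) (Ph ι κ) (X → Sm ι)}
variable {K : Ph ι κ → X → Sm ι} {Y : Matrix (Ph ι κ) (κ ⊕ κ) (X → Sm ι)} {lam : κ ⊕ κ → X → ℂ}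

lemma norm_single_le (k : ι) : ‖(Pi.single k 1 : ι → ℝ)‖ ≤ 1 := by
  rw [Pi.norm_single]; simp

lemma Bd.pd_le [PosRho ρ] [PosWt w] {F : X → Sm ι} {C : ℝ} (hN : Num r M c Z L δ)
    (hσδ : 0 < σ - δ) (hF : Bd ρ w σ F C) (k : ι) : Bd ρ w (σ - δ) (KAM.pd k F) (Z * C) :=
  (Bd.pd hN.δ_pos hσδ hF (norm_single_le k)).mono
    (mul_le_mul_of_nonneg_right hN.δ_le hF.nonneg)

lemma Ref.card_le {m n : Type*} [Fintype m] [Fintype n] (hR : Ref ρ Y0 Q1 Q2 Q3 c)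
    (hN : Num r M c Z L δ)
    (hm : (Fintype.card m : ℝ) ≤ Fintype.card (Ph ι κ))
    (hn : (Fintype.card n : ℝ) ≤ Fintype.card (Ph ι κ)) :
    (Fintype.card m : ℝ) * Fintype.card n ≤ Z := by
  have := hN.c_le
  have := hR.card
  calc (Fintype.card m : ℝ) * Fintype.card n
      ≤ Fintype.card (Ph ι κ) * Fintype.card (Ph ι κ) := by gcongr
    _ ≤ Z := by nlinarith

lemma ZB_dErr [PosRho ρ] [PosWt w] (hR : Ref ρ Y0 Q1 Q2 Q3 c) (hN : Num r M c Z L δ)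
    (hσδ : 0 < σ - δ) (h : MBd ρ w σ (Err β₀ f η om K) ε) :
    ZB ρ w (σ - δ) Z 2 ε (dErr β₀ f η om K) := by
  refine ZB.of_entries (c := Z) hσδ hN.two_le h.nonneg ?_ fun i k =>
    Bd.pd_le hN hσδ (h.entry i ()) k
  have := hR.card_le hN (m := Ph ι κ) (n := ι) le_rfl card_le_card_Ph
  have := hN.two_le
  rw [pow_two]
  gcongr

lemma Approx.ZB_T1 [PosRho ρ] (hR : Ref ρ Y0 Q1 Q2 Q3 c) (hN : Num r M c Z L δ) (hσ : 0 < σ)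
    (hk : k ≤ 1) (h : MBd ρ 1 σ (dK K) k) : ZB ρ 1 σ Z 2 1 (T1 K) :=
  ⟨hσ, hN.two_le, zero_le_one, (hR.T10_le.add h).mono (by
    have := one_add_le_pow hN.two_le hN.c_le; linarith)⟩

lemma Approx.ZB_Y [PosRho ρ] (hR : Ref ρ Y0 Q1 Q2 Q3 c) (hN : Num r M c Z L δ) (hσ : 0 < σ)
    (hk : k ≤ 1) (h : MBd ρ 1 σ (Y - Y0) k) : ZB ρ 1 σ Z 2 1 Y := by
  refine ⟨hσ, hN.two_le, zero_le_one, ?_⟩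
  have h1 := ((hR.Y0_le σ).add h)
  rw [add_sub_cancel] at h1
  exact h1.mono (by have := one_add_le_pow hN.two_le hN.c_le; linarith)

lemma ZB.of_ref {m n : Type*} [Fintype m] [Fintype n] {A : Matrix m n (X → Sm ι)}
    (hN : Num r M c Z L δ) (hσ : 0 < σ) (h : MBd ρ 1 σ A c) : ZB ρ 1 σ Z 1 1 A :=
  ⟨hσ, hN.two_le, zero_le_one, h.mono (by have := hN.c_le; linarith)⟩

lemma nErr_eq : Y.map (Dη η om) = Jm β₀ f (K ∘ Sum.inl) * Y
    - Y * LamM ι lam + nErr β₀ f η om K Y lam := by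
  rw [nErr]; abel

lemma mean_pd_eq_zero [PosRho ρ] {F : X → Sm ι} {C : ℝ} (hσ : 0 < σ) (h : Bd ρ w σ F C) (k : ι) :
    mean (pd k F) = 0 := h.mean_RD hσ _ _

open Matrix in
/-- The tangent vectors are approximately isotropic. -/
lemma Approx.ZB_A [PosRho ρ] (hR : Ref ρ Y0 Q1 Q2 Q3 c)
    (hN : Num r M c Z L δ) (hNR : NonRes ρ η om lam L δ) (hσδ : 0 < σ - 2 * δ) (hk : k ≤ 1)
    (hKr : ∀ i, IsReal (K i)) (hK : ∀ i, Bd ρ 1 σ (K i) k) (hdK : MBd ρ 1 σ (dK K) k)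
    (hF : ZB ρ 1 (σ - δ) Z 2 ε (dErr β₀ f η om K)) :
    ZB ρ 1 (σ - 2 * δ) Z 7 ε ((T1 K)ᵀ * Om ι κ X * T1 K) := by
  have hδ := hN.δ_pos
  have hσ1 : 0 < σ - δ := by linarith
  have hσ : 0 < σ := by linarith
  have hT1 := Approx.ZB_T1 hR hN hσ hk hdK
  have hT1' := hT1.anti hσ1 (by linarith)
  have hOm := ZB.of_ref hN hσ1 hR.Om_le
  have hrhs := ((hF.transpose.mul hOm).mul hT1').add ((hT1'.transpose.mul hOm).mul' hF)
  have hAb := (hT1.transpose.mul (ZB.of_ref hN hσ hR.Om_le)).mul hT1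
  have hJ := Jm_Om (ι := ι) (X := X) β₀ f (K ∘ Sum.inl)
  have hJt : (Jm β₀ f (K ∘ Sum.inl))ᵀ * Om ι κ X = -(Om ι κ X * Jm β₀ f (K ∘ Sum.inl)) :=
    eq_neg_of_add_eq_zero_left hJ
  have heq : ((T1 K)ᵀ * Om ι κ X * T1 K).map (Dη η om)
      = (dErr β₀ f η om K)ᵀ * Om ι κ X * T1 K + (T1 K)ᵀ * Om ι κ X * dErr β₀ f η om K := by
    rw [map_mul_derivation, map_mul_derivation, map_transpose_derivation, Om_map,
      T1_map β₀ f η om hKr, transpose_add, transpose_mul]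
    simp only [Matrix.add_mul, Matrix.mul_add, Matrix.mul_zero, add_zero]
    rw [Matrix.mul_assoc (T1 K)ᵀ _ (Om ι κ X), hJt]
    simp only [Matrix.mul_neg, Matrix.neg_mul, Matrix.mul_assoc]
    abel
  obtain ⟨a, ha⟩ := hNR.zero
  have hsol := ZB.of_solution (κ := fun x => (((η x)⁻¹ : ℝ) : ℂ)) (v := om) (δ := δ) (L := L)
    (μ := fun _ _ => 0) hN.L_nonneg hN.L_le (by linarith) hrhs hσ hAb.bd (fun k l => by
      rw [cst_zero, zero_mul, add_zero]
      exact congrFun (congrFun heq k) l) fun k l => ⟨a, ha, fun x => Or.inl ?_⟩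
  · rw [show σ - 2 * δ = σ - δ - δ by ring]
    exact hsol.up (by norm_num)
  · have hS := fun k => Bd.sum Finset.univ fun i _ =>
      (hT1.bd.entry (Sum.inl i) k).mul hσ.le (hK (Sum.inr i))
    have hm : mean (((T1 K)ᵀ * Om ι κ X * T1 K) k l) = 0 := by
      rw [T1_Om_T1, Bd.mean_sub hσ1.le (Bd.pd_le hN hσ1 (hS k) l) (Bd.pd_le hN hσ1 (hS l) k),
        mean_pd_eq_zero hσ (hS k), mean_pd_eq_zero hσ (hS l), sub_zero]
    exact congrFun hm x

open Matrix in
/-- The normal vectors are approximately symplectically orthogonal to the tangent ones. -/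
lemma Approx.ZB_G [PosRho ρ] (hR : Ref ρ Y0 Q1 Q2 Q3 c)
    (hN : Num r M c Z L δ) (hNR : NonRes ρ η om lam L δ) (hσδ : 0 < σ - 2 * δ) (hk : k ≤ 1)
    (hKr : ∀ i, IsReal (K i)) (hdK : MBd ρ 1 σ (dK K) k)
    (hY : MBd ρ 1 σ (Y - Y0) k) (hF : ZB ρ 1 (σ - δ) Z 2 ε (dErr β₀ f η om K))
    (he : ZB ρ 1 σ Z 0 ε (nErr β₀ f η om K Y lam)) :
    ZB ρ 1 (σ - 2 * δ) Z 7 ε ((T1 K)ᵀ * Om ι κ X * Y) := by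
  have hδ := hN.δ_pos
  have hσ1 : 0 < σ - δ := by linarith
  have hσ : 0 < σ := by linarith
  have hT1 := Approx.ZB_T1 hR hN hσ hk hdK
  have hT1' := hT1.anti hσ1 (by linarith)
  have hYb := Approx.ZB_Y hR hN hσ hk hY
  have hY' := hYb.anti hσ1 (by linarith)
  have hOm := ZB.of_ref hN hσ1 hR.Om_le
  have hrhs := ((hF.transpose.mul hOm).mul hY').add
    ((hT1'.transpose.mul hOm).mul' (he.anti hσ1 (by linarith)))
  have hGb := (hT1.transpose.mul (ZB.of_ref hN hσ hR.Om_le)).mul hYb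
  have hJ := Jm_Om (ι := ι) (X := X) β₀ f (K ∘ Sum.inl)
  have hJt : (Jm β₀ f (K ∘ Sum.inl))ᵀ * Om ι κ X = -(Om ι κ X * Jm β₀ f (K ∘ Sum.inl)) :=
    eq_neg_of_add_eq_zero_left hJ
  have heq : ((T1 K)ᵀ * Om ι κ X * Y).map (Dη η om)
      + ((T1 K)ᵀ * Om ι κ X * Y) * LamM ι lam
      = (dErr β₀ f η om K)ᵀ * Om ι κ X * Y + (T1 K)ᵀ * Om ι κ X * nErr β₀ f η om K Y lam := by
    rw [map_mul_derivation, map_mul_derivation, map_transpose_derivation, Om_map,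
      T1_map β₀ f η om hKr, transpose_add, transpose_mul,
      nErr_eq (β₀ := β₀) (f := f) (K := K) (lam := lam)]
    simp only [Matrix.add_mul, Matrix.mul_add, Matrix.mul_zero, add_zero]
    rw [Matrix.mul_assoc (T1 K)ᵀ _ (Om ι κ X), hJt]
    simp only [Matrix.mul_neg, Matrix.neg_mul, Matrix.mul_assoc, Matrix.mul_sub]
    abel
  choose a ha ha0 using hNR.pos
  have hsol := ZB.of_solution (κ := fun x => (((η x)⁻¹ : ℝ) : ℂ)) (v := om) (δ := δ) (L := L)
    (μ := fun _ j => lam j) hN.L_nonneg hN.L_le (by linarith) hrhs hσ hGb.bd (fun k l => by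
      have := congrFun (congrFun heq k) l
      rw [Matrix.add_apply, LamM, Matrix.mul_diagonal, mul_comm] at this
      exact this) fun k l => ⟨a l, ha l, fun x => Or.inr (ha0 l x)⟩
  rw [show σ - 2 * δ = σ - δ - δ by ring]
  exact hsol.up (by norm_num)

open Matrix in
lemma ZB_remainder [PosRho ρ] [PosWt w] {N a b c : Type*} [Fintype N] [Fintype a] [Fintype b]
    [Fintype c]
    {T2 X2 F1 : Matrix N a (X → Sm ι)} {e : Matrix N b (X → Sm ι)} {Q1 : Matrix a N (X → Sm ι)}
    {Q3 : Matrix b N (X → Sm ι)} {U A : Matrix a a (X → Sm ι)} {G : Matrix a b (X → Sm ι)}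
    {Om : Matrix N N (X → Sm ι)} {Rm : Matrix N c (X → Sm ι)} {y w1 : Matrix a c (X → Sm ι)}
    {w3 : Matrix b c (X → Sm ι)}
    (hT2 : ZB ρ 1 σ Z 1 1 T2) (hX2 : ZB ρ 1 σ Z 1 1 X2) (hOm : ZB ρ 1 σ Z 1 1 Om)
    (hQ1 : ZB ρ 1 σ Z 3 1 Q1) (hQ3 : ZB ρ 1 σ Z 3 1 Q3)
    (hU : ZB ρ 1 σ Z 2 1 U) (hF1 : ZB ρ 1 σ Z 2 ε F1) (he : ZB ρ 1 σ Z 0 ε e)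
    (hA : ZB ρ 1 σ Z 7 ε A) (hG : ZB ρ 1 σ Z 7 ε G) (hRm : ZB ρ w σ Z 0 ε' Rm)
    (hy : ZB ρ w σ Z 14 ε' y) (hw1 : ZB ρ w σ Z 22 ε' w1) (hw3 : ZB ρ w σ Z 22 ε' w3) :
    ZB ρ w σ Z 40 (ε * ε') (F1 * w1 + e * w3 + T2 * (U * (A * (Q1 * Rm) + G * (Q3 * Rm)
        - (F1ᵀ * Om * T2 + A * (Q1 * X2) + G * (Q3 * X2)) * (U * y)))) := by
  have h1 := (hA.mulE (hQ1.mul' hRm)).add (hG.mulE (hQ3.mul' hRm))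
  have h2 := (((hF1.transpose.mul hOm).mul hT2).add (hA.mul (hQ1.mul hX2))).add
    (hG.mul (hQ3.mul hX2))
  have h3 := hT2.mul' (hU.mul' (h1.sub (h2.mulE (hU.mul' hy))))
  exact (((hF1.mulE hw1).add (he.mulE hw3)).add h3).up (by norm_num)

end smallness

section real

variable {ι κ X : Type*} [Fintype ι] [Fintype κ]

/-- The real part of a family. -/
noncomputable def reF (F : X → Sm ι) : X → Sm ι := fun x => reS (F x)

lemma isReal_reF (F : X → Sm ι) : IsReal (reF F) := fun x ψ => by simp [reF]

lemma reF_of_real {F : X → Sm ι} (h : IsReal F) : reF F = F := by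
  funext x; ext ψ; exact h.ofReal_re x ψ

lemma reF_add (F G : X → Sm ι) : reF (F + G) = reF F + reF G := by
  funext x; ext ψ; simp [reF]

lemma reF_neg (F : X → Sm ι) : reF (-F) = -reF F := by
  funext x; ext ψ; simp [reF]

lemma reF_sub (F G : X → Sm ι) : reF (F - G) = reF F - reF G := by
  funext x; ext ψ; simp [reF]

lemma reF_sum {α : Type*} (s : Finset α) (F : α → X → Sm ι) :
    reF (∑ a ∈ s, F a) = ∑ a ∈ s, reF (F a) := by
  classical
  induction s using Finset.induction_on with
  | empty => funext x; ext ψ; simp [reF]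
  | insert a s ha ih => rw [Finset.sum_insert ha, Finset.sum_insert ha, reF_add, ih]

lemma reF_mul {F G : X → Sm ι} (h : IsReal G) : reF (G * F) = G * reF F := by
  funext x; ext ψ
  have := h x ψ
  apply Complex.ext <;> simp [reF, this]

lemma reF_RD (c : X → ℝ) (v : ι → ℝ) (F : X → Sm ι) :
    reF (RD (fun x => (c x : ℂ)) v F) = RD (fun x => (c x : ℂ)) v (reF F) := by
  funext x; ext ψ
  have h1 : HasFDerivAt (fun ψ => ((((F x).1 ψ).re : ℝ) : ℂ))
      (Complex.ofRealCLM.comp (Complex.reCLM.comp (fderiv ℝ (F x).1 ψ))) ψ :=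
    Complex.ofRealCLM.hasFDerivAt.comp ψ (Complex.reCLM.hasFDerivAt.comp ψ
      (Sm.differentiable (F x) ψ).hasFDerivAt)
  simp only [reF, reS_val, RD_apply, Sm.smul_val, dd_val, Complex.re_ofReal_mul]
  change _ = (c x : ℂ) * fderiv ℝ (fun ψ => ((((F x).1 ψ).re : ℝ) : ℂ)) ψ v
  rw [h1.fderiv]
  simp

lemma IsReal.of_reF {F : X → Sm ι} (h : reF F = F) : IsReal F := h ▸ isReal_reF F

lemma IsReal.RD {F : X → Sm ι} (h : IsReal F) (c : X → ℝ) (v : ι → ℝ) :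
    IsReal (RD (fun x => (c x : ℂ)) v F) :=
  IsReal.of_reF (by rw [reF_RD, reF_of_real h])

lemma IsReal.neg {F : X → Sm ι} (h : IsReal F) : IsReal (-F) :=
  IsReal.of_reF (by rw [reF_neg, reF_of_real h])

lemma IsReal.sub {F G : X → Sm ι} (h : IsReal F) (h' : IsReal G) : IsReal (F - G) :=
  IsReal.of_reF (by rw [reF_sub, reF_of_real h, reF_of_real h'])

lemma isReal_zero : IsReal (0 : X → Sm ι) := fun x ψ => by simp

lemma isReal_one : IsReal (1 : X → Sm ι) := fun x ψ => by simp

lemma isReal_comp {β₀ : κ → ℝ} {φ : Sm (ι ⊕ κ)} (h : ∀ x, (φ.1 x).im = 0)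
    (u : ι ⊕ κ → X → Sm ι) : IsReal (comp β₀ φ u) := fun x ψ => h _

lemma dd_im {d : Type*} [Fintype d] {φ : Sm d} (h : ∀ x, (φ.1 x).im = 0) (v : d → ℝ) (x : d → ℝ) :
    ((dd v φ).1 x).im = 0 := by
  have h1 : IsReal (fun _ : Unit => φ) := fun _ ψ => h ψ
  have h2 := h1.RD (fun _ => 1) v () x
  simpa [RD_apply] using h2

variable [DecidableEq ι] [DecidableEq κ]
variable {β₀ : κ → ℝ} {f : Sm (ι ⊕ κ)} {η : X → ℝ} {om : ι → ℝ}

lemma isReal_grad (h : ∀ x, (f.1 x).im = 0) (u : ι ⊕ κ → X → Sm ι) (i : ι ⊕ κ) :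
    IsReal (grad β₀ f u i) := isReal_comp (dd_im h _) u

lemma isReal_Jm (h : ∀ x, (f.1 x).im = 0) (u : ι ⊕ κ → X → Sm ι) (i j : Ph ι κ) :
    IsReal (Jm β₀ f u i j) := by
  rcases i with i | i <;> rcases j with j | j
  · exact isReal_zero
  · simp only [Jm, Matrix.fromBlocks_apply₁₂, Matrix.one_apply]
    split_ifs
    · exact isReal_one
    · exact isReal_zero
  · exact (isReal_comp (dd_im (dd_im h _) _) u).neg
  · exact isReal_zero

lemma isReal_Err (h : ∀ x, (f.1 x).im = 0) {K : Ph ι κ → X → Sm ι} (hK : ∀ i, IsReal (K i))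
    (i : Ph ι κ) (j : Unit) : IsReal (Err β₀ f η om K i j) := by
  rcases i with i | i
  · exact ((hK _).RD (fun x => (η x)⁻¹) om).sub (hK _)
  · exact ((hK _).RD (fun x => (η x)⁻¹) om).add (isReal_grad h _ _)

/-- The column vector of a family of functions. -/
def colV (v : Ph ι κ → X → Sm ι) : Matrix (Ph ι κ) Unit (X → Sm ι) := Matrix.of fun i _ => v i

/-- The quadratic part of the error. -/
noncomputable def quad (β₀ : κ → ℝ) (f : Sm (ι ⊕ κ)) (K v : Ph ι κ → X → Sm ι) :
    Matrix (Ph ι κ) Unit (X → Sm ι) := Matrix.of fun i _ =>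
  Sum.elim (fun _ => 0) (fun i => comp β₀ (dd (Pi.single i 1) f) (K ∘ Sum.inl + v ∘ Sum.inl)
    - comp β₀ (dd (Pi.single i 1) f) (K ∘ Sum.inl)
    - ∑ j, comp β₀ (dd (Pi.single j 1) (dd (Pi.single i 1) f)) (K ∘ Sum.inl) * v (Sum.inl j)) i

lemma Err_add (K v : Ph ι κ → X → Sm ι) :
    Err β₀ f η om (K + v) = Err β₀ f η om K
      + ((colV v).map (Dη η om) - Jm β₀ f (K ∘ Sum.inl) * colV v) + quad β₀ f K v := by
  ext1 i j
  rcases i with i | i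
  · have h1 : (Jm β₀ f (K ∘ Sum.inl) * colV v) (Sum.inl i) j = v (Sum.inr i) := by
      simp [Jm, Matrix.mul_apply, Fintype.sum_sum_type, Matrix.one_apply, colV]
    simp only [Matrix.add_apply, Matrix.sub_apply, h1]
    simp only [Err, colV, quad, Matrix.of_apply, Matrix.map_apply, Sum.elim_inl, Pi.add_apply,
      map_add, add_zero]
    ring
  · have h1 : (Jm β₀ f (K ∘ Sum.inl) * colV v) (Sum.inr i) j
        = -∑ j, comp β₀ (dd (Pi.single j 1) (dd (Pi.single i 1) f)) (K ∘ Sum.inl)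
          * v (Sum.inl j) := by
      rw [Matrix.mul_apply, Fintype.sum_sum_type]
      simp only [Jm, hess, Matrix.fromBlocks_apply₂₁, Matrix.fromBlocks_apply₂₂, Matrix.zero_apply,
        Matrix.neg_apply, Matrix.of_apply, zero_mul, Finset.sum_const_zero, add_zero, colV]
      rw [← Finset.sum_neg_distrib]
      exact Finset.sum_congr rfl fun i _ => by ring
    simp only [Matrix.add_apply, Matrix.sub_apply, h1]
    simp only [Err, colV, quad, Matrix.of_apply, Matrix.map_apply, Sum.elim_inr, Pi.add_apply,
      map_add, grad]
    rw [show (K + v) ∘ Sum.inl = K ∘ Sum.inl + v ∘ Sum.inl from rfl]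
    ring

/-- The real part of an approximate solution of the linearized equation. -/
lemma reF_linear (h : ∀ x, (f.1 x).im = 0) {K : Ph ι κ → X → Sm ι} (hK : ∀ i, IsReal (K i))
    {V R : Matrix (Ph ι κ) Unit (X → Sm ι)}
    (hV : V.map (Dη η om) - Jm β₀ f (K ∘ Sum.inl) * V = -Err β₀ f η om K + R) :
    (colV fun i => reF (V i ())).map (Dη η om)
      - Jm β₀ f (K ∘ Sum.inl) * (colV fun i => reF (V i ()))
      = -Err β₀ f η om K + R.map reF := by
  ext1 i j
  have h1 := congrArg reF (congrFun (congrFun hV i) ())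
  simp only [Matrix.sub_apply, Matrix.add_apply, Matrix.map_apply, Matrix.mul_apply,
    Matrix.neg_apply] at h1 ⊢
  rw [reF_sub, reF_add, reF_sum, reF_neg, reF_of_real (isReal_Err h hK i ())] at h1
  have h2 : reF (Dη η om (V i ())) = Dη η om (reF (V i ())) := reF_RD _ _ _
  rw [h2] at h1
  rw [← h1]
  simp only [colV, Matrix.of_apply]
  congr 1
  exact Finset.sum_congr rfl fun l _ => (reF_mul (isReal_Jm h _ _ _)).symm

end real

section torusStep

variable {ι κ X : Type*} [Fintype ι] [Fintype κ] [DecidableEq ι] [DecidableEq κ]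
variable {ρ : X → X → ℝ} {w : X → ℝ} {β₀ : κ → ℝ} {f : Sm (ι ⊕ κ)} {η : X → ℝ} {om : ι → ℝ}
variable {σ Z c k r M L δ ε ε' : ℝ}
variable {Y0 : Matrix (Ph ι κ) (κ ⊕ κ) (X → Sm ι)} {Q1 Q2 : Matrix ι (Ph ι κ) (X → Sm ι)}
  {Q3 : Matrix (κ ⊕ κ) (Ph ι κ) (X → Sm ι)}
variable {K : Ph ι κ → X → Sm ι} {Y : Matrix (Ph ι κ) (κ ⊕ κ) (X → Sm ι)} {lam : κ ⊕ κ → X → ℂ}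

lemma Ref.le_one (hR : Ref ρ Y0 Q1 Q2 Q3 c) (hk0 : 0 ≤ k) (hk : 16 * c ^ 8 * k ≤ 1) : k ≤ 1 := by
  have h1 : 1 ≤ c ^ 8 := one_le_pow₀ hR.one_le
  nlinarith

lemma Ref.card_tangent (hR : Ref ρ Y0 Q1 Q2 Q3 c) : 2 * (Fintype.card ι : ℝ) ≤ c ∧
    (Fintype.card ι : ℝ) * Fintype.card ι ≤ c := by
  have h1 : (Fintype.card ι : ℝ) ≤ Fintype.card (Ph ι κ) := card_le_card_Ph
  have h2 : (Fintype.card (Ph ι κ) : ℝ) ≤ (Fintype.card (Ph ι κ) : ℝ) ^ 2 := by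
    exact_mod_cast Nat.le_self_pow two_ne_zero _
  have h3 := hR.card
  have h4 : (0 : ℝ) ≤ Fintype.card ι := Nat.cast_nonneg _
  constructor
  · linarith
  · nlinarith

open Matrix in
lemma Approx.mean_T1_Om_Err [PosRho ρ] [PosWt w] (hw : ∀ x, w x ≤ 1) (hf : Pot f r M)
    (hN : Num r M c Z L δ) (hσδ : 0 < σ - δ) (hr : σ + 4 * k ≤ r)
    (hT1 : ZB ρ 1 σ Z 2 1 (T1 K))
    (hA : Approx ρ w β₀ f η om Y0 σ k ε ε' K Y lam) (l : ι) (j : Unit) :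
    mean (((T1 K)ᵀ * Om ι κ X * Err β₀ f η om K) l j) = 0 := by
  have hσ : 0 < σ := by have := hN.δ_pos; linarith
  obtain ⟨fh, hfh⟩ := hf.fs
  have h1 : Bd ρ 1 σ (comp β₀ f (K ∘ Sum.inl)) (4 * M) :=
    Bd.comp hσ hfh (fun i => hA.real _) (fun i => hA.K_le _) hr β₀
  have h2 : ∀ i, Bd ρ 1 σ (Dη η om (K (Sum.inl i))) (ε + k) := fun i => by
    have e : Dη η om (K (Sum.inl i)) = Err β₀ f η om K (Sum.inl i) () + K (Sum.inr i) := by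
      simp [Err]
    rw [e]
    exact ((hA.err.entry (Sum.inl i) ()).weight (w' := 1) hw).add (hA.K_le (Sum.inr i))
  have h3 := fun i => (((hA.K_le (Sum.inr i)).mul hσ.le (hA.K_le (Sum.inr i))).smul hσ.le
    (1 / 2)).sub ((h2 i).mul hσ.le (hA.K_le (Sum.inr i)))
  have h4 := h1.add (Bd.sum Finset.univ fun i _ => h3 i)
  have h5 := Bd.sum Finset.univ fun i _ =>
    (hT1.bd.entry (Sum.inl i) l).mul hσ.le (hA.K_le (Sum.inr i))
  funext x
  have h6 := h5.coef_RD hσ (fun x => (((η x)⁻¹ : ℝ) : ℂ)) om x 0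
  have h7 := Bd.coef_RD hσ h4 1 (Pi.single l 1) x 0
  have hOm : MBd ρ 1 σ (Om ι κ X) _ := MBd.of_entries (C := 2) fun i j => by
    have h0 : Bd ρ 1 σ (0 : X → Sm ι) 2 := Bd.zero.mono zero_le_two
    rcases i with i | i <;> rcases j with j | j
    · exact h0
    · exact Bd.ite (i = j)
    · exact (Bd.ite (i = j)).neg
    · exact h0
  have h8 := ((hT1.bd.transpose.mul hσ.le hOm).mul' hσ.le hA.err).entry l ()
  have h9 := Bd.pd_le hN hσδ h4 l
  have e := T1_Om_Err β₀ f η om hA.real l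
  have h10 : Dη η om (∑ i, T1 K (Sum.inl i) l * K (Sum.inr i))
      = ((T1 K)ᵀ * Om ι κ X * Err β₀ f η om K) l () - pd l (comp β₀ f (K ∘ Sum.inl)
        + ∑ i, ((1 / 2 : ℂ) • (K (Sum.inr i) * K (Sum.inr i))
          - Dη η om (K (Sum.inl i)) * K (Sum.inr i))) := by rw [e]; ring
  have h11 := ((h8.weight hw).anti (by linarith [hN.δ_pos] : σ - δ ≤ σ)).sub h9
  rw [← h10] at h11
  have h12 := h9.coef_add hσδ.le h11 x 0
  rw [← e] at h12
  simp only [mean]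
  refine h12.trans ?_
  refine (congrArg₂ (· + ·) h7 h6).trans ?_
  simp

set_option maxHeartbeats 2000000 in
open Matrix in
/-- Approximate solution of the linearized equations of motion. -/
lemma Approx.exists_correction [PosRho ρ] [PosWt w] (hw : ∀ x, w x ≤ 1) (hf : Pot f r M)
    (hR : Ref ρ Y0 Q1 Q2 Q3 c)
    (hN : Num r M c Z L δ) (hNR : NonRes ρ η om lam L δ) (hσδ : 0 < σ - 2 * δ)
    (hk : 16 * c ^ 8 * k ≤ 1) (hr : σ + 4 * k ≤ r)
    (hA : Approx ρ w β₀ f η om Y0 σ k ε ε K Y lam) :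
    ∃ V R : Matrix (Ph ι κ) Unit (X → Sm ι),
      V.map (Dη η om) - Jm β₀ f (K ∘ Sum.inl) * V = -Err β₀ f η om K + R ∧
      ZB ρ w (σ - 2 * δ) Z 30 ε V ∧ ZB ρ w (σ - 2 * δ) Z 40 (ε * ε) R := by
  have hδ := hN.δ_pos
  have hσ1 : 0 < σ - δ := by linarith
  have hσ : 0 < σ := by linarith
  have hs1 : σ - δ ≤ σ := by linarith
  have hs2 : σ - 2 * δ ≤ σ := by linarith
  have hs3 : σ - 2 * δ ≤ σ - δ := by linarith
  have hk0 := hA.dK_le.nonneg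
  have hk1 := hR.le_one hk0 hk
  have hε0 := hA.err.nonneg
  obtain ⟨P1, P2, P3, U, S, hQ, hU, hU', hP1, hP3, hUb, hθ, hS⟩ :=
    hR.exists_frame hσ hN.two_le hN.c_le hk hA.dK_le hA.Y_le
  have hT1 := Approx.ZB_T1 hR hN hσ hk1 hA.dK_le
  have hYb := Approx.ZB_Y hR hN hσ hk1 hA.Y_le
  have hOm := ZB.of_ref hN hσ hR.Om_le
  have hT2 := ZB.of_ref hN hσ hR.T2_le
  have hX2 := (ZB.of_ref hN hσ hR.T10_le).neg
  have hRm : ZB ρ w σ Z 0 ε (-Err β₀ f η om K) :=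
    ⟨hσ, hN.two_le, hε0, by simpa using hA.err.neg⟩
  have he : ZB ρ 1 σ Z 0 ε (nErr β₀ f η om K Y lam) :=
    ⟨hσ, hN.two_le, hε0, by simpa using hA.nrm⟩
  have hF := (ZB_dErr hR hN hσ1 hA.err).weight hw
  have hAA := Approx.ZB_A hR hN hNR hσδ hk1 hA.real hA.K_le hA.dK_le hF
  have hGG := Approx.ZB_G hR hN hNR hσδ hk1 hA.real hA.dK_le hA.Y_le hF he
  obtain ⟨a0, ha0⟩ := hNR.zero
  -- the component conjugate to the tangent directions
  obtain ⟨y0, hy0, hy0b⟩ := ((hT1.transpose.mul hOm).mul' hRm).exists_solution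
    (κ := fun x => (((η x)⁻¹ : ℝ) : ℂ)) (v := om) (δ := δ) (L := L) (μ := fun _ _ => 0)
    hN.L_nonneg hN.L_le hσ1 fun l j => ⟨a0, ha0, fun x => Or.inl (by
      have h1 := hA.mean_T1_Om_Err hw hf hN hσ1 hr hT1 l j
      have h2 : mean (((T1 K)ᵀ * Om ι κ X * -Err β₀ f η om K) l j) = 0 := by
        rw [Matrix.mul_neg, Matrix.neg_apply, mean_neg, h1, neg_zero]
      exact congrFun h2 x)⟩
  obtain ⟨N, hN1, hN2⟩ := exists_inv_meanM hσ hS le_rfl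
  have hN0 : ZB ρ 1 (σ - δ) Z 2 1 (1 + meanM N) := by
    refine ⟨hσ1, hN.two_le, zero_le_one, ((MBd.one.add hN2).anti hs1).mono ?_⟩
    obtain ⟨h1, h2⟩ := hR.card_tangent
    have := hN.c_le
    have := hN.two_le
    nlinarith
  have hB := ((hP1.mul' hRm).anti hσ1 hs1).sub
    (((hP1.mul hX2).anti hσ1 hs1).mul' ((hUb.anti hσ1 hs1).mul' hy0b))
  set B := P1 * -Err β₀ f η om K - P1 * -T10 ι κ X * (U * y0) with hBdef
  have hmB : ZB ρ w (σ - δ) Z _ ε (meanM B) := ⟨hσ1, hN.two_le, hε0, hB.bd.meanM hσ1.le⟩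
  set cc := -((1 + meanM N) * meanM B) with hcc
  have hcb : ZB ρ w (σ - δ) Z _ ε cc := (hN0.mul' hmB).neg
  have hcm : cc = meanM (-((1 + meanM N) * meanM B)) := by
    rw [meanM_neg, meanM_mul_meanM hσ1.le hN0.bd hB.bd,
      meanM_add hσ.le (MBd.one (ρ := ρ) (σ := σ)) hN2, meanM_one, meanM_meanM]
  have hDc : cc.map (Dη η om) = 0 := by
    rw [hcm]
    ext1 i j
    exact RD_cst _ _ _
  have hyb := hy0b.add hcb
  have hyeq : (y0 + cc).map (Dη η om) + (y0 + cc) * (0 : Matrix Unit Unit (X → Sm ι))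
      = (T1 K)ᵀ * Om ι κ X * -Err β₀ f η om K := by
    rw [map_add_derivation, hDc, Matrix.mul_zero, add_zero, add_zero]
    ext1 i j
    rw [← hy0 i j, cst_zero, zero_mul, add_zero]
    rfl
  have hr1 := ((hP1.mul' hRm).anti hσ1 hs1).sub
    (((hP1.mul hX2).anti hσ1 hs1).mul' ((hUb.anti hσ1 hs1).mul' hyb))
  have hr3 := ((hP3.mul' hRm).anti hσ1 hs1).sub
    (((hP3.mul hX2).anti hσ1 hs1).mul' ((hUb.anti hσ1 hs1).mul' hyb))
  have hmean : meanM (P1 * -Err β₀ f η om K - P1 * -T10 ι κ X * (U * (y0 + cc))) = 0 := by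
    have h1 : P1 * -Err β₀ f η om K - P1 * -T10 ι κ X * (U * (y0 + cc))
        = B + (1 + S) * cc := by
      rw [hBdef, Matrix.mul_add, Matrix.mul_add, ← Matrix.mul_assoc _ U cc, hθ, Matrix.neg_mul]
      abel
    have h1S : MBd ρ 1 (σ - δ) (1 + S) _ := (MBd.one.add hS).anti hs1
    have h2 : meanM ((1 + S) * cc) = (1 + meanM S) * cc := by
      rw [hcm, meanM_mul_meanM hσ1.le h1S hcb.bd,
        meanM_add hσ.le (MBd.one (ρ := ρ) (σ := σ)) hS, meanM_one]
    rw [h1, meanM_add hσ1.le hB.bd (h1S.mul' hσ1.le hcb.bd), h2, hcc, Matrix.mul_neg,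
      ← Matrix.mul_assoc, hN1, Matrix.one_mul, add_neg_cancel]
  obtain ⟨w1, hw1, hw1b⟩ := hr1.exists_solution
    (κ := fun x => (((η x)⁻¹ : ℝ) : ℂ)) (v := om) (δ := δ) (L := L) (μ := fun _ _ => 0)
    hN.L_nonneg hN.L_le (by linarith) fun l j => ⟨a0, ha0, fun x => Or.inl (by
      have h1 := congrFun (congrFun hmean l) j
      have h2 := congrArg mean h1
      simp only [meanM, Matrix.map_apply, Matrix.zero_apply] at h2
      rw [mean_cst, mean_zero] at h2
      exact congrFun h2 x)⟩
  choose a3 ha3 ha30 using hNR.neg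
  obtain ⟨w3, hw3, hw3b⟩ := hr3.exists_solution
    (κ := fun x => (((η x)⁻¹ : ℝ) : ℂ)) (v := om) (δ := δ) (L := L) (μ := fun i _ => -lam i)
    hN.L_nonneg hN.L_le (by linarith) fun i j => ⟨a3 i, ha3 i, fun x => Or.inr (ha30 i x)⟩
  rw [show σ - δ - δ = σ - 2 * δ by ring] at hw1b hw3b
  have key := linear_identity (Dη η om) (Jm β₀ f (K ∘ Sum.inl)) (Om ι κ X) (Om_map _)
    (Jm_Om β₀ f _) (T1 K) (T2 ι κ X) Y P1 P2 P3 hQ _ (T1_map β₀ f η om hA.real) _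
    (T2_map β₀ f η om _) (LamM ι lam) _ nErr_eq U hU hU' (-Err β₀ f η om K) 0 (y0 + cc) hyeq w1
    (by
      rw [Matrix.mul_zero, add_zero]
      ext1 i j
      rw [← hw1 i j, cst_zero, zero_mul, add_zero]
      rfl) w3 0 (by
      rw [Matrix.mul_zero, add_zero, sub_zero]
      ext1 i j
      rw [← hw3 i j, Matrix.sub_apply, LamM, Matrix.diagonal_mul, cst_neg, Matrix.map_apply, Dη]
      ring)
  rw [Matrix.mul_zero, Matrix.mul_zero, add_zero, sub_zero] at key
  have hassoc : ∀ a b c d : Matrix (Ph ι κ) Unit (X → Sm ι), a + b + c + d = a + (b + c + d) :=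
    fun a b c d => by abel
  refine ⟨_, _, key.trans (hassoc _ _ _ _), ?_, ?_⟩
  · exact ((((hT1.anti hσδ hs2).mul' hw1b).add ((hT2.anti hσδ hs2).mul'
      ((hUb.anti hσδ hs2).mul' (hyb.anti hσδ hs3)))).add
        ((hYb.anti hσδ hs2).mul' hw3b)).up (by norm_num)
  · exact ZB_remainder (hT2.anti hσδ hs2) (hX2.anti hσδ hs2) (hOm.anti hσδ hs2) (hP1.anti hσδ hs2)
      (hP3.anti hσδ hs2) (hUb.anti hσδ hs2) (hF.anti hσδ hs3) (he.anti hσδ hs2) hAA hGG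
      (hRm.anti hσδ hs2) ((hyb.anti hσδ hs3).up (by norm_num)) (hw1b.up (by norm_num))
      (hw3b.up (by norm_num))

end torusStep

section steps

variable {ι κ X : Type*} [Fintype ι] [Fintype κ] [DecidableEq ι] [DecidableEq κ]
variable {ρ : X → X → ℝ} {w : X → ℝ} {β₀ : κ → ℝ} {f : Sm (ι ⊕ κ)} {η : X → ℝ} {om : ι → ℝ}
variable {σ Z c k r M L δ ε ε' : ℝ}
variable {Y0 : Matrix (Ph ι κ) (κ ⊕ κ) (X → Sm ι)} {Q1 Q2 : Matrix ι (Ph ι κ) (X → Sm ι)}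
  {Q3 : Matrix (κ ⊕ κ) (Ph ι κ) (X → Sm ι)}
variable {K : Ph ι κ → X → Sm ι} {Y : Matrix (Ph ι κ) (κ ⊕ κ) (X → Sm ι)} {lam : κ ⊕ κ → X → ℂ}

lemma dK_add (K v : Ph ι κ → X → Sm ι) : dK (K + v) = dK K + dK v := by
  ext1 i j; simp [dK]

lemma nErr_add (K v : Ph ι κ → X → Sm ι) :
    nErr β₀ f η om (K + v) Y lam = nErr β₀ f η om K Y lam
      - (Jm β₀ f ((K + v) ∘ Sum.inl) - Jm β₀ f (K ∘ Sum.inl)) * Y := by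
  rw [nErr, nErr, Matrix.sub_mul]; abel

lemma pow_mul_le {Z ε : ℝ} (hZ : 2 ≤ Z) (hε : 0 ≤ ε) {a b : ℕ} (hab : a ≤ b) :
    Z ^ a * ε ≤ Z ^ b * ε := by
  have : 1 ≤ Z := by linarith
  gcongr

/-- One step of the Newton scheme for the embedding of the torus. -/
theorem Approx.exists_torus_step [PosRho ρ] [PosWt w] (hw : ∀ x, w x ≤ 1) (hf : Pot f r M)
    (hR : Ref ρ Y0 Q1 Q2 Q3 c)
    (hN : Num r M c Z L δ) (hNR : NonRes ρ η om lam L δ) (hσδ : 0 < σ - 3 * δ)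
    (hk : 16 * c ^ 8 * k ≤ 1) (hr : σ + 4 * k + 2 * (Z ^ 70 * ε) ≤ r / 2)
    (hA : Approx ρ w β₀ f η om Y0 σ k ε ε K Y lam) :
    ∃ K', Approx ρ w β₀ f η om Y0 (σ - 3 * δ) (k + Z ^ 70 * ε) (Z ^ 70 * ε ^ 2) (Z ^ 70 * ε)
      K' Y lam ∧ ∀ i, Bd ρ w (σ - 3 * δ) (K' i - K i) (Z ^ 70 * ε) := by
  have hδ := hN.δ_pos
  have hZ := hN.two_le
  have hε0 := hA.err.nonneg
  have hk0 := hA.dK_le.nonneg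
  have hrp := hf.pos
  have hM0 : 0 ≤ M := by obtain ⟨h, hh⟩ := hf.fs; exact hh.nonneg
  have hσ2 : 0 < σ - 2 * δ := by linarith
  have hs3 : σ - 3 * δ ≤ σ := by linarith
  have hs32 : σ - 3 * δ ≤ σ - 2 * δ := by linarith
  have hk1 := hR.le_one hk0 hk
  have hZp : 0 ≤ Z ^ 70 * ε := by positivity
  obtain ⟨V, R, hV, hVb, hRb⟩ := hA.exists_correction hw hf hR hN hNR hσ2 hk (by linarith)
  have hlin := reF_linear hf.real hA.real hV
  set v : Ph ι κ → X → Sm ι := fun i => reF (V i ()) with hv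
  have hvr : ∀ i, IsReal (v i) := fun i => isReal_reF _
  -- bounds for the correction
  have hvw2 : ∀ i, Bd ρ w (σ - 2 * δ) (v i) (Z ^ 31 * ε) := fun i =>
    ((hVb.bd.entry i ()).re hσ2.le).mono (by
      rw [pow_succ Z 30]
      have : 0 ≤ Z ^ 30 * ε := by positivity
      nlinarith)
  have hv12 : ∀ i, Bd ρ 1 (σ - 2 * δ) (v i) (Z ^ 31 * ε) := fun i => (hvw2 i).weight hw
  have hvw : ∀ i, Bd ρ w (σ - 3 * δ) (v i) (Z ^ 31 * ε) := fun i => (hvw2 i).anti hs32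
  have hv1 : ∀ i, Bd ρ 1 (σ - 3 * δ) (v i) (Z ^ 31 * ε) := fun i => (hv12 i).anti hs32
  have hdv : MBd ρ 1 (σ - 3 * δ) (dK v) (Z ^ 70 * ε) := by
    have h1 : ZB ρ 1 (σ - 3 * δ) Z 33 ε (dK v) := by
      refine ZB.of_entries (c := Z * Z ^ 31) hσδ hZ hε0 ?_ fun i l => ?_
      · have := hR.card_le hN (m := Ph ι κ) (n := ι) le_rfl card_le_card_Ph
        calc _ ≤ Z * (Z * Z ^ 31) := by gcongr
          _ = _ := by ring
      · have h2 := Bd.pd_le hN (by linarith) (hv12 i) l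
        rw [show σ - 2 * δ - δ = σ - 3 * δ by ring, ← mul_assoc] at h2
        exact h2
    exact (h1.up (by norm_num)).bd
  have hle : Z ^ 31 * ε ≤ Z ^ 70 * ε := pow_mul_le hZ hε0 (by norm_num)
  have hwid : σ - 3 * δ + 4 * k + 2 * (Z ^ 31 * ε) ≤ r / 2 := by linarith
  have hKb : ∀ i, Bd ρ 1 (σ - 3 * δ) (K i) k := fun i => (hA.K_le i).anti hs3
  have hcol := hR.card_le hN (m := Ph ι κ) (n := Ph ι κ) le_rfl le_rfl
  have hcolU : (Fintype.card (Ph ι κ) : ℝ) * Fintype.card Unit ≤ Z := by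
    have h1 : (Fintype.card (Ph ι κ) : ℝ) ≤ (Fintype.card (Ph ι κ) : ℝ) ^ 2 := by
      exact_mod_cast Nat.le_self_pow two_ne_zero _
    simp only [Fintype.card_unit, Nat.cast_one, mul_one]
    nlinarith
  -- the quadratic error
  have hquad : ZB ρ w (σ - 3 * δ) Z 64 (ε * ε) (quad β₀ f K v) := by
    refine ZB.of_entries (c := Z * (Z ^ 31 * Z ^ 31)) hσδ hZ (by positivity) ?_ fun i j => ?_
    · calc _ ≤ Z * (Z * (Z ^ 31 * Z ^ 31)) := by gcongr
        _ = _ := by ring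
    · rcases i with i | i
      · exact Bd.zero.mono (by positivity)
      · obtain ⟨gh, hgh⟩ := hf.fs1 i
        refine (Bd.comp_taylor hσδ hrp hgh (fun j => hA.real _) (fun j => hvr _)
          (fun j => hKb _) (fun j => hv1 (Sum.inl j)) (fun j => hvw _) (by positivity)
          (by positivity) hwid β₀).mono ?_
        have := hN.M2
        calc 64 * (4 / r) ^ 2 * (Z ^ 31 * ε) * (Z ^ 31 * ε) * M
            = (64 * (4 / r) ^ 2 * M) * ((Z ^ 31 * ε) * (Z ^ 31 * ε)) := by ring
          _ ≤ Z * ((Z ^ 31 * ε) * (Z ^ 31 * ε)) := by gcongr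
          _ = _ := by ring
  -- the change of the linearization
  have hJ : ZB ρ 1 (σ - 3 * δ) Z 33 ε
      (Jm β₀ f ((K + v) ∘ Sum.inl) - Jm β₀ f (K ∘ Sum.inl)) := by
    refine ZB.of_entries (c := Z * Z ^ 31) hσδ hZ hε0 ?_ fun i j => ?_
    · calc _ ≤ Z * (Z * Z ^ 31) := by gcongr
        _ = _ := by ring
    · have h0 : ∀ a : X → Sm ι, Bd ρ 1 (σ - 3 * δ) (a - a) (Z * Z ^ 31 * ε) := fun a => by
        rw [sub_self]; exact Bd.zero.mono (by positivity)
      rcases i with i | i <;> rcases j with j | j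
      · exact h0 _
      · exact h0 _
      · obtain ⟨gh, hgh⟩ := hf.fs2 i j
        have h1 := (Bd.comp_sub hσδ hrp hgh (u := K ∘ Sum.inl) (v := v ∘ Sum.inl)
          (fun j => hA.real _) (fun j => hvr _)
          (fun j => hKb _) (fun j => hv1 (Sum.inl j)) (fun j => hv1 _) (by positivity)
          hwid β₀).neg.mono (C' := Z * Z ^ 31 * ε) (by
            have := hN.M1
            calc 16 * (4 / r) * (Z ^ 31 * ε) * M = (16 * (4 / r) * M) * (Z ^ 31 * ε) := by ring
              _ ≤ Z * (Z ^ 31 * ε) := by gcongr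
              _ = _ := by ring)
        rw [neg_sub] at h1
        simp only [Jm, hess, Matrix.sub_apply, Matrix.fromBlocks_apply₂₁, Matrix.neg_apply,
          Matrix.of_apply]
        rw [neg_sub_neg]
        exact h1
      · exact h0 _
  refine ⟨K + v, ⟨fun i => (hA.real i).add (hvr i), fun i => ?_, ?_, ?_, ?_, ?_⟩, fun i => ?_⟩
  · exact ((hKb i).add (hv1 i)).mono (by linarith)
  · rw [dK_add]
    exact (hA.dK_le.anti hs3).add hdv
  · exact (hA.Y_le.anti hs3).mono (by linarith)
  · rw [Err_add, hlin, add_neg_cancel_left]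
    have hRre : ZB ρ w (σ - 3 * δ) Z 42 (ε * ε) (R.map reF) := by
      refine ZB.of_entries (c := 2 * Z ^ 40) hσδ hZ (by positivity) ?_ fun i j => ?_
      · calc _ ≤ Z * (2 * Z ^ 40) := by gcongr
          _ ≤ Z * (Z * Z ^ 40) := by gcongr
          _ = _ := by ring
      · exact (((hRb.bd.entry i j).re hσ2.le).anti hs32).mono (le_of_eq (by ring))
    rw [pow_two]
    exact ((hRre.add hquad).up (by norm_num)).bd
  · rw [nErr_add]
    have he : ZB ρ 1 (σ - 3 * δ) Z 0 ε (nErr β₀ f η om K Y lam) :=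
      ⟨hσδ, hZ, hε0, by simpa using hA.nrm.anti hs3⟩
    have hYb := Approx.ZB_Y hR hN hσδ hk1 (hA.Y_le.anti hs3)
    exact ((he.sub (hJ.mul hYb)).up (by norm_num)).bd
  · rw [Pi.add_apply, add_sub_cancel_left]
    exact (hvw i).mono hle

lemma LamM_add (lam mu : κ ⊕ κ → X → ℂ) : LamM ι (lam + mu) = LamM ι lam + LamM ι mu := by
  rw [LamM, LamM, LamM, Matrix.diagonal_add]
  congr 1

set_option maxHeartbeats 2000000 in
open Matrix in
/-- One step of the Newton scheme for the normal frame. -/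
theorem Approx.exists_normal_step [PosRho ρ] [PosWt w] (hw : ∀ x, w x ≤ 1)
    (hR : Ref ρ Y0 Q1 Q2 Q3 c)
    (hN : Num r M c Z L δ) (hNR : NonRes ρ η om lam L δ) (hσδ : 0 < σ - 2 * δ)
    (hk : 16 * c ^ 8 * k ≤ 1) (hε : ε ≤ ε')
    (hA : Approx ρ w β₀ f η om Y0 σ k ε ε' K Y lam) :
    ∃ Y' lam', Approx ρ w β₀ f η om Y0 (σ - 2 * δ) (k + Z ^ 70 * ε') ε (Z ^ 70 * ε' ^ 2) K Y' lam' ∧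
      ∀ j, LipB ρ 1 (lam' j - lam j) (Z ^ 70 * ε') := by
  have hδ := hN.δ_pos
  have hZ := hN.two_le
  have hσ1 : 0 < σ - δ := by linarith
  have hσ : 0 < σ := by linarith
  have hs1 : σ - δ ≤ σ := by linarith
  have hs2 : σ - 2 * δ ≤ σ := by linarith
  have hs3 : σ - 2 * δ ≤ σ - δ := by linarith
  have hk0 := hA.dK_le.nonneg
  have hk1 := hR.le_one hk0 hk
  have hε0 := hA.nrm.nonneg
  obtain ⟨P1, P2, P3, U, S, hQ, hU, hU', hP1, hP3, hUb, -, -⟩ :=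
    hR.exists_frame hσ hN.two_le hN.c_le hk hA.dK_le hA.Y_le
  have hT1 := Approx.ZB_T1 hR hN hσ hk1 hA.dK_le
  have hYb := Approx.ZB_Y hR hN hσ hk1 hA.Y_le
  have hOm := ZB.of_ref hN hσ hR.Om_le
  have hT2 := ZB.of_ref hN hσ hR.T2_le
  have hX2 := (ZB.of_ref hN hσ hR.T10_le).neg
  have he : ZB ρ 1 σ Z 0 ε' (nErr β₀ f η om K Y lam) :=
    ⟨hσ, hN.two_le, hε0, by simpa using hA.nrm⟩
  have hRm := he.neg
  have hF := (ZB_dErr hR hN hσ1 (hA.err.mono hε)).weight hw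
  have hAA := Approx.ZB_A hR hN hNR hσδ hk1 hA.real hA.K_le hA.dK_le hF
  have hGG := Approx.ZB_G hR hN hNR hσδ hk1 hA.real hA.dK_le hA.Y_le hF he
  choose a1 ha1 ha10 using hNR.pos
  obtain ⟨y, hy, hyb⟩ := ((hT1.transpose.mul hOm).mul' hRm).exists_solution
    (κ := fun x => (((η x)⁻¹ : ℝ) : ℂ)) (v := om) (δ := δ) (L := L) (μ := fun _ j => lam j)
    hN.L_nonneg hN.L_le hσ1 fun l j => ⟨a1 j, ha1 j, fun x => Or.inr (ha10 j x)⟩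
  have hyeq : y.map (Dη η om) + y * LamM ι lam
      = (T1 K)ᵀ * Om ι κ X * -nErr β₀ f η om K Y lam := by
    ext1 i j
    rw [← hy i j, Matrix.add_apply, LamM, Matrix.mul_diagonal, mul_comm]
    rfl
  have hr1 := ((hP1.mul' hRm).anti hσ1 hs1).sub
    (((hP1.mul hX2).anti hσ1 hs1).mul' ((hUb.anti hσ1 hs1).mul' hyb))
  have hr3 := ((hP3.mul' hRm).anti hσ1 hs1).sub
    (((hP3.mul hX2).anti hσ1 hs1).mul' ((hUb.anti hσ1 hs1).mul' hyb))
  obtain ⟨w1, hw1, hw1b⟩ := (hr1.anti hσ1 le_rfl).exists_solution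
    (κ := fun x => (((η x)⁻¹ : ℝ) : ℂ)) (v := om) (δ := δ) (L := L) (μ := fun _ j => lam j)
    hN.L_nonneg hN.L_le (by linarith) fun l j => ⟨a1 j, ha1 j, fun x => Or.inr (ha10 j x)⟩
  -- the correction of the normal frequencies
  set B := P3 * -nErr β₀ f η om K Y lam - P3 * -T10 ι κ X * (U * y) with hB
  set Δ : κ ⊕ κ → X → ℂ := fun j => mean (B j j) with hΔ
  have hΔb : ∀ j, LipB ρ 1 (Δ j) (Z ^ 11 * ε') := fun j =>
    (hr3.bd.entry j j).lipB_mean hσ1.le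
  have hDel : ∀ σ', 0 < σ' → ZB ρ 1 σ' Z 12 ε' (LamM ι Δ) := fun σ' hσ' => by
    refine ZB.of_entries (c := Z ^ 11) hσ' hZ hε0 ?_ fun i j => ?_
    · have := hR.card_le hN (m := κ ⊕ κ) (n := κ ⊕ κ) card_normal_le card_normal_le
      calc _ ≤ Z * Z ^ 11 := by gcongr
        _ = _ := by ring
    · rw [LamM, Matrix.diagonal_apply]
      split_ifs
      · exact Bd.cst (by positivity) (hΔb i)
      · exact Bd.zero.mono (by positivity)
  choose a2 ha2 ha20 using hNR.diff
  obtain ⟨a0, ha0⟩ := hNR.zero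
  obtain ⟨w3, hw3, hw3b⟩ := (hr3.sub (hDel _ hσ1)).exists_solution
    (κ := fun x => (((η x)⁻¹ : ℝ) : ℂ)) (v := om) (δ := δ) (L := L) (μ := fun i j => lam j - lam i)
    hN.L_nonneg hN.L_le (by linarith) fun i j => by
      by_cases hij : i = j
      · subst hij
        refine ⟨a0, by simpa using ha0, fun x => Or.inl ?_⟩
        have h1 : mean ((B - LamM ι Δ) i i) = 0 := by
          rw [Matrix.sub_apply, Bd.mean_sub hσ1.le (hr3.bd.entry i i)
            ((hDel _ hσ1).bd.entry i i), LamM, Matrix.diagonal_apply_eq, mean_cst]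
          exact sub_self _
        exact congrFun h1 x
      · exact ⟨a2 i j hij, ha2 i j hij, fun x => Or.inr (ha20 i j hij x)⟩
  rw [show σ - δ - δ = σ - 2 * δ by ring] at hw1b hw3b
  have key := linear_identity (Dη η om) (Jm β₀ f (K ∘ Sum.inl)) (Om ι κ X) (Om_map _)
    (Jm_Om β₀ f _) (T1 K) (T2 ι κ X) Y P1 P2 P3 hQ _ (T1_map β₀ f η om hA.real) _
    (T2_map β₀ f η om _) (LamM ι lam) _ nErr_eq U hU hU' (-nErr β₀ f η om K Y lam) (LamM ι lam) y
    hyeq w1 (by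
      ext1 i j
      rw [← hw1 i j, Matrix.add_apply, LamM, Matrix.mul_diagonal, mul_comm]
      rfl) w3 (LamM ι Δ) (by
      ext1 i j
      rw [← hw3 i j, Matrix.add_apply, Matrix.sub_apply, LamM, Matrix.mul_diagonal,
        Matrix.diagonal_mul, cst_sub, Matrix.map_apply, Dη]
      ring)
  have hVb := ((((hT1.anti hσδ hs2).mul' hw1b).add ((hT2.anti hσδ hs2).mul'
      ((hUb.anti hσδ hs2).mul' (hyb.anti hσδ hs3)))).add
        ((hYb.anti hσδ hs2).mul' hw3b)).up (b := 30) (by norm_num)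
  have hrem := ZB_remainder (hT2.anti hσδ hs2) (hX2.anti hσδ hs2) (hOm.anti hσδ hs2)
      (hP1.anti hσδ hs2)
      (hP3.anti hσδ hs2) (hUb.anti hσδ hs2) (hF.anti hσδ hs3) (he.anti hσδ hs2) hAA hGG
      (hRm.anti hσδ hs2) ((hyb.anti hσδ hs3).up (by norm_num)) (hw1b.up (by norm_num))
      (hw3b.up (by norm_num))
  set V := T1 K * w1 + T2 ι κ X * (U * y) + Y * w3 with hV
  have hle : Z ^ 30 * ε' ≤ Z ^ 70 * ε' := pow_mul_le hZ hε0 (by norm_num)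
  have hZp : 0 ≤ Z ^ 70 * ε' := by positivity
  refine ⟨Y + V, lam + Δ, ⟨hA.real, fun i => ((hA.K_le i).anti hs2).mono (by linarith),
    (hA.dK_le.anti hs2).mono (by linarith), ?_, hA.err.anti hs2, ?_⟩, fun j => ?_⟩
  · rw [show Y + V - Y0 = Y - Y0 + V by abel]
    exact ((hA.Y_le.anti hs2).add hVb.bd).mono (by linarith)
  · have h1 : nErr β₀ f η om K (Y + V) (lam + Δ) = nErr β₀ f η om K Y lam
        + (V.map (Dη η om) - Jm β₀ f (K ∘ Sum.inl) * V + V * LamM ι lam) + Y * LamM ι Δ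
          + V * LamM ι Δ := by
      rw [nErr, nErr, LamM_add, map_add_derivation]
      simp only [Matrix.add_mul, Matrix.mul_add]
      abel
    have h2 : ∀ a b c d e g : Matrix (Ph ι κ) (κ ⊕ κ) (X → Sm ι),
        a + (-a - b + c + d + e) + b + g = c + d + e + g := fun a b c d e g => by abel
    rw [h1, key, h2, pow_two]
    exact ((hrem.add (hVb.mulE (hDel _ hσδ))).up (by norm_num)).bd
  · rw [Pi.add_apply, add_sub_cancel_left]
    exact (hΔb j).mono (pow_mul_le hZ hε0 (by norm_num))

end steps

section step

variable {ι κ X : Type*} [Fintype ι] [Fintype κ] [DecidableEq ι] [DecidableEq κ]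
variable {ρ : X → X → ℝ} {w : X → ℝ} {β₀ : κ → ℝ} {f : Sm (ι ⊕ κ)} {η : X → ℝ} {om : ι → ℝ}
variable {σ Z c k r M L δ ε ε' : ℝ}
variable {Y0 : Matrix (Ph ι κ) (κ ⊕ κ) (X → Sm ι)} {Q1 Q2 : Matrix ι (Ph ι κ) (X → Sm ι)}
  {Q3 : Matrix (κ ⊕ κ) (Ph ι κ) (X → Sm ι)}
variable {K : Ph ι κ → X → Sm ι} {Y : Matrix (Ph ι κ) (κ ⊕ κ) (X → Sm ι)} {lam : κ ⊕ κ → X → ℂ}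

/-- One step of the Newton scheme. -/
theorem Approx.exists_step [PosRho ρ] [PosWt w] (hw : ∀ x, w x ≤ 1) (hf : Pot f r M)
    (hR : Ref ρ Y0 Q1 Q2 Q3 c)
    (hN : Num r M c Z L δ) (hNR : NonRes ρ η om lam L δ) (hσδ : 0 < σ - 5 * δ)
    (hk : 16 * c ^ 8 * (k + Z ^ 210 * ε) ≤ 1) (hr : σ + 4 * k + 2 * (Z ^ 210 * ε) ≤ r / 2)
    (hε1 : ε ≤ 1) (hA : Approx ρ w β₀ f η om Y0 σ k ε ε K Y lam) :
    ∃ K' Y' lam', Approx ρ w β₀ f η om Y0 (σ - 5 * δ) (k + Z ^ 210 * ε) (Z ^ 210 * ε ^ 2)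
        (Z ^ 210 * ε ^ 2) K' Y' lam' ∧
      (∀ i, Bd ρ w (σ - 5 * δ) (K' i - K i) (Z ^ 210 * ε)) ∧
      ∀ j, LipB ρ 1 (lam' j - lam j) (Z ^ 210 * ε) := by
  have hδ := hN.δ_pos
  have hZ := hN.two_le
  have hε0 := hA.err.nonneg
  have hk0 := hA.dK_le.nonneg
  have hc := hR.one_le
  have hp : ∀ n : ℕ, 0 ≤ Z ^ n * ε := fun n => mul_nonneg (pow_nonneg (by linarith) n) hε0
  have hle : Z ^ 70 * ε ≤ Z ^ 210 * ε := pow_mul_le hZ hε0 (by norm_num)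
  have hle3 : Z ^ 141 * ε ≤ Z ^ 210 * ε := pow_mul_le hZ hε0 (by norm_num)
  have hle4 : Z ^ 70 * ε ≤ Z ^ 140 * ε := pow_mul_le hZ hε0 (by norm_num)
  have hsum : Z ^ 70 * ε + Z ^ 140 * ε ≤ Z ^ 210 * ε := by
    have e : Z ^ 141 * ε = Z * (Z ^ 140 * ε) := by rw [pow_succ' Z 140, mul_assoc]
    have h0 : 2 * (Z ^ 140 * ε) ≤ Z * (Z ^ 140 * ε) := mul_le_mul_of_nonneg_right hZ (hp 140)
    rw [← e] at h0
    linarith only [h0, hle3, hle4]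
  have hc8 : 0 ≤ 16 * c ^ 8 := by positivity
  have hmul : ∀ {a b : ℝ}, a ≤ b → 16 * c ^ 8 * b ≤ 1 → 16 * c ^ 8 * a ≤ 1 := fun h h' =>
    (mul_le_mul_of_nonneg_left h hc8).trans h'
  have hZ210 := hp 210
  obtain ⟨K', hA', hK'⟩ := hA.exists_torus_step hw hf hR hN hNR (by linarith)
    (hmul (by linarith) hk) (by linarith)
  have hεε : Z ^ 70 * ε ^ 2 ≤ Z ^ 70 * ε := by
    have : ε ^ 2 ≤ ε := by nlinarith only [hε0, hε1]
    exact mul_le_mul_of_nonneg_left this (pow_nonneg (by linarith) 70)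
  obtain ⟨Y', lam', hA'', hl⟩ := hA'.exists_normal_step hw hR hN hNR (by linarith)
    (hmul (by linarith) hk) hεε
  have e1 : Z ^ 70 * (Z ^ 70 * ε) = Z ^ 140 * ε := by
    rw [← mul_assoc, ← pow_add]
  have e2 : Z ^ 70 * (Z ^ 70 * ε) ^ 2 = Z ^ 210 * ε ^ 2 := by
    rw [mul_pow, ← mul_assoc, ← pow_mul, ← pow_add]
  rw [show σ - 3 * δ - 2 * δ = σ - 5 * δ by ring, e1, e2] at hA''
  have h5 : σ - 5 * δ ≤ σ - 3 * δ := by linarith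
  refine ⟨K', Y', lam', ⟨hA''.real, fun i => (hA''.K_le i).mono (by linarith),
    hA''.dK_le.mono (by linarith), hA''.Y_le.mono (by linarith),
    hA''.err.mono (pow_mul_le hZ (sq_nonneg ε) (by norm_num)), hA''.nrm⟩,
    fun i => ((hK' i).anti h5).mono hle, fun j => (hl j).mono ?_⟩
  rw [e1]; linarith [hp 70]

end step

/-! ### Small divisors -/

section divisors

variable {ι κ X : Type*} [Fintype ι] [Fintype κ] [DecidableEq κ]

/-- The distance `|x - y| / max x y` on the space of parameters. -/
noncomputable def relDist (η : X → ℝ) (x y : X) : ℝ := |η x - η y| / max (η x) (η y)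

lemma relDist_nonneg {η : X → ℝ} (hη : ∀ x, 0 < η x) (x y : X) : 0 ≤ relDist η x y :=
  div_nonneg (abs_nonneg _) ((hη x).le.trans (le_max_left _ _))

lemma relDist_mul_max {η : X → ℝ} (hη : ∀ x, 0 < η x) (x y : X) :
    relDist η x y * max (η x) (η y) = |η x - η y| :=
  div_mul_cancel₀ _ (ne_of_gt ((hη x).trans_le (le_max_left _ _)))

/-- The small denominators. -/
noncomputable def wt (ν : ι → ℤ) : ℝ := ∏ k, ((1 + |(ν k : ℝ)|) ^ 2)⁻¹

lemma wt_pos (ν : ι → ℤ) : 0 < wt ν := Finset.prod_pos fun k _ => by positivity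

lemma wt_le_one (ν : ι → ℤ) : wt ν ≤ 1 :=
  Finset.prod_le_one (fun k _ => by positivity) fun k _ => by
    apply inv_le_one_of_one_le₀
    have := abs_nonneg (ν k : ℝ)
    nlinarith

lemma wt_neg (ν : ι → ℤ) : wt (-ν) = wt ν := by simp [wt]

lemma inv_wt_le (ν : ι → ℤ) : (wt ν)⁻¹ ≤ (1 + l1 ν) ^ (2 * Fintype.card ι) := by
  rw [wt, Finset.prod_inv_distrib, inv_inv, pow_mul, ← Finset.card_univ, ← Finset.prod_const]
  refine Finset.prod_le_prod (fun k _ => by positivity) fun k _ => ?_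
  have := abs_le_l1 ν k
  have h0 := abs_nonneg (ν k : ℝ)
  gcongr

/-- Polynomials are dominated by exponentials. -/
lemma one_add_pow_le {δ : ℝ} (hδ : 0 < δ) (hδ1 : δ ≤ 1) {a : ℝ} (ha : 0 ≤ a) (m : ℕ) :
    (1 + a) ^ m ≤ (m.factorial * Real.exp 1 * δ⁻¹ ^ m) * Real.exp (δ * a) := by
  have h := pow_le_factorial_mul_exp (by linarith : 0 ≤ 1 + a) hδ m
  refine h.trans ?_
  have : Real.exp (δ * (1 + a)) ≤ Real.exp 1 * Real.exp (δ * a) := by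
    rw [← Real.exp_add]
    gcongr
    linarith
  calc _ ≤ m.factorial * δ⁻¹ ^ m * (Real.exp 1 * Real.exp (δ * a)) := by
        gcongr
    _ = _ := by ring

lemma LipB.inv_divisor {η : X → ℝ} (hη : ∀ x, 0 < η x) {μ : X → ℂ} {C d t : ℝ}
    (hC : 0 ≤ C) (hμ : ∀ x, ‖μ x‖ ≤ C) (hμ' : ∀ x y, ‖μ x - μ y‖ ≤ C * relDist η x y)
    (hd : 0 < d) (hd1 : d ≤ 1) (h : ∀ x, d ≤ |t * (η x)⁻¹ + (μ x).im|) :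
    LipB (relDist η) 1 (fun x => ((((η x)⁻¹ : ℝ) : ℂ) * (t * Complex.I) + μ x)⁻¹)
      (2 * (1 + 2 * C) * (d⁻¹) ^ 2) ∧
    ∀ x, (((η x)⁻¹ : ℝ) : ℂ) * (t * Complex.I) + μ x ≠ 0 := by
  set g : X → ℂ := fun x => (((η x)⁻¹ : ℝ) : ℂ) * (t * Complex.I) + μ x with hg
  have him : ∀ x, (g x).im = t * (η x)⁻¹ + (μ x).im := fun x => by
    simp only [hg, Complex.add_im, Complex.re_ofReal_mul, Complex.mul_im,
      Complex.I_im, Complex.I_re, Complex.ofReal_re, Complex.ofReal_im]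
    ring
  have hgd : ∀ x, d ≤ ‖g x‖ := fun x => by
    have := Complex.abs_im_le_norm (g x)
    rw [him] at this
    exact (h x).trans this
  have hg0 : ∀ x, 0 < ‖g x‖ := fun x => hd.trans_le (hgd x)
  have hd1' : 1 ≤ d⁻¹ := (one_le_inv₀ hd).mpr hd1
  have hinv : ∀ x, ‖g x‖⁻¹ ≤ d⁻¹ := fun x => inv_anti₀ hd (hgd x)
  refine ⟨⟨fun x => ?_, fun x y => ?_⟩, fun x hx => ?_⟩
  · rw [norm_inv]
    simp only [Pi.one_apply, mul_one]
    have := hinv x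
    nlinarith
  · have hρ := relDist_nonneg hη x y
    -- the key estimate, for an ordered pair
    have key : ∀ x y, η x ≤ η y → ‖g x - g y‖ ≤ (‖g x‖ + 2 * C) * relDist η x y := by
      intro x y hxy
      have hx := hη x
      have hy := hη y
      have h1 : |t| * (η x)⁻¹ ≤ ‖g x‖ + C := by
        have h2 := Complex.abs_im_le_norm (g x)
        have h3 := Complex.abs_im_le_norm (μ x)
        have h4 := hμ x
        rw [him] at h2
        have h5 : |t * (η x)⁻¹| = |t| * (η x)⁻¹ := by rw [abs_mul, abs_of_pos (inv_pos.mpr hx)]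
        have h6 : |t * (η x)⁻¹| ≤ |t * (η x)⁻¹ + (μ x).im| + |(μ x).im| := by
          have := abs_sub (t * (η x)⁻¹ + (μ x).im) (μ x).im
          simpa using this
        linarith
      have h2 : g x - g y = ((((η x)⁻¹ - (η y)⁻¹ : ℝ)) : ℂ) * (t * Complex.I) + (μ x - μ y) := by
        simp only [hg]; push_cast; ring
      have h3 : |(η x)⁻¹ - (η y)⁻¹| = (η x)⁻¹ * relDist η x y := by
        rw [relDist, max_eq_right hxy, inv_sub_inv hx.ne' hy.ne', abs_div, abs_of_pos (mul_pos hx hy),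
          abs_sub_comm]
        field_simp
      rw [h2]
      refine (norm_add_le _ _).trans ?_
      rw [norm_mul, norm_mul, Complex.norm_I, mul_one, Complex.norm_real, Complex.norm_real,
        Real.norm_eq_abs, Real.norm_eq_abs, h3]
      have h4 := hμ' x y
      have h5 := relDist_nonneg hη x y
      nlinarith
    have hsymm : relDist η y x = relDist η x y := by
      rw [relDist, relDist, abs_sub_comm, max_comm]
    have h1 : ‖g x - g y‖ ≤ (max ‖g x‖ ‖g y‖ + 2 * C) * relDist η x y := by
      rcases le_total (η x) (η y) with hxy | hxy
      · refine (key x y hxy).trans ?_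
        gcongr
        exact le_max_left _ _
      · have := key y x hxy
        rw [norm_sub_rev, hsymm] at this
        refine this.trans ?_
        gcongr
        exact le_max_right _ _
    have h2 : ‖(g x)⁻¹ - (g y)⁻¹‖ = ‖g x - g y‖ * (‖g x‖⁻¹ * ‖g y‖⁻¹) := by
      rw [inv_sub_inv (norm_pos_iff.mp (hg0 x)) (norm_pos_iff.mp (hg0 y)), norm_div, norm_mul,
        norm_sub_rev, div_eq_mul_inv, mul_inv]
    have h3 : max ‖g x‖ ‖g y‖ * (‖g x‖⁻¹ * ‖g y‖⁻¹) ≤ d⁻¹ := by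
      rcases le_total ‖g x‖ ‖g y‖ with hxy | hxy
      · rw [max_eq_right hxy, mul_comm ‖g x‖⁻¹, ← mul_assoc, mul_inv_cancel₀ (hg0 y).ne', one_mul]
        exact hinv x
      · rw [max_eq_left hxy, ← mul_assoc, mul_inv_cancel₀ (hg0 x).ne', one_mul]
        exact hinv y
    have h4 : ‖g x‖⁻¹ * ‖g y‖⁻¹ ≤ d⁻¹ ^ 2 := by
      rw [pow_two]
      exact mul_le_mul (hinv x) (hinv y) (inv_nonneg.mpr (norm_nonneg _)) (by positivity)
    simp only [Pi.one_apply, max_self, mul_one]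
    rw [h2]
    have h5 : 0 ≤ ‖g x‖⁻¹ * ‖g y‖⁻¹ := by positivity
    calc 2 * (‖g x - g y‖ * (‖g x‖⁻¹ * ‖g y‖⁻¹))
        ≤ 2 * ((max ‖g x‖ ‖g y‖ + 2 * C) * relDist η x y * (‖g x‖⁻¹ * ‖g y‖⁻¹)) := by gcongr
      _ = 2 * (max ‖g x‖ ‖g y‖ * (‖g x‖⁻¹ * ‖g y‖⁻¹) + 2 * C * (‖g x‖⁻¹ * ‖g y‖⁻¹))
          * relDist η x y := by ring
      _ ≤ 2 * (d⁻¹ + 2 * C * d⁻¹ ^ 2) * relDist η x y := by gcongr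
      _ ≤ 2 * (1 + 2 * C) * d⁻¹ ^ 2 * relDist η x y := by
        gcongr ?_ * _
        nlinarith
  · have := hg0 x
    simp only [hg] at this
    rw [hx, norm_zero] at this
    exact lt_irrefl _ this

variable {η : X → ℝ} {om : ι → ℝ}

/-- Divisors bounded below by multiples of `wt ν`. -/
lemma exists_isDiv (hη : ∀ x, 0 < η x) {μ : X → ℂ} {C γ δ : ℝ}
    (hC : 0 ≤ C) (hμ : ∀ x, ‖μ x‖ ≤ C) (hμ' : ∀ x y, ‖μ x - μ y‖ ≤ C * relDist η x y)
    (hγ : 0 < γ) (hγ1 : γ ≤ 1) (hδ : 0 < δ) (hδ1 : δ ≤ 1)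
    (h : ∀ ν x, γ * wt ν ≤ |dotZ ν om * (η x)⁻¹ + (μ x).im|) {m : ℕ}
    (hm : 4 * Fintype.card ι ≤ m) :
    ∃ a, IsDiv (relDist η) (fun x => (((η x)⁻¹ : ℝ) : ℂ)) om μ
      (2 * (1 + 2 * C) * γ⁻¹ ^ 2 * (m.factorial * Real.exp 1 * δ⁻¹ ^ m)) δ a ∧
      ∀ x, μ x * a 0 x = 1 := by
  have : PosRho (relDist η) := ⟨relDist_nonneg hη⟩
  have key := fun ν : ι → ℤ => LipB.inv_divisor hη (t := dotZ ν om) hC hμ hμ'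
    (mul_pos hγ (wt_pos ν)) (mul_le_one₀ hγ1 (wt_pos ν).le (wt_le_one ν)) (h ν)
  refine ⟨fun ν x => ((((η x)⁻¹ : ℝ) : ℂ) * (dotZ ν om * Complex.I) + μ x)⁻¹,
    ⟨fun ν => (key ν).1.mono ?_, fun ν x _ => mul_inv_cancel₀ ((key ν).2 x)⟩, fun x => ?_⟩
  · rw [mul_inv, mul_pow, mul_assoc _ _ (Real.exp _), ← mul_assoc (2 * (1 + 2 * C))]
    have h0 := l1_nonneg ν
    gcongr
    refine le_trans ?_ (one_add_pow_le hδ hδ1 h0 m)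
    calc (wt ν)⁻¹ ^ 2 ≤ ((1 + l1 ν) ^ (2 * Fintype.card ι)) ^ 2 := by
          have := inv_wt_le ν
          have := wt_pos ν
          gcongr
      _ = (1 + l1 ν) ^ (4 * Fintype.card ι) := by rw [← pow_mul]; ring_nf
      _ ≤ _ := pow_le_pow_right₀ (by linarith) hm
  · have := (key 0).2 x
    simp only [dotZ_zero_left, Complex.ofReal_zero, zero_mul, mul_zero, zero_add] at this ⊢
    exact mul_inv_cancel₀ this

lemma exists_isDiv_zero (hη : ∀ x, 0 < η x) (hη1 : ∀ x, η x ≤ 1) {C₀ τ δ : ℝ} (hC₀ : 0 < C₀)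
    (hdio : ∀ ν : ι → ℤ, ν ≠ 0 → C₀ * l1 ν ^ (-τ) ≤ |dotZ ν om|) (hδ : 0 < δ) (hδ1 : δ ≤ 1)
    {m : ℕ} (hm : τ ≤ m) :
    ∃ a, IsDiv (relDist η) (fun x => (((η x)⁻¹ : ℝ) : ℂ)) om 0
      (2 * C₀⁻¹ * (m.factorial * Real.exp 1 * δ⁻¹ ^ m)) δ a := by
  have : PosRho (relDist η) := ⟨relDist_nonneg hη⟩
  have hpos : ∀ ν : ι → ℤ, ν ≠ 0 → 0 < |dotZ ν om| := fun ν hν =>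
    lt_of_lt_of_le (mul_pos hC₀ (Real.rpow_pos_of_pos (zero_lt_one.trans_le (one_le_l1 hν)) _))
      (hdio ν hν)
  refine ⟨fun ν x => if ν = 0 then 0 else (((η x : ℝ)) : ℂ) * (dotZ ν om * Complex.I)⁻¹, ⟨fun ν => ?_,
    fun ν x hν => ?_⟩⟩
  · have h0 := l1_nonneg ν
    by_cases hν : ν = 0
    · simp only [hν, if_true]
      exact LipB.zero.mono (by positivity)
    · simp only [hν, if_false]
      have h1 := one_le_l1 hν
      have hinv : |dotZ ν om|⁻¹ ≤ C₀⁻¹ * (m.factorial * Real.exp 1 * δ⁻¹ ^ m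
          * Real.exp (δ * l1 ν)) := by
        calc |dotZ ν om|⁻¹ ≤ (C₀ * l1 ν ^ (-τ))⁻¹ :=
              inv_anti₀ (mul_pos hC₀ (Real.rpow_pos_of_pos (by linarith) _)) (hdio ν hν)
          _ = C₀⁻¹ * l1 ν ^ τ := by
              rw [mul_inv, Real.rpow_neg (by linarith), inv_inv]
          _ ≤ C₀⁻¹ * (1 + l1 ν) ^ m := by
              gcongr
              calc l1 ν ^ τ ≤ l1 ν ^ (m : ℝ) := Real.rpow_le_rpow_of_exponent_le h1 hm
                _ = l1 ν ^ m := Real.rpow_natCast _ _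
                _ ≤ _ := by gcongr; linarith
          _ ≤ _ := by
              gcongr
              exact one_add_pow_le hδ hδ1 h0 m
      refine LipB.mono (A := 2 * |dotZ ν om|⁻¹) ⟨fun x => ?_, fun x y => ?_⟩ (by nlinarith)
      · rw [norm_mul, norm_inv, norm_mul, Complex.norm_I, mul_one, Complex.norm_real,
          Complex.norm_real, Real.norm_eq_abs, Real.norm_eq_abs, abs_of_pos (hη x)]
        have := hη1 x
        have : 0 ≤ |dotZ ν om|⁻¹ := by positivity
        simp only [Pi.one_apply, mul_one]
        nlinarith
      · rw [← sub_mul, ← Complex.ofReal_sub, norm_mul, norm_inv, norm_mul, Complex.norm_I, mul_one,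
          Complex.norm_real, Complex.norm_real, Real.norm_eq_abs, Real.norm_eq_abs,
          ← relDist_mul_max hη]
        have h2 : max (η x) (η y) ≤ 1 := max_le (hη1 x) (hη1 y)
        have h3 : 0 ≤ |dotZ ν om|⁻¹ := by positivity
        have h4 := relDist_nonneg hη x y
        simp only [Pi.one_apply, max_self, mul_one]
        have h5 : relDist η x y * max (η x) (η y) ≤ relDist η x y := mul_le_of_le_one_right h4 h2
        nlinarith
  · simp only [hν, if_false, Pi.zero_apply, add_zero]
    have h1 : (dotZ ν om : ℂ) ≠ 0 := by
      exact_mod_cast abs_pos.mp (hpos ν hν)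
    have h2 : (η x : ℂ) ≠ 0 := by exact_mod_cast (hη x).ne'
    have h3 := Complex.I_ne_zero
    push_cast
    field_simp

/-- Nonresonance conditions imply bounds on the inverses of all divisors. -/
lemma nonRes_of {lam : κ ⊕ κ → X → ℂ} (hη : ∀ x, 0 < η x) (hη1 : ∀ x, η x ≤ 1) {C₀ τ δ C γ L : ℝ}
    (hC₀ : 0 < C₀) (hdio : ∀ ν : ι → ℤ, ν ≠ 0 → C₀ * l1 ν ^ (-τ) ≤ |dotZ ν om|)
    (hδ : 0 < δ) (hδ1 : δ ≤ 1) (hC : 0 ≤ C) (hlam : ∀ j x, ‖lam j x‖ ≤ C)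
    (hlam' : ∀ j x y, ‖lam j x - lam j y‖ ≤ C * relDist η x y) (hγ : 0 < γ) (hγ1 : γ ≤ 1)
    (h1 : ∀ j ν x, γ * wt ν ≤ |dotZ ν om * (η x)⁻¹ + (lam j x).im|)
    (h2 : ∀ i j, i ≠ j → ∀ ν x, γ * wt ν ≤ |dotZ ν om * (η x)⁻¹ + (lam j x - lam i x).im|)
    {m : ℕ} (hm : 4 * Fintype.card ι ≤ m) (hmτ : τ ≤ m)
    (hL : (2 * (1 + 4 * C) + 2 * C₀⁻¹) * γ⁻¹ ^ 2 * (m.factorial * Real.exp 1 * δ⁻¹ ^ m) ≤ L) :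
    NonRes (relDist η) η om lam L δ := by
  have : PosRho (relDist η) := ⟨relDist_nonneg hη⟩
  have hmon : ∀ {μ : X → ℂ} {L' : ℝ} {a : (ι → ℤ) → X → ℂ},
      IsDiv (relDist η) (fun x => (((η x)⁻¹ : ℝ) : ℂ)) om μ L' δ a → L' ≤ L →
      IsDiv (relDist η) (fun x => (((η x)⁻¹ : ℝ) : ℂ)) om μ L δ a := fun ha hl =>
    ⟨fun ν => (ha.lip ν).mono (mul_le_mul_of_nonneg_right hl (Real.exp_pos _).le), ha.inv⟩
  have hP : 0 ≤ (m.factorial * Real.exp 1 * δ⁻¹ ^ m) := by positivity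
  have hγ' : 1 ≤ γ⁻¹ ^ 2 := one_le_pow₀ ((one_le_inv₀ hγ).mpr hγ1)
  have hC0' : 0 ≤ C₀⁻¹ := by positivity
  have hl1 : 2 * (1 + 2 * C) * γ⁻¹ ^ 2 * (m.factorial * Real.exp 1 * δ⁻¹ ^ m) ≤ L := by
    refine le_trans ?_ hL
    gcongr
    linarith
  have hl2 : 2 * (1 + 2 * (2 * C)) * γ⁻¹ ^ 2 * (m.factorial * Real.exp 1 * δ⁻¹ ^ m) ≤ L := by
    refine le_trans ?_ hL
    gcongr
    linarith
  have hl0 : 2 * C₀⁻¹ * (m.factorial * Real.exp 1 * δ⁻¹ ^ m) ≤ L := by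
    refine le_trans (mul_le_mul_of_nonneg_right ?_ hP) hL
    calc 2 * C₀⁻¹ ≤ 2 * (1 + 4 * C) + 2 * C₀⁻¹ := by linarith
      _ ≤ _ := le_mul_of_one_le_right (by positivity) hγ'
  refine ⟨?_, fun j => ?_, fun j => ?_, fun i j hij => ?_⟩
  · obtain ⟨a, ha⟩ := exists_isDiv_zero hη hη1 hC₀ hdio hδ hδ1 hmτ
    exact ⟨a, hmon ha hl0⟩
  · obtain ⟨a, ha, h0⟩ := exists_isDiv hη hC (hlam j) (hlam' j) hγ hγ1 hδ hδ1 (h1 j) hm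
    exact ⟨a, hmon ha hl1, h0⟩
  · obtain ⟨a, ha, h0⟩ := exists_isDiv hη (μ := -lam j) hC (fun x => by simpa using hlam j x)
      (fun x y => by
        rw [Pi.neg_apply, Pi.neg_apply, neg_sub_neg, norm_sub_rev]; exact hlam' j x y)
      hγ hγ1 hδ hδ1 (fun ν x => by
        have := h1 j (-ν) x
        rw [wt_neg] at this
        refine this.trans (le_of_eq ?_)
        rw [← abs_neg]
        congr 1
        simp [dotZ]
        ring) hm
    exact ⟨a, hmon ha hl1, h0⟩
  · obtain ⟨a, ha, h0⟩ := exists_isDiv hη (μ := lam j - lam i) (C := 2 * C) (by linarith)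
      (fun x => (norm_sub_le _ _).trans (by linarith [hlam j x, hlam i x]))
      (fun x y => by
        have e : (lam j - lam i) x - (lam j - lam i) y
            = (lam j x - lam j y) - (lam i x - lam i y) := by simp; ring
        rw [e]
        refine (norm_sub_le _ _).trans ?_
        linarith [hlam' j x y, hlam' i x y])
      hγ hγ1 hδ hδ1 (h2 i j hij) hm
    exact ⟨a, hmon ha hl2, h0⟩

end divisors

section restriction

variable {ι κ X X' : Type*} [Fintype ι] [Fintype κ] [DecidableEq ι] [DecidableEq κ]
variable {m n p : Type*} [Fintype m] [Fintype n] [Fintype p]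

lemma Matrix_map_comp_mul (g : X' → X) (A : Matrix m n (X → Sm ι)) (B : Matrix n p (X → Sm ι)) :
    (A * B).map (· ∘ g) = A.map (· ∘ g) * B.map (· ∘ g) := by
  ext i j x : 3
  simp [Matrix.mul_apply, Finset.sum_apply]

variable {ρ : X → X → ℝ} {w : X → ℝ} {β₀ : κ → ℝ} {f : Sm (ι ⊕ κ)} {η : X → ℝ} {om : ι → ℝ}
variable {σ k ε ε' : ℝ} {Y0 : Matrix (Ph ι κ) (κ ⊕ κ) (X → Sm ι)}
variable {K : Ph ι κ → X → Sm ι} {Y : Matrix (Ph ι κ) (κ ⊕ κ) (X → Sm ι)} {lam : κ ⊕ κ → X → ℂ}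

lemma Jm_comap (g : X' → X) (u : ι ⊕ κ → X → Sm ι) :
    (Jm β₀ f u).map (· ∘ g) = Jm β₀ f fun i => u i ∘ g := by
  ext i j x : 3
  rcases i with i | i <;> rcases j with j | j
  · rfl
  · simp only [Jm, Matrix.map_apply, Matrix.fromBlocks_apply₁₂, Matrix.one_apply,
      Function.comp_apply]
    split_ifs <;> rfl
  · rfl
  · rfl

lemma nErr_comap (g : X' → X) : (nErr β₀ f η om K Y lam).map (· ∘ g)
    = nErr β₀ f (η ∘ g) om (fun i => K i ∘ g) (Y.map (· ∘ g)) fun j => lam j ∘ g := by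
  have h1 : ∀ A B : Matrix (Ph ι κ) (κ ⊕ κ) (X → Sm ι),
      (A + B).map (· ∘ g) = A.map (· ∘ g) + B.map (· ∘ g) := fun A B => rfl
  have h2 : ∀ A B : Matrix (Ph ι κ) (κ ⊕ κ) (X → Sm ι),
      (A - B).map (· ∘ g) = A.map (· ∘ g) - B.map (· ∘ g) := fun A B => rfl
  have h3 : (LamM ι lam).map (· ∘ g) = LamM ι fun j => lam j ∘ g := by
    ext i j x : 3
    simp only [LamM, Matrix.map_apply, Matrix.diagonal_apply, Function.comp_apply]
    split_ifs <;> rfl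
  rw [nErr, nErr, h1, h2, Matrix_map_comp_mul, Matrix_map_comp_mul, Jm_comap, h3]
  rfl

lemma Approx.comap (g : X' → X) (h : Approx ρ w β₀ f η om Y0 σ k ε ε' K Y lam) :
    Approx (fun a b => ρ (g a) (g b)) (w ∘ g) β₀ f (η ∘ g) om (Y0.map (· ∘ g)) σ k ε ε'
      (fun i => K i ∘ g) (Y.map (· ∘ g)) (fun j => lam j ∘ g) where
  real i x ψ := h.real i (g x) ψ
  K_le i := (h.K_le i).comap g
  dK_le := h.dK_le.comap g
  Y_le := h.Y_le.comap g
  err := by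
    have := h.err.comap g
    refine (show (Err β₀ f η om K).map (· ∘ g) = Err β₀ f (η ∘ g) om fun i => K i ∘ g from ?_) ▸ this
    ext i j x : 3
    rcases i with i | i <;> rfl
  nrm := nErr_comap (β₀ := β₀) (f := f) (η := η) (om := om) (K := K) (Y := Y) (lam := lam) g
    ▸ h.nrm.comap g

end restriction

section numerics

lemma pow_mul_inv_pow {Z : ℝ} (hZ : 0 < Z) (ε : ℝ) (N n : ℕ) :
    (Z ^ (n + 1)) ^ N * (ε * Z⁻¹ ^ ((N + 1) * n)) = ε * Z ^ N * Z⁻¹ ^ n := by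
  have h : Z ^ (n * N) * Z⁻¹ ^ (N * n) = 1 := by
    rw [mul_comm n N, ← mul_pow, mul_inv_cancel₀ hZ.ne', one_pow]
  calc (Z ^ (n + 1)) ^ N * (ε * Z⁻¹ ^ ((N + 1) * n))
      = (Z ^ (n * N) * Z⁻¹ ^ (N * n)) * (ε * Z ^ N * Z⁻¹ ^ n) := by
        rw [← pow_mul, add_mul, one_mul, pow_add, add_mul, one_mul, pow_add]; ring
    _ = _ := by rw [h, one_mul]

lemma pow_mul_sq_le {Z ε : ℝ} (hZ : 1 ≤ Z) (hε : 0 ≤ ε) (N n : ℕ) (h : ε * Z ^ (2 * N + 1) ≤ 1) :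
    (Z ^ (n + 1)) ^ N * (ε * Z⁻¹ ^ ((N + 1) * n)) ^ 2 ≤ ε * Z⁻¹ ^ ((N + 1) * (n + 1)) := by
  have hZ0 : 0 < Z := by linarith
  have hi : Z⁻¹ ≤ 1 := inv_le_one_of_one_le₀ hZ
  have h1 : Z⁻¹ ^ n ≤ 1 := pow_le_one₀ (by positivity) hi
  have h2 : Z ^ (N + 1) * Z⁻¹ ^ (N + 1) = 1 := by rw [← mul_pow, mul_inv_cancel₀ hZ0.ne', one_pow]
  have h3 : ε * Z ^ N * Z⁻¹ ^ n ≤ Z⁻¹ ^ (N + 1) := by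
    calc ε * Z ^ N * Z⁻¹ ^ n ≤ ε * Z ^ N * 1 := by gcongr
      _ = ε * Z ^ N * (Z ^ (N + 1) * Z⁻¹ ^ (N + 1)) := by rw [h2]
      _ = (ε * Z ^ (2 * N + 1)) * Z⁻¹ ^ (N + 1) := by ring
      _ ≤ 1 * Z⁻¹ ^ (N + 1) := by gcongr
      _ = _ := one_mul _
  calc _ = ((Z ^ (n + 1)) ^ N * (ε * Z⁻¹ ^ ((N + 1) * n))) * (ε * Z⁻¹ ^ ((N + 1) * n)) := by ring
    _ = (ε * Z ^ N * Z⁻¹ ^ n) * (ε * Z⁻¹ ^ ((N + 1) * n)) := by rw [pow_mul_inv_pow hZ0]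
    _ ≤ Z⁻¹ ^ (N + 1) * (ε * Z⁻¹ ^ ((N + 1) * n)) := by gcongr
    _ = _ := by rw [mul_add (N + 1) n 1, pow_add]; ring

lemma pow_mul_le_geom {Z ε k : ℝ} (hZ : 2 ≤ Z) (hε : 0 ≤ ε) (N n : ℕ) (h : ε * Z ^ N ≤ k / 2) :
    (Z ^ (n + 1)) ^ N * (ε * Z⁻¹ ^ ((N + 1) * n)) ≤ k / 2 * (1 / 2) ^ n := by
  have hZ0 : 0 < Z := by linarith
  rw [pow_mul_inv_pow hZ0]
  have : Z⁻¹ ≤ 1 / 2 := by rw [inv_eq_one_div]; exact one_div_le_one_div_of_le two_pos hZ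
  have h0 : 0 ≤ k / 2 := le_trans (by positivity) h
  gcongr

end numerics

section iteration

variable {ι κ : Type*} [Fintype ι] [Fintype κ] [DecidableEq ι] [DecidableEq κ]

/-- The numerical parameters of the iteration. -/
structure Par where
  (r M C₀ τ c Z σ k ε W ηb γ m₀ C : ℝ)
  m : ℕ

namespace Par

variable (P : Par)

/-- The loss of analyticity at the `n`-th step. -/
noncomputable def δn (n : ℕ) : ℝ := P.σ / 20 * (1 / 2) ^ n
/-- The width of analyticity at the `n`-th step. -/
noncomputable def σn (n : ℕ) : ℝ := P.σ / 2 + P.σ / 2 * (1 / 2) ^ n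
/-- The size of the solution at the `n`-th step. -/
noncomputable def kn (n : ℕ) : ℝ := P.k * (2 - (1 / 2) ^ n)
/-- The size of the error at the `n`-th step. -/
noncomputable def εn (n : ℕ) : ℝ := P.ε * P.Z⁻¹ ^ ((210 + 1) * n)
/-- The nonresonance constant at the `n`-th step. -/
noncomputable def γn (n : ℕ) : ℝ := P.γ * (1 / 2) ^ n

/-- The conditions on the parameters which make the iteration converge. -/
structure Ok (d : ℕ) : Prop where
  C₀_pos : 0 < P.C₀
  τ_le : P.τ ≤ P.m
  d_le : 4 * d ≤ P.m
  two_le : 2 ≤ P.Z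
  c_le : P.c ≤ P.Z
  M1 : 16 * (4 / P.r) * P.M ≤ P.Z
  M2 : 64 * (4 / P.r) ^ 2 * P.M ≤ P.Z
  σ_pos : 0 < P.σ
  σ_le : P.σ ≤ 20
  k_pos : 0 < P.k
  k_c : 32 * P.c ^ 8 * P.k ≤ 1
  k_r : P.σ + 10 * P.k ≤ P.r / 2
  k_m : P.k ≤ P.m₀ / 8
  k_C : P.k ≤ P.C
  one_le : 1 ≤ P.c
  W_pos : 0 < P.W
  W_le : P.W * P.ηb ^ 2 ≤ 1
  ηb_pos : 0 < P.ηb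
  ηb_le : P.ηb ≤ 1
  γ_pos : 0 < P.γ
  γ_le : P.γ ≤ 1
  γ_m : P.γ ≤ P.m₀ / 2
  δ_le : ∀ n, 2 * (P.δn n)⁻¹ ≤ P.Z ^ (n + 1)
  L_le : ∀ n, (2 * (1 + 4 * P.C) + 2 * P.C₀⁻¹) * (P.γn n)⁻¹ ^ 2
    * (P.m.factorial * Real.exp 1 * (P.δn n)⁻¹ ^ P.m) ≤ P.Z ^ (n + 1)
  ε_nonneg : 0 ≤ P.ε
  ε_le : P.ε * P.Z ^ (2 * 210 + 1) ≤ 1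
  ε_k : P.ε * P.Z ^ 210 ≤ P.k / 2

lemma σn_succ (n : ℕ) : P.σn (n + 1) = P.σn n - 5 * P.δn n := by
  simp only [σn, δn, pow_succ]; ring

lemma kn_succ (n : ℕ) : P.kn (n + 1) = P.kn n + P.k / 2 * (1 / 2) ^ n := by
  simp only [kn, pow_succ]; ring

variable {P} {d : ℕ}

lemma Ok.half_le_σn (hP : P.Ok d) (n : ℕ) : P.σ / 2 ≤ P.σn n := by
  have := hP.σ_pos
  have : 0 ≤ P.σ / 2 * (1 / 2) ^ n := by positivity
  simp only [σn]; linarith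

lemma Ok.σn_le (hP : P.Ok d) (n : ℕ) : P.σn n ≤ P.σ := by
  have := hP.σ_pos
  have h : ((1 : ℝ) / 2) ^ n ≤ 1 := pow_le_one₀ (by norm_num) (by norm_num)
  simp only [σn]; nlinarith

lemma Ok.kn_le (hP : P.Ok d) (n : ℕ) : P.kn n ≤ 2 * P.k := by
  have := hP.k_pos
  have h : (0 : ℝ) ≤ (1 / 2) ^ n := by positivity
  simp only [kn]; nlinarith

lemma Ok.εn_nonneg (hP : P.Ok d) (n : ℕ) : 0 ≤ P.εn n := by
  have := hP.ε_nonneg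
  have := hP.two_le
  unfold εn
  exact mul_nonneg (by assumption) (pow_nonneg (inv_nonneg.mpr (by linarith)) _)

lemma Ok.εn_le (hP : P.Ok d) (n : ℕ) : P.εn n ≤ P.ε * (1 / 2) ^ n := by
  have h0 := hP.ε_nonneg
  have := hP.two_le
  have h : P.Z⁻¹ ≤ 1 / 2 := by rw [inv_eq_one_div]; exact one_div_le_one_div_of_le two_pos this
  have h1 : 0 ≤ P.Z⁻¹ := inv_nonneg.mpr (by linarith)
  unfold εn
  refine mul_le_mul_of_nonneg_left ?_ h0
  calc P.Z⁻¹ ^ ((210 + 1) * n) ≤ P.Z⁻¹ ^ n :=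
        pow_le_pow_of_le_one h1 (by linarith) (by omega)
    _ ≤ _ := pow_le_pow_left₀ h1 h n

lemma Ok.ε_le_one (hP : P.Ok d) : P.ε ≤ 1 := by
  have h0 := hP.ε_nonneg
  have h1 : 1 ≤ P.Z ^ (2 * 210 + 1) := one_le_pow₀ (by linarith [hP.two_le])
  exact (le_mul_of_one_le_right h0 h1).trans hP.ε_le

lemma Ok.εn_le_one (hP : P.Ok d) (n : ℕ) : P.εn n ≤ 1 := by
  have h : ((1 : ℝ) / 2) ^ n ≤ 1 := pow_le_one₀ (by norm_num) (by norm_num)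
  have := hP.ε_nonneg
  have := hP.ε_le_one
  have := hP.εn_le n
  nlinarith

lemma Ok.gain_le (hP : P.Ok d) (n : ℕ) : (P.Z ^ (n + 1)) ^ 210 * P.εn n ≤ P.k / 2 * (1 / 2) ^ n :=
  pow_mul_le_geom hP.two_le hP.ε_nonneg 210 n hP.ε_k

lemma Ok.quad_le (hP : P.Ok d) (n : ℕ) : (P.Z ^ (n + 1)) ^ 210 * P.εn n ^ 2 ≤ P.εn (n + 1) :=
  pow_mul_sq_le (by linarith [hP.two_le]) hP.ε_nonneg 210 n hP.ε_le

lemma Ok.num (hP : P.Ok d) (n : ℕ) : Num P.r P.M P.c (P.Z ^ (n + 1)) (P.Z ^ (n + 1)) (P.δn n) := by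
  have hZ := hP.two_le
  have hZn : P.Z ≤ P.Z ^ (n + 1) := le_self_pow₀ (by linarith) (by omega)
  have hσ := hP.σ_pos
  exact ⟨hZ.trans hZn, hP.c_le.trans hZn, by positivity, le_rfl, by unfold δn; positivity,
    hP.δ_le n, hP.M1.trans hZn, hP.M2.trans hZn⟩

end Par

variable (P : Par)

/-- The weight `W η²`. -/
def wP (G : Set ℝ) (x : G) : ℝ := P.W * x.1 ^ 2

/-- A constant matrix as a matrix of families. -/
def cm {m n : Type*} (X : Type*) (ι : Type*) [Fintype ι] (y : Matrix m n ℂ) :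
    Matrix m n (X → Sm ι) := y.map fun z _ => algebraMap ℂ (Sm ι) z

/-- The state of the iteration. -/
structure St (ι κ : Type*) [Fintype ι] where
  G : Set ℝ
  K : Ph ι κ → ℝ → Sm ι
  Y : Matrix (Ph ι κ) (κ ⊕ κ) (ℝ → Sm ι)
  lam : κ ⊕ κ → ℝ → ℂ

variable (β₀ : κ → ℝ) (f : Sm (ι ⊕ κ)) (om : ι → ℝ) (y0 : Matrix (Ph ι κ) (κ ⊕ κ) ℂ)
  (q1 q2 : Matrix ι (Ph ι κ) ℂ) (q3 : Matrix (κ ⊕ κ) (Ph ι κ) ℂ) (lam0 : κ ⊕ κ → ℂ)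

/-- The conditions satisfied after `n` steps. -/
structure Good (n : ℕ) (S : St ι κ) : Prop where
  sub : S.G ⊆ Set.Ioo 0 P.ηb
  approx : Approx (relDist (Subtype.val : S.G → ℝ)) (wP P S.G) β₀ f Subtype.val om (cm S.G ι y0)
    (P.σn n) (P.kn n) (P.εn n) (P.εn n) (fun i x => S.K i x) (S.Y.map fun F x => F x)
    (fun j x => S.lam j x)
  lam : ∀ j, LipB (relDist (Subtype.val : S.G → ℝ)) 1 (fun x => S.lam j x - lam0 j) (P.kn n)

/-- The nonresonant parameters. -/
def nrSet (n : ℕ) (S : St ι κ) : Set ℝ := {x ∈ S.G | ∀ ν : ι → ℤ, ν ≠ 0 →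
  (∀ j, P.γn n * wt ν ≤ |dotZ ν om * x⁻¹ + (S.lam j x).im|) ∧
  ∀ i j, i ≠ j → P.γn n * wt ν ≤ |dotZ ν om * x⁻¹ + (S.lam j x - S.lam i x).im|}

/-- The hypotheses on the unperturbed system. -/
structure Hyp : Prop where
  pot : Pot f P.r P.M
  dio : ∀ ν : ι → ℤ, ν ≠ 0 → P.C₀ * l1 ν ^ (-P.τ) ≤ |dotZ ν om|
  ref : ∀ G : Set ℝ, G ⊆ Set.Ioo 0 P.ηb → Ref (relDist (Subtype.val : G → ℝ)) (cm G ι y0)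
    (cm G ι q1) (cm G ι q2) (cm G ι q3) P.c
  lam_le : ∀ j, ‖lam0 j‖ + P.k ≤ P.C
  lam_ge : ∀ j, P.m₀ ≤ |(lam0 j).im|
  sub_ge : ∀ i j, i ≠ j → P.m₀ ≤ |(lam0 j - lam0 i).im|

variable {P β₀ f om y0 q1 q2 q3 lam0}

lemma wt_zero : wt (0 : ι → ℤ) = 1 := by simp [wt]

lemma dotZ_zero (v : ι → ℝ) : dotZ (0 : ι → ℤ) v = 0 := by simp [dotZ]

instance relDist_posRho {G : Set ℝ} [h : Fact (G ⊆ Set.Ioi 0)] :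
    PosRho (relDist (Subtype.val : G → ℝ)) := ⟨relDist_nonneg fun x => h.out x.2⟩

lemma Good.nonRes (hP : P.Ok (Fintype.card ι)) (hH : Hyp P f om y0 q1 q2 q3 lam0) {n : ℕ}
    {S : St ι κ} (hS : Good P β₀ f om y0 lam0 n S) :
    NonRes (relDist (Subtype.val : nrSet P om n S → ℝ)) Subtype.val om (fun j x => S.lam j x)
      (P.Z ^ (n + 1)) (P.δn n) := by
  have hsub : nrSet P om n S ⊆ S.G := fun x hx => hx.1
  have h2 : ((1 : ℝ) / 2) ^ n ≤ 1 := pow_le_one₀ (by norm_num) (by norm_num)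
  have h20 : (0 : ℝ) < (1 / 2) ^ n := by positivity
  have hγ := hP.γ_pos
  have hγm := hP.γ_m
  have hkm := hP.k_m
  have hσ := hP.σ_pos
  have hkk := hP.kn_le n
  have hγn : P.γn n ≤ P.γ := by unfold Par.γn; nlinarith
  have hb : ∀ j x, x ∈ S.G → ‖S.lam j x - lam0 j‖ ≤ P.k := fun j x hx => by
    have := (hS.lam j).1 ⟨x, hx⟩
    simp only [Pi.one_apply, mul_one] at this
    linarith
  have him : ∀ j x, x ∈ S.G → |(S.lam j x).im - (lam0 j).im| ≤ P.k := fun j x hx =>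
    (Complex.abs_im_le_norm (S.lam j x - lam0 j)).trans (hb j x hx)
  refine nonRes_of (C := P.C) (γ := P.γn n) (m := P.m) (fun x => (hS.sub (hsub x.2)).1)
    (fun x => (hS.sub (hsub x.2)).2.le.trans hP.ηb_le) hP.C₀_pos hH.dio
    (by unfold Par.δn; positivity) ?_ (hP.k_pos.le.trans hP.k_C) (fun j x => ?_)
    (fun j x y => ?_) (by unfold Par.γn; positivity) (hγn.trans hP.γ_le) (fun j ν x => ?_)
    (fun i j hij ν x => ?_) hP.d_le hP.τ_le (hP.L_le n)
  · have := hP.σ_le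
    unfold Par.δn; nlinarith
  · have h1 := hb j x (hsub x.2)
    have h2 := norm_add_le (S.lam j x - lam0 j) (lam0 j)
    rw [sub_add_cancel] at h2
    linarith [hH.lam_le j]
  · have h1 := (hS.lam j).2 ⟨x, hsub x.2⟩ ⟨y, hsub y.2⟩
    simp only [Pi.one_apply, max_self, mul_one, sub_sub_sub_cancel_right] at h1
    have h3 : 0 ≤ relDist (Subtype.val : S.G → ℝ) ⟨x, hsub x.2⟩ ⟨y, hsub y.2⟩ :=
      relDist_nonneg (fun x => (hS.sub x.2).1) _ _
    have h4 : relDist (Subtype.val : S.G → ℝ) ⟨x, hsub x.2⟩ ⟨y, hsub y.2⟩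
      = relDist (Subtype.val : nrSet P om n S → ℝ) x y := rfl
    rw [h4] at h1 h3
    have := hP.k_C
    nlinarith
  · by_cases hν : ν = 0
    · subst hν
      rw [wt_zero, mul_one, dotZ_zero, zero_mul, zero_add]
      have h1 := him j x (hsub x.2)
      have h3 := hH.lam_ge j
      have h4 := abs_sub_abs_le_abs_sub (lam0 j).im (S.lam j x).im
      rw [abs_sub_comm] at h4
      linarith
    · exact (x.2.2 ν hν).1 j
  · by_cases hν : ν = 0
    · subst hν
      rw [wt_zero, mul_one, dotZ_zero, zero_mul, zero_add]
      have h1 := him j x (hsub x.2)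
      have h1' := him i x (hsub x.2)
      have h3 := hH.sub_ge i j hij
      have h4 := abs_sub_abs_le_abs_sub (lam0 j - lam0 i).im (S.lam j x - S.lam i x).im
      have h5 : (lam0 j - lam0 i).im - (S.lam j x - S.lam i x).im
          = ((S.lam i x).im - (lam0 i).im) - ((S.lam j x).im - (lam0 j).im) := by
        simp; ring
      have h6 := abs_sub ((S.lam i x).im - (lam0 i).im) ((S.lam j x).im - (lam0 j).im)
      rw [h5] at h4
      linarith
    · exact (x.2.2 ν hν).2 i j hij

/-- Extension of a family by zero. -/
noncomputable def ext0 {E : Type*} [Zero E] (G : Set ℝ) (F : G → E) (x : ℝ) : E :=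
  open Classical in if h : x ∈ G then F ⟨x, h⟩ else 0

lemma ext0_coe {E : Type*} [Zero E] (G : Set ℝ) (F : G → E) (x : G) : ext0 G F x = F x := by
  simp [ext0]

lemma Good.exists_succ (hP : P.Ok (Fintype.card ι)) (hH : Hyp P f om y0 q1 q2 q3 lam0) {n : ℕ}
    {S : St ι κ} (hS : Good P β₀ f om y0 lam0 n S) :
    ∃ S' : St ι κ, Good P β₀ f om y0 lam0 (n + 1) S' ∧ S'.G = nrSet P om n S ∧
      ∀ i, Bd (relDist (Subtype.val : S'.G → ℝ)) (wP P S'.G) (P.σn (n + 1))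
        (fun x => S'.K i x - S.K i x) (P.k / 2 * (1 / 2) ^ n) := by
  have hsub : nrSet P om n S ⊆ S.G := fun x hx => hx.1
  have hsub' := hsub.trans hS.sub
  have hF : Fact (nrSet P om n S ⊆ Set.Ioi 0) := ⟨fun x hx => (hsub' hx).1⟩
  have hW := hP.W_pos
  have hPW : PosWt (wP P (nrSet P om n S)) := ⟨fun x => by unfold wP; positivity⟩
  have hw : ∀ x, wP P (nrSet P om n S) x ≤ 1 := fun x => by
    refine le_trans ?_ hP.W_le
    have h1 := (hsub' x.2).1
    have h2 := (hsub' x.2).2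
    unfold wP
    gcongr
  have hA := hS.approx.comap (Set.inclusion hsub)
  have hσ := hP.half_le_σn (n + 1)
  rw [P.σn_succ] at hσ
  have hg := hP.gain_le n
  have h2 : ((1 : ℝ) / 2) ^ n ≤ 1 := pow_le_one₀ (by norm_num) (by norm_num)
  have hkn := hP.kn_le (n + 1)
  rw [P.kn_succ] at hkn
  have hknn := hP.kn_le n
  have hk0 := hP.k_pos
  have hkle : P.kn n + (P.Z ^ (n + 1)) ^ 210 * P.εn n ≤ 2 * P.k := by linarith
  have hgk : (P.Z ^ (n + 1)) ^ 210 * P.εn n ≤ P.k := by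
    refine hg.trans ?_
    nlinarith only [hk0, h2]
  have hc := hP.one_le
  obtain ⟨K', Y', lam', h1, h3, h4⟩ := hA.exists_step (Q1 := cm _ ι q1) (Q2 := cm _ ι q2)
    (Q3 := cm _ ι q3) hw hH.pot (hH.ref _ hsub') (hP.num n)
    (hS.nonRes hP hH) (by have := hP.σ_pos; linarith only [this, hσ])
    (by
      have := hP.k_c
      calc 16 * P.c ^ 8 * (P.kn n + (P.Z ^ (n + 1)) ^ 210 * P.εn n)
          ≤ 16 * P.c ^ 8 * (2 * P.k) := mul_le_mul_of_nonneg_left hkle (by positivity)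
        _ = 32 * P.c ^ 8 * P.k := by ring
        _ ≤ 1 := this)
    (by linarith only [hP.k_r, hP.σn_le n, hknn, hgk]) (hP.εn_le_one n)
  rw [← P.σn_succ] at h1 h3
  refine ⟨⟨nrSet P om n S, fun i => ext0 _ (K' i), fun i j => ext0 _ (Y' i j),
    fun j => ext0 _ (lam' j)⟩, ⟨hsub', ?_, fun j => ?_⟩, rfl, fun i => ?_⟩
  · have e1 : (fun (i : Ph ι κ) (x : nrSet P om n S) => ext0 _ (K' i) (x : ℝ)) = K' := by
      funext i x; exact ext0_coe _ _ x
    have e2 : Matrix.map (fun i j => ext0 _ (Y' i j) : Matrix (Ph ι κ) (κ ⊕ κ) (ℝ → Sm ι))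
        (fun F (x : nrSet P om n S) => F x) = Y' := by
      ext1 i j; funext x; exact ext0_coe _ _ x
    have e3 : (fun (j : κ ⊕ κ) (x : nrSet P om n S) => ext0 _ (lam' j) (x : ℝ)) = lam' := by
      funext i x; exact ext0_coe _ _ x
    simp only
    rw [e1, e2, e3]
    have hle : P.kn n + (P.Z ^ (n + 1)) ^ 210 * P.εn n ≤ P.kn (n + 1) := by
      rw [P.kn_succ]; linarith only [hg]
    exact ⟨h1.real, fun i => (h1.K_le i).mono hle, h1.dK_le.mono hle, h1.Y_le.mono hle,
      h1.err.mono (hP.quad_le n), h1.nrm.mono (hP.quad_le n)⟩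
  · have e : (fun x : nrSet P om n S => ext0 _ (lam' j) (x : ℝ) - lam0 j)
        = (lam' j - fun x : nrSet P om n S => S.lam j x) + fun x : nrSet P om n S => S.lam j x - lam0 j := by
      funext x; simp [ext0_coe]
    simp only
    rw [e, P.kn_succ, add_comm (P.kn n)]
    refine ((h4 j).mono hg).add ?_
    exact ⟨fun x => (hS.lam j).1 ⟨x, hsub x.2⟩,
      fun x y => (hS.lam j).2 ⟨x, hsub x.2⟩ ⟨y, hsub y.2⟩⟩
  · refine (Bd.mono ?_ hg)
    refine (h3 i).congr fun x ψ => ?_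
    simp [ext0_coe]

end iteration

section limit

variable {ι κ : Type*} [Fintype ι] [Fintype κ] [DecidableEq ι] [DecidableEq κ]
variable {P : Par} {β₀ : κ → ℝ} {f : Sm (ι ⊕ κ)} {om : ι → ℝ} {y0 : Matrix (Ph ι κ) (κ ⊕ κ) ℂ}
  {q1 q2 : Matrix ι (Ph ι κ) ℂ} {q3 : Matrix (κ ⊕ κ) (Ph ι κ) ℂ} {lam0 : κ ⊕ κ → ℂ}

lemma Good.exists_seq (hP : P.Ok (Fintype.card ι)) (hH : Hyp P f om y0 q1 q2 q3 lam0)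
    {S0 : St ι κ} (h0 : Good P β₀ f om y0 lam0 0 S0) :
    ∃ S : ℕ → St ι κ, S 0 = S0 ∧ ∀ n, Good P β₀ f om y0 lam0 n (S n) ∧
      (S (n + 1)).G = nrSet P om n (S n) ∧
      ∀ i, Bd (relDist (Subtype.val : (S (n + 1)).G → ℝ)) (wP P (S (n + 1)).G) (P.σn (n + 1))
        (fun x => (S (n + 1)).K i x - (S n).K i x) (P.k / 2 * (1 / 2) ^ n) := by
  let step : ∀ n, {S // Good P β₀ f om y0 lam0 n S} → {S // Good P β₀ f om y0 lam0 (n + 1) S} :=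
    fun n S => ⟨(S.2.exists_succ hP hH).choose, (S.2.exists_succ hP hH).choose_spec.1⟩
  let seq : ∀ n, {S // Good P β₀ f om y0 lam0 n S} := fun n => Nat.rec ⟨S0, h0⟩ step n
  exact ⟨fun n => (seq n).1, rfl, fun n => ⟨(seq n).2, ((seq n).2.exists_succ hP hH).choose_spec.2⟩⟩

lemma norm_dd_le {X : Type*} {ρ : X → X → ℝ} [PosRho ρ] {σ C : ℝ} (hσ : 0 < σ) {F : X → Sm ι}
    (hF : Bd ρ 1 σ F C) (v : ι → ℝ) (x : X) (ψ : ι → ℝ) :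
    ‖(dd v (F x)).1 ψ‖ ≤ (1 + ‖v‖) * (4 * σ⁻¹) * C := by
  have hpos : 0 < 1 + ‖v‖ := by positivity
  have hv : ‖(1 + ‖v‖)⁻¹ • v‖ ≤ 1 := by
    rw [norm_smul, norm_inv, Real.norm_of_nonneg hpos.le, inv_mul_le_iff₀ hpos]
    linarith
  have h1 := (Bd.pd (δ := σ / 2) (by linarith) (by linarith) hF hv).norm_le (by linarith) x ψ
    zero_le_one
  have h2 : (RD 1 ((1 + ‖v‖)⁻¹ • v) F x).1 ψ = ((1 + ‖v‖)⁻¹ : ℝ) * (dd v (F x)).1 ψ := by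
    simp [dd_val]
  rw [h2, norm_mul, Complex.norm_real, norm_inv, Real.norm_of_nonneg hpos.le] at h1
  have h3 : ‖(dd v (F x)).1 ψ‖ = (1 + ‖v‖) * ((1 + ‖v‖)⁻¹ * ‖(dd v (F x)).1 ψ‖) := by
    field_simp
  rw [h3, mul_assoc]
  refine mul_le_mul_of_nonneg_left ?_ hpos.le
  have hC := hF.nonneg
  simp only [Pi.one_apply, mul_one] at h1
  have h4 : (σ / 2)⁻¹ = 2 * σ⁻¹ := by field_simp
  rw [h4] at h1
  have : 0 ≤ σ⁻¹ * C := by positivity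
  linarith

theorem exists_torus (hP : P.Ok (Fintype.card ι)) (hH : Hyp P f om y0 q1 q2 q3 lam0)
    {S0 : St ι κ} (h0 : Good P β₀ f om y0 lam0 0 S0) :
    ∃ S : ℕ → St ι κ, S 0 = S0 ∧ (∀ n, Good P β₀ f om y0 lam0 n (S n)) ∧
      (∀ n, (S (n + 1)).G = nrSet P om n (S n)) ∧
      ∃ K : Ph ι κ → (⋂ n, (S n).G : Set ℝ) → Sm ι, (∀ i, IsReal (K i)) ∧
        (∀ i, Bd (relDist Subtype.val) (wP P (⋂ n, (S n).G)) (P.σ / 2)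
          (fun x => K i x - S0.K i x) P.k) ∧
        Err β₀ f Subtype.val om K = 0 := by
  obtain ⟨S, hS0, hS⟩ := Good.exists_seq hP hH h0
  have hsub : ∀ n, (⋂ n, (S n).G) ⊆ (S n).G := fun n => Set.iInter_subset _ n
  have hGs : (⋂ n, (S n).G) ⊆ Set.Ioo 0 P.ηb := (hsub 0).trans (hS 0).1.sub
  have hF : Fact ((⋂ n, (S n).G) ⊆ Set.Ioi 0) := ⟨fun x hx => (hGs hx).1⟩
  have hW := hP.W_pos
  have hPW : PosWt (wP P (⋂ n, (S n).G)) := ⟨fun x => by unfold wP; positivity⟩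
  have hw : ∀ x, wP P (⋂ n, (S n).G) x ≤ 1 := fun x => by
    refine le_trans ?_ hP.W_le
    have h1 := (hGs x.2).1
    have h2 := (hGs x.2).2
    unfold wP
    gcongr
  have hσ : 0 < P.σ / 2 := by linarith [hP.σ_pos]
  have hD : ∀ i n, Bd (relDist Subtype.val) (wP P (⋂ n, (S n).G)) (P.σ / 2)
      (fun x => (S (n + 1)).K i x - (S n).K i x) (P.k / 2 * (1 / 2) ^ n) := fun i n =>
    (((hS n).2.2 i).comap (Set.inclusion (hsub (n + 1)))).anti (hP.half_le_σn _)
  have hsum : ∀ n, HasSum (fun k => P.k / 2 * (1 / 2 : ℝ) ^ (k + n)) (P.k * (1 / 2) ^ n) := fun n => by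
    have := hasSum_geometric_two.mul_left (P.k / 2 * (1 / 2) ^ n)
    have e : (fun k => P.k / 2 * (1 / 2 : ℝ) ^ (k + n))
        = fun k => P.k / 2 * (1 / 2) ^ n * (1 / 2 : ℝ) ^ k := by funext k; rw [pow_add]; ring
    rw [e, show P.k * (1 / 2 : ℝ) ^ n = P.k / 2 * (1 / 2) ^ n * 2 by ring]
    exact this
  have h1 : ∀ i, ∃ T : (⋂ n, (S n).G : Set ℝ) → Sm ι,
      ∀ (x : (⋂ n, (S n).G : Set ℝ)) ψ, HasSum (fun n => ((S (n + 1)).K i x - (S n).K i x).1 ψ) ((T x).1 ψ) := fun i =>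
    (Bd.tsum hσ (hD i) (by simpa using (hsum 0).summable)).imp fun T hT => hT.2
  choose T hT using h1
  set K : Ph ι κ → (⋂ n, (S n).G : Set ℝ) → Sm ι := fun i x => S0.K i x + T i x with hK
  have hR : ∀ i n, Bd (relDist Subtype.val) (wP P (⋂ n, (S n).G)) (P.σ / 2)
      (fun x => K i x - (S n).K i x) (P.k * (1 / 2) ^ n) := fun i n => by
    rw [← (hsum n).tsum_eq]
    refine Bd.of_hasSum hσ (fun k => hD i (k + n)) (hsum n).summable fun x ψ => ?_
    have h2 := (hasSum_nat_add_iff' n).mpr (hT i x ψ)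
    have h3 : ∑ k ∈ Finset.range n, ((S (k + 1)).K i x - (S k).K i x).1 ψ
        = ((S n).K i x).1 ψ - (S0.K i x).1 ψ := by
      simp only [Sm.sub_val]
      rw [Finset.sum_range_sub (fun k => ((S k).K i x).1 ψ), hS0]
    rw [h3] at h2
    have e : (T i x).1 ψ - (((S n).K i x).1 ψ - (S0.K i x).1 ψ)
        = (S0.K i x + T i x - (S n).K i x).1 ψ := by
      simp only [Sm.sub_val, Sm.add_val]; ring
    rw [e] at h2
    exact h2
  have hR1 : ∀ i n, Bd (relDist Subtype.val) 1 (P.σ / 2)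
      (fun x : (⋂ n, (S n).G : Set ℝ) => K i x - (S n).K i x) (P.k * (1 / 2) ^ n) :=
    fun i n => (hR i n).weight hw
  have hz : Tendsto (fun n => P.k * (1 / 2 : ℝ) ^ n) atTop (nhds 0) := by
    simpa using (tendsto_pow_atTop_nhds_zero_of_lt_one (by norm_num : (0 : ℝ) ≤ 1 / 2)
      (by norm_num)).const_mul P.k
  have hlim : ∀ i (x : (⋂ n, (S n).G : Set ℝ)) ψ, Tendsto (fun n => ((S n).K i x).1 ψ) atTop (nhds ((K i x).1 ψ)) := by
    intro i x ψ
    rw [tendsto_iff_norm_sub_tendsto_zero]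
    refine squeeze_zero (fun _ => norm_nonneg _) (fun n => ?_) hz
    have := (hR1 i n).norm_le hσ.le x ψ zero_le_one
    have h0 := norm_nonneg ((K i x - (S n).K i x).1 ψ)
    rw [Pi.one_apply, mul_one] at this
    rw [norm_sub_rev]
    rw [Sm.sub_val] at this h0
    linarith
  have hlimd : ∀ i (x : (⋂ n, (S n).G : Set ℝ)) ψ, Tendsto (fun n => (dd om ((S n).K i x)).1 ψ) atTop
      (nhds ((dd om (K i x)).1 ψ)) := by
    intro i x ψ
    rw [tendsto_iff_norm_sub_tendsto_zero]
    have hz' := hz.const_mul ((1 + ‖om‖) * (4 * (P.σ / 2)⁻¹))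
    rw [mul_zero] at hz'
    refine squeeze_zero (fun _ => norm_nonneg _) (fun n => ?_) hz'
    have := norm_dd_le hσ (hR1 i n) om x ψ
    rw [norm_sub_rev]
    rwa [map_sub] at this
  have hreal : ∀ i, IsReal (K i) := fun i x ψ => by
    refine tendsto_nhds_unique ((Complex.continuous_im.tendsto _).comp (hlim i x ψ)) ?_
    refine tendsto_const_nhds.congr fun n => ?_
    exact ((hS n).1.approx.real i ⟨x, hsub n x.2⟩ ψ).symm
  refine ⟨S, hS0, fun n => (hS n).1, fun n => (hS n).2.1, K, hreal, fun i => ?_, ?_⟩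
  · have := hR i 0
    rw [hS0, pow_zero, mul_one] at this
    exact this
  · ext i u x ψ
    have herr : Tendsto (fun n => (Err β₀ f Subtype.val om (fun i (x : (S n).G) => (S n).K i x) i u
        ⟨x, hsub n x.2⟩).1 ψ) atTop (nhds 0) := by
      rw [tendsto_zero_iff_norm_tendsto_zero]
      have hz' : Tendsto (fun n => P.ε * (1 / 2 : ℝ) ^ n) atTop (nhds 0) := by
        simpa using (tendsto_pow_atTop_nhds_zero_of_lt_one (by norm_num : (0 : ℝ) ≤ 1 / 2)
          (by norm_num)).const_mul P.ε
      refine squeeze_zero (fun _ => norm_nonneg _) (fun n => ?_) hz'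
      have hx := hw x
      have hw0 : 0 ≤ wP P (S n).G ⟨x, hsub n x.2⟩ := by unfold wP; positivity
      have h1 := (((hS n).1.approx.err.entry i u).norm_le
        (hσ.le.trans (hP.half_le_σn n)) ⟨x, hsub n x.2⟩ ψ hw0)
      have h2 := hP.εn_le n
      have h3 := hP.εn_nonneg n
      have h4 : P.εn n * wP P (S n).G ⟨x, hsub n x.2⟩ ≤ P.εn n * 1 :=
        mul_le_mul_of_nonneg_left hx h3
      have h5 := norm_nonneg ((Err β₀ f Subtype.val om (fun i (x : (S n).G) => (S n).K i x) i u
        ⟨x, hsub n x.2⟩).1 ψ)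
      linarith
    refine tendsto_nhds_unique ?_ herr
    rcases i with i | i
    · exact ((hlimd (Sum.inl i) x ψ).const_mul _).sub (hlim (Sum.inr i) x ψ)
    · refine ((hlimd (Sum.inr i) x ψ).const_mul _).add ?_
      have hq : Tendsto (fun n => qpt β₀ ((fun i (x : (S n).G) => (S n).K i x) ∘ Sum.inl)
          ⟨x, hsub n x.2⟩ ψ) atTop (nhds (qpt β₀ (K ∘ Sum.inl) x ψ)) := by
        rw [tendsto_pi_nhds]
        intro j
        exact tendsto_const_nhds.add
          ((Complex.continuous_re.tendsto _).comp (hlim (Sum.inl j) x ψ))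
      exact ((Sm.contDiff (dd (Pi.single i 1) f)).continuous.tendsto _).comp hq

end limit

section initial

variable {ι κ X : Type*} [Fintype ι] [Fintype κ] [DecidableEq ι] [DecidableEq κ]

/-- The Wiener norm of a single function is at most `C`. -/
def Wn (σ : ℝ) (h : Sm ι) (C : ℝ) : Prop := Bd (relDist fun _ : Unit => (1 : ℝ)) 1 σ (fun _ => h) C

instance posRho_unit : PosRho (relDist fun _ : Unit => (1 : ℝ)) :=
  ⟨relDist_nonneg fun _ => one_pos⟩

lemma Wn.bd {ρ : X → X → ℝ} [PosRho ρ] {σ C : ℝ} {h : Sm ι} (H : Wn σ h C) :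
    Bd ρ 1 σ (fun _ : X => h) C := by
  obtain ⟨c, m, hm, hC⟩ := H
  refine ⟨fun ν _ => c ν (), m, ⟨hm.nonneg, fun ν => ⟨fun x => (hm.lip ν).1 (), fun x y => ?_⟩,
    fun x ψ => hm.rep () ψ, hm.summable⟩, hC⟩
  have := PosRho.nonneg (ρ := ρ) x y
  have := hm.nonneg ν
  simp only [sub_self, norm_zero, mul_zero, Pi.one_apply, max_self, mul_one]
  positivity

lemma Wn.exists_solution {om : ι → ℝ} {C₀ τ : ℝ} (hC₀ : 0 < C₀)
    (hdio : ∀ ν : ι → ℤ, ν ≠ 0 → C₀ * l1 ν ^ (-τ) ≤ |dotZ ν om|) {σ δ C : ℝ} (hδ : 0 < δ)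
    (hσδ : 0 < σ - δ) {h : Sm ι} (H : Wn σ h C) (h0 : coef h.1 0 = 0) :
    ∃ y : Sm ι, ∃ C', dd om y = h ∧ Wn (σ - δ) y C' ∧ coef y.1 0 = 0 := by
  have hδ1 : 0 < min δ 1 := lt_min hδ one_pos
  obtain ⟨m, hm⟩ := exists_nat_ge τ
  obtain ⟨a, ha⟩ := exists_isDiv_zero (η := fun _ : Unit => (1 : ℝ)) (om := om) (fun _ => one_pos)
    (fun _ => le_rfl) hC₀ hdio hδ1 (min_le_right _ _) hm
  have hmin := min_le_left δ 1
  obtain ⟨y, hy, hyb⟩ := KAM.exists_solution (by positivity) (by linarith)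
    (by linarith : 0 < σ - min δ 1) ha H (fun _ => Or.inl h0)
  have hyb' := hyb.anti (by linarith : σ - δ ≤ σ - min δ 1)
  have hmn := hyb'.mean (σ' := σ - δ) hσδ.le
  refine ⟨y () - (cst (mean y) : Unit → Sm ι) (), _, ?_, (hyb'.sub hmn).congr fun x ψ => rfl, ?_⟩
  · rw [map_sub]
    have h1 := congrFun hy ()
    have h2 := congrFun (RD_cst (1 : Unit → ℂ) om (mean y) (ι := ι)) ()
    simp only [RD_apply, Pi.one_apply, one_smul, Pi.zero_apply] at h2
    rw [h2, sub_zero]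
    simpa [cst_zero] using h1
  · have := congrFun (hyb'.mean_sub hσδ.le hmn) ()
    rw [mean_cst, sub_self] at this
    exact this

lemma Wn.re {σ C : ℝ} {h : Sm ι} (hσ : 0 ≤ σ) (H : Wn σ h C) : Wn σ (reS h) (2 * C) := Bd.re hσ H

lemma dd_reS (v : ι → ℝ) (h : Sm ι) : dd v (reS h) = reS (dd v h) := by
  have := congrFun (reF_RD (fun _ : Unit => (1 : ℝ)) v fun _ => h) ()
  simpa [RD_apply, reF] using this.symm

lemma reS_eq {h : Sm ι} (hr : ∀ ψ, (h.1 ψ).im = 0) : reS h = h :=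
  congrFun (reF_of_real (X := Unit) (F := fun _ => h) fun _ ψ => hr ψ) ()

lemma exists_forall_le {α : Type*} [Fintype α] {Q : α → ℝ → Prop}
    (hQ : ∀ a C C', Q a C → C ≤ C' → Q a C') (h : ∀ a, ∃ C, Q a C) : ∃ C, 0 ≤ C ∧ ∀ a, Q a C := by
  choose C hC using h
  refine ⟨∑ a, |C a|, Finset.sum_nonneg fun _ _ => abs_nonneg _, fun a => hQ a _ _ (hC a) ?_⟩
  exact (le_abs_self _).trans
    (Finset.single_le_sum (f := fun a => |C a|) (fun _ _ => abs_nonneg _) (Finset.mem_univ a))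

variable {G : Set ℝ} {ηb W : ℝ}

lemma LipB.eta (hG : G ⊆ Set.Ioo 0 ηb) :
    LipB (relDist (Subtype.val : G → ℝ)) 1 (fun x => ((x.1 : ℝ) : ℂ)) (2 * ηb) := by
  have hpos : ∀ x : G, 0 < x.1 := fun x => (hG x.2).1
  refine ⟨fun x => ?_, fun x y => ?_⟩
  · rw [Complex.norm_real, Real.norm_of_nonneg (hpos x).le, Pi.one_apply, mul_one]
    linarith [(hG x.2).2]
  · rw [← Complex.ofReal_sub, Complex.norm_real, Real.norm_eq_abs, ← relDist_mul_max hpos]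
    have h1 : max (x : ℝ) y ≤ ηb := max_le (hG x.2).2.le (hG y.2).2.le
    have h2 := relDist_nonneg hpos x y
    simp only [Pi.one_apply, max_self, mul_one]
    nlinarith

lemma abs_sq_sub_sq_le (hG : G ⊆ Set.Ioo 0 ηb) (x y : G) :
    |x.1 ^ 2 - y.1 ^ 2| ≤ 2 * max x.1 y.1 ^ 2 * relDist (Subtype.val : G → ℝ) x y := by
  have hpos : ∀ x : G, 0 < x.1 := fun x => (hG x.2).1
  have hx := hpos x
  have hy := hpos y
  have h1 : |x.1 ^ 2 - y.1 ^ 2| = |x.1 - y.1| * (x.1 + y.1) := by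
    rw [show x.1 ^ 2 - y.1 ^ 2 = (x.1 - y.1) * (x.1 + y.1) by ring, abs_mul,
      abs_of_pos (by linarith : 0 < x.1 + y.1)]
  have h2 := relDist_nonneg hpos x y
  have h3 : x.1 + y.1 ≤ 2 * max x.1 y.1 := by
    linarith [le_max_left x.1 y.1, le_max_right x.1 y.1]
  have h4 : 0 < max x.1 y.1 := lt_of_lt_of_le hx (le_max_left _ _)
  rw [h1, ← relDist_mul_max hpos]
  calc relDist Subtype.val x y * max x.1 y.1 * (x.1 + y.1)
      ≤ relDist Subtype.val x y * max x.1 y.1 * (2 * max x.1 y.1) := by gcongr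
    _ = _ := by ring

lemma LipB.eta_sq (hG : G ⊆ Set.Ioo 0 ηb) (hη : ηb ≤ 1) :
    LipB (relDist (Subtype.val : G → ℝ)) 1 (fun x => ((x.1 ^ 2 : ℝ) : ℂ)) (4 * ηb) := by
  have hpos : ∀ x : G, 0 < x.1 := fun x => (hG x.2).1
  refine ⟨fun x => ?_, fun x y => ?_⟩
  · rw [Complex.norm_real, Real.norm_of_nonneg (by positivity), Pi.one_apply, mul_one]
    nlinarith [(hG x.2).2, hpos x]
  · rw [← Complex.ofReal_sub, Complex.norm_real, Real.norm_eq_abs]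
    have h1 : max (x : ℝ) y ≤ ηb := max_le (hG x.2).2.le (hG y.2).2.le
    have h2 := relDist_nonneg hpos x y
    have h3 := abs_sq_sub_sq_le hG x y
    have h4 : 0 < max x.1 y.1 := lt_of_lt_of_le (hpos x) (le_max_left _ _)
    have h5 : max x.1 y.1 ^ 2 ≤ ηb := by nlinarith
    have h6 : 2 * max x.1 y.1 ^ 2 * relDist (Subtype.val : G → ℝ) x y
      ≤ 2 * ηb * relDist (Subtype.val : G → ℝ) x y := by gcongr
    simp only [Pi.one_apply, max_self, mul_one]
    linarith

lemma LipB.eta_sq_weight (hG : G ⊆ Set.Ioo 0 ηb) (hW : 0 < W) :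
    LipB (relDist (Subtype.val : G → ℝ)) (fun x => W * x.1 ^ 2) (fun x => ((x.1 ^ 2 : ℝ) : ℂ))
      (4 / W) := by
  have hpos : ∀ x : G, 0 < x.1 := fun x => (hG x.2).1
  refine ⟨fun x => ?_, fun x y => ?_⟩
  · rw [Complex.norm_real, Real.norm_of_nonneg (by positivity)]
    have : 4 / W * (W * x.1 ^ 2) = 4 * x.1 ^ 2 := by field_simp
    rw [this]
    nlinarith [hpos x]
  · rw [← Complex.ofReal_sub, Complex.norm_real, Real.norm_eq_abs]
    have h2 := relDist_nonneg hpos x y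
    have h3 := abs_sq_sub_sq_le hG x y
    have h4 : W * max x.1 y.1 ^ 2 ≤ max (W * x.1 ^ 2) (W * y.1 ^ 2) := by
      rcases max_choice x.1 y.1 with h | h <;> rw [h]
      · exact le_max_left _ _
      · exact le_max_right _ _
    calc 2 * |x.1 ^ 2 - y.1 ^ 2|
        ≤ 4 / W * (W * max x.1 y.1 ^ 2) * relDist (Subtype.val : G → ℝ) x y := by
          rw [show 4 / W * (W * max x.1 y.1 ^ 2) = 4 * max x.1 y.1 ^ 2 by field_simp]; linarith
      _ ≤ _ := by gcongr

/-- A function on the torus `β = β₀`. -/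
noncomputable def atβ (β₀ : κ → ℝ) (φ : Sm (ι ⊕ κ)) : Sm ι :=
  comp β₀ φ (0 : ι ⊕ κ → Unit → Sm ι) ()

lemma comp_zero (β₀ : κ → ℝ) (φ : Sm (ι ⊕ κ)) :
    comp β₀ φ (0 : ι ⊕ κ → X → Sm ι) = fun _ => atβ β₀ φ := rfl

lemma Wn.atβ {r M : ℝ} (hr : 0 < r) {φ : Sm (ι ⊕ κ)} {φh : (ι ⊕ κ → ℤ) → ℂ} (hφ : FS r M φ φh)
    (β₀ : κ → ℝ) : Wn r (atβ β₀ φ) (4 * M) :=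
  Bd.comp (C := 0) hr hφ (fun _ _ _ => rfl) (fun _ => Bd.zero) (by linarith) β₀

variable {β₀ : κ → ℝ} {f : Sm (ι ⊕ κ)} {om : ι → ℝ} {r M : ℝ}

/-- The mean over `α` of the matrix of the linearized equations. -/
noncomputable def J0 (β₀ : κ → ℝ) (f : Sm (ι ⊕ κ)) : Matrix (Ph ι κ) (Ph ι κ) ℂ :=
  Matrix.fromBlocks 0 1
    (-Matrix.of fun i j => coef (atβ β₀ (dd (Pi.single j 1) (dd (Pi.single i 1) f))).1 0) 0

/-- The first approximation to the angles and momenta. -/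
lemma exists_initial_torus (hf : Pot f r M) {C₀ τ : ℝ} (hC₀ : 0 < C₀)
    (hdio : ∀ ν : ι → ℤ, ν ≠ 0 → C₀ * l1 ν ^ (-τ) ≤ |dotZ ν om|)
    (hmean : ∀ i, coef (atβ β₀ (dd (Pi.single i 1) f)).1 0 = 0) :
    ∃ (u p : ι ⊕ κ → Sm ι) (C : ℝ), 0 ≤ C ∧ (∀ i, dd om (u i) = p i) ∧
      (∀ i, dd om (p i) = -atβ β₀ (dd (Pi.single i 1) f)) ∧ (∀ i ψ, ((u i).1 ψ).im = 0) ∧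
      (∀ i ψ, ((p i).1 ψ).im = 0) ∧ (∀ i, Wn (r / 4) (u i) C) ∧ ∀ i, Wn (r / 4) (p i) C := by
  have hr := hf.pos
  have h1 : ∀ i, ∃ (u p : Sm ι) (C : ℝ), dd om u = p ∧
      dd om p = -atβ β₀ (dd (Pi.single i 1) f) ∧ (∀ ψ, (u.1 ψ).im = 0) ∧
      (∀ ψ, (p.1 ψ).im = 0) ∧ Wn (r / 4) u C ∧ Wn (r / 4) p C := fun i => by
    obtain ⟨φh, hφ⟩ := hf.fs1 i
    have hg : Wn r (-atβ β₀ (dd (Pi.single i 1) f)) (4 * M) := (Wn.atβ hr hφ β₀).neg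
    obtain ⟨p, C, hp, hpb, hp0⟩ := hg.exists_solution hC₀ hdio (by linarith : 0 < r / 2)
      (by linarith) (by
        have := coef_neg (atβ β₀ (dd (Pi.single i 1) f)).1 0
        rw [hmean i, neg_zero] at this
        exact this)
    obtain ⟨u, C', hu, hub, -⟩ := hpb.exists_solution hC₀ hdio (by linarith : 0 < r / 4)
      (by linarith) hp0
    rw [show r - r / 2 - r / 4 = r / 4 by ring] at hub
    have hreal : ∀ ψ, ((-atβ β₀ (dd (Pi.single i 1) f)).1 ψ).im = 0 := fun ψ => by
      rw [Sm.neg_val, Complex.neg_im]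
      exact neg_eq_zero.mpr (dd_im hf.real _ _)
    refine ⟨reS u, reS p, max (2 * C') (2 * C), by rw [dd_reS, hu], by
      rw [dd_reS, hp, reS_eq hreal], fun ψ => by simp, fun ψ => by simp,
      (hub.re (by linarith)).mono (le_max_left _ _),
      ((hpb.re (by linarith)).anti (by linarith)).mono (le_max_right _ _)⟩
  choose u p C hu hp hur hpr hub hpb using h1
  refine ⟨u, p, ∑ i, C i, Finset.sum_nonneg fun i _ => (hub i).nonneg, hu, hp, hur, hpr,
    fun i => (hub i).mono ?_, fun i => (hpb i).mono ?_⟩ <;>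
  exact Finset.single_le_sum (f := C) (fun i _ => (hub i).nonneg) (Finset.mem_univ i)

/-- The averaging transformation of the linearized equations. -/
lemma exists_initial_frame (hf : Pot f r M) {C₀ τ : ℝ} (hC₀ : 0 < C₀)
    (hdio : ∀ ν : ι → ℤ, ν ≠ 0 → C₀ * l1 ν ^ (-τ) ≤ |dotZ ν om|) :
    ∃ (S : Matrix (Ph ι κ) (Ph ι κ) (Sm ι)) (C : ℝ), 0 ≤ C ∧
      (∀ i j, dd om (S i j) = Jm β₀ f (0 : ι ⊕ κ → Unit → Sm ι) i j ()
        - algebraMap ℂ (Sm ι) (J0 β₀ f i j)) ∧ (∀ i j, Wn (r / 4) (S i j) C) := by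
  have hr := hf.pos
  have h1 : ∀ ij : Ph ι κ × Ph ι κ, ∃ (S : Sm ι) (C : ℝ),
      dd om S = Jm β₀ f (0 : ι ⊕ κ → Unit → Sm ι) ij.1 ij.2 ()
        - algebraMap ℂ (Sm ι) (J0 β₀ f ij.1 ij.2) ∧ Wn (r / 4) S C := by
    rintro ⟨i, j⟩
    have hzero : ∀ h : Sm ι, h = 0 → ∃ (S : Sm ι) (C : ℝ), dd om S = h ∧ Wn (r / 4) S C :=
      fun h hh => ⟨0, 0, by rw [hh, map_zero], Bd.zero⟩
    rcases i with i | i <;> rcases j with j | j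
    · exact hzero _ (by simp [Jm, J0])
    · refine hzero _ ?_
      simp only [Jm, J0, Matrix.fromBlocks_apply₁₂, Matrix.one_apply]
      split_ifs <;> simp
    · obtain ⟨φh, hφ⟩ := hf.fs2 i j
      set h := atβ β₀ (dd (Pi.single j 1) (dd (Pi.single i 1) f)) with hh
      have hg : Wn r h (4 * M) := Wn.atβ hr hφ β₀
      have hmn := Bd.mean (σ' := r) hr.le hg
      have hz := congrFun (Bd.mean_sub hr.le hg hmn) ()
      rw [mean_cst, sub_self] at hz
      have hgm : Wn r (-(h - (cst (mean fun _ : Unit => h) : Unit → Sm ι) ())) (4 * M + 4 * M) :=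
        (hg.sub hmn).neg
      obtain ⟨S, C, hS, hSb, -⟩ := hgm.exists_solution hC₀ hdio (by linarith : 0 < 3 * r / 4)
        (by linarith) (by
          have := coef_neg (h.1 - ((cst (mean fun _ : Unit => h) : Unit → Sm ι) ()).1) 0
          rw [show coef (h.1 - ((cst (mean fun _ : Unit => h) : Unit → Sm ι) ()).1) 0 = 0 from hz,
            neg_zero] at this
          exact this)
      rw [show r - 3 * r / 4 = r / 4 by ring] at hSb
      refine ⟨S, C, ?_, hSb⟩
      rw [hS]
      simp only [Jm, J0, Matrix.fromBlocks_apply₂₁, Matrix.neg_apply, Matrix.of_apply, hess,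
        map_neg, comp_zero, ← hh]
      rw [Pi.neg_apply, neg_sub_neg, neg_sub]
      rfl
    · exact hzero _ (by simp [Jm, J0])
  choose S C hS hSb using h1
  refine ⟨Matrix.of fun i j => S (i, j), ∑ ij, C ij, Finset.sum_nonneg fun i _ => (hSb i).nonneg,
    fun i j => hS (i, j), fun i j => (hSb (i, j)).mono ?_⟩
  exact Finset.single_le_sum (f := C) (fun i _ => (hSb i).nonneg) (Finset.mem_univ (i, j))

end initial

section initialApprox

variable {ι κ X : Type*} [Fintype ι] [Fintype κ] [DecidableEq ι] [DecidableEq κ]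
variable {β₀ : κ → ℝ} {f : Sm (ι ⊕ κ)} {om : ι → ℝ} {r M : ℝ}

lemma Bd.smul_unit {ρ : X → X → ℝ} [PosRho ρ] {w : X → ℝ} [PosWt w] {a : X → ℂ} {A : ℝ}
    (hA : 0 ≤ A) (ha : LipB ρ w a A) {σ C : ℝ} (hσ : 0 ≤ σ) {h : Sm ι} (H : Wn σ h C) :
    Bd ρ w σ (fun x => a x • h) (A * C) :=
  ((Bd.cst (σ := σ) (ι := ι) hA ha).mul hσ (H.bd (ρ := ρ))).congr fun x ψ => by simp [KAM.cst]

lemma Wn.pd {σ δ C : ℝ} {h : Sm ι} (hδ : 0 < δ) (hσδ : 0 < σ - δ) (H : Wn σ h C) (k : ι) :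
    Wn (σ - δ) (dd (Pi.single k 1) h) (2 * δ⁻¹ * C) :=
  (Bd.pd hδ hσδ H (norm_single_le k)).congr fun x ψ => by simp

lemma MBd.cm {ρ : X → X → ℝ} [PosRho ρ] {m n : Type*} [Fintype m] [Fintype n] (y : Matrix m n ℂ)
    (σ : ℝ) : MBd ρ 1 σ (cm X ι y) (∑ i, ∑ j, 2 * ‖y i j‖) :=
  ⟨fun i j => 2 * ‖y i j‖, fun i j => Bd.const (y i j), le_rfl⟩

/-- The unperturbed torus, corrected to first order. -/
noncomputable def initK (u p : ι ⊕ κ → Sm ι) (i : Ph ι κ) (x : ℝ) : Sm ι :=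
  Sum.elim (fun i => ((x ^ 2 : ℝ) : ℂ) • u i) (fun i => (x : ℂ) • p i) i

lemma Jm_comp_sub {ρ : X → X → ℝ} [PosRho ρ] (hf : Pot f r M) {σ C : ℝ} (hσ : 0 < σ)
    {u : ι ⊕ κ → X → Sm ι} (hur : ∀ i, IsReal (u i)) (hu : ∀ i, Bd ρ 1 σ (u i) C) (hC : 0 ≤ C)
    (hr : σ + 2 * C ≤ r / 2) :
    MBd ρ 1 σ (Jm β₀ f u - Jm β₀ f (0 : ι ⊕ κ → X → Sm ι))
      (Fintype.card (Ph ι κ) * Fintype.card (Ph ι κ) * (16 * (4 / r) * C * M)) := by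
  have hr0 := hf.pos
  obtain ⟨_, h0⟩ := hf.fs
  have hM := h0.nonneg
  have hz : ∀ F : X → Sm ι, F = 0 → Bd ρ 1 σ F (16 * (4 / r) * C * M) := fun F hF => by
    rw [hF]; exact Bd.zero.mono (by positivity)
  refine MBd.of_entries fun i j => ?_
  rcases i with i | i <;> rcases j with j | j
  · exact hz _ (by simp [Jm])
  · exact hz _ (by simp [Jm])
  · obtain ⟨φh, hφ⟩ := hf.fs2 i j
    have := Bd.comp_sub (u := 0) (v := u) (C := 0) hσ hr0 hφ (fun _ => isReal_zero) hur
      (fun _ => Bd.zero) hu hu hC (by linarith) β₀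
    rw [zero_add] at this
    refine this.neg.congr fun x ψ => ?_
    simp only [Jm, hess, Matrix.sub_apply, Matrix.fromBlocks_apply₂₁, Matrix.neg_apply,
      Matrix.of_apply, Pi.sub_apply, Pi.neg_apply, Sm.sub_val, Sm.neg_val]
    ring
  · exact hz _ (by simp [Jm])

lemma Jm_zero_le {ρ : X → X → ℝ} [PosRho ρ] (hf : Pot f r M) {σ : ℝ} (hσ : σ ≤ r) :
    MBd ρ 1 σ (Jm β₀ f (0 : ι ⊕ κ → X → Sm ι))
      (Fintype.card (Ph ι κ) * Fintype.card (Ph ι κ) * (2 + 4 * M)) := by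
  obtain ⟨_, h0⟩ := hf.fs
  have hM := h0.nonneg
  refine MBd.of_entries fun i j => ?_
  rcases i with i | i <;> rcases j with j | j
  · exact (Bd.zero (w := 1)).mono (by positivity)
  · exact (Bd.ite (i = j)).mono (by linarith)
  · obtain ⟨φh, hφ⟩ := hf.fs2 i j
    exact (((Wn.atβ hf.pos hφ β₀).bd (ρ := ρ)).anti hσ).neg.mono (by linarith)
  · exact (Bd.zero (w := 1)).mono (by positivity)

lemma LamM_le {ρ : X → X → ℝ} [PosRho ρ] (lam : κ ⊕ κ → ℂ) (σ : ℝ) :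
    MBd ρ 1 σ (LamM ι fun j (_ : X) => lam j) (∑ i, ∑ j : κ ⊕ κ, if i = j then 2 * ‖lam i‖ else 0) := by
  refine ⟨fun i j => if i = j then 2 * ‖lam i‖ else 0, fun i j => ?_, le_rfl⟩
  by_cases h : i = j
  · subst h
    rw [LamM, Matrix.diagonal_apply_eq]
    simp only [if_true]
    exact Bd.const (lam i)
  · simpa [LamM, h] using Bd.zero (ρ := ρ) (w := 1) (σ := σ) (ι := ι)

/-- The error of the averaged frame. -/
lemma nErr_averaged {η : X → ℝ} (hη : ∀ x, η x ≠ 0) {u : Ph ι κ → X → Sm ι}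
    {S : Matrix (Ph ι κ) (Ph ι κ) (Sm ι)} {y0 : Matrix (Ph ι κ) (κ ⊕ κ) ℂ} {lam0 : κ ⊕ κ → ℂ}
    (hy : J0 β₀ f * y0 = y0 * Matrix.diagonal lam0)
    (hS : ∀ i j, dd om (S i j) = Jm β₀ f (0 : ι ⊕ κ → Unit → Sm ι) i j ()
        - algebraMap ℂ (Sm ι) (J0 β₀ f i j)) {SE Jz : Matrix (Ph ι κ) (Ph ι κ) (X → Sm ι)}
    {Yc : Matrix (Ph ι κ) (κ ⊕ κ) (X → Sm ι)} {L : Matrix (κ ⊕ κ) (κ ⊕ κ) (X → Sm ι)}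
    (hSE : SE = Matrix.of fun i j x => (η x : ℂ) • S i j) (hJz : Jz = Jm β₀ f 0)
    (hYc : Yc = cm X ι y0) (hL : L = LamM ι fun j _ => lam0 j) :
    nErr β₀ f η om u (Yc + SE * Yc) (fun j _ => lam0 j)
      = -((Jm β₀ f (u ∘ Sum.inl) - Jz) * (Yc + SE * Yc)) - Jz * (SE * Yc) + (SE * Yc) * L := by
  obtain ⟨Jc, hJc⟩ : ∃ Jc : Matrix (Ph ι κ) (Ph ι κ) (X → Sm ι), Jc = cm X ι (J0 β₀ f) := ⟨_, rfl⟩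
  have h1 : Jc * Yc = Yc * L := by
    ext i j x ψ
    have := congrFun (congrFun hy i) j
    rw [Matrix.mul_diagonal, Matrix.mul_apply] at this
    have e : (Yc * L) i j = Yc i j * cst fun _ => lam0 j := by
      rw [hL, LamM]; exact Matrix.mul_diagonal _ _ _ _
    rw [e, hJc, hYc]
    simp only [Matrix.mul_apply, Finset.sum_apply, Sm.sum_val, cm,
      Matrix.map_apply, Pi.mul_apply, Sm.mul_val, Sm.algebraMap_val, cst]
    exact this
  have h2 : (Yc + SE * Yc).map (Dη η om) = (Jz - Jc) * Yc := by
    ext1 i j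
    have hc : ∀ i j, Dη η om (Yc i j) = 0 := fun i j => by
      rw [hYc]; exact RD_cst _ _ fun _ => y0 i j
    have hse : ∀ i j, Dη η om (SE i j) = (Jz - Jc) i j := fun i j => by
      funext x
      have hJ : Jz i j x = Jm β₀ f (0 : ι ⊕ κ → Unit → Sm ι) i j () := by
        rw [hJz]
        rcases i with i | i <;> rcases j with j | j
        · rfl
        · simp only [Jm, Matrix.fromBlocks_apply₁₂, Matrix.one_apply]
          split_ifs <;> rfl
        · rfl
        · rfl
      rw [hSE, Dη, RD_apply, Matrix.of_apply, Derivation.map_smul, smul_smul, ← Complex.ofReal_mul,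
        inv_mul_cancel₀ (hη x), Complex.ofReal_one, one_smul, hS, Matrix.sub_apply, Pi.sub_apply,
        hJ, hJc]
      rfl
    simp only [Matrix.map_apply, Matrix.add_apply, Matrix.mul_apply, map_add, map_sum,
      Derivation.leibniz, hc, hse, zero_add, smul_eq_mul]
    exact Finset.sum_congr rfl fun k _ => by rw [mul_zero, zero_add, mul_comm]
  rw [nErr, h2, ← hL, Matrix.sub_mul, h1]
  simp only [Matrix.mul_add, Matrix.sub_mul, Matrix.add_mul]
  abel

set_option maxHeartbeats 1000000 in
/-- The first approximation to the invariant torus and its normal frame. -/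
theorem exists_initial (hf : Pot f r M) {C₀ τ : ℝ} (hC₀ : 0 < C₀)
    (hdio : ∀ ν : ι → ℤ, ν ≠ 0 → C₀ * l1 ν ^ (-τ) ≤ |dotZ ν om|)
    (hmean : ∀ i, coef (atβ β₀ (dd (Pi.single i 1) f)).1 0 = 0)
    {y0 : Matrix (Ph ι κ) (κ ⊕ κ) ℂ} {lam0 : κ ⊕ κ → ℂ}
    (hy : J0 β₀ f * y0 = y0 * Matrix.diagonal lam0) :
    ∃ (C1 : ℝ) (K : Ph ι κ → ℝ → Sm ι) (Y : Matrix (Ph ι κ) (κ ⊕ κ) (ℝ → Sm ι)), 0 < C1 ∧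
      ∀ ηb W : ℝ, 0 < ηb → ηb ≤ 1 → C1 * ηb ≤ 1 → 0 < W →
        Approx (relDist (Subtype.val : Set.Ioo 0 ηb → ℝ)) (fun x => W * x.1 ^ 2) β₀ f Subtype.val om
          (cm (Set.Ioo 0 ηb) ι y0) (r / 8) (C1 * ηb) (C1 / W) (C1 * ηb) (fun i x => K i x)
          (Y.map fun F x => F x) (fun j _ => lam0 j) ∧
        ∀ i, Bd (relDist (Subtype.val : Set.Ioo 0 ηb → ℝ)) (fun x => W * x.1 ^ 2) (r / 8)
          (fun x => K (Sum.inl i) x) (C1 / W) := by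
  obtain ⟨u, p, C, hC, hu, hp, hur, hpr, hub, hpb⟩ :=
    exists_initial_torus (β₀ := β₀) hf hC₀ hdio hmean
  obtain ⟨S, CS, hCS, hS, hSb⟩ := exists_initial_frame (β₀ := β₀) hf hC₀ hdio
  have hr := hf.pos
  obtain ⟨_, hfs⟩ := hf.fs
  have hM := hfs.nonneg
  set N : ℝ := (Fintype.card (Ph ι κ) : ℝ) with hN
  set cy : ℝ := ∑ i, ∑ j, 2 * ‖y0 i j‖ with hcy
  set cl : ℝ := ∑ i, ∑ j : κ ⊕ κ, if i = j then 2 * ‖lam0 i‖ else 0 with hcl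
  have hN0 : 0 ≤ N := Nat.cast_nonneg _
  have hι0 : (0 : ℝ) ≤ Fintype.card ι := Nat.cast_nonneg _
  have hcy0 : 0 ≤ cy := Finset.sum_nonneg fun i _ => Finset.sum_nonneg fun j _ => by positivity
  have hcl0 : 0 ≤ cl := Finset.sum_nonneg fun i _ => Finset.sum_nonneg fun j _ => by positivity
  set s := N * N * (2 * CS) with hs
  have hs0 : 0 ≤ s := by positivity
  set t1 := 4 * C with ht1
  set t2 := N * Fintype.card ι * (4 * (2 * (r / 8)⁻¹ * C)) with ht2
  set t3 := s * cy with ht3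
  set t4 := N * 1 * (16 * (4 / r) * (4 * C) * M) with ht4
  set t5 := N * N * (16 * (4 / r) * (4 * C) * M) * (cy + s * cy)
    + N * N * (2 + 4 * M) * (s * cy) + s * cy * cl with ht5
  set t6 := 64 * C / r with ht6
  have h1 : 0 ≤ t1 := by positivity
  have h2 : 0 ≤ t2 := by positivity
  have h3 : 0 ≤ t3 := by positivity
  have h4 : 0 ≤ t4 := by positivity
  have h5 : 0 ≤ t5 := by positivity
  have h6 : 0 ≤ t6 := by positivity
  refine ⟨1 + t1 + t2 + t3 + t4 + t5 + t6, initK u p,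
    Matrix.of fun i j x => algebraMap ℂ (Sm ι) (y0 i j)
      + ∑ k, ((x : ℂ) • S i k) * algebraMap ℂ (Sm ι) (y0 k j), by positivity, ?_⟩
  intro ηb W hη hη1 hCη hW
  have hsub : Set.Ioo 0 ηb ⊆ Set.Ioo 0 ηb := subset_rfl
  have hF : Fact (Set.Ioo 0 ηb ⊆ Set.Ioi 0) := ⟨fun x hx => hx.1⟩
  have hPW : PosWt (fun x : Set.Ioo 0 ηb => W * x.1 ^ 2) := ⟨fun x => by positivity⟩
  have hσ : 0 < r / 8 := by linarith
  have hle : ∀ t, t ≤ 1 + t1 + t2 + t3 + t4 + t5 + t6 → t * ηb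
      ≤ (1 + t1 + t2 + t3 + t4 + t5 + t6) * ηb := fun t ht => mul_le_mul_of_nonneg_right ht hη.le
  have hle' : ∀ t, t ≤ 1 + t1 + t2 + t3 + t4 + t5 + t6 → t / W
      ≤ (1 + t1 + t2 + t3 + t4 + t5 + t6) / W := fun t ht => by gcongr
  have hsm : t6 * ηb ≤ 1 := (hle t6 (by linarith)).trans hCη
  have hsm' : 64 * (C * ηb) ≤ r := by
    rw [ht6, div_mul_eq_mul_div, div_le_one hr] at hsm
    linarith
  have hub8 : ∀ i, Wn (r / 8) (u i) C := fun i => (hub i).anti (by linarith)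
  have hpb8 : ∀ i, Wn (r / 8) (p i) C := fun i => (hpb i).anti (by linarith)
  have hL1 := LipB.eta hsub
  have hL2 := LipB.eta_sq hsub hη1
  have hL3 := LipB.eta_sq_weight hsub hW
  have hK2 : ∀ i, Bd (relDist (Subtype.val : Set.Ioo 0 ηb → ℝ)) 1 (r / 8)
      (fun x => initK u p (Sum.inl i) x) (4 * ηb * C) := fun i =>
    Bd.smul_unit (by positivity) hL2 hσ.le (hub8 i)
  have hK1 : ∀ i, Bd (relDist (Subtype.val : Set.Ioo 0 ηb → ℝ)) 1 (r / 8)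
      (fun x => initK u p (Sum.inr i) x) (2 * ηb * C) := fun i =>
    Bd.smul_unit (by positivity) hL1 hσ.le (hpb8 i)
  have hKw : ∀ i, Bd (relDist (Subtype.val : Set.Ioo 0 ηb → ℝ)) (fun x => W * x.1 ^ 2) (r / 8)
      (fun x => initK u p (Sum.inl i) x) (4 / W * C) := fun i =>
    Bd.smul_unit (by positivity) hL3 hσ.le (hub8 i)
  have hreal : ∀ i, IsReal (fun x : Set.Ioo 0 ηb => initK u p i x) := by
    intro i x ψ
    rcases i with i | i
    · simp only [initK, Sum.elim_inl, Sm.smul_val, Complex.im_ofReal_mul,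
        hur, mul_zero]
    · simp only [initK, Sum.elim_inr, Sm.smul_val, Complex.im_ofReal_mul,
        hpr, mul_zero]
  have hY : (Matrix.of fun (i : Ph ι κ) (j : κ ⊕ κ) (x : ℝ) => algebraMap ℂ (Sm ι) (y0 i j)
      + ∑ k, ((x : ℂ) • S i k) * algebraMap ℂ (Sm ι) (y0 k j)).map
        (fun F (x : Set.Ioo 0 ηb) => F x)
      = cm (Set.Ioo 0 ηb) ι y0 + (Matrix.of fun i j (x : Set.Ioo 0 ηb) => ((x : ℝ) : ℂ) • S i j :
        Matrix (Ph ι κ) (Ph ι κ) (Set.Ioo 0 ηb → Sm ι)) * cm (Set.Ioo 0 ηb) ι y0 := by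
    ext i j x ψ
    simp [cm, Matrix.mul_apply, Finset.sum_apply]
  rw [hY]
  set SE : Matrix (Ph ι κ) (Ph ι κ) (Set.Ioo 0 ηb → Sm ι) :=
    Matrix.of fun i j x => ((x : ℝ) : ℂ) • S i j with hSE
  have hSEb : MBd (relDist (Subtype.val : Set.Ioo 0 ηb → ℝ)) 1 (r / 8) SE (s * ηb) :=
    (MBd.of_entries fun i j => Bd.smul_unit (by positivity) hL1 hσ.le
      ((hSb i j).anti (by linarith))).mono (le_of_eq (by rw [hs]; ring))
  have hcmb := MBd.cm (ρ := relDist (Subtype.val : Set.Ioo 0 ηb → ℝ)) (ι := ι) y0 (r / 8)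
  have hSY := hSEb.mul hσ.le hcmb
  have hYb := (hcmb.add hSY).mono (show cy + s * ηb * cy ≤ cy + s * cy by
    have : s * ηb * cy ≤ s * 1 * cy := by gcongr
    linarith)
  refine ⟨⟨hreal, fun i => ?_, ?_, ?_, ?_, ?_⟩, fun i => (hKw i).mono ?_⟩
  · rcases i with i | i
    · refine (hK2 i).mono (le_trans (le_of_eq ?_) (hle t1 (by linarith)))
      rw [ht1]; ring
    · refine (hK1 i).mono (le_trans ?_ (hle t1 (by linarith)))
      rw [ht1]
      nlinarith [mul_nonneg hη.le hC]
  · refine (MBd.of_entries (C := 4 * ηb * (2 * (r / 8)⁻¹ * C)) fun i k => ?_).mono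
      (le_trans (le_of_eq ?_) (hle t2 (by linarith)))
    · have hd : ∀ (a : Set.Ioo 0 ηb → ℂ), LipB (relDist Subtype.val) 1 a (4 * ηb) → ∀ h : Sm ι,
          Wn (r / 4) h C → Bd (relDist (Subtype.val : Set.Ioo 0 ηb → ℝ)) 1 (r / 8)
            (pd k fun x => a x • h) (4 * ηb * (2 * (r / 8)⁻¹ * C)) := fun a ha h hh => by
        have h1 := hh.pd (δ := r / 8) hσ (by linarith) k
        rw [show r / 4 - r / 8 = r / 8 by ring] at h1
        refine (Bd.smul_unit (by positivity) ha hσ.le h1).congr fun x ψ => ?_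
        simp only [pd, RD_apply, Derivation.map_smul, Pi.one_apply, one_smul]
      rcases i with i | i
      · exact hd _ hL2 _ (hub i)
      · exact hd _ (hL1.mono (by linarith)) _ (hpb i)
    · rw [ht2, hN]; ring
  · rw [add_sub_cancel_left]
    refine hSY.mono (le_trans (le_of_eq ?_) (hle t3 (by linarith)))
    rw [ht3]; ring
  · refine (MBd.of_entries (C := 16 * (4 / r) * (4 / W * C) * M) fun i k => ?_).mono
      (le_trans (le_of_eq ?_) (hle' t4 (by linarith)))
    · rcases i with i | i
      · refine ((Bd.zero).mono (by positivity)).congr fun x ψ => ?_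
        have hx : (x : ℝ) ≠ 0 := x.2.1.ne'
        have hx' : ((x : ℝ) : ℂ) ≠ 0 := by exact_mod_cast hx
        simp only [Err, Matrix.of_apply, Sum.elim_inl, Pi.sub_apply, Dη, RD_apply, initK,
          Sum.elim_inr, Derivation.map_smul, hu, Sm.sub_val, Sm.smul_val, Pi.zero_apply, Sm.zero_val]
        push_cast
        field_simp
        ring
      · obtain ⟨φh, hφ⟩ := hf.fs1 i
        have := Bd.comp_sub (u := 0) (v := fun i (x : Set.Ioo 0 ηb) => initK u p (Sum.inl i) x)
          (C := 0) hσ hr hφ (fun _ => isReal_zero) (fun i => hreal (Sum.inl i))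
          (fun _ => Bd.zero) hK2 hKw (by positivity) (by linarith) β₀
        rw [zero_add] at this
        refine this.congr fun x ψ => ?_
        have hx' : ((x : ℝ) : ℂ) ≠ 0 := by exact_mod_cast x.2.1.ne'
        simp only [Err, Matrix.of_apply, Sum.elim_inr, Pi.add_apply, Dη, RD_apply, initK,
          Derivation.map_smul, hp, Sm.add_val, Sm.smul_val, Sm.neg_val, Pi.sub_apply, Sm.sub_val, comp_zero]
        push_cast
        rw [inv_mul_cancel_left₀ hx', neg_add_eq_sub]
        rfl
    · rw [ht4, hN]
      simp only [Fintype.card_unit, Nat.cast_one]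
      ring
  · rw [nErr_averaged (om := om) (S := S) (η := Subtype.val) (fun x => x.2.1.ne') hy hS hSE rfl rfl rfl]
    have hJ := Jm_comp_sub (β₀ := β₀) hf hσ (fun i => hreal (Sum.inl i)) hK2 (by positivity)
      (by linarith)
    have hJ0 := Jm_zero_le (β₀ := β₀) (ρ := relDist (Subtype.val : Set.Ioo 0 ηb → ℝ)) hf
      (by linarith : r / 8 ≤ r)
    have hl := LamM_le (ρ := relDist (Subtype.val : Set.Ioo 0 ηb → ℝ)) (ι := ι) lam0 (r / 8)
    refine ((((hJ.mul hσ.le hYb).neg.sub (hJ0.mul hσ.le hSY))).add (hSY.mul hσ.le hl)).mono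
      (le_trans (le_of_eq ?_) (hle t5 (by linarith)))
    rw [ht5]; ring
  · refine le_trans (le_of_eq ?_) (hle' t1 (by linarith))
    rw [ht1]; ring

end initialApprox

section reference

variable {ι κ X : Type*} [Fintype ι] [Fintype κ] [DecidableEq ι] [DecidableEq κ]
variable {m n p : Type*} [Fintype m] [Fintype n] [Fintype p]

lemma cm_mul (A : Matrix m n ℂ) (B : Matrix n p ℂ) : cm X ι (A * B) = cm X ι A * cm X ι B := by
  ext i j x ψ
  simp [cm, Matrix.mul_apply, Finset.sum_apply]

lemma cm_add (A B : Matrix m n ℂ) : cm X ι (A + B) = cm X ι A + cm X ι B := by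
  ext i j x ψ
  simp [cm]

lemma cm_one [DecidableEq m] : cm X ι (1 : Matrix m m ℂ) = 1 := by
  ext i j x ψ
  by_cases h : i = j
  · subst h; simp [cm]
  · simp [cm, h]

variable (ι κ) in
/-- The constant tangent vectors. -/
def t10 : Matrix (Ph ι κ) ι ℂ := Matrix.of fun i k => if i = Sum.inl (Sum.inl k) then 1 else 0

variable (ι κ) in
/-- The constant vectors conjugate to the tangent ones. -/
def t2 : Matrix (Ph ι κ) ι ℂ := Matrix.of fun i k => if i = Sum.inr (Sum.inl k) then 1 else 0

lemma cm_t10 : cm X ι (t10 ι κ) = T10 ι κ X := by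
  ext i j x ψ
  simp only [cm, t10, T10, Matrix.map_apply, Matrix.of_apply]
  split_ifs <;> simp

lemma cm_t2 : cm X ι (t2 ι κ) = T2 ι κ X := by
  ext i j x ψ
  simp only [cm, t2, T2, Matrix.map_apply, Matrix.of_apply]
  split_ifs <;> simp

variable (ι) in
/-- The normal frame of the averaged system. -/
noncomputable def refY (V : Matrix κ κ ℂ) (lam : κ ⊕ κ → ℂ) : Matrix (Ph ι κ) (κ ⊕ κ) ℂ :=
  Matrix.of fun i j => Sum.elim (Sum.elim 0 fun i => V i (Sum.elim id id j))
    (Sum.elim 0 fun i => lam j * V i (Sum.elim id id j)) i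

variable (ι) in
/-- The dual of the normal frame of the averaged system. -/
noncomputable def refQ (V' : Matrix κ κ ℂ) (lam : κ ⊕ κ → ℂ) : Matrix (κ ⊕ κ) (Ph ι κ) ℂ :=
  Matrix.of fun j i => Sum.elim (Sum.elim 0 fun i => V' (Sum.elim id id j) i / 2)
    (Sum.elim 0 fun i => (2 * lam j)⁻¹ * V' (Sum.elim id id j) i) i

/-- The normal frequencies `± i s`. -/
noncomputable def refLam (s : κ → ℝ) : κ ⊕ κ → ℂ :=
  Sum.elim (fun j => (s j : ℂ) * Complex.I) fun j => -((s j : ℂ) * Complex.I)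

lemma ref_inv {V V' : Matrix κ κ ℂ} (hV : V * V' = 1) {s : κ → ℝ} (hs : ∀ j, 0 < s j) :
    t10 ι κ * (t10 ι κ).transpose + t2 ι κ * (t2 ι κ).transpose
      + refY ι V (refLam s) * refQ ι V' (refLam s) = 1 := by
  have h1 : ∀ i k, ∑ j, V i j * V' j k = if i = k then 1 else 0 := fun i k => by
    rw [← Matrix.mul_apply, hV, Matrix.one_apply]
  have hs' : ∀ j, (s j : ℂ) ≠ 0 := fun j => by exact_mod_cast (hs j).ne'
  have hI := Complex.I_ne_zero
  ext i k
  rw [Matrix.add_apply, Matrix.add_apply, Matrix.mul_apply, Matrix.mul_apply, Matrix.mul_apply,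
    Fintype.sum_sum_type]
  rcases i with (i | i) | (i | i) <;> rcases k with (k | k) | (k | k) <;>
    simp only [t10, t2, refY, refQ, refLam, Matrix.transpose_apply, Matrix.of_apply, Sum.elim_inl,
      Sum.elim_inr, Pi.zero_apply, zero_mul, mul_zero, Finset.sum_const_zero, add_zero, zero_add,
      Sum.inl.injEq, Sum.inr.injEq, reduceCtorEq, if_false, Matrix.one_apply, id, ← h1,
      ← Finset.sum_add_distrib]
  · simp
  · refine Finset.sum_congr rfl fun j _ => by ring
  · refine Finset.sum_eq_zero fun j _ => ?_
    have := hs' j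
    field_simp
    ring
  · simp
  · refine Finset.sum_eq_zero fun j _ => ?_
    ring
  · refine Finset.sum_congr rfl fun j _ => ?_
    have := hs' j
    field_simp
    ring

lemma t10_transpose_mul : (t10 ι κ).transpose * t10 ι κ = 1 := by
  ext i k
  simp [t10, Matrix.mul_apply, Matrix.one_apply, eq_comm]

/-- The reference frame built from the eigenvectors of the averaged Hessian. -/
lemma exists_ref {V V' : Matrix κ κ ℂ} (hV : V * V' = 1) {s : κ → ℝ} (hs : ∀ j, 0 < s j) :
    ∃ c : ℝ, ∀ (X : Type) (ρ : X → X → ℝ) [PosRho ρ], Ref ρ (cm X ι (refY ι V (refLam s)))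
      (cm X ι (t10 ι κ).transpose) (cm X ι (t2 ι κ).transpose)
      (cm X ι (refQ ι V' (refLam s))) c := by
  set c1 : ℝ := ∑ i, ∑ j, 2 * ‖refY ι V (refLam s) i j‖
  set c2 : ℝ := ∑ i, ∑ j, 2 * ‖(t10 ι κ).transpose i j‖
  set c3 : ℝ := ∑ i, ∑ j, 2 * ‖(t2 ι κ).transpose i j‖
  set c4 : ℝ := ∑ i, ∑ j, 2 * ‖refQ ι V' (refLam s) i j‖
  set c5 : ℝ := 2 * (Fintype.card (Ph ι κ) : ℝ) ^ 2
  have h1 : 0 ≤ c1 := Finset.sum_nonneg fun i _ => Finset.sum_nonneg fun j _ => by positivity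
  have h2 : 0 ≤ c2 := Finset.sum_nonneg fun i _ => Finset.sum_nonneg fun j _ => by positivity
  have h3 : 0 ≤ c3 := Finset.sum_nonneg fun i _ => Finset.sum_nonneg fun j _ => by positivity
  have h4 : 0 ≤ c4 := Finset.sum_nonneg fun i _ => Finset.sum_nonneg fun j _ => by positivity
  have h5 : 0 ≤ c5 := by positivity
  refine ⟨1 + c1 + c2 + c3 + c4 + c5, fun X ρ _ => ⟨?_, ?_, by linarith, by linarith, fun σ =>
    (MBd.cm _ σ).mono (by linarith), fun σ => (MBd.cm _ σ).mono (by linarith), fun σ =>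
    (MBd.cm _ σ).mono (by linarith), fun σ => (MBd.cm _ σ).mono (by linarith)⟩⟩
  · rw [← cm_t10, ← cm_t2, ← cm_mul, ← cm_mul, ← cm_mul, ← cm_add, ← cm_add, ref_inv hV hs, cm_one]
  · rw [← cm_t10, ← cm_mul, t10_transpose_mul, cm_one]

variable {β₀ : κ → ℝ} {f : Sm (ι ⊕ κ)} {om : ι → ℝ} {r M : ℝ}

lemma atβ_dd_inl (β₀ : κ → ℝ) (φ : Sm (ι ⊕ κ)) (k : ι) :
    atβ β₀ (dd (Pi.single (Sum.inl k) 1) φ) = dd (Pi.single k 1) (atβ β₀ φ) := by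
  have h := congrFun (RD_comp (X := Unit) β₀ φ (u := 0) (fun _ => isReal_zero) 1 (Pi.single k 1)) ()
  rw [RD_apply, Pi.one_apply, one_smul, comp_zero, Finset.sum_apply,
    Finset.sum_eq_single (Sum.inl k)] at h
  · rw [h]
    ext ψ
    simp [comp_zero, cst]
  · intro i _ hi
    ext ψ
    rcases i with i | i
    · have : i ≠ k := fun h => hi (by rw [h])
      simp [cst, this]
    · simp [cst]
  · simp

lemma coef_atβ_inl (hr : 0 < r) {φ : Sm (ι ⊕ κ)} {φh : (ι ⊕ κ → ℤ) → ℂ} (hφ : FS r M φ φh)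
    (β₀ : κ → ℝ) (k : ι) : coef (atβ β₀ (dd (Pi.single (Sum.inl k) 1) φ)).1 0 = 0 := by
  rw [atβ_dd_inl]
  have := congrFun (Bd.mean_RD hr (Wn.atβ hr hφ β₀) 1 (Pi.single k 1)) ()
  simpa [mean] using this

lemma J0_mul_refY (hf : Pot f r M) {V : Matrix κ κ ℂ} {s : κ → ℝ}
    (hV : ∀ i j, ∑ k, coef (atβ β₀ (dd (Pi.single (Sum.inr k) 1)
      (dd (Pi.single (Sum.inr i) 1) f))).1 0 * V k j = V i j * ((s j : ℂ)) ^ 2) :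
    J0 β₀ f * refY ι V (refLam s) = refY ι V (refLam s) * Matrix.diagonal (refLam s) := by
  have h1 : ∀ i k, coef (atβ β₀ (dd (Pi.single (Sum.inl k) 1) (dd (Pi.single i 1) f))).1 0 = 0 :=
    fun i k => (hf.fs1 i).elim fun _ h => coef_atβ_inl hf.pos h β₀ k
  have h2 : ∀ i k, coef (atβ β₀ (dd (Pi.single i 1) (dd (Pi.single (Sum.inl k) 1) f))).1 0 = 0 :=
    fun i k => by rw [dd_comm]; exact h1 i k
  have hl : ∀ j, refLam s j ^ 2 = -((s (Sum.elim id id j) : ℂ)) ^ 2 := fun j => by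
    rcases j with j | j <;> simp [refLam, mul_pow]
  ext i j
  rw [Matrix.mul_diagonal, Matrix.mul_apply, Fintype.sum_sum_type]
  rcases i with i | i
  · simp only [J0, Matrix.fromBlocks_apply₁₁, Matrix.fromBlocks_apply₁₂, Matrix.zero_apply,
      zero_mul, Finset.sum_const_zero, zero_add, Matrix.one_apply, ite_mul, one_mul,
      Finset.sum_ite_eq, Finset.mem_univ, if_true]
    rcases i with i | i <;> simp [refY, mul_comm]
  · simp only [J0, Matrix.fromBlocks_apply₂₁, Matrix.fromBlocks_apply₂₂, Matrix.zero_apply,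
      zero_mul, Finset.sum_const_zero, add_zero, Matrix.neg_apply, Matrix.of_apply]
    rcases i with i | i
    · simp [h2, refY]
    · rw [Fintype.sum_sum_type]
      simp only [h1, neg_zero, zero_mul, Finset.sum_const_zero, zero_add, neg_mul,
        Finset.sum_neg_distrib]
      have e : ∀ k, refY ι V (refLam s) (Sum.inl (Sum.inr k)) j = V k (Sum.elim id id j) :=
        fun k => rfl
      simp only [e, hV]
      have e' : refY ι V (refLam s) (Sum.inr (Sum.inr i)) j
        = refLam s j * V i (Sum.elim id id j) := rfl
      rw [e', mul_comm (refLam s j), mul_assoc, ← pow_two, hl]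
      ring

lemma exists_pos_le {α : Type*} [Fintype α] (g : α → ℝ) (hg : ∀ a, 0 < g a) :
    ∃ m, 0 < m ∧ ∀ a, m ≤ g a := by
  obtain ⟨C, hC0, hC⟩ := exists_forall_le (Q := fun a C => (g a)⁻¹ ≤ C)
    (fun _ _ _ h h' => h.trans h') fun a => ⟨_, le_rfl⟩
  refine ⟨(1 + C)⁻¹, by positivity, fun a => inv_le_of_inv_le₀ (hg a) ?_⟩
  linarith [hC a]

end reference

section parameters

variable {ι κ : Type} [Fintype ι] [Fintype κ] [DecidableEq ι] [DecidableEq κ]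
variable {β₀ : κ → ℝ} {f : Sm (ι ⊕ κ)} {om : ι → ℝ} {r M : ℝ}

lemma refLam_im (s : κ → ℝ) (j : κ ⊕ κ) : (refLam s j).im = Sum.elim s (-s) j := by
  rcases j with j | j <;> simp [refLam]

lemma refLam_im_ne {s : κ → ℝ} (hs : ∀ j, 0 < s j) (hinj : Function.Injective s) {i j : κ ⊕ κ}
    (hij : i ≠ j) : (refLam s j - refLam s i).im ≠ 0 := by
  rw [Complex.sub_im, refLam_im, refLam_im]
  rcases i with i | i <;> rcases j with j | j
  · have : s j ≠ s i := fun h => hij (by rw [hinj h])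
    exact sub_ne_zero.mpr this
  · simp only [Sum.elim_inl, Sum.elim_inr, Pi.neg_apply]
    linarith [hs i, hs j]
  · simp only [Sum.elim_inl, Sum.elim_inr, Pi.neg_apply]
    linarith [hs i, hs j]
  · have : s j ≠ s i := fun h => hij (by rw [hinj h])
    simp only [Sum.elim_inr, Pi.neg_apply]
    intro h
    exact this (by linarith)

lemma refLam_im_ne_zero {s : κ → ℝ} (hs : ∀ j, 0 < s j) (j : κ ⊕ κ) : (refLam s j).im ≠ 0 := by
  rw [refLam_im]
  rcases j with j | j
  · exact (hs j).ne'
  · exact (neg_lt_zero.mpr (hs j)).ne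

lemma exists_gap {s : κ → ℝ} (hs : ∀ j, 0 < s j) (hinj : Function.Injective s) :
    ∃ m₀, 0 < m₀ ∧ (∀ j, m₀ ≤ |(refLam s j).im|) ∧
      ∀ i j, i ≠ j → m₀ ≤ |(refLam s j - refLam s i).im| := by
  obtain ⟨m1, h1, h1'⟩ := exists_pos_le (fun j => |(refLam s j).im|) fun j =>
    abs_pos.mpr (refLam_im_ne_zero hs j)
  obtain ⟨m2, h2, h2'⟩ := exists_pos_le
    (fun ij : (κ ⊕ κ) × (κ ⊕ κ) => if ij.1 = ij.2 then 1
      else |(refLam s ij.2 - refLam s ij.1).im|) fun ij => by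
    split_ifs with h
    · exact one_pos
    · exact abs_pos.mpr (refLam_im_ne hs hinj h)
  refine ⟨min m1 m2, lt_min h1 h2, fun j => (min_le_left _ _).trans (h1' j), fun i j hij =>
    (min_le_right _ _).trans ?_⟩
  have := h2' (i, j)
  simpa [hij] using this

lemma geom_le {A B Z : ℝ} (hA : 0 ≤ A) (hB : 0 ≤ B) (hAZ : A ≤ Z) (hBZ : B ≤ Z) (n : ℕ) :
    A * B ^ n ≤ Z ^ (n + 1) := by
  rw [pow_succ']
  have : 0 ≤ Z := hA.trans hAZ
  gcongr

lemma inv_geom (a : ℝ) (n : ℕ) : (a * (1 / 2) ^ n)⁻¹ = a⁻¹ * 2 ^ n := by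
  rw [mul_inv, one_div, inv_pow, inv_inv]

set_option maxHeartbeats 1000000 in
/-- A choice of the parameters for which the iteration can be started. -/
theorem exists_par (hf : Pot f r M) (hr1 : r ≤ 1) {C₀ τ : ℝ} (hC₀ : 0 < C₀)
    (hdio : ∀ ν : ι → ℤ, ν ≠ 0 → C₀ * l1 ν ^ (-τ) ≤ |dotZ ν om|)
    (hmean : ∀ i, coef (atβ β₀ (dd (Pi.single i 1) f)).1 0 = 0)
    {V V' : Matrix κ κ ℂ} (hV : V * V' = 1) {s : κ → ℝ} (hs : ∀ j, 0 < s j)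
    (hinj : Function.Injective s)
    (heig : ∀ i j, ∑ k, coef (atβ β₀ (dd (Pi.single (Sum.inr k) 1)
      (dd (Pi.single (Sum.inr i) 1) f))).1 0 * V k j = V i j * ((s j : ℂ)) ^ 2) :
    ∃ (P : Par) (y0 : Matrix (Ph ι κ) (κ ⊕ κ) ℂ) (q1 q2 : Matrix ι (Ph ι κ) ℂ)
      (q3 : Matrix (κ ⊕ κ) (Ph ι κ) ℂ) (S0 : St ι κ), P.Ok (Fintype.card ι) ∧
      Hyp P f om y0 q1 q2 q3 (refLam s) ∧ Good P β₀ f om y0 (refLam s) 0 S0 ∧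
      S0.G = Set.Ioo 0 P.ηb ∧
      ∀ i, Bd (relDist (Subtype.val : S0.G → ℝ)) (wP P S0.G) P.σ (fun x => S0.K (Sum.inl i) x)
        P.k := by
  have hr := hf.pos
  obtain ⟨c, hc⟩ := exists_ref (ι := ι) hV hs
  have hc1 : 1 ≤ c := by
    have : PosRho (fun _ _ : Unit => (0 : ℝ)) := ⟨fun _ _ => le_rfl⟩
    exact (hc Unit fun _ _ => 0).one_le
  obtain ⟨m₀, hm₀, hm1, hm2⟩ := exists_gap hs hinj
  obtain ⟨CL, hCL0, hCL⟩ := exists_forall_le (Q := fun j C => ‖refLam s j‖ ≤ C)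
    (fun _ _ _ h h' => h.trans h') fun a => ⟨_, le_rfl⟩
  obtain ⟨C1, K, Y, hC1, hini⟩ := exists_initial (β₀ := β₀) (y0 := refY ι V (refLam s))
    (lam0 := refLam s) hf hC₀ hdio hmean (J0_mul_refY hf heig)
  obtain ⟨m, hmτ⟩ : ∃ m : ℕ, τ ≤ m ∧ 4 * Fintype.card ι ≤ m := by
    obtain ⟨m, hm⟩ := exists_nat_ge τ
    refine ⟨m + 4 * Fintype.card ι, ?_, by omega⟩
    push_cast
    have : (0 : ℝ) ≤ 4 * Fintype.card ι := by positivity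
    linarith
  obtain ⟨k, hk0, hk1, hk2, hk3⟩ : ∃ k : ℝ, 0 < k ∧ 32 * c ^ 8 * k ≤ 1 ∧ k ≤ r / 40
      ∧ k ≤ m₀ / 8 := by
    have hc0 : 0 < 32 * c ^ 8 := by positivity
    refine ⟨min (32 * c ^ 8)⁻¹ (min (r / 40) (m₀ / 8)), ?_, ?_, ?_, ?_⟩
    · exact lt_min (by positivity) (lt_min (by positivity) (by positivity))
    · calc _ ≤ 32 * c ^ 8 * (32 * c ^ 8)⁻¹ := by gcongr; exact min_le_left _ _
        _ = 1 := mul_inv_cancel₀ hc0.ne'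
    · exact (min_le_right _ _).trans (min_le_left _ _)
    · exact (min_le_right _ _).trans (min_le_right _ _)
  obtain ⟨γ, hγ0, hγ1, hγ2⟩ : ∃ γ : ℝ, 0 < γ ∧ γ ≤ 1 ∧ γ ≤ m₀ / 2 :=
    ⟨min 1 (m₀ / 2), lt_min one_pos (by linarith), min_le_left _ _, min_le_right _ _⟩
  set σ := r / 8 with hσ
  have hσ0 : 0 < σ := by positivity
  set A := (2 * (1 + 4 * (CL + k)) + 2 * C₀⁻¹) * γ⁻¹ ^ 2
    * (m.factorial * Real.exp 1 * (σ / 20)⁻¹ ^ m) with hA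
  have hA0 : 0 ≤ A := by positivity
  obtain ⟨Z, hZ2, hZc, hZ1, hZ3, hZ4, hZ5, hZ6⟩ : ∃ Z : ℝ, 2 ≤ Z ∧ c ≤ Z ∧
      16 * (4 / r) * M ≤ Z ∧ 64 * (4 / r) ^ 2 * M ≤ Z ∧ 2 * (σ / 20)⁻¹ ≤ Z ∧ A ≤ Z ∧
      4 * 2 ^ m ≤ Z := by
    refine ⟨2 + |c| + |16 * (4 / r) * M| + |64 * (4 / r) ^ 2 * M| + |2 * (σ / 20)⁻¹| + |A|
      + |(4 * 2 ^ m : ℝ)|, ?_⟩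
    have h1 := abs_nonneg c
    have h2 := abs_nonneg (16 * (4 / r) * M)
    have h3 := abs_nonneg (64 * (4 / r) ^ 2 * M)
    have h4 := abs_nonneg (2 * (σ / 20)⁻¹)
    have h5 := abs_nonneg A
    have h6 := abs_nonneg (4 * 2 ^ m : ℝ)
    refine ⟨?_, ?_, ?_, ?_, ?_, ?_, ?_⟩
    · linarith
    · linarith [le_abs_self c]
    · linarith [le_abs_self (16 * (4 / r) * M)]
    · linarith [le_abs_self (64 * (4 / r) ^ 2 * M)]
    · linarith [le_abs_self (2 * (σ / 20)⁻¹)]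
    · linarith [le_abs_self A]
    · linarith [le_abs_self (4 * 2 ^ m : ℝ)]
  obtain ⟨ε, hε0, hε1, hε2, hε3⟩ : ∃ ε : ℝ, 0 < ε ∧ ε * Z ^ (2 * 210 + 1) ≤ 1 ∧
      ε * Z ^ 210 ≤ k / 2 ∧ ε ≤ k := by
    have hZ1' : 1 ≤ Z := by linarith
    have hp : 0 < Z ^ (2 * 210 + 1) := pow_pos (by linarith) _
    have hmin : 0 < min 1 (k / 2) := lt_min one_pos (by linarith)
    have he : min 1 (k / 2) * (Z ^ (2 * 210 + 1))⁻¹ * Z ^ (2 * 210 + 1) = min 1 (k / 2) :=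
      inv_mul_cancel_right₀ hp.ne' _
    have he0 : 0 < min 1 (k / 2) * (Z ^ (2 * 210 + 1))⁻¹ := mul_pos hmin (inv_pos.mpr hp)
    have hle : min 1 (k / 2) * (Z ^ (2 * 210 + 1))⁻¹ * Z ^ 210 ≤ k / 2 :=
      (mul_le_mul_of_nonneg_left (pow_le_pow_right₀ hZ1' (by norm_num)) he0.le).trans
        (he.le.trans (min_le_right _ _))
    refine ⟨min 1 (k / 2) * (Z ^ (2 * 210 + 1))⁻¹, he0, ?_, hle, ?_⟩
    · rw [he]; exact min_le_left _ _
    · have := le_mul_of_one_le_right he0.le (one_le_pow₀ hZ1' : 1 ≤ Z ^ 210)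
      linarith
  obtain ⟨ηb, hη0, hη1, hη2⟩ : ∃ ηb : ℝ, 0 < ηb ∧ ηb ≤ 1 ∧ C1 * ηb ≤ ε := by
    refine ⟨min 1 (ε / C1), lt_min one_pos (by positivity), min_le_left _ _, ?_⟩
    calc C1 * min 1 (ε / C1) ≤ C1 * (ε / C1) := by gcongr; exact min_le_right _ _
      _ = ε := by field_simp
  have hk1' : k ≤ 1 := by linarith
  have hW0 : 0 < C1 / ε := by positivity
  obtain ⟨hap, hw⟩ := hini ηb (C1 / ε) hη0 hη1 (by linarith) hW0
  rw [div_div_cancel₀ hC1.ne'] at hap hw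
  set P : Par := ⟨r, M, C₀, τ, c, Z, σ, k, ε, C1 / ε, ηb, γ, m₀, CL + k, m⟩ with hP
  have hσn : P.σn 0 = σ := by simp [Par.σn, hP]
  have hkn : P.kn 0 = k := by simp only [Par.kn, hP, pow_zero]; ring
  have hεn : P.εn 0 = ε := by simp only [Par.εn, hP, mul_zero, pow_zero, mul_one]
  refine ⟨P, refY ι V (refLam s), (t10 ι κ).transpose, (t2 ι κ).transpose,
    refQ ι V' (refLam s), ⟨Set.Ioo 0 ηb, K, Y, fun j _ => refLam s j⟩, ?_, ?_, ?_, rfl,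
    fun i => (hw i).mono hε3⟩
  · refine ⟨hC₀, hmτ.1, hmτ.2, hZ2, hZc, hZ1, hZ3, hσ0, ?_, hk0, hk1, ?_, hk3, ?_, hc1, hW0, ?_,
      hη0, hη1, hγ0, hγ1, hγ2, fun n => ?_, fun n => ?_, hε0.le, hε1, hε2⟩
    · change r / 8 ≤ 20
      linarith
    · change r / 8 + 10 * k ≤ r / 2
      linarith
    · change k ≤ CL + k
      linarith
    · change C1 / ε * ηb ^ 2 ≤ 1
      rw [div_mul_eq_mul_div, div_le_one hε0]
      nlinarith
    · change 2 * (σ / 20 * (1 / 2) ^ n)⁻¹ ≤ Z ^ (n + 1)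
      rw [inv_geom, ← mul_assoc]
      exact geom_le (by positivity) two_pos.le hZ4 hZ2 n
    · change (2 * (1 + 4 * (CL + k)) + 2 * C₀⁻¹) * (γ * (1 / 2) ^ n)⁻¹ ^ 2
        * (m.factorial * Real.exp 1 * (σ / 20 * (1 / 2) ^ n)⁻¹ ^ m) ≤ Z ^ (n + 1)
      rw [inv_geom, inv_geom, mul_pow, mul_pow]
      refine le_trans (le_of_eq ?_) (geom_le hA0 (by positivity) hZ5 hZ6 n)
      have e1 : ((2 : ℝ) ^ n) ^ 2 = 4 ^ n := by rw [← pow_mul, mul_comm, pow_mul]; norm_num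
      have e2 : ((2 : ℝ) ^ n) ^ m = (2 ^ m) ^ n := by rw [← pow_mul, mul_comm, pow_mul]
      rw [e1, e2, mul_pow, hA]
      ring
  · refine ⟨hf, hdio, fun G hG => ?_, fun j => ?_, hm1, hm2⟩
    · have : Fact (G ⊆ Set.Ioi 0) := ⟨fun x hx => (hG hx).1⟩
      exact hc G _
    · change ‖refLam s j‖ + k ≤ CL + k
      linarith [hCL j]
  · have : Fact (Set.Ioo 0 ηb ⊆ Set.Ioi 0) := ⟨fun x hx => hx.1⟩
    refine ⟨subset_rfl, ?_, fun j => ?_⟩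
    · rw [hσn, hkn, hεn]
      exact ⟨hap.real, fun i => (hap.K_le i).mono (by linarith), hap.dK_le.mono (by linarith),
        hap.Y_le.mono (by linarith), hap.err, hap.nrm.mono hη2⟩
    · rw [hkn]
      simp only [sub_self]
      exact (LipB.zero).mono hk0.le

end parameters

section measure

/-- A countable union of sets which are uniformly small near `0`, and each of which stays away from
`0`, has density `0` at `0`. -/
lemma tendsto_density_zero {α : Type*} [Countable α] {R : α → Set ℝ} {c : α → ℝ} (hc : Summable c)
    (hR : ∀ a ε, 0 < ε → volume (R a ∩ Set.Ioo 0 ε) ≤ ENNReal.ofReal (c a * ε))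
    (hR0 : ∀ a, ∃ δ, 0 < δ ∧ R a ∩ Set.Ioo 0 δ = ∅) (hc0 : ∀ a, 0 ≤ c a) :
    Tendsto (fun ε => (volume ((⋃ a, R a) ∩ Set.Ioo 0 ε)).toReal / ε) (nhdsWithin 0 (Set.Ioi 0))
      (nhds 0) := by
  have hfin : ∀ a ε, volume (R a ∩ Set.Ioo 0 ε) ≠ ⊤ := fun a ε =>
    ne_top_of_le_ne_top (by simp) (measure_mono (Set.inter_subset_right (s := R a)))
  have hbd : ∀ a ε, 0 < ε → (volume (R a ∩ Set.Ioo 0 ε)).toReal / ε ≤ c a := fun a ε hε => by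
    rw [div_le_iff₀ hε]
    exact ENNReal.toReal_le_of_le_ofReal (mul_nonneg (hc0 a) hε.le) (hR a ε hε)
  have h1 : Tendsto (fun ε => ∑' a, (volume (R a ∩ Set.Ioo 0 ε)).toReal / ε)
      (nhdsWithin 0 (Set.Ioi 0)) (nhds (∑' _ : α, (0 : ℝ))) := by
    refine tendsto_tsum_of_dominated_convergence hc (fun a => ?_) ?_
    · obtain ⟨δ, hδ, h⟩ := hR0 a
      refine tendsto_const_nhds.congr' ?_
      filter_upwards [Ioo_mem_nhdsGT hδ] with ε hε
      have : R a ∩ Set.Ioo 0 ε = ∅ := Set.subset_empty_iff.mp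
        (h ▸ Set.inter_subset_inter_right _ (Set.Ioo_subset_Ioo_right hε.2.le))
      simp [this]
    · filter_upwards [self_mem_nhdsWithin] with ε hε a
      rw [Real.norm_of_nonneg (div_nonneg ENNReal.toReal_nonneg (le_of_lt hε))]
      exact hbd a ε hε
  rw [tsum_zero] at h1
  refine squeeze_zero' ?_ ?_ h1
  · filter_upwards [self_mem_nhdsWithin] with ε hε
    exact div_nonneg ENNReal.toReal_nonneg (le_of_lt hε)
  · filter_upwards [self_mem_nhdsWithin] with ε (hε : 0 < ε)
    rw [tsum_div_const]
    gcongr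
    rw [← ENNReal.tsum_toReal_eq (fun a => hfin a ε)]
    refine ENNReal.toReal_mono ?_ ?_
    · refine ne_top_of_le_ne_top ?_ (ENNReal.tsum_le_tsum fun a => hR a ε hε)
      rw [← ENNReal.ofReal_tsum_of_nonneg (fun a => mul_nonneg (hc0 a) hε.le) (hc.mul_right ε)]
      exact ENNReal.ofReal_ne_top
    · rw [Set.iUnion_inter]
      exact measure_iUnion_le _

/-- The complement of a set of density `0` at `0` contains a measurable set of density `1`. -/
lemma exists_measurable_density_one {B : Set ℝ} {εb : ℝ} (hεb : 0 < εb)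
    (hB : Tendsto (fun ε => (volume (B ∩ Set.Ioo 0 ε)).toReal / ε) (nhdsWithin 0 (Set.Ioi 0))
      (nhds 0)) :
    ∃ E : Set ℝ, MeasurableSet E ∧ E ⊆ Set.Ioo 0 εb \ B ∧
      Tendsto (fun ε => (volume (E ∩ Set.Ioo 0 ε)).toReal / ε) (nhdsWithin 0 (Set.Ioi 0))
        (nhds 1) := by
  refine ⟨Set.Ioo 0 εb \ toMeasurable volume B, measurableSet_Ioo.diff (measurableSet_toMeasurable _ _),
    Set.sdiff_subset_sdiff_right (subset_toMeasurable _ _), ?_⟩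
  have h := (tendsto_const_nhds (x := (1 : ℝ))).sub hB
  rw [sub_zero] at h
  refine h.congr' ?_
  filter_upwards [Ioo_mem_nhdsGT hεb] with ε hε
  have e1 : (Set.Ioo 0 εb \ toMeasurable volume B) ∩ Set.Ioo 0 ε
      = Set.Ioo 0 ε \ (toMeasurable volume B ∩ Set.Ioo 0 ε) := by
    ext x
    simp only [Set.mem_inter_iff, Set.mem_sdiff, Set.mem_Ioo]
    constructor
    · rintro ⟨⟨⟨h1, h2⟩, h3⟩, h4⟩
      exact ⟨h4, fun h => h3 h.1⟩
    · rintro ⟨h1, h2⟩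
      exact ⟨⟨⟨h1.1, h1.2.trans hε.2⟩, fun h => h2 ⟨h, h1⟩⟩, h1⟩
  have e2 : volume (toMeasurable volume B ∩ Set.Ioo 0 ε) = volume (B ∩ Set.Ioo 0 ε) :=
    Measure.measure_toMeasurable_inter_of_sFinite measurableSet_Ioo _
  have hfin : volume (toMeasurable volume B ∩ Set.Ioo 0 ε) ≠ ⊤ :=
    ne_top_of_le_ne_top (by simp) (measure_mono (Set.inter_subset_right (s := toMeasurable volume B)))
  rw [e1, measure_sdiff Set.inter_subset_right
    ((measurableSet_toMeasurable _ _).inter measurableSet_Ioo).nullMeasurableSet hfin, e2,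
    ENNReal.toReal_sub_of_le (e2 ▸ measure_mono Set.inter_subset_right) (by simp), Real.volume_Ioo,
    ENNReal.toReal_ofReal (by linarith [hε.1]), sub_zero, sub_div, div_self hε.1.ne']

variable {ι κ : Type} [Fintype ι] [Fintype κ] [DecidableEq ι] [DecidableEq κ]

lemma summable_wt_one : Summable fun n : ℤ => ((1 + |(n : ℝ)|) ^ 2)⁻¹ := by
  have h : Summable fun n : ℕ => ((1 + (n : ℝ)) ^ 2)⁻¹ := by
    have := (summable_nat_add_iff 1).mpr (Real.summable_nat_pow_inv.mpr (by norm_num : 1 < 2))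
    refine this.congr fun n => ?_
    push_cast
    rw [add_comm]
  refine Summable.of_nat_of_neg (by simpa using h) (by simpa using h)

lemma summable_pi_prod {g : ℤ → ℝ} (h0 : ∀ n, 0 ≤ g n) (hg : Summable g) :
    Summable fun ν : ι → ℤ => ∏ k, g (ν k) := by
  refine summable_of_sum_le (c := ∏ _k : ι, ∑' n, g n)
    (fun ν => Finset.prod_nonneg fun k _ => h0 _) fun s => ?_
  calc ∑ ν ∈ s, ∏ k, g (ν k)
      ≤ ∑ ν ∈ Fintype.piFinset fun k => s.image fun ν => ν k, ∏ k, g (ν k) := by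
        refine Finset.sum_le_sum_of_subset_of_nonneg (fun ν hν => ?_)
          fun ν _ _ => Finset.prod_nonneg fun k _ => h0 _
        rw [Fintype.mem_piFinset]
        exact fun k => Finset.mem_image_of_mem _ hν
    _ = ∏ k, ∑ n ∈ s.image fun ν => ν k, g n := (Finset.prod_univ_sum _ _).symm
    _ ≤ _ := Finset.prod_le_prod (fun k _ => Finset.sum_nonneg fun _ _ => h0 _) fun k _ =>
        hg.sum_le_tsum _ fun _ _ => h0 _

lemma summable_wt : Summable (wt : (ι → ℤ) → ℝ) := by
  have h := summable_pi_prod (ι := ι) (g := fun n : ℤ => ((1 + |(n : ℝ)|) ^ 2)⁻¹)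
    (fun n => by positivity) summable_wt_one
  exact h.congr fun ν => by rw [wt]

lemma abs_sub_le_of_resonance {x y a μ μ' m k d : ℝ} (hx : 0 < x) (hy : 0 < y)
    (hm : m + k ≤ |μ|) (hl : |μ - μ'| * max x y ≤ k * |x - y|) (h1 : |a * x⁻¹ + μ| ≤ d)
    (h2 : |a * y⁻¹ + μ'| ≤ d) : m * |x - y| ≤ 2 * d * max x y := by
  have hd : 0 ≤ d := (abs_nonneg _).trans h1
  have h1' : |a + x * μ| ≤ d * x := by
    have : a + x * μ = (a * x⁻¹ + μ) * x := by field_simp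
    rw [this, abs_mul, abs_of_pos hx]
    gcongr
  have h2' : |a + y * μ'| ≤ d * y := by
    have : a + y * μ' = (a * y⁻¹ + μ') * y := by field_simp
    rw [this, abs_mul, abs_of_pos hy]
    gcongr
  have h3 : |(x - y) * μ| ≤ |a + x * μ| + |a + y * μ'| + y * |μ - μ'| := by
    have e : (x - y) * μ = (a + x * μ) - (a + y * μ') - y * (μ - μ') := by ring
    rw [e]
    refine (abs_sub _ _).trans ?_
    rw [abs_mul y, abs_of_pos hy]
    gcongr
    exact abs_sub _ _
  rw [abs_mul] at h3
  have h4 : y * |μ - μ'| ≤ |μ - μ'| * max x y := by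
    rw [mul_comm]
    gcongr
    exact le_max_right _ _
  have h5 : d * x ≤ d * max x y := by gcongr; exact le_max_left _ _
  have h6 : d * y ≤ d * max x y := by gcongr; exact le_max_right _ _
  have h7 : |x - y| * (m + k) ≤ |x - y| * |μ| := by gcongr
  nlinarith

variable {P : Par} {β₀ : κ → ℝ} {f : Sm (ι ⊕ κ)} {om : ι → ℝ} {y0 : Matrix (Ph ι κ) (κ ⊕ κ) ℂ}
  {q1 q2 : Matrix ι (Ph ι κ) ℂ} {q3 : Matrix (κ ⊕ κ) (Ph ι κ) ℂ} {lam0 : κ ⊕ κ → ℂ}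

/-- The combinations of the normal frequencies which enter the nonresonance conditions. -/
noncomputable def mu (S : St ι κ) (q : (κ ⊕ κ) ⊕ (κ ⊕ κ) × (κ ⊕ κ)) (x : ℝ) : ℝ :=
  Sum.elim (fun j => (S.lam j x).im) (fun ij => (S.lam ij.2 x - S.lam ij.1 x).im) q

/-- The parameters `ε = η²` lost at the `n`-th step because of one resonance. -/
def resSet (P : Par) (om : ι → ℝ) (n : ℕ) (S : St ι κ) (ν : ι → ℤ)
    (q : (κ ⊕ κ) ⊕ (κ ⊕ κ) × (κ ⊕ κ)) : Set ℝ :=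
  {e | ν ≠ 0 ∧ (∀ ij, q = Sum.inr ij → ij.1 ≠ ij.2) ∧ √e ∈ S.G ∧
    |dotZ ν om * (√e)⁻¹ + mu S q √e| < P.γn n * wt ν}

lemma mem_iUnion_resSet {S : ℕ → St ι κ} (hS : ∀ n, (S (n + 1)).G = nrSet P om n (S n)) {e : ℝ}
    (h0 : √e ∈ (S 0).G) (h : √e ∉ ⋂ n, (S n).G) :
    ∃ n ν q, e ∈ resSet P om n (S n) ν q := by
  by_contra hcon
  push Not at hcon
  refine h (Set.mem_iInter.mpr fun n => ?_)
  induction n with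
  | zero => exact h0
  | succ n ih =>
    rw [hS]
    refine ⟨ih, fun ν hν => ⟨fun j => ?_, fun i j hij => ?_⟩⟩
    · by_contra hlt
      exact hcon n ν (Sum.inl j) ⟨hν, (fun _ h => nomatch h), ih, not_le.mp hlt⟩
    · by_contra hlt
      refine hcon n ν (Sum.inr (i, j)) ⟨hν, fun ij h => ?_, ih, not_le.mp hlt⟩
      cases h
      exact hij

lemma Good.mu_bounds (hP : P.Ok (Fintype.card ι)) (hH : Hyp P f om y0 q1 q2 q3 lam0) {n : ℕ}
    {S : St ι κ} (hS : Good P β₀ f om y0 lam0 n S) {q : (κ ⊕ κ) ⊕ (κ ⊕ κ) × (κ ⊕ κ)}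
    (hq : ∀ ij, q = Sum.inr ij → ij.1 ≠ ij.2) :
    (∀ x ∈ S.G, P.m₀ / 2 + P.m₀ / 4 ≤ |mu S q x|) ∧ (∀ x ∈ S.G, |mu S q x| ≤ 2 * P.C) ∧
      ∀ x ∈ S.G, ∀ y ∈ S.G, |mu S q x - mu S q y| * max x y ≤ P.m₀ / 4 * |x - y| := by
  have hkm := hP.k_m
  have hk := hP.k_pos
  have hkk := hP.kn_le n
  have hb : ∀ j x, x ∈ S.G → ‖S.lam j x - lam0 j‖ ≤ P.k := fun j x hx => by
    have := (hS.lam j).1 ⟨x, hx⟩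
    simp only [Pi.one_apply, mul_one] at this
    linarith
  have hpos : ∀ x : S.G, 0 < x.1 := fun x => (hS.sub x.2).1
  have hl : ∀ j, ∀ x ∈ S.G, ∀ y ∈ S.G, ‖S.lam j x - S.lam j y‖ * max x y ≤ P.k * |x - y| := by
    intro j x hx y hy
    have h1 := (hS.lam j).2 ⟨x, hx⟩ ⟨y, hy⟩
    simp only [Pi.one_apply, max_self, mul_one, sub_sub_sub_cancel_right] at h1
    have h3 := relDist_nonneg hpos ⟨x, hx⟩ ⟨y, hy⟩
    have h4 := relDist_mul_max hpos ⟨x, hx⟩ ⟨y, hy⟩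
    have h5 : ‖S.lam j x - S.lam j y‖ ≤ P.k * relDist (Subtype.val : S.G → ℝ) ⟨x, hx⟩ ⟨y, hy⟩ := by
      nlinarith
    have h6 : 0 < max x y := lt_of_lt_of_le (hpos ⟨x, hx⟩) (le_max_left _ _)
    calc ‖S.lam j x - S.lam j y‖ * max x y
        ≤ P.k * relDist (Subtype.val : S.G → ℝ) ⟨x, hx⟩ ⟨y, hy⟩ * max x y := by gcongr
      _ = P.k * (relDist (Subtype.val : S.G → ℝ) ⟨x, hx⟩ ⟨y, hy⟩ * max x y) := by ring
      _ = _ := by rw [h4]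
  have him : ∀ z : ℂ, |z.im| ≤ ‖z‖ := Complex.abs_im_le_norm
  have hC : ∀ j x, x ∈ S.G → ‖S.lam j x‖ ≤ P.C := fun j x hx => by
    have h2 := norm_add_le (S.lam j x - lam0 j) (lam0 j)
    rw [sub_add_cancel] at h2
    linarith [hH.lam_le j, hb j x hx]
  have hC0 := hk.le.trans hP.k_C
  rcases q with j | ⟨i, j⟩
  · refine ⟨fun x hx => ?_, fun x hx => ?_, fun x hx y hy => ?_⟩
    · have h1 := (him (S.lam j x - lam0 j)).trans (hb j x hx)
      rw [Complex.sub_im] at h1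
      have h4 := abs_sub_abs_le_abs_sub (lam0 j).im (S.lam j x).im
      rw [abs_sub_comm] at h4
      have h3 := hH.lam_ge j
      simp only [mu, Sum.elim_inl]
      linarith
    · exact (him _).trans (by linarith [hC j x hx])
    · have h6 : 0 < max x y := lt_of_lt_of_le (hpos ⟨x, hx⟩) (le_max_left _ _)
      refine le_trans ?_ ((hl j x hx y hy).trans ?_)
      · simp only [mu, Sum.elim_inl, ← Complex.sub_im]
        gcongr
        exact him _
      · gcongr
        linarith
  · have hij := hq _ rfl
    refine ⟨fun x hx => ?_, fun x hx => ?_, fun x hx y hy => ?_⟩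
    · have h1 := (him (S.lam j x - lam0 j)).trans (hb j x hx)
      have h1' := (him (S.lam i x - lam0 i)).trans (hb i x hx)
      have h3 := hH.sub_ge i j hij
      have h4 := abs_sub_abs_le_abs_sub (lam0 j - lam0 i).im (S.lam j x - S.lam i x).im
      have h5 : (lam0 j - lam0 i).im - (S.lam j x - S.lam i x).im
          = (S.lam i x - lam0 i).im - (S.lam j x - lam0 j).im := by simp; ring
      have h6 := abs_sub (S.lam i x - lam0 i).im (S.lam j x - lam0 j).im
      rw [h5] at h4
      simp only [mu, Sum.elim_inr]
      linarith
    · refine (him _).trans ((norm_sub_le _ _).trans ?_)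
      linarith [hC j x hx, hC i x hx]
    · have h6 : 0 < max x y := lt_of_lt_of_le (hpos ⟨x, hx⟩) (le_max_left _ _)
      have e : mu S (Sum.inr (i, j)) x - mu S (Sum.inr (i, j)) y
          = (S.lam j x - S.lam j y).im - (S.lam i x - S.lam i y).im := by
        simp [mu]; ring
      have h7 : |mu S (Sum.inr (i, j)) x - mu S (Sum.inr (i, j)) y|
          ≤ ‖S.lam j x - S.lam j y‖ + ‖S.lam i x - S.lam i y‖ := by
        rw [e]
        exact (abs_sub _ _).trans (add_le_add (him _) (him _))
      have h8 := mul_le_mul_of_nonneg_right h7 h6.le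
      have h9 : 0 ≤ |x - y| := abs_nonneg _
      have := hl j x hx y hy
      have := hl i x hx y hy
      nlinarith

/-- The size of one resonance. -/
lemma Good.volume_resSet_le (hP : P.Ok (Fintype.card ι)) (hH : Hyp P f om y0 q1 q2 q3 lam0) {n : ℕ}
    {S : St ι κ} (hS : Good P β₀ f om y0 lam0 n S) (ν : ι → ℤ) (q : (κ ⊕ κ) ⊕ (κ ⊕ κ) × (κ ⊕ κ))
    (ε : ℝ) : volume (resSet P om n S ν q ∩ Set.Ioo 0 ε)
      ≤ ENNReal.ofReal (8 / P.m₀ * (P.γn n * wt ν) * ε) := by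
  have hm₀ : 0 < P.m₀ := by linarith [hP.k_m, hP.k_pos]
  refine (Real.volume_le_diam _).trans (Metric.ediam_le fun e he e' he' => ?_)
  rw [edist_dist, Real.dist_eq]
  refine ENNReal.ofReal_le_ofReal ?_
  obtain ⟨⟨-, hq, hG, hr⟩, he0, heε⟩ := he
  obtain ⟨⟨-, -, hG', hr'⟩, he0', heε'⟩ := he'
  obtain ⟨h1, -, h3⟩ := hS.mu_bounds hP hH hq
  set x := √e with hx
  set y := √e' with hy
  have hx0 : 0 < x := Real.sqrt_pos.mpr he0
  have hy0 : 0 < y := Real.sqrt_pos.mpr he0'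
  have h4 := abs_sub_le_of_resonance hx0 hy0 (h1 x hG) (h3 x hG y hG') hr.le hr'.le
  set d := P.γn n * wt ν
  have hd : 0 ≤ d := (abs_nonneg _).trans hr.le
  have hex : e = x ^ 2 := (Real.sq_sqrt he0.le).symm
  have hey : e' = y ^ 2 := (Real.sq_sqrt he0'.le).symm
  have h5 : |e - e'| = |x - y| * (x + y) := by
    rw [hex, hey, show x ^ 2 - y ^ 2 = (x - y) * (x + y) by ring, abs_mul,
      abs_of_pos (by linarith : 0 < x + y)]
  have h6 : x + y ≤ 2 * max x y := by linarith [le_max_left x y, le_max_right x y]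
  have h7 : max x y ^ 2 ≤ ε := by
    rcases max_choice x y with h | h <;> rw [h]
    · rw [← hex]; exact heε.le
    · rw [← hey]; exact heε'.le
  have h8 : |x - y| ≤ 4 / P.m₀ * d * max x y := by
    rw [div_mul_eq_mul_div, div_mul_eq_mul_div, le_div_iff₀ hm₀]
    linarith
  have h9 : 0 < max x y := lt_of_lt_of_le hx0 (le_max_left _ _)
  calc |e - e'| = |x - y| * (x + y) := h5
    _ ≤ (4 / P.m₀ * d * max x y) * (2 * max x y) := by gcongr
    _ = 8 / P.m₀ * d * max x y ^ 2 := by ring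
    _ ≤ _ := by gcongr

/-- Resonances stay away from `0`. -/
lemma Good.resSet_inter_eq_empty (hP : P.Ok (Fintype.card ι)) (hH : Hyp P f om y0 q1 q2 q3 lam0)
    {n : ℕ} {S : St ι κ} (hS : Good P β₀ f om y0 lam0 n S) (ν : ι → ℤ)
    (q : (κ ⊕ κ) ⊕ (κ ⊕ κ) × (κ ⊕ κ)) :
    ∃ δ, 0 < δ ∧ resSet P om n S ν q ∩ Set.Ioo 0 δ = ∅ := by
  by_cases hν : ν = 0
  · refine ⟨1, one_pos, Set.eq_empty_of_forall_notMem fun e he => he.1.1 hν⟩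
  have hC := hP.k_pos.le.trans hP.k_C
  have hom : 0 < |dotZ ν om| := lt_of_lt_of_le (mul_pos hP.C₀_pos
    (Real.rpow_pos_of_pos (zero_lt_one.trans_le (one_le_l1 hν)) _)) (hH.dio ν hν)
  have hd : P.γn n * wt ν ≤ 1 := by
    have h1 : P.γn n ≤ 1 := by
      have h2 : ((1 : ℝ) / 2) ^ n ≤ 1 := pow_le_one₀ (by norm_num) (by norm_num)
      have := hP.γ_pos
      have := hP.γ_le
      unfold Par.γn
      nlinarith
    have h3 := wt_le_one ν
    have h4 := wt_pos ν
    nlinarith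
  have hB : 0 < 1 + 2 * P.C := by linarith
  refine ⟨(|dotZ ν om| / (1 + 2 * P.C)) ^ 2, by positivity,
    Set.eq_empty_of_forall_notMem fun e he => ?_⟩
  obtain ⟨⟨-, hq, hG, hr⟩, he0, heδ⟩ := he
  obtain ⟨-, h2, -⟩ := hS.mu_bounds hP hH hq
  have hx0 : 0 < √e := Real.sqrt_pos.mpr he0
  have h3 : √e < |dotZ ν om| / (1 + 2 * P.C) := (Real.sqrt_lt' (by positivity)).mpr heδ
  rw [lt_div_iff₀ hB] at h3
  have h4 : |dotZ ν om * (√e)⁻¹| ≤ |dotZ ν om * (√e)⁻¹ + mu S q √e| + |mu S q √e| := by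
    have := abs_sub (dotZ ν om * (√e)⁻¹ + mu S q √e) (mu S q √e)
    rwa [add_sub_cancel_right] at this
  have h5 := h2 _ hG
  rw [abs_mul, abs_inv, abs_of_pos hx0] at h4
  have h6 : |dotZ ν om| * (√e)⁻¹ ≤ 1 + 2 * P.C := by linarith
  rw [mul_inv_le_iff₀ hx0] at h6
  linarith

/-- The set of nonresonant `ε` has density `1` at `0`. -/
theorem exists_parameters (hP : P.Ok (Fintype.card ι)) (hH : Hyp P f om y0 q1 q2 q3 lam0)
    {S : ℕ → St ι κ} (hS : ∀ n, Good P β₀ f om y0 lam0 n (S n))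
    (hG : ∀ n, (S (n + 1)).G = nrSet P om n (S n)) (h0 : (S 0).G = Set.Ioo 0 P.ηb) :
    ∃ E : Set ℝ, MeasurableSet E ∧ E ⊆ Set.Ioo 0 (P.ηb ^ 2) ∧ (∀ e ∈ E, √e ∈ ⋂ n, (S n).G) ∧
      Tendsto (fun ε => (volume (E ∩ Set.Ioo 0 ε)).toReal / ε) (nhdsWithin 0 (Set.Ioi 0))
        (nhds 1) := by
  have hm₀ : 0 < P.m₀ := by linarith [hP.k_m, hP.k_pos]
  have hγ := hP.γ_pos
  have hη := hP.ηb_pos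
  let R : ℕ × (ι → ℤ) × ((κ ⊕ κ) ⊕ (κ ⊕ κ) × (κ ⊕ κ)) → Set ℝ := fun a =>
    resSet P om a.1 (S a.1) a.2.1 a.2.2
  let c : ℕ × (ι → ℤ) × ((κ ⊕ κ) ⊕ (κ ⊕ κ) × (κ ⊕ κ)) → ℝ := fun a =>
    8 / P.m₀ * (P.γn a.1 * wt a.2.1)
  have hc : Summable c := by
    have h1 : Summable fun n : ℕ => P.γn n := (summable_geometric_two).mul_left P.γ
    have h2 : Summable fun b : (ι → ℤ) × ((κ ⊕ κ) ⊕ (κ ⊕ κ) × (κ ⊕ κ)) => wt b.1 * (1 : ℝ) :=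
      summable_wt.mul_of_nonneg (g := fun _ => (1 : ℝ)) (Summable.of_finite)
        (fun ν => (wt_pos ν).le) fun _ => zero_le_one
    simp only [mul_one] at h2
    have h3 := h1.mul_of_nonneg h2 (fun n => by unfold Par.γn; positivity)
      fun b => (wt_pos b.1).le
    exact h3.mul_left (8 / P.m₀)
  have hD := tendsto_density_zero (R := R) hc (fun a ε _ => (hS a.1).volume_resSet_le hP hH _ _ ε)
    (fun a => (hS a.1).resSet_inter_eq_empty hP hH _ _) fun a => by
      have := (wt_pos a.2.1).le
      have : 0 ≤ P.γn a.1 := by unfold Par.γn; positivity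
      positivity
  obtain ⟨E, hE, hsub, hE1⟩ := exists_measurable_density_one (εb := P.ηb ^ 2) (by positivity) hD
  refine ⟨E, hE, fun e he => (hsub he).1, fun e he => ?_, hE1⟩
  by_contra hcon
  obtain ⟨⟨he0, he1⟩, hnot⟩ := hsub he
  obtain ⟨n, ν, q, h⟩ := mem_iUnion_resSet hG (e := e) (by
    rw [h0]
    exact ⟨Real.sqrt_pos.mpr he0, (Real.sqrt_lt' hη).mpr he1⟩) hcon
  exact hnot (Set.mem_iUnion.mpr ⟨(n, ν, q), h⟩)

end measure

open scoped NNReal ENNReal in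
lemma exists_uniform_powerSeries {E F : Type*} [NormedAddCommGroup E] [NormedSpace ℝ E]
    [NormedAddCommGroup F] [NormedSpace ℝ F] [CompleteSpace F] {g : E → F}
    (hg : AnalyticOnNhd ℝ g Set.univ) {K : Set E} (hK : IsCompact K) :
    ∃ C : ℝ≥0, ∃ ρ : ℝ≥0, 0 < ρ ∧ ∀ y ∈ K, ∃ p : FormalMultilinearSeries ℝ E F,
      HasFPowerSeriesOnBall g p y ρ ∧ ∀ m, ‖p m‖₊ * ρ ^ m ≤ C := by
  refine hK.induction_on (p := fun K => ∃ C : ℝ≥0, ∃ ρ : ℝ≥0, 0 < ρ ∧ ∀ y ∈ K,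
    ∃ p : FormalMultilinearSeries ℝ E F,
      HasFPowerSeriesOnBall g p y ρ ∧ ∀ m, ‖p m‖₊ * ρ ^ m ≤ C) ?_ ?_ ?_ ?_
  · exact ⟨0, 1, one_pos, by simp⟩
  · rintro s t hst ⟨C, ρ, hρ, h⟩
    exact ⟨C, ρ, hρ, fun y hy => h y (hst hy)⟩
  · rintro s t ⟨C, ρ, hρ, h⟩ ⟨C', ρ', hρ', h'⟩
    refine ⟨max C C', min ρ ρ', lt_min hρ hρ', fun y hy => ?_⟩
    rcases hy with hy | hy
    · obtain ⟨p, hp, hb⟩ := h y hy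
      refine ⟨p, hp.mono (by simpa using ⟨hρ, hρ'⟩) (by simp), fun m => le_trans ?_ (le_max_left _ _)⟩
      exact le_trans (by gcongr; exact min_le_left _ _) (hb m)
    · obtain ⟨p, hp, hb⟩ := h' y hy
      refine ⟨p, hp.mono (by simpa using ⟨hρ, hρ'⟩) (by simp), fun m => le_trans ?_ (le_max_right _ _)⟩
      exact le_trans (by gcongr; exact min_le_right _ _) (hb m)
  · intro x _
    obtain ⟨p, R, hp⟩ := hg x trivial
    obtain ⟨ρ, hρ0, hρ⟩ := ENNReal.lt_iff_exists_nnreal_btwn.1 hp.r_pos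
    have hρ0' : 0 < ρ := by exact_mod_cast hρ0
    have h2 : ((ρ / 2 : ℝ≥0) : ℝ≥0∞) + (ρ / 2 : ℝ≥0) < R := by
      rw [← ENNReal.coe_add, add_halves]; exact hρ
    have h3 := p.changeOriginSeries_summable_aux₁ (h2.trans_le hp.r_le)
    refine ⟨Metric.ball x (ρ / 2 : ℝ≥0), mem_nhdsWithin_of_mem_nhds
      (Metric.ball_mem_nhds _ (by positivity)),
      ∑' s : Σ k l : ℕ, { s : Finset (Fin (k + l)) // s.card = l },
        ‖p (s.1 + s.2.1)‖₊ * (ρ / 2) ^ s.2.1 * (ρ / 2) ^ s.1, ρ / 2, by positivity, fun y hy =>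
        ⟨p.changeOrigin (y - x), ?_, fun m => ?_⟩⟩
    all_goals
      have hyx : ‖y - x‖₊ < ρ / 2 := by
        rw [Metric.mem_ball, dist_eq_norm] at hy; exact_mod_cast hy
      have hyR : (‖y - x‖₊ : ℝ≥0∞) < R :=
        (ENNReal.coe_lt_coe.2 hyx).trans_le (le_self_add.trans h2.le)
    · have h := hp.changeOrigin hyR
      rw [add_sub_cancel] at h
      refine h.mono (by positivity) ?_
      refine ENNReal.le_sub_of_add_le_left (by simp) ?_
      refine le_trans ?_ h2.le
      gcongr
    · calc ‖p.changeOrigin (y - x) m‖₊ * (ρ / 2) ^ m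
          ≤ (∑' s : Σ l : ℕ, { s : Finset (Fin (m + l)) // s.card = l },
              ‖p (m + s.1)‖₊ * (ρ / 2) ^ s.1) * (ρ / 2) ^ m := by
            gcongr
            refine (p.nnnorm_changeOrigin_le m (hyR.trans_le hp.r_le)).trans ?_
            refine Summable.tsum_le_tsum (fun s => ?_)
              (p.changeOriginSeries_summable_aux₂ (hyR.trans_le hp.r_le) m)
              (p.changeOriginSeries_summable_aux₂ ((le_self_add.trans_lt h2).trans_le hp.r_le) m)
            gcongr
        _ = ∑' s : Σ l : ℕ, { s : Finset (Fin (m + l)) // s.card = l },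
              ‖p (m + s.1)‖₊ * (ρ / 2) ^ s.1 * (ρ / 2) ^ m := NNReal.tsum_mul_right _ _ |>.symm
        _ ≤ ∑' k, ∑' s : Σ l : ℕ, { s : Finset (Fin (k + l)) // s.card = l },
              ‖p (k + s.1)‖₊ * (ρ / 2) ^ s.1 * (ρ / 2) ^ k :=
            (NNReal.summable_sigma.1 h3).2.le_tsum m (fun _ _ => zero_le)
        _ = _ := (h3.tsum_sigma' (NNReal.summable_sigma.1 h3).1).symm

/-- The half-open unit box. -/
def ubox (d : Type*) : Set (d → ℝ) := {x | ∀ i, x i ∈ Set.Ioc (0 : ℝ) 1}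

variable {d : Type} [Fintype d]

lemma ubox_subset : ubox d ⊆ Set.univ.pi fun _ => Set.Icc (0 : ℝ) 1 :=
  fun _ hx i _ => Set.Ioc_subset_Icc_self (hx i)

lemma volume_ubox : volume (ubox d) = 1 := by
  have h : ubox d = Set.univ.pi fun _ => Set.Ioc (0 : ℝ) 1 := by ext; simp [ubox]
  rw [h, Real.volume_pi_Ioc]
  simp

lemma measurableSet_ubox : MeasurableSet (ubox d) := by
  have h : ubox d = Set.univ.pi fun _ => Set.Ioc (0 : ℝ) 1 := by ext; simp [ubox]
  rw [h]
  exact MeasurableSet.univ_pi fun _ => measurableSet_Ioc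

lemma mFourier_coe (k : d → ℤ) (x : d → ℝ) :
    UnitAddTorus.mFourier k (fun i => (x i : UnitAddCircle)) = chr k ((2 * π) • x) := by
  simp only [UnitAddTorus.mFourier, ContinuousMap.coe_mk, fourier_coe_apply, chr, dotZ,
    ← Complex.exp_sum, Complex.ofReal_sum, Finset.sum_mul]
  congr 1
  refine Finset.sum_congr rfl fun i _ => ?_
  simp
  ring

lemma mFourierCoeff_translate [DecidableEq d] {g : (d → ℝ) → ℂ} {H : UnitAddTorus d → ℂ}
    (hH : ∀ y : d → ℝ, H (fun i => (y i : UnitAddCircle)) = g y) (k : d → ℤ) (v : d → ℝ) :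
    ∫ x in ubox d, chr (-k) ((2 * π) • x) * g (x + v)
      = chr k ((2 * π) • v) * UnitAddTorus.mFourierCoeff H k := by
  rw [UnitAddTorus.mFourierCoeff_eq_integral H k v]
  have hm := (measurePreserving_add_right volume v).setIntegral_preimage_emb
    (MeasurableEquiv.addRight v).measurableEmbedding
    (fun x => UnitAddTorus.mFourier (-k) (fun i => (x i : UnitAddCircle)) • H fun i => (x i : UnitAddCircle))
    {x | ∀ i, x i ∈ Set.Ioc (v i) (v i + 1)}
  have h : (fun x => x + v) ⁻¹' {x | ∀ i, x i ∈ Set.Ioc (v i) (v i + 1)} = ubox d := by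
    ext x
    simp only [ubox, Set.mem_preimage, Set.mem_ofPred_eq, Pi.add_apply, Set.mem_Ioc]
    exact forall_congr' fun i => by constructor <;> rintro ⟨h1, h2⟩ <;> constructor <;> linarith
  rw [← hm, h, ← integral_const_mul]
  congr 1
  ext x
  rw [mFourier_coe, hH, smul_add, chr_add_right, smul_eq_mul, mul_assoc, mul_left_comm (chr k _),
    ← mul_assoc (chr k _), ← chr_add_left]
  simp

lemma hasSum_congr_of_eq {α : Type*} {f g : α → ℂ} {a b : ℂ} (h : HasSum f a) (hfg : ∀ m, g m = f m)
    (hab : b = a) : HasSum g b := by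
  rw [hab, funext hfg]; exact h

lemma hasSum_unique_coeff {F : ℝ → ℂ} {a b : ℕ → ℂ} {ρ ρ' : ℝ} (hρ : 0 < ρ) (hρ' : 0 < ρ')
    (ha : ∀ t, |t| < ρ → HasSum (fun m => t ^ m • a m) (F t))
    (hb : ∀ t, |t| < ρ' → HasSum (fun m => t ^ m • b m) (F t)) (m : ℕ) : a m = b m := by
  have key : ∀ {a : ℕ → ℂ} {ρ : ℝ}, 0 < ρ →
      (∀ t, |t| < ρ → HasSum (fun m => t ^ m • a m) (F t)) →
      HasFPowerSeriesAt F (fun m => ContinuousMultilinearMap.mkPiRing ℝ (Fin m) (a m)) 0 := by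
    intro a ρ hρ h
    refine hasFPowerSeriesAt_iff.2 ?_
    filter_upwards [Metric.ball_mem_nhds (0 : ℝ) hρ] with t ht
    have := h t (by simpa using ht)
    simpa [FormalMultilinearSeries.coeff] using this
  have h := congrFun ((key hρ ha).eq_formalMultilinearSeries (key hρ' hb)) m
  have h2 := congrArg (fun q => q fun _ => (1 : ℝ)) h
  simpa using h2

lemma exists_mFourierCoeff_decay {g : (d → ℝ) → ℂ} (hg : AnalyticOnNhd ℝ g Set.univ)
    {H : UnitAddTorus d → ℂ} (hH : ∀ y : d → ℝ, H (fun i => (y i : UnitAddCircle)) = g y) :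
    ∃ C ρ : ℝ, 0 ≤ C ∧ 0 < ρ ∧ ∀ k j, ‖UnitAddTorus.mFourierCoeff H k‖ * Real.exp (ρ * |(k j : ℝ)|) ≤ C := by
  classical
  obtain ⟨C, ρ, hρ, h⟩ := exists_uniform_powerSeries hg
    (isCompact_univ_pi fun _ : d => isCompact_Icc (a := (0 : ℝ)) (b := 1))
  have hρ' : (0 : ℝ) < ρ := hρ
  refine ⟨2 * C, π * ρ, by positivity, by positivity, fun k j => ?_⟩
  set c := UnitAddTorus.mFourierCoeff H k
  set e : d → ℝ := Pi.single j 1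
  have he : ‖e‖ = 1 := by simp [e, Pi.norm_single]
  set A : ℕ → (d → ℝ) → ℂ := fun m x => (m.factorial : ℝ)⁻¹ • iteratedFDeriv ℝ m g x (fun _ => e)
  set b : ℕ → ℂ := fun m => ∫ x in ubox d, chr (-k) ((2 * π) • x) * A m x
  have hA : ∀ m, ∀ x ∈ ubox d, ‖A m x‖ ≤ C * ((ρ : ℝ)⁻¹) ^ m := by
    intro m x hx
    obtain ⟨p, hp, hb⟩ := h x (ubox_subset hx)
    have h1 : A m x = p m fun _ => e := by
      simp only [A]
      rw [← hp.factorial_smul, ← Nat.cast_smul_eq_nsmul ℝ, smul_smul, inv_mul_cancel₀ (by positivity), one_smul]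
    have h2 : ‖p m‖ * (ρ : ℝ) ^ m ≤ C := by exact_mod_cast hb m
    rw [h1, inv_pow, ← div_eq_mul_inv, le_div_iff₀ (by positivity)]
    refine le_trans ?_ h2
    gcongr
    refine ((p m).le_opNorm _).trans ?_
    simp [he]
  have hAc : ∀ m, Continuous (A m) := by
    intro m
    have h1 : ContDiff ℝ ω g := hg.contDiff
    have h2 := (h1.of_le (le_top : (m : WithTop ℕ∞) ≤ ω)).continuous_iteratedFDeriv (m := m) le_rfl
    have h3 : Continuous fun x => iteratedFDeriv ℝ m g x (fun _ => e) :=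
      (ContinuousMultilinearMap.apply ℝ (fun _ : Fin m => d → ℝ) ℂ (fun _ => e)).continuous.comp h2
    simp only [A]
    fun_prop
  have hcc : Continuous fun x : d → ℝ => chr (-k) ((2 * π) • x) :=
    (continuous_chr _).comp (continuous_const_smul _)
  have hfin : volume (ubox d) < ⊤ := by simp [volume_ubox]
  have hub : ∀ {G : (d → ℝ) → ℂ}, Continuous G → IntegrableOn G (ubox d) := by
    intro G hG
    exact (hG.continuousOn.integrableOn_compact
      (isCompact_univ_pi fun _ : d => isCompact_Icc (a := (0 : ℝ)) (b := 1))).mono_set ubox_subset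
  have hb : ∀ m, ‖b m‖ ≤ C * ((ρ : ℝ)⁻¹) ^ m := by
    intro m
    have := norm_setIntegral_le_of_norm_le_const (C := C * ((ρ : ℝ)⁻¹) ^ m)
      (f := fun x => chr (-k) ((2 * π) • x) * A m x) hfin (fun x hx => by
        rw [norm_mul, norm_chr, one_mul]; exact hA m x hx)
    simpa [Measure.real, volume_ubox] using this
  have hs1 : ∀ t : ℝ, |t| < ρ → HasSum (fun m => t ^ m • b m) (chr k ((2 * π) • t • e) * c) := by
    intro t ht
    rw [← mFourierCoeff_translate hH]
    have hq : Summable fun m => C * (|t| * (ρ : ℝ)⁻¹) ^ m := by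
      refine (summable_geometric_of_lt_one (by positivity) ?_).mul_left _
      rw [← div_eq_mul_inv, div_lt_one hρ']; exact ht
    have hF : ∀ m, ∀ x ∈ ubox d, ‖chr (-k) ((2 * π) • x) * (t ^ m • A m x)‖ ≤ C * (|t| * (ρ : ℝ)⁻¹) ^ m := by
      intro m x hx
      rw [norm_mul, norm_chr, one_mul, norm_smul, norm_pow, Real.norm_eq_abs, mul_pow, mul_left_comm]
      exact mul_le_mul_of_nonneg_left (hA m x hx) (by positivity)
    have hcm : ∀ m, Continuous fun x => chr (-k) ((2 * π) • x) * (t ^ m • A m x) :=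
      fun m => by have := hAc m; fun_prop
    have hI := hasSum_integral_of_summable_integral_norm (μ := volume.restrict (ubox d))
      (F := fun m x => chr (-k) ((2 * π) • x) * (t ^ m • A m x)) (fun m => hub (hcm m)) ?_
    · refine hasSum_congr_of_eq hI (fun m => ?_) ?_
      · rw [← integral_smul]
        congr 1
        ext x
        simp only [A, mul_smul_comm]
      · refine setIntegral_congr_fun measurableSet_ubox fun x hx => ?_
        obtain ⟨p, hp, -⟩ := h x (ubox_subset hx)
        have h1 := hp.hasSum_iteratedFDeriv (y := t • e) (by
          simp only [Metric.mem_eball, edist_zero_right]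
          rw [enorm_eq_nnnorm]
          have : ‖t • e‖₊ < ρ := by
            rw [← NNReal.coe_lt_coe]
            simpa [norm_smul, he] using ht
          exact_mod_cast this)
        rw [← (h1.mul_left (chr (-k) ((2 * π) • x))).tsum_eq]
        refine tsum_congr fun m => ?_
        have h2 := (iteratedFDeriv ℝ m g x).map_smul_univ (fun _ => t) (fun _ => e)
        simp only [Finset.prod_const, Finset.card_univ, Fintype.card_fin] at h2
        rw [h2, smul_comm]
    · refine hq.of_nonneg_of_le (fun m => integral_nonneg fun _ => norm_nonneg _) fun m => ?_
      have := setIntegral_mono_on (hub (hcm m)).norm (integrableOn_const (C := C * (|t| * (ρ : ℝ)⁻¹) ^ m) hfin.ne)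
        measurableSet_ubox (hF m)
      simpa [Measure.real, volume_ubox] using this
  have hs2 : ∀ t : ℝ, |t| < 1 → HasSum (fun m : ℕ => t ^ m • ((2 * π * k j * Complex.I) ^ m / m.factorial * c))
      (chr k ((2 * π) • t • e) * c) := by
    intro t _
    have h1 := (NormedSpace.expSeries_div_hasSum_exp ((2 * π * k j * Complex.I) * (t : ℂ))).mul_right c
    have h2 : chr k ((2 * π) • t • e) = Complex.exp ((2 * π * k j * Complex.I) * (t : ℂ)) := by
      simp only [chr, dotZ_smul_right, e, dotZ_single]
      push_cast
      ring_nf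
    rw [h2, Complex.exp_eq_exp_ℂ]
    refine hasSum_congr_of_eq h1 (fun m => ?_) rfl
    rw [mul_pow, Complex.real_smul]
    push_cast
    ring
  have hbm : ∀ m, ‖c‖ * ((2 * π * |(k j : ℝ)|) ^ m / m.factorial) ≤ C * ((ρ : ℝ)⁻¹) ^ m := by
    intro m
    have := hb m
    rw [hasSum_unique_coeff hρ' one_pos hs1 hs2 m] at this
    simpa [norm_mul, norm_pow, abs_of_pos pi_pos, mul_comm] using this
  have hl := (NormedSpace.expSeries_div_hasSum_exp (π * ρ * |(k j : ℝ)|)).mul_left ‖c‖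
  rw [← Real.exp_eq_exp_ℝ] at hl
  have hr := hasSum_geometric_two.mul_left (C : ℝ)
  rw [mul_comm (C : ℝ) 2] at hr
  refine hasSum_le (fun m => ?_) hl hr
  calc ‖c‖ * ((π * ρ * |(k j : ℝ)|) ^ m / m.factorial)
      = ‖c‖ * ((2 * π * |(k j : ℝ)|) ^ m / m.factorial) * ((1 / 2) ^ m * (ρ : ℝ) ^ m) := by
        rw [mul_assoc ‖c‖, div_mul_eq_mul_div, ← mul_pow, ← mul_pow]; ring_nf
    _ ≤ C * ((ρ : ℝ)⁻¹) ^ m * ((1 / 2) ^ m * (ρ : ℝ) ^ m) :=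
        mul_le_mul_of_nonneg_right (hbm m) (by positivity)
    _ = C * (1 / 2) ^ m := by
        rw [inv_pow]; field_simp

lemma periodic_zvec [DecidableEq d] {g : (d → ℝ) → ℂ} {T : ℝ} (hg : ∀ x i, g (x + Pi.single i T) = g x)
    (n : d → ℤ) (x : d → ℝ) : g (x + fun i => (n i : ℝ) * T) = g x := by
  have h1 : ∀ (m : ℤ) (i : d) (x : d → ℝ), g (x + Pi.single i ((m : ℝ) * T)) = g x := by
    intro m i x
    have h : Function.Periodic (fun t : ℝ => g (x + Pi.single i t)) T := fun t => by
      simp only [Pi.single_add, ← add_assoc, hg]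
    have h2 := h.int_mul m 0
    simpa using h2
  have h2 : ∀ S : Finset d, g (x + ∑ i ∈ S, Pi.single i ((n i : ℝ) * T)) = g x := by
    intro S
    induction S using Finset.induction_on with
    | empty => simp
    | insert i S hi ih => rw [Finset.sum_insert hi, add_comm (Pi.single i _), ← add_assoc, h1, ih]
  have h3 := h2 Finset.univ
  rwa [Finset.univ_sum_single] at h3

lemma exists_torus_lift [DecidableEq d] {g : (d → ℝ) → ℂ} (hc : Continuous g)
    (hg : ∀ x i, g (x + Pi.single i 1) = g x) :
    ∃ H : C(UnitAddTorus d, ℂ), ∀ y : d → ℝ, H (fun i => (y i : UnitAddCircle)) = g y := by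
  have hq : IsOpenQuotientMap (Pi.map fun (_ : d) (t : ℝ) => (t : UnitAddCircle)) :=
    IsOpenQuotientMap.piMap fun _ => QuotientAddGroup.isOpenQuotientMap_mk
  let q : C(d → ℝ, UnitAddTorus d) := ⟨_, hq.continuous⟩
  have hq' : Topology.IsQuotientMap q := hq.isQuotientMap
  have hf : Function.FactorsThrough (⟨g, hc⟩ : C(d → ℝ, ℂ)) q := by
    intro x y hxy
    have h : ∀ i, ∃ n : ℤ, x i = y i + n := by
      intro i
      have h1 : ((x i : ℝ) : UnitAddCircle) = (y i : ℝ) := congrFun hxy i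
      rw [eq_comm, QuotientAddGroup.eq, AddSubgroup.mem_zmultiples_iff] at h1
      obtain ⟨n, hn⟩ := h1
      exact ⟨n, by simp at hn; linarith⟩
    choose n hn using h
    have hx : x = y + fun i => (n i : ℝ) * 1 := by ext i; simp [hn i]
    simp only [ContinuousMap.coe_mk]
    rw [hx, periodic_zvec hg]
  exact ⟨hq'.lift ⟨g, hc⟩ hf, fun y => DFunLike.congr_fun (hq'.lift_comp ⟨g, hc⟩ hf) y⟩

lemma exists_fs [Nonempty d] [DecidableEq d] (φ : Sm d) (ha : AnalyticOnNhd ℝ φ.1 Set.univ)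
    (hp : ∀ x i, φ.1 (x + Pi.single i (2 * π)) = φ.1 x) :
    ∃ r M φh, 0 < r ∧ FS r M φ φh := by
  set g : (d → ℝ) → ℂ := fun x => φ.1 ((2 * π) • x)
  have hga : AnalyticOnNhd ℝ g Set.univ := by
    have h : AnalyticOnNhd ℝ (fun x : d → ℝ => (2 * π) • x) Set.univ :=
      ((2 * π) • ContinuousLinearMap.id ℝ (d → ℝ)).analyticOnNhd _
    exact ha.comp h fun _ _ => trivial
  have hgp : ∀ x i, g (x + Pi.single i 1) = g x := by
    intro x i
    simp only [g, smul_add]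
    rw [show (2 * π) • (Pi.single i 1 : d → ℝ) = Pi.single i (2 * π) by
      rw [← Pi.single_smul]; simp, hp]
  have hgc : Continuous g := continuousOn_univ.1 hga.continuousOn
  obtain ⟨H, hH⟩ := exists_torus_lift hgc hgp
  obtain ⟨C, ρ, hC, hρ, hd⟩ := exists_mFourierCoeff_decay hga hH
  set N : ℝ := (Fintype.card d : ℝ) with hN
  have hN0 : 0 < N := by simp [hN, Fintype.card_pos]
  set c := UnitAddTorus.mFourierCoeff (H : UnitAddTorus d → ℂ)
  have hdec : ∀ k, ‖c k‖ ≤ C * Real.exp (-(ρ / N) * l1 k) := by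
    intro k
    obtain ⟨j, hj⟩ : ∃ j, l1 k ≤ N * |(k j : ℝ)| := by
      by_contra! hcon
      have := Finset.sum_lt_sum_of_nonempty (Finset.univ_nonempty (α := d)) fun j _ => hcon j
      rw [← Finset.mul_sum, Finset.sum_const, Finset.card_univ, nsmul_eq_mul] at this
      exact lt_irrefl _ this
    have h1 := hd k j
    rw [← le_div_iff₀ (Real.exp_pos _), div_eq_mul_inv, ← Real.exp_neg] at h1
    refine h1.trans ?_
    gcongr
    rw [neg_mul]
    refine neg_le_neg ?_
    rw [div_mul_eq_mul_div, div_le_iff₀ hN0]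
    nlinarith
  set r := ρ / N / 2
  have hr : 0 < r := by positivity
  have hsum : Summable fun k => Real.exp (r * l1 k) * ‖c k‖ := by
    have h1 : Summable fun n : ℤ => Real.exp (-r * |(n : ℝ)|) := by
      have h0 : Summable fun n : ℕ => Real.exp (-r * |((n : ℤ) : ℝ)|) := by
        simpa [mul_comm] using Real.summable_exp_nat_mul_iff.2 (neg_neg_of_pos hr)
      exact Summable.of_nat_of_neg h0 (by simpa using h0)
    have h2 := summable_pi_prod (ι := d) (fun n => (Real.exp_pos _).le) h1
    refine (h2.mul_left C).of_nonneg_of_le (fun k => by positivity) fun k => ?_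
    rw [← Real.exp_sum, ← Finset.mul_sum]
    calc Real.exp (r * l1 k) * ‖c k‖ ≤ Real.exp (r * l1 k) * (C * Real.exp (-(ρ / N) * l1 k)) := by
          gcongr; exact hdec k
      _ = C * Real.exp (r * l1 k + -(ρ / N) * l1 k) := by rw [Real.exp_add]; ring
      _ = C * Real.exp (-r * l1 k) := by congr 2; simp only [r]; ring
  have hsc : Summable c := by
    refine Summable.of_norm (hsum.of_nonneg_of_le (fun _ => norm_nonneg _) fun k => ?_)
    exact le_mul_of_one_le_left (norm_nonneg _) (Real.one_le_exp (mul_nonneg hr.le (l1_nonneg k)))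
  refine ⟨r, _, c, hr, fun x => ?_, hsum, le_rfl⟩
  have h := UnitAddTorus.hasSum_mFourier_series_apply_of_summable hsc
    (fun i => (((2 * π)⁻¹ • x) i : UnitAddCircle))
  rw [hH] at h
  refine hasSum_congr_of_eq h (fun k => ?_) ?_
  · rw [mFourier_coe, smul_smul, mul_inv_cancel₀ (by positivity), one_smul, smul_eq_mul]
  · simp only [g, smul_smul]
    rw [mul_inv_cancel₀ (by positivity), one_smul]

lemma FS.mono {r M r' M' : ℝ} {φ : Sm d} {φh : (d → ℤ) → ℂ} (h : FS r M φ φh) (hr : r' ≤ r) (hM : M ≤ M') :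
    FS r' M' φ φh := by
  have h1 : ∀ k, Real.exp (r' * l1 k) * ‖φh k‖ ≤ Real.exp (r * l1 k) * ‖φh k‖ := fun k => by
    have := l1_nonneg k
    gcongr
  have h2 := h.summable.of_nonneg_of_le (fun k => by positivity) h1
  exact ⟨h.rep, h2, (h2.tsum_le_tsum h1 h.summable).trans (h.le.trans hM)⟩

variable {ι κ : Type} [Fintype ι] [Fintype κ] [DecidableEq ι] [DecidableEq κ]

lemma exists_pot [Nonempty ι] (φ : Sm (ι ⊕ κ)) (ha : AnalyticOnNhd ℝ φ.1 Set.univ)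
    (hp : ∀ x i, φ.1 (x + Pi.single i (2 * π)) = φ.1 x) (hre : ∀ x, (φ.1 x).im = 0) :
    ∃ r M, r ≤ 1 ∧ Pot φ r M := by
  obtain ⟨r, M, φh, hr, h⟩ := exists_fs φ ha hp
  have hM := h.nonneg
  have hn : ∀ i, ‖(Pi.single i 1 : ι ⊕ κ → ℝ)‖ ≤ 1 := norm_single_le
  have h1 : ∀ i, FS (r / 2) ((r - r / 2)⁻¹ * M) (dd (Pi.single i 1) φ) _ :=
    fun i => h.dd (by positivity) (by linarith) (hn i)
  have h2 : ∀ i j, FS (r / 4) ((r / 2 - r / 4)⁻¹ * ((r - r / 2)⁻¹ * M))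
      (dd (Pi.single j 1) (dd (Pi.single i 1) φ)) _ :=
    fun i j => (h1 i).dd (by positivity) (by linarith) (hn j)
  set M1 := (r - r / 2)⁻¹ * M
  set M2 := (r / 2 - r / 4)⁻¹ * M1
  have hM1 : 0 ≤ M1 := mul_nonneg (inv_nonneg.2 (by linarith)) hM
  have hM2 : 0 ≤ M2 := mul_nonneg (inv_nonneg.2 (by linarith)) hM1
  exact ⟨min 1 (r / 4), M + M1 + M2, min_le_left _ _, hre, by positivity,
    ⟨_, h.mono ((min_le_right _ _).trans (by linarith)) (by linarith)⟩,
    fun i => ⟨_, (h1 i).mono ((min_le_right _ _).trans (by linarith)) (by linarith)⟩,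
    fun i j => ⟨_, (h2 i j).mono (min_le_right _ _) (by linarith)⟩⟩

variable {ι κ : Type} [Fintype ι] [Fintype κ] [DecidableEq ι] [DecidableEq κ]

/-- The inclusion of the second factor. -/
noncomputable def inrL (ι κ : Type) [Fintype ι] [Fintype κ] : (κ → ℝ) →L[ℝ] (ι ⊕ κ → ℝ) :=
  ContinuousLinearMap.pi (Sum.elim (fun _ => 0) fun j => ContinuousLinearMap.proj j)

lemma inrL_single (j : κ) : inrL ι κ (Pi.single j 1) = Pi.single (Sum.inr j) 1 := by
  ext i
  cases i <;> simp [inrL, Pi.single_apply]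

lemma sumElim_eq (α : ι → ℝ) (β : κ → ℝ) : Sum.elim α β = Sum.elim α 0 + inrL ι κ β := by
  ext i
  cases i <;> simp [inrL]

lemma continuous_sumElim : Continuous fun p : (ι → ℝ) × (κ → ℝ) => (Sum.elim p.1 p.2 : ι ⊕ κ → ℝ) :=
  continuous_pi fun i => by cases i <;> simp <;> fun_prop

lemma coef_atβ_zero (β : κ → ℝ) (φ : Sm (ι ⊕ κ)) : coef (atβ β φ).1 0
    = (((2 * π) ^ Fintype.card ι : ℝ) : ℂ)⁻¹ * ∫ α in cube ι, φ.1 (Sum.elim α β) := by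
  have h : ∀ α : ι → ℝ, (atβ β φ).1 α = φ.1 (Sum.elim α β) := fun α =>
    congrArg φ.1 (funext fun i => by simp [qpt])
  simp [coef, h]

/-- Differentiation under the integral sign. -/
lemma hasFDerivAt_coef_atβ (φ : Sm (ι ⊕ κ)) (β : κ → ℝ) :
    ∃ L : (κ → ℝ) →L[ℝ] ℂ, HasFDerivAt (fun β => coef (atβ β φ).1 0) L β ∧
      ∀ j, L (Pi.single j 1) = coef (atβ β (dd (Pi.single (Sum.inr j) 1) φ)).1 0 := by
  set F' : (κ → ℝ) → (ι → ℝ) → (κ → ℝ) →L[ℝ] ℂ :=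
    fun β α => (fderiv ℝ φ.1 (Sum.elim α β)).comp (inrL ι κ)
  have hφ := Sm.contDiff φ
  have hc : Continuous fun p : (ι → ℝ) × (κ → ℝ) => F' p.2 p.1 :=
    ((hφ.continuous_fderiv (by simp)).comp continuous_sumElim).clm_comp continuous_const
  obtain ⟨C, hC⟩ := (isCompact_cube (ι := ι)).prod (isCompact_closedBall β 1) |>.exists_bound_of_continuousOn
    hc.continuousOn
  have hFc : ∀ β, Continuous fun α : ι → ℝ => φ.1 (Sum.elim α β) := fun β =>
    hφ.continuous.comp (continuous_sumElim.comp (by fun_prop : Continuous fun α : ι → ℝ => (α, β)))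
  have hF'c : Continuous (F' β) := hc.comp (by fun_prop : Continuous fun α : ι → ℝ => (α, β))
  have hI : Integrable (F' β) (volume.restrict (cube ι)) :=
    hF'c.continuousOn.integrableOn_compact isCompact_cube
  have h := hasFDerivAt_integral_of_dominated_of_fderiv_le (𝕜 := ℝ) (μ := volume.restrict (cube ι))
    (F := fun β α => φ.1 (Sum.elim α β)) (F' := F') (bound := fun _ => C) (x₀ := β)
    (Metric.closedBall_mem_nhds β one_pos)
    (Eventually.of_forall fun β => (hFc β).aestronglyMeasurable)
    ((hFc β).continuousOn.integrableOn_compact isCompact_cube)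
    hF'c.aestronglyMeasurable
    ((ae_restrict_iff' isCompact_cube.measurableSet).2 (Eventually.of_forall fun α hα x hx =>
      hC (α, x) ⟨hα, hx⟩)) (integrable_const _)
    (Eventually.of_forall fun α x _ => by
      have h1 : HasFDerivAt (fun β : κ → ℝ => (Sum.elim α β : ι ⊕ κ → ℝ)) (inrL ι κ) x := by
        rw [show (fun β : κ → ℝ => (Sum.elim α β : ι ⊕ κ → ℝ)) = _ from funext (sumElim_eq α)]
        exact (inrL ι κ).hasFDerivAt.const_add _
      exact (Sm.differentiable φ _).hasFDerivAt.comp x h1)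
  refine ⟨_, (h.const_mul _).congr_of_eventuallyEq (Eventually.of_forall fun β => coef_atβ_zero β φ),
    fun j => ?_⟩
  rw [coef_atβ_zero]
  simp only [smul_apply, smul_eq_mul]
  rw [ContinuousLinearMap.integral_apply hI]
  simp [F', inrL_single, dd_val]

lemma fderiv_re_coef (φ : Sm (ι ⊕ κ)) (β : κ → ℝ) (j : κ) :
    fderiv ℝ (fun β => (coef (atβ β φ).1 0).re) β (Pi.single j 1)
      = (coef (atβ β (dd (Pi.single (Sum.inr j) 1) φ)).1 0).re := by
  obtain ⟨L, hL, hj⟩ := hasFDerivAt_coef_atβ φ β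
  have h := (Complex.reCLM.hasFDerivAt.comp β hL).fderiv
  simp only [Function.comp_def, Complex.reCLM_apply] at h
  rw [h, ← hj]
  rfl

lemma coef_im {β : κ → ℝ} {φ : Sm (ι ⊕ κ)} (h : ∀ x, (φ.1 x).im = 0) :
    ((coef (atβ β φ).1 0).re : ℂ) = coef (atβ β φ).1 0 := by
  have h1 : ∀ x, φ.1 x = (((φ.1 x).re : ℝ) : ℂ) := fun x => by apply Complex.ext <;> simp [h x]
  rw [coef_atβ_zero, integral_congr_ae (Eventually.of_forall fun α => h1 (Sum.elim α β)),
    integral_complex_ofReal, ← Complex.ofReal_inv, ← Complex.ofReal_mul, Complex.ofReal_re]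

lemma exists_eigenbasis (A : Matrix κ κ ℝ) {a : κ → ℝ} (ha : Function.Injective a)
    (h : ∀ j, Module.End.HasEigenvalue (Matrix.toLin' A) (a j)) :
    ∃ V V' : Matrix κ κ ℝ, V * V' = 1 ∧ ∀ i j, ∑ k, A i k * V k j = V i j * a j := by
  choose v hv using fun j => (h j).exists_hasEigenvector
  set V : Matrix κ κ ℝ := Matrix.of fun i j => v j i
  have hV : IsUnit V := by
    rw [← Matrix.linearIndependent_cols_iff_isUnit]
    exact Module.End.eigenvectors_linearIndependent' _ a ha v hv
  obtain ⟨V', hV'⟩ := hV.exists_right_inv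
  refine ⟨V, V', hV', fun i j => ?_⟩
  have := congrFun (hv j).apply_eq_smul i
  simpa [Matrix.mulVec, dotProduct, V, mul_comm] using this

variable {f₀ : (κ → ℝ) → ℝ} {φ : Sm (ι ⊕ κ)} {β₀ : κ → ℝ}

/-- The hypotheses on the averaged potential in terms of Fourier coefficients. -/
theorem exists_frame {r M : ℝ} (hφ : Pot φ r M) (hf₀ : ∀ β, (f₀ β : ℂ) = coef (atβ β φ).1 0)
    (hcrit : fderiv ℝ f₀ β₀ = 0) {a : κ → ℝ} (hpos : ∀ i, 0 < a i) (ha : Function.Injective a)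
    (heig : ∀ i, Module.End.HasEigenvalue (Matrix.toLin' fun i' j' : κ =>
        fderiv ℝ (fun β => fderiv ℝ f₀ β (Pi.single j' 1)) β₀ (Pi.single i' 1)) (a i)) :
    (∀ i, coef (atβ β₀ (dd (Pi.single i 1) φ)).1 0 = 0) ∧
    ∃ (V V' : Matrix κ κ ℂ) (s : κ → ℝ), V * V' = 1 ∧ (∀ j, 0 < s j) ∧ Function.Injective s ∧
      ∀ i j, ∑ k, coef (atβ β₀ (dd (Pi.single (Sum.inr k) 1)
        (dd (Pi.single (Sum.inr i) 1) φ))).1 0 * V k j = V i j * ((s j : ℂ)) ^ 2 := by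
  have h0 : f₀ = fun β => (coef (atβ β φ).1 0).re := by
    ext β; rw [← hf₀, Complex.ofReal_re]
  have h1 : ∀ j, (fun β => fderiv ℝ f₀ β (Pi.single j 1))
      = fun β => (coef (atβ β (dd (Pi.single (Sum.inr j) 1) φ)).1 0).re := fun j => by
    ext β; rw [h0, fderiv_re_coef]
  refine ⟨fun i => ?_, ?_⟩
  · cases i with
    | inl k => obtain ⟨h, hh⟩ := hφ.fs; exact coef_atβ_inl hφ.pos hh β₀ k
    | inr j =>
      rw [← coef_im (dd_im hφ.real _), ← congrFun (h1 j) β₀, hcrit]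
      simp
  · obtain ⟨V, V', hV, h⟩ := exists_eigenbasis _ ha heig
    refine ⟨V.map (algebraMap ℝ ℂ), V'.map (algebraMap ℝ ℂ), fun j => √(a j), ?_,
      fun j => Real.sqrt_pos.2 (hpos j), fun i j hij => ha ?_, fun i j => ?_⟩
    · rw [← Matrix.map_mul, hV]; simp
    · exact (Real.sqrt_inj (hpos i).le (hpos j).le).1 hij
    · have h2 := congrArg (fun x : ℝ => (x : ℂ)) (h i j)
      push_cast at h2
      rw [← Complex.ofReal_pow, Real.sq_sqrt (hpos j).le]
      simp only [Matrix.map_apply, Complex.coe_algebraMap]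
      rw [← h2]
      refine Finset.sum_congr rfl fun k _ => ?_
      rw [h1, fderiv_re_coef, dd_comm, coef_im (dd_im (dd_im hφ.real _) _)]

/-- Extension of a Lipschitz family of functions to all values of the parameter. -/
lemma exists_lipschitz_extension {Ψ : Type*} [PseudoMetricSpace Ψ] {S : Set ℝ} {a : ℝ → Ψ → ℝ} {L : ℝ}
    (hL : 0 ≤ L) (h0 : 0 ∈ S) (ha0 : ∀ ψ, a 0 ψ = 0)
    (h1 : ∀ e ∈ S, ∀ e' ∈ S, ∀ ψ, |a e ψ - a e' ψ| ≤ L * |e - e'|)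
    (h2 : ∀ e ∈ S, ∀ ψ ψ', |a e ψ - a e ψ'| ≤ L * dist ψ ψ') :
    ∃ A : ℝ × Ψ → ℝ, (∀ e ∈ S, ∀ ψ, A (e, ψ) = a e ψ) ∧
      (∀ p q, |A p - A q| ≤ L * (|p.1 - q.1| + dist p.2 q.2)) ∧
      ∀ ψ ψ', (∀ e, a e ψ = a e ψ') → ∀ ε, A (ε, ψ) = A (ε, ψ') := by
  have hne : Nonempty S := ⟨⟨0, h0⟩⟩
  set A : ℝ × Ψ → ℝ := fun p => ⨅ e : S, (a e p.2 + L * |p.1 - e|)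
  have hbd : ∀ p : ℝ × Ψ, BddBelow (Set.range fun e : S => a e p.2 + L * |p.1 - e|) := by
    rintro ⟨ε, ψ⟩
    refine ⟨-(L * |ε|), ?_⟩
    rintro _ ⟨e, rfl⟩
    have h3 := h1 e e.2 0 h0 ψ
    rw [ha0, sub_zero, sub_zero] at h3
    have h4 := neg_abs_le (a e ψ)
    have h5 : L * |(e : ℝ)| ≤ L * (|ε| + |ε - e|) := by
      gcongr
      have := abs_sub_abs_le_abs_sub (e : ℝ) ε
      rw [abs_sub_comm] at this
      linarith
    simp only
    nlinarith
  have hle : ∀ p q, A p ≤ A q + L * (|p.1 - q.1| + dist p.2 q.2) := by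
    intro p q
    rw [← sub_le_iff_le_add]
    refine le_ciInf fun e => ?_
    have h3 : A p ≤ a e p.2 + L * |p.1 - e| := ciInf_le (hbd p) e
    have h4 := (abs_le.1 (h2 e e.2 p.2 q.2)).2
    have h5 : L * |p.1 - e| ≤ L * (|p.1 - q.1| + |q.1 - e|) := by
      gcongr; exact abs_sub_le _ _ _
    nlinarith
  refine ⟨A, fun e he ψ => le_antisymm ?_ ?_, fun p q => ?_, fun ψ ψ' h ε => ?_⟩
  · simpa using ciInf_le (hbd (e, ψ)) ⟨e, he⟩
  · refine le_ciInf fun e' => ?_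
    have := (abs_le.1 (h1 e he e' e'.2 ψ)).2
    simp only
    linarith
  · rw [abs_le]
    have h3 := hle p q
    have h4 := hle q p
    rw [abs_sub_comm, dist_comm] at h4
    constructor <;> linarith
  · simp only [A, h]

variable {ι κ : Type} [Fintype ι] [Fintype κ] [DecidableEq ι] [DecidableEq κ]

section single
variable {P : Par} {G : Set ℝ} {F : G → Sm ι} {σ C : ℝ}

lemma Bd.analyticOnNhd {X : Type*} {ρ : X → X → ℝ} {w : X → ℝ} {F : X → Sm ι}
    (h : Bd ρ w σ F C) (hσ : 0 < σ) (x : X) :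
    AnalyticOnNhd ℝ (fun ψ => ((F x).1 ψ).re) Set.univ := by
  obtain ⟨c, m, hm, -⟩ := h
  have h1 := analyticOnNhd_fourier hσ (hm.summable_norm x)
  have h2 : (fun ψ => ∑' ν, c ν x * chr ν ψ) = (F x).1 := funext fun ψ => (hm.rep x ψ).tsum_eq
  rw [h2] at h1
  exact (Complex.reCLM.analyticOnNhd Set.univ).comp h1 fun _ _ => trivial

lemma Bd.periodic {X : Type*} {ρ : X → X → ℝ} {w : X → ℝ} {F : X → Sm ι}
    (h : Bd ρ w σ F C) (x : X) (ψ : ι → ℝ) (k : ι) :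
    (F x).1 (ψ + Pi.single k (2 * π)) = (F x).1 ψ := by
  obtain ⟨c, m, hm, -⟩ := h
  have h1 := hm.rep x (ψ + Pi.single k (2 * π))
  simp only [chr_period] at h1
  exact h1.unique (hm.rep x ψ)

lemma Bd.dist_le {X : Type*} {ρ : X → X → ℝ} [PosRho ρ] {F : X → Sm ι} (h : Bd ρ 1 σ F C) (hσ : 0 < σ)
    (x : X) (ψ ψ' : ι → ℝ) : ‖(F x).1 ψ - (F x).1 ψ'‖ ≤ 8 * σ⁻¹ * C * dist ψ ψ' := by
  have hC := h.nonneg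
  rw [dist_eq_norm]
  refine Convex.norm_image_sub_le_of_norm_fderiv_le (𝕜 := ℝ) (s := Set.univ)
    (fun z _ => Sm.differentiable (F x) z) (fun z _ => ?_) convex_univ trivial trivial
  refine ContinuousLinearMap.opNorm_le_of_unit_norm (by positivity) fun v hv => ?_
  have := norm_dd_le hσ h v x z
  rw [hv] at this
  refine this.trans (le_of_eq ?_)
  ring

lemma Bd.param_le [Fact (G ⊆ Set.Ioi 0)] (hW : 0 ≤ P.W) (h : Bd (relDist Subtype.val) (wP P G) σ F C)
    (hσ : 0 ≤ σ) (x y : G) (ψ : ι → ℝ) :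
    ‖(F x).1 ψ - (F y).1 ψ‖ ≤ C * P.W * |x.1 ^ 2 - y.1 ^ 2| := by
  have hpos : ∀ x : G, 0 < x.1 := fun x => (Fact.out : G ⊆ Set.Ioi 0) x.2
  have : PosWt (wP P G) := ⟨fun x => by unfold wP; positivity⟩
  have h1 := h.lip_le hσ x y ψ
  have hC := h.nonneg
  have hx := hpos x
  have hy := hpos y
  set n := ‖(F x).1 ψ - (F y).1 ψ‖ with hn
  have hn0 : 0 ≤ n := norm_nonneg _
  have h2 : max (wP P G x) (wP P G y) = P.W * max x.1 y.1 ^ 2 := by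
    unfold wP
    rcases le_total x.1 y.1 with hxy | hxy
    · rw [max_eq_right hxy, max_eq_right (by gcongr)]
    · rw [max_eq_left hxy, max_eq_left (by gcongr)]
  have hm : 0 < max x.1 y.1 := lt_max_of_lt_left hx
  have h3 : C * max (wP P G x) (wP P G y) * relDist Subtype.val x y
      = C * P.W * (max x.1 y.1 * |x.1 - y.1|) := by
    rw [h2, relDist]; field_simp
  have h4 : max x.1 y.1 * |x.1 - y.1| ≤ |x.1 ^ 2 - y.1 ^ 2| := by
    rw [sq_sub_sq, abs_mul, abs_of_pos (add_pos hx hy)]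
    gcongr
    exact max_le (by linarith) (by linarith)
  rw [h3] at h1
  have h5 : C * P.W * (max x.1 y.1 * |x.1 - y.1|) ≤ C * P.W * |x.1 ^ 2 - y.1 ^ 2| := by gcongr
  linarith

end single

variable {β₀ : κ → ℝ} {f : Sm (ι ⊕ κ)} {om : ι → ℝ} {r M : ℝ}

/-- The equations of motion on an exactly invariant torus. -/
lemma dd_dd_of_Err_eq_zero {X : Type*} {η : X → ℝ} {K : Ph ι κ → X → Sm ι} (h : Err β₀ f η om K = 0)
    (x : X) (hx : 0 < η x) (i : ι ⊕ κ) : dd om (dd om (K (Sum.inl i) x))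
      = (-(η x ^ 2 : ℝ) : ℂ) • grad β₀ f (K ∘ Sum.inl) i x := by
  have h1 : ((η x)⁻¹ : ℂ) • dd om (K (Sum.inl i) x) = K (Sum.inr i) x := by
    have := congrFun (congrFun (congrFun h (Sum.inl i)) ()) x
    simp only [Err, Matrix.of_apply, Sum.elim_inl, Pi.sub_apply, Matrix.zero_apply, Pi.zero_apply,
      sub_eq_zero] at this
    rw [← this, Dη, RD_apply, Complex.ofReal_inv]
  have h2 : ((η x)⁻¹ : ℂ) • dd om (K (Sum.inr i) x) = -grad β₀ f (K ∘ Sum.inl) i x := by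
    have := congrFun (congrFun (congrFun h (Sum.inr i)) ()) x
    simp only [Err, Matrix.of_apply, Sum.elim_inr, Pi.add_apply, Matrix.zero_apply, Pi.zero_apply] at this
    rw [← eq_neg_iff_add_eq_zero] at this
    rw [← this, Dη, RD_apply, Complex.ofReal_inv]
  have hη : (η x : ℂ) ≠ 0 := by exact_mod_cast hx.ne'
  have h3 : ((η x : ℂ) * η x) • (((η x)⁻¹ : ℂ) • ((η x)⁻¹ : ℂ) • dd om (dd om (K (Sum.inl i) x)))
      = dd om (dd om (K (Sum.inl i) x)) := by
    rw [smul_smul, smul_smul]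
    rw [show (η x : ℂ) * η x * ((η x)⁻¹ : ℂ) * ((η x)⁻¹ : ℂ) = 1 by field_simp, one_smul]
  rw [← h3, ← Derivation.map_smul (dd om), h1, h2]
  push_cast
  rw [neg_smul, smul_neg, sq]

/-- Invariant tori of the perturbed system, for a set of parameters of density one at zero. -/
theorem exists_invariant_tori (hf : Pot f r M) (hr1 : r ≤ 1) {C₀ τ : ℝ} (hC₀ : 0 < C₀)
    (hdio : ∀ ν : ι → ℤ, ν ≠ 0 → C₀ * l1 ν ^ (-τ) ≤ |dotZ ν om|)
    (hmean : ∀ i, coef (atβ β₀ (dd (Pi.single i 1) f)).1 0 = 0)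
    {V V' : Matrix κ κ ℂ} (hV : V * V' = 1) {s : κ → ℝ} (hs : ∀ j, 0 < s j)
    (hinj : Function.Injective s)
    (heig : ∀ i j, ∑ k, coef (atβ β₀ (dd (Pi.single (Sum.inr k) 1)
      (dd (Pi.single (Sum.inr i) 1) f))).1 0 * V k j = V i j * ((s j : ℂ)) ^ 2) :
    ∃ (εb : ℝ) (E : Set ℝ) (v : ι ⊕ κ → ℝ × (ι → ℝ) → ℝ) (L : ℝ), 0 < εb ∧ MeasurableSet E ∧
      E ⊆ Set.Ioo 0 εb ∧
      Tendsto (fun ε => (volume (E ∩ Set.Ioo 0 ε)).toReal / ε) (nhdsWithin 0 (Set.Ioi 0)) (nhds 1) ∧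
      0 ≤ L ∧ (∀ i p q, |v i p - v i q| ≤ L * (|p.1 - q.1| + dist p.2 q.2)) ∧
      (∀ i ε ψ k, v i (ε, ψ + Pi.single k (2 * π)) = v i (ε, ψ)) ∧ (∀ i ψ, v i (0, ψ) = 0) ∧
      ∀ e ∈ E, (∀ i, AnalyticOnNhd ℝ (fun ψ => v i (e, ψ)) Set.univ) ∧
        ∃ U : ι ⊕ κ → Sm ι, (∀ i ψ, v i (e, ψ) = ((U i).1 ψ).re) ∧
          ∀ i ψ, ((dd om (dd om (U i))).1 ψ).re = -e * ((dd (Pi.single i 1) f).1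
            fun j => Sum.elim ψ β₀ j + v j (e, ψ)).re := by
  obtain ⟨P, y0, q1, q2, q3, S0, hP, hH, h0, hG0, hS0⟩ :=
    exists_par hf hr1 hC₀ hdio hmean hV hs hinj heig
  obtain ⟨S, hSe, hS, hSG, K, hKr, hK, hErr⟩ := exists_torus hP hH h0
  obtain ⟨E, hEm, hEs, hEG, hEt⟩ := exists_parameters hP hH hS hSG (by rw [hSe, hG0])
  have hGs : (⋂ n, (S n).G : Set ℝ) ⊆ Set.Ioo 0 P.ηb := (Set.iInter_subset _ 0).trans (hS 0).sub
  have hFact : Fact ((⋂ n, (S n).G : Set ℝ) ⊆ Set.Ioi 0) := ⟨fun x hx => (hGs hx).1⟩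
  have hW := hP.W_pos
  have hPW : PosWt (wP P (⋂ n, (S n).G : Set ℝ)) := ⟨fun x => by unfold wP; positivity⟩
  have hw : ∀ x, wP P (⋂ n, (S n).G : Set ℝ) x ≤ 1 := fun x => by
    refine le_trans ?_ hP.W_le
    have h1 := (hGs x.2).1
    have h2 := (hGs x.2).2
    unfold wP
    gcongr
  have hσ : 0 < P.σ / 2 := by linarith [hP.σ_pos]
  have hsub : (⋂ n, (S n).G : Set ℝ) ⊆ S0.G := by rw [← hSe]; exact Set.iInter_subset _ 0
  have hB : ∀ i, Bd (relDist Subtype.val) (wP P (⋂ n, (S n).G : Set ℝ)) (P.σ / 2) (K (Sum.inl i)) (P.k + P.k) := fun i =>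
    ((hK (Sum.inl i)).add (((hS0 i).comap (Set.inclusion hsub)).anti (by linarith [hP.σ_pos]))).congr
      fun x ψ => by simp
  have hB1 : ∀ i, Bd (relDist Subtype.val) 1 (P.σ / 2) (K (Sum.inl i)) (P.k + P.k) := fun i =>
    (hB i).weight hw
  set k2 := P.k + P.k
  have hk2 : 0 ≤ k2 := by have := hP.k_pos; simp only [k2]; linarith
  set L := k2 * P.W + 8 * (P.σ / 2)⁻¹ * k2
  have hL1 : k2 * P.W ≤ L := le_add_of_nonneg_right (by positivity)
  have hL2 : 8 * (P.σ / 2)⁻¹ * k2 ≤ L := le_add_of_nonneg_left (by positivity)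
  have hL : 0 ≤ L := by positivity
  classical
  set a : ι ⊕ κ → ℝ → (ι → ℝ) → ℝ := fun i e ψ =>
    if h : e ∈ E then ((K (Sum.inl i) ⟨√e, hEG e h⟩).1 ψ).re else 0
  have haE : ∀ i e (h : e ∈ E) ψ, a i e ψ = ((K (Sum.inl i) ⟨√e, hEG e h⟩).1 ψ).re :=
    fun i e h ψ => dif_pos h
  have hEpos : ∀ e ∈ E, 0 < e := fun e he => (hEs he).1
  have h0E : (0 : ℝ) ∉ E := fun h => lt_irrefl _ (hEpos 0 h)
  have ha0 : ∀ i ψ, a i 0 ψ = 0 := fun i ψ => dif_neg h0E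
  have hsm : ∀ i e (he : e ∈ E) ψ, |a i e ψ| ≤ L * e := by
    intro i e he ψ
    rw [haE i e he]
    have h1 := (hB i).norm_le hσ.le ⟨√e, hEG e he⟩ ψ (PosWt.nonneg _)
    simp only [wP, Real.sq_sqrt (hEpos e he).le] at h1
    have h2 := Complex.abs_re_le_norm ((K (Sum.inl i) ⟨√e, hEG e he⟩).1 ψ)
    have h3 : k2 * P.W * e ≤ L * e := mul_le_mul_of_nonneg_right hL1 (hEpos e he).le
    have h4 := norm_nonneg ((K (Sum.inl i) ⟨√e, hEG e he⟩).1 ψ)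
    nlinarith
  have hx := fun i => exists_lipschitz_extension (S := insert 0 E) (a := a i) hL (Set.mem_insert _ _)
    (ha0 i) (fun e he e' he' ψ => by
      rcases he with rfl | he <;> rcases he' with rfl | he'
      · simp
      · rw [ha0, zero_sub, zero_sub, abs_neg, abs_neg, abs_of_pos (hEpos e' he')]
        exact hsm i e' he' ψ
      · rw [ha0, sub_zero, sub_zero, abs_of_pos (hEpos e he)]
        exact hsm i e he ψ
      · rw [haE i e he, haE i e' he', ← Complex.sub_re]
        have h1 := (hB i).param_le hW.le hσ.le ⟨√e, hEG e he⟩ ⟨√e', hEG e' he'⟩ ψ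
        simp only [Real.sq_sqrt (hEpos e he).le, Real.sq_sqrt (hEpos e' he').le] at h1
        exact (Complex.abs_re_le_norm _).trans (h1.trans (by gcongr)))
    (fun e he ψ ψ' => by
      rcases he with rfl | he
      · rw [ha0, ha0]; simpa using mul_nonneg hL dist_nonneg
      · rw [haE i e he, haE i e he, ← Complex.sub_re]
        exact (Complex.abs_re_le_norm _).trans (((hB1 i).dist_le hσ _ ψ ψ').trans (by gcongr)))
  choose v hv1 hv2 hv3 using hx
  refine ⟨P.ηb ^ 2, E, v, L, pow_pos hP.ηb_pos 2, hEm, hEs, hEt, hL, hv2, fun i ε ψ k => ?_,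
    fun i ψ => ?_, fun e he => ?_⟩
  · refine hv3 i _ _ (fun e => ?_) ε
    by_cases he : e ∈ E
    · rw [haE i e he, haE i e he, (hB i).periodic]
    · simp only [a, dif_neg he]
  · rw [hv1 i 0 (Set.mem_insert _ _), ha0]
  · have hve : ∀ i ψ, v i (e, ψ) = ((K (Sum.inl i) ⟨√e, hEG e he⟩).1 ψ).re := fun i ψ => by
      rw [hv1 i e (Set.mem_insert_of_mem _ he), haE i e he]
    refine ⟨fun i => ?_, fun i => K (Sum.inl i) ⟨√e, hEG e he⟩, hve, fun i ψ => ?_⟩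
    · simp only [hve]
      exact (hB i).analyticOnNhd hσ _
    · beta_reduce
      rw [dd_dd_of_Err_eq_zero hErr ⟨√e, hEG e he⟩ (Real.sqrt_pos.2 (hEpos e he)) i, Sm.smul_val,
        Real.sq_sqrt (hEpos e he).le, ← Complex.ofReal_neg, Complex.re_ofReal_mul]
      congr 2
      simp only [grad, comp, hve]
      rfl

lemma hasDerivAt_line (F : Sm ι) (ψ om : ι → ℝ) (t : ℝ) :
    HasDerivAt (fun u : ℝ => (F.1 (ψ + u • om)).re) ((dd om F).1 (ψ + t • om)).re t := by
  have h1 : HasDerivAt (fun u : ℝ => ψ + u • om) om t := by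
    simpa using ((hasDerivAt_id t).smul_const om).const_add ψ
  have h2 := (Sm.differentiable F (ψ + t • om)).hasFDerivAt.comp_hasDerivAt t h1
  exact (Complex.reCLM.hasFDerivAt.comp_hasDerivAt t h2)

variable {ι κ : Type} [Fintype ι] [Fintype κ] [DecidableEq ι] [DecidableEq κ]

/-- Splitting of the variables into angles `α` and `β`. -/
noncomputable def splitL (ι κ : Type) [Fintype ι] [Fintype κ] :
    (ι ⊕ κ → ℝ) →L[ℝ] (ι → ℝ) × (κ → ℝ) :=
  (ContinuousLinearMap.pi fun k => ContinuousLinearMap.proj (Sum.inl k)).prod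
    (ContinuousLinearMap.pi fun j => ContinuousLinearMap.proj (Sum.inr j))

lemma splitL_apply (x : ι ⊕ κ → ℝ) : splitL ι κ x = (fun k => x (Sum.inl k), fun j => x (Sum.inr j)) := rfl

lemma splitL_single_inl (k : ι) (t : ℝ) : splitL ι κ (Pi.single (Sum.inl k) t) = (Pi.single k t, 0) := by
  ext i <;> simp [splitL_apply, Pi.single_apply]

lemma splitL_single_inr (j : κ) (t : ℝ) : splitL ι κ (Pi.single (Sum.inr j) t) = (0, Pi.single j t) := by
  ext i <;> simp [splitL_apply, Pi.single_apply]

variable {f : (ι → ℝ) × (κ → ℝ) → ℝ}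

lemma analyticOnNhd_comp_splitL (hf : AnalyticOnNhd ℝ f Set.univ) :
    AnalyticOnNhd ℝ (fun x => (f (splitL ι κ x) : ℂ)) Set.univ :=
  (Complex.ofRealCLM.analyticOnNhd Set.univ).comp
    (hf.comp ((splitL ι κ).analyticOnNhd Set.univ) fun _ _ => trivial) fun _ _ => trivial

/-- A real analytic function as an element of the algebra of smooth functions. -/
noncomputable def potential (hf : AnalyticOnNhd ℝ f Set.univ) : Sm (ι ⊕ κ) :=
  ⟨fun x => (f (splitL ι κ x) : ℂ), show ContDiff ℝ ∞ _ from (analyticOnNhd_comp_splitL hf).contDiff⟩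

lemma potential_val (hf : AnalyticOnNhd ℝ f Set.univ) (x : ι ⊕ κ → ℝ) :
    (potential hf).1 x = (f (splitL ι κ x) : ℂ) := rfl

lemma dd_potential (hf : AnalyticOnNhd ℝ f Set.univ) (v x : ι ⊕ κ → ℝ) :
    (dd v (potential hf)).1 x = (fderiv ℝ f (splitL ι κ x) (splitL ι κ v) : ℂ) := by
  have h1 := (hf (splitL ι κ x) trivial).differentiableAt.hasFDerivAt
  have h2 := Complex.ofRealCLM.hasFDerivAt.comp x (h1.comp x (splitL ι κ).hasFDerivAt)
  have h3 : HasFDerivAt (potential hf).1 _ x := h2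
  rw [dd_val, h3.fderiv]
  rfl

lemma exists_pot_potential [Nonempty ι] (hf : AnalyticOnNhd ℝ f Set.univ)
    (hp1 : ∀ p k, f (p.1 + Pi.single k (2 * π), p.2) = f p)
    (hp2 : ∀ p j, f (p.1, p.2 + Pi.single j (2 * π)) = f p) :
    ∃ r M, r ≤ 1 ∧ Pot (potential hf) r M := by
  refine exists_pot _ (analyticOnNhd_comp_splitL hf) (fun x i => ?_) fun x => by simp [potential_val]
  simp only [potential_val, map_add]
  congr 1
  cases i with
  | inl k => rw [splitL_single_inl, ← hp1 (splitL ι κ x) k]; congr 1; ext <;> simp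
  | inr j => rw [splitL_single_inr, ← hp2 (splitL ι κ x) j]; congr 1; ext <;> simp

lemma lipschitzWith_pi {κ : Type} [Fintype κ] {Ψ : Type*} [PseudoMetricSpace Ψ] {v : κ → ℝ × Ψ → ℝ} {L : ℝ}
    (hL : 0 ≤ L) (h : ∀ i p q, |v i p - v i q| ≤ L * (|p.1 - q.1| + dist p.2 q.2)) :
    LipschitzWith (2 * L).toNNReal fun p i => v i p := by
  refine LipschitzWith.of_dist_le_mul fun p q => ?_
  rw [Real.coe_toNNReal _ (by positivity)]
  refine (dist_pi_le_iff (by positivity)).2 fun i => ?_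
  rw [Real.dist_eq]
  refine (h i p q).trans ?_
  rw [mul_comm 2 L, mul_assoc]
  gcongr
  rw [← Real.dist_eq, Prod.dist_eq, two_mul]
  exact add_le_add (le_max_left _ _) (le_max_right _ _)

/-- The second derivative along a linear flow. -/
lemma deriv_deriv_line {J : Type} [Fintype J] (U : J → Sm ι) (ψ om : ι → ℝ) (b c : J → ℝ) (t : ℝ) :
    deriv (deriv fun u : ℝ => fun i => b i + u * c i + ((U i).1 (ψ + u • om)).re) t
      = fun i => ((dd om (dd om (U i))).1 (ψ + t • om)).re := by
  have h1 : (deriv fun u : ℝ => fun i => b i + u * c i + ((U i).1 (ψ + u • om)).re)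
      = fun u i => c i + ((dd om (U i)).1 (ψ + u • om)).re := by
    ext1 u
    refine (hasDerivAt_pi.2 fun i => ?_).deriv
    have := ((((hasDerivAt_id u).mul_const (c i)).const_add (b i)).add (hasDerivAt_line (U i) ψ om u))
    simp only [one_mul] at this
    exact this
  rw [h1]
  exact (hasDerivAt_pi.2 fun i => (hasDerivAt_line (dd om (U i)) ψ om t).const_add (c i)).deriv

end KAM

/-- Existence of elliptic resonant invariant tori for a set of values of `ε` of relative
density `1` at `0`, with parametric equations extending to Lipschitz functions of `(ε, ψ)`. -/
theorem elliptic_resonant_tori_lipschitz (r s : ℕ) (hr : 1 ≤ r) (hs : 1 ≤ s)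
    (ω : Fin r → ℝ) (C₀ τ₀ : ℝ) (hC₀ : 0 < C₀) (hτ₀ : (r : ℝ) - 1 ≤ τ₀)
    (hdio : ∀ ν : Fin r → ℤ, ν ≠ 0 →
      C₀ * (∑ k, |(ν k : ℝ)|) ^ (-τ₀) ≤ |∑ k, ω k * (ν k : ℝ)|)
    (f : (Fin r → ℝ) × (Fin s → ℝ) → ℝ)
    (hfa : AnalyticOnNhd ℝ f Set.univ)
    (hper₁ : ∀ p : (Fin r → ℝ) × (Fin s → ℝ), ∀ i : Fin r,
      f (p.1 + Pi.single i (2 * π), p.2) = f p)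
    (hper₂ : ∀ p : (Fin r → ℝ) × (Fin s → ℝ), ∀ j : Fin s,
      f (p.1, p.2 + Pi.single j (2 * π)) = f p)
    (f₀ : (Fin s → ℝ) → ℝ)
    (hf₀ : ∀ β, f₀ β = ((2 * π) ^ r)⁻¹ *
      ∫ α in Set.univ.pi fun _ : Fin r => Set.Icc (0 : ℝ) (2 * π), f (α, β))
    (β₀ : Fin s → ℝ)
    (hcrit : fderiv ℝ f₀ β₀ = 0)
    (a : Fin s → ℝ) (hpos : ∀ i, 0 < a i) (hmono : StrictMono a)
    (heig : ∀ i, Module.End.HasEigenvalue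
      (Matrix.toLin' fun i' j' : Fin s =>
        fderiv ℝ (fun β => fderiv ℝ f₀ β (Pi.single j' 1)) β₀ (Pi.single i' 1)) (a i)) :
    ∃ (εbar : ℝ) (E : Set ℝ)
      (A : ℝ × (Fin r → ℝ) → Fin r → ℝ) (B : ℝ × (Fin r → ℝ) → Fin s → ℝ),
      0 < εbar ∧ MeasurableSet E ∧ E ⊆ Set.Ioo 0 εbar ∧
      Tendsto (fun ε => (volume (E ∩ Set.Ioo 0 ε)).toReal / ε)
        (nhdsWithin 0 (Set.Ioi 0)) (nhds 1) ∧
      (∃ K : NNReal, LipschitzOnWith K A (Set.Icc 0 εbar ×ˢ Set.univ)) ∧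
      (∃ K : NNReal, LipschitzOnWith K B (Set.Icc 0 εbar ×ˢ Set.univ)) ∧
      (∀ ε ψ i, A (ε, ψ + Pi.single i (2 * π)) = A (ε, ψ)) ∧
      (∀ ε ψ i, B (ε, ψ + Pi.single i (2 * π)) = B (ε, ψ)) ∧
      (∀ ψ, A (0, ψ) = 0) ∧ (∀ ψ, B (0, ψ) = 0) ∧
      (∀ ε ∈ E,
        AnalyticOnNhd ℝ (fun ψ => A (ε, ψ)) Set.univ ∧
        AnalyticOnNhd ℝ (fun ψ => B (ε, ψ)) Set.univ ∧
        (∀ ψ : Fin r → ℝ, ∀ t : ℝ,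
          deriv (deriv fun u : ℝ => ψ + u • ω + A (ε, ψ + u • ω)) t
            = (fun i => -ε * fderiv ℝ f
                (ψ + t • ω + A (ε, ψ + t • ω), β₀ + B (ε, ψ + t • ω)) (Pi.single i 1, 0)) ∧
          deriv (deriv fun u : ℝ => β₀ + B (ε, ψ + u • ω)) t
            = (fun j => -ε * fderiv ℝ f
                (ψ + t • ω + A (ε, ψ + t • ω), β₀ + B (ε, ψ + t • ω)) (0, Pi.single j 1)))) := by
  have hne : Nonempty (Fin r) := ⟨⟨0, hr⟩⟩
  obtain ⟨ρ, M, hρ, hpot⟩ := KAM.exists_pot_potential hfa hper₁ hper₂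
  have hf₀' : ∀ β, (f₀ β : ℂ) = KAM.coef (KAM.atβ β (KAM.potential hfa)).1 0 := by
    intro β
    rw [KAM.coef_atβ_zero, hf₀, Complex.ofReal_mul, Complex.ofReal_inv, Fintype.card_fin,
      ← integral_complex_ofReal]
    rfl
  obtain ⟨hmean, V, V', σ, hV, hσ, hinj, hVe⟩ :=
    KAM.exists_frame hpot hf₀' hcrit hpos hmono.injective heig
  obtain ⟨εb, E, v, L, hεb, hEm, hEs, hEt, hL, hlip, hper, hzero, htori⟩ :=
    KAM.exists_invariant_tori (om := ω) hpot hρ hC₀ (τ := τ₀)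
      (fun ν hν => by simpa only [KAM.l1, KAM.dotZ, mul_comm] using hdio ν hν) hmean hV hσ hinj hVe
  refine ⟨εb, E, fun p i => v (Sum.inl i) p, fun p j => v (Sum.inr j) p, hεb, hEm, hEs, hEt,
    ⟨_, (KAM.lipschitzWith_pi hL fun i => hlip (Sum.inl i)).lipschitzOnWith⟩,
    ⟨_, (KAM.lipschitzWith_pi hL fun j => hlip (Sum.inr j)).lipschitzOnWith⟩,
    fun ε ψ i => funext fun k => hper _ ε ψ i, fun ε ψ i => funext fun k => hper _ ε ψ i,
    fun ψ => funext fun k => hzero _ ψ, fun ψ => funext fun k => hzero _ ψ, fun ε hε => ?_⟩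
  obtain ⟨han, U, hU, hode⟩ := htori ε hε
  refine ⟨AnalyticOnNhd.pi fun i => han (Sum.inl i), AnalyticOnNhd.pi fun j => han (Sum.inr j),
    fun ψ t => ⟨?_, ?_⟩⟩
  · have h := KAM.deriv_deriv_line (fun i => U (Sum.inl i)) ψ ω ψ ω t
    have e : (fun u : ℝ => ψ + u • ω + fun i => v (Sum.inl i) (ε, ψ + u • ω))
        = fun u i => ψ i + u * ω i + ((U (Sum.inl i)).1 (ψ + u • ω)).re := by
      funext u i; simp [hU]
    rw [e, h]
    funext i
    rw [hode, KAM.dd_potential, Complex.ofReal_re, KAM.splitL_single_inl, KAM.splitL_apply]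
    rfl
  · have h := KAM.deriv_deriv_line (fun j => U (Sum.inr j)) ψ ω β₀ 0 t
    have e : (fun u : ℝ => β₀ + fun j => v (Sum.inr j) (ε, ψ + u • ω))
        = fun u j => β₀ j + u * (0 : Fin s → ℝ) j + ((U (Sum.inr j)).1 (ψ + u • ω)).re := by
      funext u j; simp [hU]
    rw [e, h]
    funext j
    rw [hode, KAM.dd_potential, Complex.ofReal_re, KAM.splitL_single_inr, KAM.splitL_apply]
    rfl
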